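/- There exists an absolute constant C > 0 such that: there are infinitely many positive integers d for which there exists a totally real number field K of degree d over ℚ such that, for every real X ≥ 1, there exists a finite set A ⊆ O_K with X^d ≤ |A| ≤ (CX)^d, |A+A| ≤ C^d·|A|, and |AA| ≤ 2^{−d}·|A|^2. -/

import Mathlib

open Pointwise NumberField

/-- A number field is totally real if every embedding into `ℂ` takes real values. -/
def TotallyReal (K : Type*) [Field K] : Prop :=
  ∀ φ : K →+* ℂ, ∀ x : K, (φ x).im = 0

set_option linter.unusedSectionVars false

section BoxConstruction

variable {R ι κ : Type*} [CommRing R]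

/-- The elements of `R` whose image under each `σ i` is bounded by `r i`. -/
def realBox (σ : ι → R →+* ℝ) (r : ι → ℝ) : Set R := {x | ∀ i, |σ i x| ≤ r i}

theorem realBox_mono {σ : ι → R →+* ℝ} {r s : ι → ℝ} (h : ∀ i, r i ≤ s i) :
    realBox σ r ⊆ realBox σ s := fun _ hx i => (hx i).trans (h i)

theorem realBox_packing [Fintype ι] [Nonempty ι] {σ : ι → R →+* ℝ}
    (hσ : ∀ x : R, x ≠ 0 → 1 ≤ ∏ i, |σ i x|) {r : ι → ℝ} (hr : ∀ i, 0 < r i) {M : ℕ}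
    (hM : 0 < M) (hrM : ∏ i, r i ≤ (M : ℝ) ^ Fintype.card ι) :
    (realBox σ r).Finite ∧ (realBox σ r).ncard ≤ (2 * M + 1) ^ Fintype.card ι := by
  classical
  have hM' : (0 : ℝ) < M := by exact_mod_cast hM
  let f : R → ι → ℤ := fun x i => ⌊σ i x * M / r i⌋
  let t : Finset (ι → ℤ) := Fintype.piFinset fun _ => Finset.Icc (-M : ℤ) M
  have hmaps : ∀ x ∈ realBox σ r, f x ∈ t := by
    intro x hx
    simp only [t, Fintype.mem_piFinset, Finset.mem_Icc]
    intro i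
    have h1 := abs_le.1 (hx i)
    constructor
    · apply Int.le_floor.2
      rw [le_div_iff₀ (hr i)]
      push_cast
      nlinarith [h1.1]
    · have : σ i x * M / r i ≤ M := by
        rw [div_le_iff₀ (hr i)]
        nlinarith [h1.2]
      exact_mod_cast (Int.floor_le _).trans this
  have hinj : Set.InjOn f (realBox σ r) := by
    intro x _ y _ hxy
    by_contra hne
    have h1 := hσ (x - y) (sub_ne_zero.2 hne)
    have h2 : ∀ i, |σ i (x - y)| < r i / M := by
      intro i
      have h3 := Int.abs_sub_lt_one_of_floor_eq_floor (congrFun hxy i)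
      rw [lt_div_iff₀ hM', map_sub]
      rw [← sub_div, abs_div, abs_of_pos (hr i), div_lt_one (hr i), ← sub_mul, abs_mul,
        abs_of_pos hM'] at h3
      exact h3
    have h3 : ∏ i, |σ i (x - y)| < ∏ i, r i / M := by
      by_cases h0 : ∃ i, |σ i (x - y)| = 0
      · obtain ⟨i, hi⟩ := h0
        rw [Finset.prod_eq_zero (Finset.mem_univ i) hi]
        exact Finset.prod_pos fun i _ => div_pos (hr i) hM'
      · push Not at h0
        exact Finset.prod_lt_prod_of_nonempty
          (fun i _ => lt_of_le_of_ne (abs_nonneg _) (Ne.symm (h0 i))) (fun i _ => h2 i)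
          Finset.univ_nonempty
    rw [Finset.prod_div_distrib, Finset.prod_const, Finset.card_univ] at h3
    have : (∏ i, r i) / (M : ℝ) ^ Fintype.card ι ≤ 1 := div_le_one_of_le₀ hrM (by positivity)
    linarith
  have hfin : (realBox σ r).Finite :=
    Set.Finite.of_finite_image (t.finite_toSet.subset (by rintro _ ⟨x, hx, rfl⟩; exact hmaps x hx))
      hinj
  refine ⟨hfin, ?_⟩
  calc (realBox σ r).ncard = (f '' realBox σ r).ncard := hinj.ncard_image.symm
    _ ≤ (t : Set (ι → ℤ)).ncard :=
      Set.ncard_le_ncard (by rintro _ ⟨x, hx, rfl⟩; exact hmaps x hx) t.finite_toSet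
    _ = (2 * M + 1) ^ Fintype.card ι := by
      rw [Set.ncard_coe_finset, Fintype.card_piFinset, Finset.prod_const, Finset.card_univ,
        Int.card_Icc]
      congr 1
      omega

theorem card_functions_sum_le [Fintype κ] [DecidableEq κ] (N : ℕ) (s : Finset (κ → ℕ))
    (hs : ∀ e ∈ s, ∑ j, e j ≤ N) : s.card ≤ 2 ^ (N + Fintype.card κ) := by
  have hsub : s ⊆ Fintype.piFinset fun _ : κ => Finset.range (N + 1) := by
    intro e he
    rw [Fintype.mem_piFinset]
    intro j
    rw [Finset.mem_range, Nat.lt_succ_iff]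
    exact (Finset.single_le_sum (fun i _ => Nat.zero_le (e i)) (Finset.mem_univ j)).trans (hs e he)
  have h1 : (s.card : ℝ) ≤ ∑ e ∈ s, (2 : ℝ) ^ N * ∏ j, (1 / 2 : ℝ) ^ e j := by
    rw [Finset.card_eq_sum_ones]
    push_cast
    apply Finset.sum_le_sum
    intro e he
    rw [Finset.prod_pow_eq_pow_sum]
    rw [one_div, inv_pow, ← div_eq_mul_inv, le_div_iff₀ (by positivity), one_mul]
    exact pow_le_pow_right₀ (by norm_num) (hs e he)
  have h2 : ∑ e ∈ s, (2 : ℝ) ^ N * ∏ j, (1 / 2 : ℝ) ^ e j ≤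
      (2 : ℝ) ^ N * ∏ _j : κ, ∑ a ∈ Finset.range (N + 1), (1 / 2 : ℝ) ^ a := by
    rw [Finset.prod_univ_sum, ← Finset.mul_sum]
    gcongr
  have h3 : ∑ a ∈ Finset.range (N + 1), (1 / 2 : ℝ) ^ a ≤ 2 := by
    have := sum_geometric_two_le (N + 1)
    simpa using this
  have h4 : ∏ _j : κ, ∑ a ∈ Finset.range (N + 1), (1 / 2 : ℝ) ^ a ≤ 2 ^ Fintype.card κ := by
    rw [Finset.prod_const, Finset.card_univ]
    gcongr
  have h5 : (s.card : ℝ) ≤ 2 ^ (N + Fintype.card κ) := by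
    rw [pow_add]
    refine (h1.trans h2).trans ?_
    gcongr
  exact_mod_cast h5

/-- The weight attached to an exponent vector: `q ^ t j` on the first copy of `κ` and its inverse
on the second one. -/
noncomputable def gridWeight (q : ℝ) (t : κ → ℕ) : κ ⊕ κ → ℝ :=
  Sum.elim (fun j => q ^ t j) (fun j => (q ^ t j)⁻¹)

theorem gridWeight_pos {q : ℝ} (hq : 0 < q) (t : κ → ℕ) (i : κ ⊕ κ) : 0 < gridWeight q t i := by
  rcases i with j | j <;> simp only [gridWeight, Sum.elim_inl, Sum.elim_inr] <;> positivity

theorem prod_gridWeight [Fintype κ] {q : ℝ} (hq : 0 < q) (t : κ → ℕ) :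
    ∏ i, gridWeight q t i = 1 := by
  rw [Fintype.prod_sum_type]
  simp only [gridWeight, Sum.elim_inl, Sum.elim_inr]
  rw [← Finset.prod_mul_distrib]
  exact Finset.prod_eq_one fun j _ => mul_inv_cancel₀ (by positivity)

theorem gridWeight_mul {q : ℝ} (t u : κ → ℕ) (i : κ ⊕ κ) :
    gridWeight q t i * gridWeight q u i = gridWeight q (t + u) i := by
  rcases i with j | j <;>
    simp [gridWeight, pow_add, mul_comm]

theorem gridWeight_le {q : ℝ} (hq : 1 ≤ q) {k : ℕ} {t : κ → ℕ} (ht : ∀ j, t j ≤ k)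
    (i : κ ⊕ κ) : gridWeight q t i ≤ q ^ k := by
  rcases i with j | j
  · exact pow_le_pow_right₀ hq (ht j)
  · exact (inv_le_one_of_one_le₀ (one_le_pow₀ hq)).trans (one_le_pow₀ hq)

/-- The fibres of the multiplication map on grid elements times box elements are small. -/
theorem card_fiber_grid_mul_le [Fintype κ] [DecidableEq κ] {σ : κ ⊕ κ → R →+* ℝ}
    (hσ : ∀ x : R, x ≠ 0 → 1 ≤ ∏ i, |σ i x|) [IsDomain R] {q : ℝ} (hq : 1 < q)
    {Q r r' : ℝ} (hr : 0 < r) (hqr : r' * Q = q * r)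
    (a : (κ → ℕ) → R) (ha0 : ∀ t, a t ≠ 0) (ha : ∀ t i, |σ i (a t)| ≤ Q * gridWeight q t i)
    (F : Finset ((κ → ℕ) × R)) (hF : ∀ p ∈ F, ∀ i, r ≤ |σ i p.2| ∧ |σ i p.2| ≤ r')
    (x : R) (hx : ∀ p ∈ F, a p.1 * p.2 = x) : F.card ≤ 2 ^ (3 * Fintype.card κ) := by
  rcases F.eq_empty_or_nonempty with rfl | ⟨p0, hp0⟩
  · simp
  have hq0 : 0 < q := by linarith
  have hcard : Fintype.card (κ ⊕ κ) = 2 * Fintype.card κ := by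
    rw [Fintype.card_sum]; ring
  have hxpos : ∀ i, 0 < |σ i x| := by
    intro i
    rw [← hx p0 hp0, map_mul, abs_mul]
    refine mul_pos ?_ (hr.trans_le (hF p0 hp0 i).1)
    by_contra h
    have h0 : |σ i (a p0.1)| = 0 := le_antisymm (not_lt.1 h) (abs_nonneg _)
    have := hσ _ (ha0 p0.1)
    rw [Finset.prod_eq_zero (Finset.mem_univ i) h0] at this
    linarith
  have hprodx : r ^ (2 * Fintype.card κ) ≤ ∏ i, |σ i x| := by
    rw [← hx p0 hp0]
    simp only [map_mul, abs_mul]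
    rw [Finset.prod_mul_distrib]
    have h1 : r ^ (2 * Fintype.card κ) ≤ ∏ i, |σ i p0.2| := by
      rw [← hcard, ← Finset.card_univ, ← Finset.prod_const]
      exact Finset.prod_le_prod (fun _ _ => hr.le) fun i _ => (hF p0 hp0 i).1
    calc r ^ (2 * Fintype.card κ) = 1 * r ^ (2 * Fintype.card κ) := (one_mul _).symm
      _ ≤ _ := mul_le_mul (hσ _ (ha0 p0.1)) h1 (by positivity) (by positivity)
  let c : κ ⊕ κ → ℝ := fun i => r' * Q / |σ i x|
  have hqQ : 0 < r' * Q := by rw [hqr]; positivity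
  have hc : ∀ i, 0 < c i := fun i => div_pos hqQ (hxpos i)
  have hge : ∀ p ∈ F, ∀ i, 1 ≤ c i * gridWeight q p.1 i := by
    intro p hp i
    simp only [c]
    rw [div_mul_eq_mul_div, one_le_div (hxpos i), ← hx p hp, map_mul, abs_mul]
    calc |σ i (a p.1)| * |σ i p.2| ≤ (Q * gridWeight q p.1 i) * r' :=
          mul_le_mul (ha _ i) (hF p hp i).2 (abs_nonneg _) ((abs_nonneg _).trans (ha _ i))
      _ = _ := by ring
  have hprodc : ∀ t, ∏ i, (c i * gridWeight q t i) ≤ q ^ (2 * Fintype.card κ) := by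
    intro t
    rw [Finset.prod_mul_distrib, prod_gridWeight hq0, mul_one, Finset.prod_div_distrib,
      Finset.prod_const, Finset.card_univ, hcard, hqr, mul_pow]
    rw [div_le_iff₀ (Finset.prod_pos fun i _ => hxpos i)]
    gcongr
  let e : (κ → ℕ) × R → κ → ℕ := fun p j => ⌊Real.logb q (c (Sum.inl j)) + p.1 j⌋₊
  have hlog : ∀ (p : (κ → ℕ) × R) j, Real.logb q (c (Sum.inl j)) + p.1 j =
      Real.logb q (c (Sum.inl j) * gridWeight q p.1 (Sum.inl j)) := by
    intro p j
    rw [Real.logb_mul (hc _).ne' (gridWeight_pos hq0 _ _).ne']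
    simp only [gridWeight, Sum.elim_inl]
    rw [Real.logb_pow, Real.logb_self_eq_one hq, mul_one]
  have hinj : Set.InjOn e F := by
    intro p hp p' hp' h
    have h1 : p.1 = p'.1 := by
      funext j
      have h2 := congrFun h j
      simp only [e] at h2
      have hnn : ∀ p ∈ F, 0 ≤ Real.logb q (c (Sum.inl j)) + p.1 j := by
        intro p hp
        rw [hlog]
        exact Real.logb_nonneg hq (hge p hp _)
      have h3 := hnn p hp
      have h4 := hnn p' hp'
      have h5 : ⌊Real.logb q (c (Sum.inl j)) + p.1 j⌋ = ⌊Real.logb q (c (Sum.inl j)) + p'.1 j⌋ := by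
        rw [← Int.natCast_floor_eq_floor h3, ← Int.natCast_floor_eq_floor h4, h2]
      rw [Int.floor_add_natCast, Int.floor_add_natCast] at h5
      omega
    refine Prod.ext h1 (mul_left_cancel₀ (ha0 p.1) ?_)
    rw [hx p hp, h1, hx p' hp']
  rw [← Finset.card_image_of_injOn hinj]
  refine (card_functions_sum_le (2 * Fintype.card κ) _ ?_).trans (by
    apply Nat.pow_le_pow_right <;> omega)
  intro e' he'
  obtain ⟨p, hp, rfl⟩ := Finset.mem_image.1 he'
  have h1 : (∑ j, e p j : ℝ) ≤ ∑ i, Real.logb q (c i * gridWeight q p.1 i) := by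
    rw [Fintype.sum_sum_type]
    have h2 : ∑ j, (e p j : ℝ) ≤
        ∑ j, Real.logb q (c (Sum.inl j) * gridWeight q p.1 (Sum.inl j)) := by
      apply Finset.sum_le_sum
      intro j _
      rw [← hlog]
      apply Nat.floor_le
      rw [hlog]
      exact Real.logb_nonneg hq (hge p hp _)
    have h3 : 0 ≤ ∑ j, Real.logb q (c (Sum.inr j) * gridWeight q p.1 (Sum.inr j)) :=
      Finset.sum_nonneg fun j _ => Real.logb_nonneg hq (hge p hp _)
    linarith
  have h2 : ∑ i, Real.logb q (c i * gridWeight q p.1 i) ≤ (2 * Fintype.card κ : ℕ) := by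
    rw [← Real.logb_prod _ _ fun i _ => (mul_pos (hc i) (gridWeight_pos hq0 _ _)).ne']
    rw [Real.logb_le_iff_le_rpow hq, Real.rpow_natCast]
    · exact hprodc p.1
    · exact Finset.prod_pos fun i _ => mul_pos (hc i) (gridWeight_pos hq0 _ _)
  exact_mod_cast h1.trans h2

end BoxConstruction

section BoxConstruction2

variable {R κ : Type*} [CommRing R]

/-- The number of steps of the grid used for the root discriminant bound `ρ`. -/
def gridSize (ρ : ℕ) : ℕ := 2 * (3456 * ρ ^ 4) ^ 2

/-- The constant of the sum-product construction for the root discriminant bound `ρ`. -/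
def sumProductConst (ρ : ℕ) : ℕ := 180 * ρ ^ 2 * (gridSize ρ + 1) * (6 * ρ) ^ gridSize ρ

theorem realBox_packing_const [Fintype κ] [Nonempty κ] {σ : κ ⊕ κ → R →+* ℝ}
    (hσ : ∀ x : R, x ≠ 0 → 1 ≤ ∏ i, |σ i x|) {w : κ ⊕ κ → ℝ} (hw : ∀ i, 0 < w i)
    (hw1 : ∏ i, w i = 1) {M : ℕ} (hM : 0 < M) :
    (realBox σ fun i => M * w i).Finite ∧
      (realBox σ fun i => M * w i).ncard ≤ (3 * M) ^ (2 * Fintype.card κ) := by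
  have hcard : Fintype.card (κ ⊕ κ) = 2 * Fintype.card κ := by
    rw [Fintype.card_sum]; ring
  have h := realBox_packing hσ (r := fun i => M * w i)
    (fun i => mul_pos (by exact_mod_cast hM) (hw i)) hM (by
      rw [Finset.prod_mul_distrib, hw1, mul_one, Finset.prod_const, Finset.card_univ])
  rw [hcard] at h
  exact ⟨h.1, h.2.trans (Nat.pow_le_pow_left (by omega) _)⟩

theorem exists_sumProduct_set [Fintype κ] [Nonempty κ] [IsDomain R] {σ : κ ⊕ κ → R →+* ℝ}
    (hσ : ∀ x : R, x ≠ 0 → 1 ≤ ∏ i, |σ i x|) {ρ : ℕ} (hρ : 1 ≤ ρ)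
    (hbox : ∀ r : κ ⊕ κ → ℝ, (∀ i, 0 < r i) →
      ∏ i, r i ≤ (ρ : ℝ) ^ (2 * Fintype.card κ) * (realBox σ r).ncard)
    (X : ℝ) (hX : 1 ≤ X) :
    ∃ A : Set R, A.Finite ∧ X ^ (2 * Fintype.card κ) ≤ A.ncard ∧
      (A.ncard : ℝ) ≤ (sumProductConst ρ * X) ^ (2 * Fintype.card κ) ∧
      ((A + A).ncard : ℝ) ≤ (sumProductConst ρ : ℝ) ^ (2 * Fintype.card κ) * A.ncard ∧
      2 ^ (2 * Fintype.card κ) * ((A * A).ncard : ℝ) ≤ (A.ncard : ℝ) ^ 2 := by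
  classical
  set m := Fintype.card κ with hm
  have hm0 : 0 < m := Fintype.card_pos
  have hcard : Fintype.card (κ ⊕ κ) = 2 * m := by rw [Fintype.card_sum]; ring
  have hρ' : (1 : ℝ) ≤ ρ := by exact_mod_cast hρ
  set k := gridSize ρ with hk
  set N := ⌈4 * ρ * X⌉₊ with hN
  have hN1 : 4 * ρ * X ≤ N := Nat.le_ceil _
  have hN2 : (N : ℝ) ≤ 5 * ρ * X := by
    have := (Nat.ceil_lt_add_one (a := 4 * ρ * X) (by positivity)).le
    have : 1 ≤ ρ * X := by nlinarith
    linarith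
  have hN0 : 0 < N := by
    have : (0 : ℝ) < N := lt_of_lt_of_le (by positivity) hN1
    exact_mod_cast this
  have hN0' : (0 : ℝ) < N := by exact_mod_cast hN0
  set q : ℝ := 6 * ρ with hq
  have hq1 : 1 < q := by rw [hq]; linarith
  have hq0 : 0 < q := by linarith
  set Q : ℝ := 2 * ρ with hQ
  have hQ0 : 0 < Q := by rw [hQ]; linarith
  -- the multipliers
  have hexa : ∀ t : κ → ℕ, ∃ a : R, a ≠ 0 ∧ ∀ i, |σ i a| ≤ Q * gridWeight q t i := by
    intro t
    by_contra! hcon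
    have hsub : realBox σ (fun i => Q * gridWeight q t i) ⊆ {0} := by
      intro x hx
      by_contra h0
      obtain ⟨i, hi⟩ := hcon x h0
      exact absurd (hx i) (not_le.2 hi)
    have h1 := hbox (fun i => Q * gridWeight q t i) fun i => mul_pos hQ0 (gridWeight_pos hq0 t i)
    rw [Finset.prod_mul_distrib, prod_gridWeight hq0, mul_one, Finset.prod_const, Finset.card_univ,
      hcard] at h1
    have h2 : ((realBox σ fun i => Q * gridWeight q t i).ncard : ℝ) ≤ 1 := by
      have := Set.ncard_le_ncard hsub
      rw [Set.ncard_singleton] at this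
      exact_mod_cast this
    have h3 : Q ^ (2 * m) ≤ (ρ : ℝ) ^ (2 * m) :=
      h1.trans (mul_le_of_le_one_right (by positivity) h2)
    have h4 : (ρ : ℝ) ^ (2 * m) < Q ^ (2 * m) :=
      pow_lt_pow_left₀ (by rw [hQ]; linarith) (by linarith) (by omega)
    linarith
  choose a ha0 ha using hexa
  -- the base box
  set B0 : Set R := realBox σ fun _ => (N : ℝ) with hB0
  have hB0fin : B0.Finite ∧ B0.ncard ≤ (3 * N) ^ (2 * m) := by
    have := realBox_packing_const hσ (w := fun _ => 1) (fun _ => one_pos) (by simp) hN0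
    simpa [hB0] using this
  set Bf : Finset R := hB0fin.1.toFinset.image fun y => (2 * N : ℕ) + y with hBf
  have hBcard : Bf.card = B0.ncard := by
    rw [hBf, Finset.card_image_of_injective _ (add_right_injective _)]
    exact (Set.ncard_eq_toFinset_card _ hB0fin.1).symm
  have hBlow : (N / ρ : ℝ) ^ (2 * m) ≤ Bf.card := by
    have h1 := hbox (fun _ => (N : ℝ)) fun _ => hN0'
    rw [Finset.prod_const, Finset.card_univ, hcard] at h1
    rw [hBcard, div_pow, div_le_iff₀ (by positivity), mul_comm (B0.ncard : ℝ)]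
    exact h1
  have hBmem : ∀ b ∈ Bf, ∀ i, (N : ℝ) ≤ |σ i b| ∧ |σ i b| ≤ 3 * N := by
    intro b hb i
    obtain ⟨y, hy, rfl⟩ := Finset.mem_image.1 hb
    have h1 := abs_le.1 ((hB0fin.1.mem_toFinset.1 hy) i)
    rw [map_add, map_natCast]
    push_cast
    rw [abs_of_pos (by linarith)]
    constructor <;> linarith
  -- the grid
  set G : Finset (κ → ℕ) := Fintype.piFinset fun _ => Finset.range (k + 1) with hG
  have hGcard : G.card = (k + 1) ^ m := by
    rw [hG, Fintype.card_piFinset, Finset.prod_const, Finset.card_range, Finset.card_univ]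
  have hGmem : ∀ t ∈ G, ∀ j, t j ≤ k := fun t ht j =>
    Nat.lt_succ_iff.1 (Finset.mem_range.1 (Fintype.mem_piFinset.1 ht j))
  set Af : Finset R := (G ×ˢ Bf).image fun p => a p.1 * p.2 with hAf
  have hAup : Af.card ≤ G.card * Bf.card := by
    rw [← Finset.card_product]; exact Finset.card_image_le
  have hAlow : G.card * Bf.card ≤ 2 ^ (3 * m) * Af.card := by
    rw [← Finset.card_product]
    refine Finset.card_le_mul_card_image_of_maps_to (f := fun p => a p.1 * p.2) (t := Af)
      (fun p hp => Finset.mem_image_of_mem _ hp) _ fun x _ => ?_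
    refine card_fiber_grid_mul_le hσ hq1 (Q := Q) (r := N) (r' := 3 * N) hN0'
      (by rw [hq, hQ]; ring) a ha0 ha _ ?_ x ?_
    · intro p hp
      exact hBmem _ (Finset.mem_product.1 (Finset.mem_filter.1 hp).1).2
    · intro p hp
      exact (Finset.mem_filter.1 hp).2
  have hAmem : ∀ t ∈ G, ∀ b ∈ Bf, ∀ i, |σ i (a t * b)| ≤ 3 * N * Q * gridWeight q t i := by
    intro t ht b hb i
    rw [map_mul, abs_mul]
    calc _ ≤ (Q * gridWeight q t i) * (3 * N) :=
          mul_le_mul (ha _ i) (hBmem b hb i).2 (abs_nonneg _) ((abs_nonneg _).trans (ha _ i))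
      _ = _ := by ring
  have hlowR : (k + 1 : ℝ) ^ m * (N / (4 * ρ)) ^ (2 * m) ≤ Af.card := by
    have h1 : ((k + 1 : ℝ)) ^ m * (N / ρ) ^ (2 * m) ≤ 4 ^ (2 * m) * Af.card := by
      calc ((k + 1 : ℝ)) ^ m * (N / ρ) ^ (2 * m) ≤ (G.card : ℝ) * Bf.card := by
            rw [hGcard]; push_cast; gcongr
        _ ≤ 2 ^ (3 * m) * Af.card := by exact_mod_cast hAlow
        _ ≤ _ := by
            have : (2 : ℝ) ^ (3 * m) ≤ 4 ^ (2 * m) := by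
              rw [pow_mul, pow_mul]
              exact pow_le_pow_left₀ (by norm_num) (by norm_num) _
            gcongr
    rw [show (N / (4 * ρ) : ℝ) = N / ρ / 4 by field_simp, div_pow _ (4 : ℝ), mul_div_assoc',
      div_le_iff₀ (by positivity), mul_comm (Af.card : ℝ)]
    exact h1
  have hk1 : (1 : ℝ) ≤ (k + 1 : ℝ) := by linarith [(Nat.cast_nonneg k : (0 : ℝ) ≤ k)]
  have hXlow : X ^ (2 * m) ≤ Af.card := by
    refine le_trans ?_ hlowR
    calc X ^ (2 * m) ≤ (N / (4 * ρ)) ^ (2 * m) := by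
          gcongr
          rw [le_div_iff₀ (by positivity)]
          linarith
      _ ≤ _ := le_mul_of_one_le_left (by positivity) (one_le_pow₀ hk1)
  have hCdef : (sumProductConst ρ : ℝ) = 180 * ρ ^ 2 * (k + 1) * q ^ k := by
    rw [sumProductConst, ← hk, hq]; push_cast; ring
  have hqk : 1 ≤ q ^ k := one_le_pow₀ hq1.le
  refine ⟨Af, Af.finite_toSet, ?_, ?_, ?_, ?_⟩
  · rwa [Set.ncard_coe_finset]
  · rw [Set.ncard_coe_finset]
    calc (Af.card : ℝ) ≤ (k + 1 : ℝ) ^ m * (3 * N) ^ (2 * m) := by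
          have := hAup.trans (Nat.mul_le_mul_left _ (hBcard.le.trans hB0fin.2))
          rw [hGcard] at this
          exact_mod_cast this
      _ ≤ (k + 1 : ℝ) ^ (2 * m) * (3 * N) ^ (2 * m) := by
          gcongr ?_ * _
          exact pow_le_pow_right₀ hk1 (by omega)
      _ = ((k + 1 : ℝ) * (3 * N)) ^ (2 * m) := (mul_pow _ _ _).symm
      _ ≤ _ := by
          refine pow_le_pow_left₀ (by positivity) ?_ _
          rw [hCdef]
          have h1 : (15 * ρ * X : ℝ) ≤ 180 * ρ ^ 2 * q ^ k * X := by
            have : (15 * ρ : ℝ) ≤ 180 * ρ ^ 2 * q ^ k := by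
              calc (15 * ρ : ℝ) ≤ 180 * ρ ^ 2 * 1 := by nlinarith
                _ ≤ _ := by gcongr
            gcongr
          calc (k + 1 : ℝ) * (3 * N) ≤ (k + 1) * (180 * ρ ^ 2 * q ^ k * X) := by
                refine mul_le_mul_of_nonneg_left ?_ (by linarith); linarith
            _ = _ := by ring
  · have h1 := realBox_packing_const hσ (w := fun _ => 1) (fun _ => one_pos) (by simp)
      (M := 12 * N * ρ * (6 * ρ) ^ k) (by positivity)
    have hsub : (Af : Set R) + Af ⊆
        realBox σ fun i => ((12 * N * ρ * (6 * ρ) ^ k : ℕ) : ℝ) * 1 := by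
      rintro _ ⟨x, hx, y, hy, rfl⟩ i
      have key : ∀ x ∈ Af, |σ i x| ≤ 3 * N * Q * q ^ k := by
        intro x hx
        obtain ⟨⟨t, b⟩, hp, rfl⟩ := Finset.mem_image.1 hx
        obtain ⟨ht, hb⟩ := Finset.mem_product.1 hp
        refine (hAmem t ht b hb i).trans ?_
        gcongr
        exact gridWeight_le hq1.le (hGmem t ht) i
      change |σ i (x + y)| ≤ _
      rw [map_add]
      refine (abs_add_le _ _).trans ((add_le_add (key x hx) (key y hy)).trans_eq ?_)
      rw [hQ, hq]; push_cast; ring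
    have h2 := (Set.ncard_le_ncard hsub h1.1).trans h1.2
    rw [Set.ncard_coe_finset]
    calc (((Af : Set R) + Af).ncard : ℝ) ≤ (3 * (12 * N * ρ * q ^ k)) ^ (2 * m) := by
          rw [hq]; exact_mod_cast h2
      _ ≤ (sumProductConst ρ * X) ^ (2 * m) := by
          refine pow_le_pow_left₀ (by positivity) ?_ _
          rw [hCdef]
          calc (3 * (12 * N * ρ * q ^ k) : ℝ) ≤ 3 * (12 * (5 * ρ * X) * ρ * q ^ k) := by gcongr
            _ = (180 * ρ ^ 2 * q ^ k * X) * 1 := by ring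
            _ ≤ (180 * ρ ^ 2 * q ^ k * X) * (k + 1) := by gcongr
            _ = _ := by ring
      _ ≤ _ := by rw [mul_pow]; gcongr
  · set H : Finset (κ → ℕ) := Fintype.piFinset fun _ => Finset.range (2 * k + 1) with hH
    have hHcard : H.card = (2 * k + 1) ^ m := by
      rw [hH, Fintype.card_piFinset, Finset.prod_const, Finset.card_range, Finset.card_univ]
    set M : ℕ := 36 * N ^ 2 * ρ ^ 2 with hM
    have h1 : ∀ t : κ → ℕ, _ := fun t => realBox_packing_const hσ (w := gridWeight q t)
      (fun i => gridWeight_pos hq0 t i) (prod_gridWeight hq0 t) (M := M) (by positivity)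
    have hsub : (Af : Set R) * Af ⊆ ⋃ t ∈ H, realBox σ fun i => (M : ℝ) * gridWeight q t i := by
      rintro _ ⟨x, hx, y, hy, rfl⟩
      obtain ⟨⟨t, b⟩, hp, rfl⟩ := Finset.mem_image.1 hx
      obtain ⟨ht, hb⟩ := Finset.mem_product.1 hp
      obtain ⟨⟨u, c⟩, hp', rfl⟩ := Finset.mem_image.1 hy
      obtain ⟨hu, hc⟩ := Finset.mem_product.1 hp'
      simp only [Set.mem_iUnion]
      refine ⟨t + u, ?_, fun i => ?_⟩
      · rw [hH, Fintype.mem_piFinset]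
        intro j
        have := hGmem t ht j
        have := hGmem u hu j
        simp only [Pi.add_apply, Finset.mem_range]
        omega
      · rw [map_mul, abs_mul]
        calc _ ≤ (3 * N * Q * gridWeight q t i) * (3 * N * Q * gridWeight q u i) :=
              mul_le_mul (hAmem t ht b hb i) (hAmem u hu c hc i) (abs_nonneg _)
                ((abs_nonneg _).trans (hAmem t ht b hb i))
          _ = (M : ℝ) * (gridWeight q t i * gridWeight q u i) := by
              rw [hM, hQ]; push_cast; ring
          _ = _ := by rw [gridWeight_mul]
    have hfin : (⋃ t ∈ H, realBox σ fun i => (M : ℝ) * gridWeight q t i).Finite :=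
      H.finite_toSet.biUnion fun t _ => (h1 t).1
    have h2 : ((Af : Set R) * Af).ncard ≤ (2 * k + 1) ^ m * (3 * M) ^ (2 * m) := by
      refine (Set.ncard_le_ncard hsub hfin).trans ((Finset.set_ncard_biUnion_le _ _).trans ?_)
      rw [← hHcard, ← smul_eq_mul]
      exact Finset.sum_le_card_nsmul _ _ _ fun t _ => (h1 t).2
    rw [Set.ncard_coe_finset]
    have h3 : (2 : ℝ) ^ (2 * m) * (((Af : Set R) * Af).ncard : ℝ) ≤
        2 ^ (2 * m) * ((2 * k + 1) ^ m * (3 * M) ^ (2 * m)) := by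
      gcongr
      exact_mod_cast h2
    have h4 : ((k + 1 : ℝ) ^ m * (N / (4 * ρ)) ^ (2 * m)) ^ 2 ≤ (Af.card : ℝ) ^ 2 := by gcongr
    refine h3.trans (le_trans ?_ h4)
    have h5 : (2 : ℝ) ^ (2 * m) * ((2 * k + 1) ^ m * (3 * M) ^ (2 * m)) =
        (2 ^ 2 * ((2 * k + 1) * (3 * M) ^ 2)) ^ m := by
      simp only [mul_pow, pow_mul]
    have h6 : ((k + 1 : ℝ) ^ m * (N / (4 * ρ)) ^ (2 * m)) ^ 2 =
        ((k + 1) ^ 2 * (N / (4 * ρ)) ^ 4) ^ m := by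
      rw [mul_pow, mul_pow, ← pow_mul, ← pow_mul, ← pow_mul, ← pow_mul]
      congr 2 <;> ring
    rw [h5, h6]
    have hkval : (k : ℝ) = 2 * (3456 * ρ ^ 4) ^ 2 := by rw [hk, gridSize]; push_cast; ring
    refine pow_le_pow_left₀ (by positivity) ?_ _
    rw [div_pow, mul_div_assoc', le_div_iff₀ (by positivity)]
    have h7 : (2 ^ 2 * ((2 * k + 1) * (3 * M) ^ 2) * (4 * ρ) ^ 4 : ℝ) =
        (2 * k + 1) * (2 ^ 2 * (3 * 36) ^ 2 * 4 ^ 4 * ρ ^ 8) * N ^ 4 := by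
      rw [hM]; push_cast; ring
    rw [h7]
    gcongr
    calc (2 * k + 1 : ℝ) * (2 ^ 2 * (3 * 36) ^ 2 * 4 ^ 4 * ρ ^ 8)
        ≤ (2 * (k + 1)) * ((2 * (3456 * ρ ^ 4) ^ 2 + 1) / 2) := by
          apply mul_le_mul (by linarith) _ (by positivity) (by positivity)
          have : (0 : ℝ) ≤ ρ ^ 8 := by positivity
          nlinarith
      _ = ((k : ℝ) + 1) ^ 2 := by rw [← hkval]; ring

end BoxConstruction2

section LatticeCount

open MeasureTheory

/-- If no point is covered more than `N` times by the translates of `s` under a lattice, then the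
measure of `s` is at most `N` times the covolume. -/
theorem measure_le_mul_of_covering {E L : Type*} [MeasurableSpace E] {μ : Measure E} {F s : Set E}
    [AddGroup L] [Countable L] [AddAction L E] [MeasurableSpace L] [MeasurableVAdd L E]
    [VAddInvariantMeasure L E μ] (fund : IsAddFundamentalDomain L F μ) (hs : MeasurableSet s)
    (N : ℕ) (hN : ∀ (x : E) (T : Finset L), (∀ l ∈ T, x ∈ l +ᵥ s) → T.card ≤ N) :
    μ s ≤ N * μ F := by
  classical
  have hms : ∀ l : L, MeasurableSet (l +ᵥ s) := fun l => hs.const_vadd l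
  calc μ s = ∑' l : L, μ ((l +ᵥ s) ∩ F) := fund.measure_eq_tsum s
    _ = ∑' l : L, ∫⁻ x in F, (l +ᵥ s).indicator 1 x ∂μ := by
        congr 1
        ext l
        rw [lintegral_indicator_one (hms l), Measure.restrict_apply (hms l)]
    _ = ∫⁻ x in F, ∑' l : L, (l +ᵥ s).indicator 1 x ∂μ :=
        (lintegral_tsum fun l => (measurable_one.indicator (hms l)).aemeasurable).symm
    _ ≤ ∫⁻ _ in F, (N : ENNReal) ∂μ := by
        apply lintegral_mono
        intro x
        change ∑' l : L, (l +ᵥ s).indicator 1 x ≤ (N : ENNReal)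
        rw [ENNReal.tsum_eq_iSup_sum]
        refine iSup_le fun T => ?_
        have : ∑ l ∈ T, (l +ᵥ s).indicator (1 : E → ENNReal) x =
            ((T.filter fun l => x ∈ l +ᵥ s).card : ENNReal) := by
          rw [Finset.card_filter]
          push_cast
          exact Finset.sum_congr rfl fun l _ => by simp [Set.indicator_apply]
        rw [this]
        exact_mod_cast hN x _ fun l hl => (Finset.mem_filter.1 hl).2
    _ = N * μ F := by rw [setLIntegral_const]

end LatticeCount

section TotallyRealBoxes

open MeasureTheory mixedEmbedding

variable (K : Type*) [Field K] [NumberField K] [IsTotallyReal K]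

/-- The real embedding of the ring of integers of a totally real field attached to a place. -/
noncomputable def realEmbedding (w : InfinitePlace K) : 𝓞 K →+* ℝ :=
  (InfinitePlace.embedding_of_isReal (IsTotallyReal.isReal w)).comp (algebraMap (𝓞 K) K)

omit [NumberField K] in
theorem abs_realEmbedding (w : InfinitePlace K) (x : 𝓞 K) : |realEmbedding K w x| = w x :=
  InfinitePlace.norm_embedding_of_isReal (IsTotallyReal.isReal w) _

theorem IsTotallyReal.card_infinitePlace :
    Fintype.card (InfinitePlace K) = InfinitePlace.nrRealPlaces K := by
  rw [InfinitePlace.card_eq_nrRealPlaces_add_nrComplexPlaces,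
    IsTotallyReal.nrComplexPlaces_eq_zero, add_zero]

theorem one_le_prod_abs_realEmbedding (x : 𝓞 K) (hx : x ≠ 0) :
    1 ≤ ∏ w, |realEmbedding K w x| := by
  have h := InfinitePlace.prod_eq_abs_norm (K := K) (x : K)
  simp only [IsTotallyReal.mult_eq, pow_one] at h
  simp only [abs_realEmbedding]
  rw [h, ← Algebra.coe_norm_int]
  have : Algebra.norm ℤ x ≠ 0 := Algebra.norm_ne_zero_iff.2 hx
  have h1 : 1 ≤ |Algebra.norm ℤ x| := Int.one_le_abs this
  exact_mod_cast h1

theorem prod_le_sqrt_discr_mul_ncard_realBox (r : InfinitePlace K → ℝ) (hr : ∀ w, 0 < r w)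
    (hfin : (realBox (realEmbedding K) r).Finite) :
    ∏ w, r w ≤ √|(discr K : ℝ)| * (realBox (realEmbedding K) r).ncard := by
  classical
  have h_fund := ZSpan.isAddFundamentalDomain' (latticeBasis K) volume
  have : Countable (Submodule.span ℤ (Set.range (latticeBasis K))).toAddSubgroup := by
    change Countable (Submodule.span ℤ (Set.range (latticeBasis K)))
    infer_instance
  let f : InfinitePlace K → NNReal := fun w => ⟨r w / 2, (half_pos (hr w)).le⟩
  have hms : MeasurableSet (convexBodyLT K f) := by
    refine MeasurableSet.prod ?_ ?_
    · exact MeasurableSet.pi Set.countable_univ fun w _ => measurableSet_ball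
    · exact MeasurableSet.pi Set.countable_univ fun w _ => measurableSet_ball
  have key := measure_le_mul_of_covering h_fund hms (realBox (realEmbedding K) r).ncard (by
    intro x T hT
    rcases T.eq_empty_or_nonempty with rfl | ⟨l0, hl0⟩
    · simp
    have hex : ∀ l : (Submodule.span ℤ (Set.range (latticeBasis K))).toAddSubgroup,
        ∃ a : 𝓞 K, mixedEmbedding K (a : K) = l := by
      rintro ⟨l, hl⟩
      rw [Submodule.mem_toAddSubgroup, mem_span_latticeBasis] at hl
      obtain ⟨a, ⟨a, rfl⟩, rfl⟩ := hl
      exact ⟨a, rfl⟩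
    choose g hg using hex
    have hginj : Function.Injective g := by
      intro l l' h
      apply Subtype.ext
      rw [← hg, ← hg, h]
    rw [← Finset.card_image_of_injective T (f := fun l => g l - g l0)
      (fun l l' h => hginj (sub_left_injective h)), ← Set.ncard_coe_finset]
    refine Set.ncard_le_ncard ?_ hfin
    intro y hy
    obtain ⟨l, hl, rfl⟩ := Finset.mem_image.1 (Finset.mem_coe.1 hy)
    intro w
    have hw : w.IsReal := IsTotallyReal.isReal w
    have h1 : ∀ l ∈ T, |x.1 ⟨w, hw⟩ - InfinitePlace.embedding_of_isReal hw (g l : K)| < r w / 2 := by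
      intro l hl
      obtain ⟨z, hz, rfl⟩ := hT l hl
      have h2 := (Set.mem_prod.1 hz).1 ⟨w, hw⟩ (Set.mem_univ _)
      have h3 : ((l +ᵥ z : mixedSpace K)).1 ⟨w, hw⟩ =
          InfinitePlace.embedding_of_isReal hw (g l : K) + z.1 ⟨w, hw⟩ := by
        change ((l : mixedSpace K) + z).1 ⟨w, hw⟩ = _
        rw [← hg l]
        rfl
      change |((l +ᵥ z : mixedSpace K)).1 ⟨w, hw⟩ - _| < _
      rw [h3, add_sub_cancel_left]
      rw [mem_ball_zero_iff, Real.norm_eq_abs] at h2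
      exact h2
    have h2 := h1 l hl
    have h3 := h1 l0 hl0
    change |InfinitePlace.embedding_of_isReal hw ((g l - g l0 : 𝓞 K) : K)| ≤ r w
    push_cast
    rw [map_sub, abs_le]
    rw [abs_lt] at h2 h3
    constructor <;> linarith)
  rw [convexBodyLT_volume, volume_fundamentalDomain_latticeBasis,
    IsTotallyReal.nrComplexPlaces_eq_zero, pow_zero, one_mul] at key
  simp only [IsTotallyReal.mult_eq, pow_one] at key
  rw [convexBodyLTFactor, IsTotallyReal.nrComplexPlaces_eq_zero, pow_zero, mul_one,
    ← IsTotallyReal.card_infinitePlace] at key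
  have key2 : (2 : NNReal) ^ Fintype.card (InfinitePlace K) * ∏ w, f w ≤
      (realBox (realEmbedding K) r).ncard * NNReal.sqrt ‖discr K‖₊ := by
    exact_mod_cast key
  have key3 : (2 : ℝ) ^ Fintype.card (InfinitePlace K) * ∏ w, r w / 2 ≤
      (realBox (realEmbedding K) r).ncard * √|(discr K : ℝ)| := by
    have := NNReal.coe_le_coe.2 key2
    push_cast at this
    have hn : ‖discr K‖ = |(discr K : ℝ)| := by rw [Int.norm_eq_abs]
    rw [hn] at this
    exact this
  rw [Finset.prod_div_distrib, Finset.prod_const, Finset.card_univ,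
    mul_div_cancel₀ _ (by positivity)] at key3
  linarith

theorem exists_sumProduct_set_of_discr_le (m : ℕ) (hm : 0 < m)
    (hK : Module.finrank ℚ K = 2 * m) (ρ : ℕ) (hρ : 1 ≤ ρ)
    (hD : |(discr K : ℝ)| ≤ (ρ : ℝ) ^ (2 * (2 * m))) (X : ℝ) (hX : 1 ≤ X) :
    ∃ A : Set (𝓞 K), A.Finite ∧ X ^ (2 * m) ≤ A.ncard ∧
      (A.ncard : ℝ) ≤ (sumProductConst ρ * X) ^ (2 * m) ∧
      ((A + A).ncard : ℝ) ≤ (sumProductConst ρ : ℝ) ^ (2 * m) * A.ncard ∧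
      2 ^ (2 * m) * ((A * A).ncard : ℝ) ≤ (A.ncard : ℝ) ^ 2 := by
  have hcard : Fintype.card (InfinitePlace K) = Fintype.card (Fin m ⊕ Fin m) := by
    rw [IsTotallyReal.card_infinitePlace, ← IsTotallyReal.finrank K, hK,
      Fintype.card_sum, Fintype.card_fin]
    ring
  let e : InfinitePlace K ≃ Fin m ⊕ Fin m := Fintype.equivOfCardEq hcard
  have : Nonempty (Fin m) := ⟨⟨0, hm⟩⟩
  have hσ : ∀ x : 𝓞 K, x ≠ 0 → 1 ≤ ∏ i, |realEmbedding K (e.symm i) x| := by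
    intro x hx
    rw [e.symm.prod_comp fun w => |realEmbedding K w x|]
    exact one_le_prod_abs_realEmbedding K x hx
  have h := exists_sumProduct_set (σ := fun i => realEmbedding K (e.symm i)) hσ hρ (by
    intro r hr
    have hbox : realBox (fun i => realEmbedding K (e.symm i)) r =
        realBox (realEmbedding K) fun w => r (e w) := by
      ext x
      constructor
      · intro h w
        simpa using h (e w)
      · intro h i
        simpa using h (e.symm i)
    have hfin : (realBox (fun i => realEmbedding K (e.symm i)) r).Finite := by
      obtain ⟨M, hM⟩ := exists_nat_ge (1 + ∑ i, r i)
      have hM0 : 0 < M := by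
        have : 0 ≤ ∑ i, r i := Finset.sum_nonneg fun i _ => (hr i).le
        have : (0 : ℝ) < M := by linarith
        exact_mod_cast this
      refine (realBox_packing hσ (r := fun _ => (M : ℝ)) (fun _ => by exact_mod_cast hM0) hM0
        (by simp)).1.subset (realBox_mono fun i => ?_)
      have := Finset.single_le_sum (f := r) (fun i _ => (hr i).le) (Finset.mem_univ i)
      linarith
    rw [hbox] at hfin ⊢
    have h1 := prod_le_sqrt_discr_mul_ncard_realBox K (fun w => r (e w)) (fun w => hr _) hfin
    rw [e.prod_comp] at h1
    refine h1.trans ?_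
    gcongr
    rw [Real.sqrt_le_left (by positivity), ← pow_mul, Fintype.card_fin, mul_comm (2 * m)]
    exact hD) X hX
  simpa only [Fintype.card_fin] using h

end TotallyRealBoxes

section Herbrand

open AddSubgroup

theorem AddSubgroup.relIndex_sup_eq_of_le {G : Type*} [AddCommGroup G] {H K L : AddSubgroup G} (h : L ≤ H) :
    H.relIndex (K ⊔ L) = H.relIndex K := by
  rw [← relIndex_sup_right, ← relIndex_sup_right (H := K), sup_assoc, sup_eq_right.2 h]

theorem AddSubgroup.map_inf_comap {G G' : Type*} [AddCommGroup G] [AddCommGroup G'] (f : G →+ G')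
    (H : AddSubgroup G) (K : AddSubgroup G') : (H ⊓ K.comap f).map f = H.map f ⊓ K := by
  ext x
  simp only [mem_map, mem_inf, mem_comap]
  constructor
  · rintro ⟨y, ⟨h1, h2⟩, rfl⟩
    exact ⟨⟨y, h1, rfl⟩, h2⟩
  · rintro ⟨⟨y, h1, rfl⟩, h2⟩
    exact ⟨y, ⟨h1, h2⟩, rfl⟩

/-- The two Tate cohomology groups of a finite quotient have the same order. -/
theorem AddSubgroup.relIndex_comap_eq_of_finite {I : Type*} [AddCommGroup I] (P : AddSubgroup I)
    (hP : P.index ≠ 0) (f g : I →+ I) (hfP : P.map f ≤ P) (hgP : P.map g ≤ P)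
    (hfg : f.comp g = 0) (hgf : g.comp f = 0) :
    (P ⊔ f.range).relIndex (P.comap g) = (P ⊔ g.range).relIndex (P.comap f) := by
  have key : ∀ f g : I →+ I, P.map f ≤ P → P.map g ≤ P → g.comp f = 0 →
      P.index = (P.comap f).index * (P ⊔ f.range).relIndex (P.comap g) * (P.comap g).index := by
    intro f g hf hg h
    have h1 : P ⊔ f.range ≤ P.comap g := by
      refine sup_le (map_le_iff_le_comap.1 hg) ?_
      rintro _ ⟨x, rfl⟩
      have := DFunLike.congr_fun h x
      simp only [AddMonoidHom.comp_apply, AddMonoidHom.zero_apply] at this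
      simp [mem_comap, this]
    rw [← relIndex_mul_index (le_sup_left.trans h1), ← relIndex_mul_relIndex _ _ _ le_sup_left h1]
    congr 2
    rw [sup_comm, relIndex_sup_right, AddMonoidHom.range_eq_map, ← relIndex_comap,
      relIndex_top_right]
  have e1 := key f g hfP hgP hgf
  have e2 := key g f hgP hfP hfg
  have n1 : (P.comap f).index ≠ 0 := by intro h; apply hP; rw [e1, h]; simp
  have n2 : (P.comap g).index ≠ 0 := by intro h; apply hP; rw [e1, h]; simp
  rw [e1] at e2
  have : (P.comap f).index * (P.comap g).index * (P ⊔ f.range).relIndex (P.comap g) =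
     (P.comap f).index * (P.comap g).index * (P ⊔ g.range).relIndex (P.comap f) := by
    linarith
  exact mul_left_cancel₀ (mul_ne_zero n1 n2) this

/-- Six term exact sequence for the cohomology of an involution, in numerical form. -/
theorem ambiguous_index_formula {A I : Type*} [AddCommGroup A] [AddCommGroup I]
    (D : A →+ I) (N δ : A →+ A) (N' δ' : I →+ I)
    (hN : D.comp N = N'.comp D) (hδ : D.comp δ = δ'.comp D)
    (hNδ : N.ker = δ.range) (hNδ' : N'.ker = δ'.range) (hδN : δ.comp N = 0)
    (hδN' : δ'.comp N' = 0) (hD : D.range.index ≠ 0)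
    (h2 : (D.ker.map δ).relIndex (D.ker ⊓ N.ker) = 2 * (D.ker.map N).relIndex (D.ker ⊓ δ.ker))
    (h0 : (D.ker.map N).relIndex (D.ker ⊓ δ.ker) ≠ 0) :
    (δ.ker.map D ⊔ N'.range).relIndex δ'.ker =
      2 * N.range.relIndex (δ.ker ⊓ N'.range.comap D) := by
  have hN1 : ∀ x, D (N x) = N' (D x) := fun x => DFunLike.congr_fun hN x
  have hδ1 : ∀ x, D (δ x) = δ' (D x) := fun x => DFunLike.congr_fun hδ x
  have hδN1 : ∀ x, δ (N x) = 0 := fun x => DFunLike.congr_fun hδN x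
  have hδN1' : ∀ x, δ' (N' x) = 0 := fun x => DFunLike.congr_fun hδN' x
  have kN : ∀ x, N x = 0 ↔ ∃ y, δ y = x := fun x => by
    rw [← AddMonoidHom.mem_ker, hNδ]; rfl
  have kN' : ∀ x, N' x = 0 ↔ ∃ y, δ' y = x := fun x => by
    rw [← AddMonoidHom.mem_ker, hNδ']; rfl
  have hNδ1 : ∀ x, N (δ x) = 0 := fun x => (kN _).2 ⟨x, rfl⟩
  have hNδ1' : ∀ x, N' (δ' x) = 0 := fun x => (kN' _).2 ⟨x, rfl⟩
  set U := D.ker with hU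
  set P := D.range with hP
  -- the six factors
  set a := N.range.relIndex (U ⊓ δ.ker) with ha
  set b := (N.range.map D).relIndex ((δ.ker ⊓ N'.range.comap D).map D) with hb
  set c := (δ.ker.map D).relIndex (P ⊓ N'.range) with hc
  set d := (δ.ker.map D ⊔ (P ⊓ N'.range)).relIndex (P ⊓ δ'.ker) with hd
  set e := (U.map N).relIndex (U ⊓ N.range) with he
  set f := ((P ⊓ δ'.ker) ⊔ N'.range).relIndex δ'.ker with hf
  have t1 : N.range.relIndex (δ.ker ⊓ N'.range.comap D) = a * b := by
    have hle : N.range ≤ δ.ker ⊓ N'.range.comap D := by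
      rintro _ ⟨x, rfl⟩
      exact ⟨hδN1 x, D x, (hN1 x).symm⟩
    have : N.range ⊔ (U ⊓ δ.ker) = (N.range.map D).comap D ⊓ (δ.ker ⊓ N'.range.comap D) := by
      apply le_antisymm
      · refine sup_le (le_inf (le_comap_map _ _) hle) ?_
        rintro x ⟨hx, hx'⟩
        have hx0 : D x = 0 := hx
        refine ⟨?_, hx', ?_⟩
        · change D x ∈ map D N.range
          rw [hx0]; exact zero_mem _
        · change D x ∈ N'.range
          rw [hx0]; exact zero_mem _
      · rintro x ⟨⟨_, ⟨y, rfl⟩, hy⟩, hx, -⟩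
        rw [mem_sup]
        refine ⟨N y, ⟨y, rfl⟩, x - N y, ⟨?_, ?_⟩, by abel⟩
        · change D _ = 0
          rw [map_sub, hy, sub_self]
        · change δ _ = 0
          rw [map_sub, hδN1, show δ x = 0 from hx, sub_self]
    rw [← relIndex_mul_relIndex N.range (N.range ⊔ (U ⊓ δ.ker)) _ le_sup_left
      (this ▸ inf_le_right)]
    congr 1
    · rw [sup_comm, relIndex_sup_right]
    · rw [this, inf_relIndex_right, relIndex_comap]
  have t2 : (U.map N).relIndex (U ⊓ δ.ker) = e * a := by
    have : U ⊓ N.range = N.range ⊓ (U ⊓ δ.ker) := by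
      apply le_antisymm
      · rintro _ ⟨hx, y, rfl⟩
        exact ⟨⟨y, rfl⟩, hx, hδN1 y⟩
      · exact fun x hx => ⟨hx.2.1, hx.1⟩
    rw [← relIndex_mul_relIndex (U.map N) (U ⊓ N.range) (U ⊓ δ.ker), ha]
    · congr 1
      rw [this, inf_relIndex_right]
    · rintro _ ⟨x, hx, rfl⟩
      refine ⟨?_, x, rfl⟩
      change D _ = 0
      rw [hN1, show D x = 0 from hx, map_zero]
    · rw [this]; exact inf_le_right
  have t3 : (P ⊔ δ'.range).relIndex (P.comap N') = b * c := by
    have e1 : P ⊔ δ'.range = (N.range.map D).comap N' := by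
      apply le_antisymm
      · refine sup_le ?_ ?_
        · rintro _ ⟨x, rfl⟩
          exact ⟨N x, ⟨x, rfl⟩, hN1 x⟩
        · rintro _ ⟨x, rfl⟩
          simp [mem_comap, hNδ1', zero_mem]
      · rintro x ⟨_, ⟨y, rfl⟩, hy⟩
        rw [hN1] at hy
        obtain ⟨z, hz⟩ := (kN' (x - D y)).1 (by rw [map_sub, hy, sub_self])
        rw [mem_sup]
        exact ⟨D y, ⟨y, rfl⟩, δ' z, ⟨z, rfl⟩, by rw [hz]; abel⟩
    have e2 : ((δ.ker.map D).comap N').map N' = (δ.ker ⊓ N'.range.comap D).map D := by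
      rw [map_inf_comap, map_comap_eq, inf_comm]
    rw [← relIndex_mul_relIndex _ ((δ.ker.map D).comap N') (P.comap N')]
    · congr 1
      · rw [e1, relIndex_comap, e2]
      · rw [relIndex_comap, map_comap_eq, inf_comm]
    · rw [e1]
      refine comap_mono (map_mono ?_)
      rintro _ ⟨x, rfl⟩
      exact hδN1 x
    · exact comap_mono (map_le_range _ _)
  have t4 : (U.map δ).relIndex (U ⊓ N.ker) = c * d := by
    have e1 : (U.map δ).comap δ = (δ.ker.map D).comap D := by
      rw [comap_map_eq, comap_map_eq, sup_comm]
    have e2 : (U.comap δ).map δ = U ⊓ N.ker := by rw [map_comap_eq, hNδ, inf_comm]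
    have e3 : (U.comap δ).map D = P ⊓ δ'.ker := by
      have : U.comap δ = δ'.ker.comap D := by
        ext x
        change D (δ x) = 0 ↔ δ' (D x) = 0
        rw [hδ1]
      rw [this, map_comap_eq]
    have : (U.map δ).relIndex (U ⊓ N.ker) = (δ.ker.map D).relIndex (P ⊓ δ'.ker) := by
      rw [← e2, ← relIndex_comap, e1, relIndex_comap, e3]
    rw [this, ← relIndex_mul_relIndex _ (δ.ker.map D ⊔ (P ⊓ N'.range)) _ le_sup_left]
    · congr 1
      rw [sup_comm, relIndex_sup_right]
    · refine sup_le ?_ ?_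
      · rintro _ ⟨x, hx, rfl⟩
        refine ⟨⟨x, rfl⟩, ?_⟩
        change δ' _ = 0
        rw [← hδ1, show δ x = 0 from hx, map_zero]
      · refine inf_le_inf_left _ ?_
        rintro _ ⟨x, rfl⟩
        exact hδN1' x
  have hNle : N'.range ≤ δ'.ker := by
    rintro _ ⟨x, rfl⟩
    exact hδN1' x
  have hDle : δ.ker.map D ≤ P ⊓ δ'.ker := by
    rintro _ ⟨x, hx, rfl⟩
    refine ⟨⟨x, rfl⟩, ?_⟩
    change δ' _ = 0
    rw [← hδ1, show δ x = 0 from hx, map_zero]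
  have t5 : (δ.ker.map D ⊔ N'.range).relIndex δ'.ker = d * f := by
    rw [← relIndex_mul_relIndex _ ((P ⊓ δ'.ker) ⊔ N'.range) _ (sup_le_sup_right hDle _)
      (sup_le inf_le_right hNle)]
    congr 1
    rw [relIndex_sup_eq_of_le le_sup_right, ← inf_relIndex_right, sup_inf_assoc_of_le _ hDle,
      ← inf_assoc, inf_comm _ P, inf_assoc, inf_eq_left.2 hNle]
  have t6 : (P ⊔ N'.range).relIndex (P.comap δ') = f * e := by
    have hPδ : P ≤ P.comap δ' := by
      rintro _ ⟨x, rfl⟩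
      exact ⟨δ x, hδ1 x⟩
    rw [← relIndex_mul_relIndex _ (δ'.ker ⊔ P) _ (sup_le le_sup_right (hNle.trans le_sup_left))
      (sup_le (fun x hx => by
        rw [mem_comap, show δ' x = 0 from hx]; exact zero_mem _) hPδ)]
    congr 1
    · rw [relIndex_sup_eq_of_le le_sup_left, ← inf_relIndex_right, sup_comm P,
        sup_inf_assoc_of_le _ hNle, sup_comm]
    · have e1 : δ'.ker ⊔ P = (P.map δ').comap δ' := by rw [comap_map_eq, sup_comm]
      have e2 : (P.comap δ').map δ' = (U.comap N).map D := by
        rw [map_comap_eq, ← hNδ']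
        ext x
        constructor
        · rintro ⟨hx, y, rfl⟩
          exact ⟨y, by change D (N y) = 0; rw [hN1]; exact hx, rfl⟩
        · rintro ⟨y, hy, rfl⟩
          exact ⟨by change N' (D y) = 0; rw [← hN1]; exact hy, y, rfl⟩
      have e3 : (P.map δ').comap D = (U.map N).comap N := by
        have : P.map δ' = δ.range.map D := by
          rw [hP, ← AddMonoidHom.range_comp, ← hδ, AddMonoidHom.range_comp]
        rw [this, comap_map_eq, comap_map_eq, hNδ, sup_comm]
      rw [e1, relIndex_comap, e2, ← relIndex_comap, e3, relIndex_comap, map_comap_eq, inf_comm]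
  have t7 := relIndex_comap_eq_of_finite P hD δ' N'
    (by rintro _ ⟨_, ⟨x, rfl⟩, rfl⟩; exact ⟨δ x, hδ1 x⟩)
    (by rintro _ ⟨_, ⟨x, rfl⟩, rfl⟩; exact ⟨N x, hN1 x⟩)
    (by ext x; exact hδN1' x) (by ext x; exact hNδ1' x)
  rw [t3, t6] at t7
  rw [t4, t2] at h2
  rw [t2] at h0
  have hc0 : c ≠ 0 := by
    intro h
    apply h0
    rw [h, zero_mul] at h2
    omega
  have he0 : e ≠ 0 := left_ne_zero_of_mul h0
  rw [t5, t1]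
  have : c * e * (d * f) = c * e * (2 * (a * b)) := by
    calc c * e * (d * f) = (c * d) * (f * e) := by ring
      _ = _ := by rw [h2, ← t7]; ring
  exact mul_left_cancel₀ (mul_ne_zero hc0 he0) this

end Herbrand

section GolodShafarevich

variable {Γ : Type*} [Group Γ]

local notation "𝔽" => ZMod 2

/-- The submodule generated by the `(g - 1) • m` with `m ∈ N`. -/
noncomputable def augSMul {M : Type*} [AddCommGroup M] [Module (MonoidAlgebra 𝔽 Γ) M]
    (N : Submodule (MonoidAlgebra 𝔽 Γ) M) : Submodule (MonoidAlgebra 𝔽 Γ) M :=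
  Submodule.span _ {x | ∃ g : Γ, ∃ m ∈ N, x = MonoidAlgebra.of 𝔽 Γ g • m - m}

section basics

variable {M M' : Type*} [AddCommGroup M] [Module (MonoidAlgebra 𝔽 Γ) M]
  [AddCommGroup M'] [Module (MonoidAlgebra 𝔽 Γ) M']

theorem of_smul_sub_mem_augSMul {N : Submodule (MonoidAlgebra 𝔽 Γ) M} (g : Γ) {m : M} (hm : m ∈ N) :
    MonoidAlgebra.of 𝔽 Γ g • m - m ∈ augSMul N :=
  Submodule.subset_span ⟨g, m, hm, rfl⟩

theorem augSMul_le (N : Submodule (MonoidAlgebra 𝔽 Γ) M) : augSMul N ≤ N := by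
  rw [augSMul, Submodule.span_le]
  rintro _ ⟨g, m, hm, rfl⟩
  exact N.sub_mem (N.smul_mem _ hm) hm

theorem augSMul_mono {N N' : Submodule (MonoidAlgebra 𝔽 Γ) M} (h : N ≤ N') :
    augSMul N ≤ augSMul N' := by
  refine Submodule.span_mono ?_
  rintro _ ⟨g, m, hm, rfl⟩
  exact ⟨g, m, h hm, rfl⟩

theorem map_augSMul (f : M →ₗ[MonoidAlgebra 𝔽 Γ] M') (N : Submodule (MonoidAlgebra 𝔽 Γ) M) :
    (augSMul N).map f = augSMul (N.map f) := by
  rw [augSMul, Submodule.map_span, augSMul]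
  congr 1
  ext x
  constructor
  · rintro ⟨_, ⟨g, m, hm, rfl⟩, rfl⟩
    exact ⟨g, f m, ⟨m, hm, rfl⟩, by simp⟩
  · rintro ⟨g, _, ⟨m, hm, rfl⟩, rfl⟩
    exact ⟨_, ⟨g, m, hm, rfl⟩, by simp⟩

theorem map_augSMul_iterate (f : M →ₗ[MonoidAlgebra 𝔽 Γ] M') (n : ℕ)
    (N : Submodule (MonoidAlgebra 𝔽 Γ) M) :
    (augSMul^[n] N).map f = augSMul^[n] (N.map f) := by
  induction n generalizing N with
  | zero => rfl
  | succ n ih => rw [Function.iterate_succ_apply, ih, map_augSMul, Function.iterate_succ_apply]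

theorem augSMul_iterate_mono (n : ℕ) {N N' : Submodule (MonoidAlgebra 𝔽 Γ) M} (h : N ≤ N') :
    augSMul^[n] N ≤ augSMul^[n] N' :=
  (show Monotone (augSMul : Submodule (MonoidAlgebra 𝔽 Γ) M → _) from
    fun _ _ => augSMul_mono).iterate n h

variable (hΓ : IsPGroup 2 Γ)

include hΓ in
/-- A nonzero finite module over a `2`-group has a nonzero invariant functional. -/
theorem eq_bot_of_augSMul_eq [Finite M] {N : Submodule (MonoidAlgebra 𝔽 Γ) M} (h : augSMul N = N) :
    N = ⊥ := by
  by_contra hN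
  -- the group acts on the functionals of `N`
  let act : MulAction Γ (N →+ 𝔽) :=
    { smul := fun g φ => φ.comp (DistribSMul.toAddMonoidHom N (MonoidAlgebra.of 𝔽 Γ g⁻¹))
      one_smul := fun φ => by
        ext x
        change φ (MonoidAlgebra.of 𝔽 Γ 1⁻¹ • x) = φ x
        rw [inv_one, map_one, one_smul]
      mul_smul := fun g h φ => by
        ext x
        change φ (MonoidAlgebra.of 𝔽 Γ (g * h)⁻¹ • x) =
          φ (MonoidAlgebra.of 𝔽 Γ h⁻¹ • MonoidAlgebra.of 𝔽 Γ g⁻¹ • x)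
        rw [mul_inv_rev, map_mul, mul_smul] }
  have hact : ∀ (g : Γ) (φ : N →+ 𝔽) (x : N), (g • φ) x = φ (MonoidAlgebra.of 𝔽 Γ g⁻¹ • x) :=
    fun _ _ _ => rfl
  let : Module 𝔽 N := Module.compHom N (algebraMap 𝔽 (MonoidAlgebra 𝔽 Γ))
  have : Module.Finite 𝔽 N := Module.Finite.of_finite
  let eq : (N →+ 𝔽) ≃ Module.Dual 𝔽 N :=
    { toFun := fun φ => φ.toZModLinearMap 2
      invFun := fun φ => φ.toAddMonoidHom
      left_inv := fun φ => rfl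
      right_inv := fun φ => rfl }
  have : Finite (Module.Dual 𝔽 N) := Module.finite_of_finite 𝔽
  have : Finite (N →+ 𝔽) := Finite.of_equiv _ eq.symm
  have hpos : 0 < Module.finrank 𝔽 N := by
    have : Nontrivial N := Submodule.nontrivial_iff_ne_bot.2 hN
    exact Module.finrank_pos
  have hcard : 2 ∣ Nat.card (N →+ 𝔽) := by
    rw [Nat.card_congr eq, Module.natCard_eq_pow_finrank (K := 𝔽), Subspace.dual_finrank_eq,
      Nat.card_zmod]
    exact dvd_pow_self _ hpos.ne'
  have h0 : (0 : N →+ 𝔽) ∈ MulAction.fixedPoints Γ (N →+ 𝔽) := by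
    intro g; ext x; rw [hact]; rfl
  obtain ⟨φ, hφ, hne⟩ := hΓ.exists_fixed_point_of_prime_dvd_card_of_fixed_point (N →+ 𝔽) hcard h0
  apply hne
  have hinv : ∀ (g : Γ) (x : N), φ (MonoidAlgebra.of 𝔽 Γ g • x) = φ x := by
    intro g x
    have := DFunLike.congr_fun (hφ g⁻¹) x
    rwa [hact, inv_inv] at this
  -- the submodule of elements all of whose multiples are killed
  let S : Submodule (MonoidAlgebra 𝔽 Γ) M :=
    { carrier := {x | ∃ hx : x ∈ N, φ ⟨x, hx⟩ = 0}
      zero_mem' := ⟨N.zero_mem, φ.map_zero⟩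
      add_mem' := by
        rintro x y ⟨hx, hx'⟩ ⟨hy, hy'⟩
        refine ⟨N.add_mem hx hy, ?_⟩
        have := φ.map_add ⟨x, hx⟩ ⟨y, hy⟩
        rw [hx', hy', add_zero] at this
        exact this
      smul_mem' := by
        rintro a x ⟨hx, hx'⟩
        refine ⟨N.smul_mem _ hx, ?_⟩
        have : ∀ a : MonoidAlgebra 𝔽 Γ, φ (a • (⟨x, hx⟩ : N)) = 0 := by
          intro a
          induction a using MonoidAlgebra.induction_on with
          | of g => rw [hinv, hx']
          | add a b ha hb => rw [add_smul, φ.map_add, ha, hb, add_zero]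
          | smul r a ha =>
            have hr : r = 0 ∨ r = 1 := by revert r; decide
            rcases hr with rfl | rfl
            · rw [zero_smul, zero_smul, φ.map_zero]
            · rw [one_smul, ha]
        exact this a }
  have hS : N ≤ S := by
    rw [← h, augSMul, Submodule.span_le]
    rintro _ ⟨g, m, hm, rfl⟩
    refine ⟨N.sub_mem (N.smul_mem _ hm) hm, ?_⟩
    have := φ.map_sub (MonoidAlgebra.of 𝔽 Γ g • (⟨m, hm⟩ : N)) ⟨m, hm⟩
    rw [hinv, sub_self] at this
    exact this
  ext x
  exact (hS x.2).2.symm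

include hΓ in
theorem eq_of_sup_augSMul_eq [Finite M] {N N' : Submodule (MonoidAlgebra 𝔽 Γ) M} (h : N' ≤ N)
    (hN : N' ⊔ augSMul N = N) : N' = N := by
  have h1 : augSMul (N.map N'.mkQ) = N.map N'.mkQ := by
    rw [← map_augSMul]
    conv_rhs => rw [← hN, Submodule.map_sup]
    simp
  have : Finite (M ⧸ N') := Finite.of_surjective _ N'.mkQ_surjective
  have h2 := eq_bot_of_augSMul_eq hΓ h1
  refine le_antisymm h ?_
  intro x hx
  have : N'.mkQ x ∈ N.map N'.mkQ := ⟨x, hx, rfl⟩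
  rw [h2] at this
  simpa using this

variable [Module 𝔽 M] [IsScalarTower 𝔽 (MonoidAlgebra 𝔽 Γ) M]
  [Module 𝔽 M'] [IsScalarTower 𝔽 (MonoidAlgebra 𝔽 Γ) M']

theorem finrank_map_add_finrank_inf_ker [Finite M] (f : M →ₗ[MonoidAlgebra 𝔽 Γ] M')
    (N : Submodule (MonoidAlgebra 𝔽 Γ) M) :
    Module.finrank 𝔽 (N.map f) + Module.finrank 𝔽 (N ⊓ LinearMap.ker f : Submodule _ M) =
      Module.finrank 𝔽 N := by
  have : Module.Finite 𝔽 M := Module.Finite.of_finite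
  let f' : M →ₗ[𝔽] M' := f.restrictScalars 𝔽
  let N' : Submodule 𝔽 M := N.restrictScalars 𝔽
  have h := (f'.domRestrict N').finrank_range_add_finrank_ker
  have h1 : Module.finrank 𝔽 (LinearMap.range (f'.domRestrict N')) =
      Module.finrank 𝔽 (N.map f) := by
    rw [LinearMap.range_domRestrict]
    rfl
  have h2 : Module.finrank 𝔽 (LinearMap.ker (f'.domRestrict N')) =
      Module.finrank 𝔽 (N ⊓ LinearMap.ker f : Submodule _ M) := by
    rw [(Submodule.equivMapOfInjective N'.subtype N'.injective_subtype _).finrank_eq]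
    have : (LinearMap.ker (f'.domRestrict N')).map N'.subtype =
        (N ⊓ LinearMap.ker f).restrictScalars 𝔽 := by
      ext x
      constructor
      · rintro ⟨y, hy, rfl⟩
        exact ⟨y.2, hy⟩
      · rintro ⟨hx, hx'⟩
        exact ⟨⟨x, hx⟩, hx', rfl⟩
    rw [this]
    rfl
  rw [← h1, ← h2]
  exact h

theorem exists_generators [Finite M] (N : Submodule (MonoidAlgebra 𝔽 Γ) M) :
    ∃ (r : ℕ) (x : Fin r → M), Module.finrank 𝔽 (augSMul N) + r = Module.finrank 𝔽 N ∧
      (∀ i, x i ∈ N) ∧ (∀ c : Fin r → 𝔽, ∑ i, c i • x i ∈ augSMul N → c = 0) ∧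
      N = Submodule.span (MonoidAlgebra 𝔽 Γ) (Set.range x) ⊔ augSMul N := by
  have : Module.Finite 𝔽 M := Module.Finite.of_finite
  let N' : Submodule 𝔽 M := N.restrictScalars 𝔽
  let J' : Submodule 𝔽 M := (augSMul N).restrictScalars 𝔽
  have hJN : J' ≤ N' := augSMul_le N
  obtain ⟨C, hC⟩ := (J'.submoduleOf N').exists_isCompl
  let b := Module.finBasis 𝔽 C
  refine ⟨Module.finrank 𝔽 C, fun i => ((b i : N') : M), ?_, fun i => (b i : N').2, ?_, ?_⟩
  · have := Submodule.finrank_add_eq_of_isCompl hC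
    rw [(Submodule.submoduleOfEquivOfLe hJN).finrank_eq] at this
    exact this
  · intro c hc
    have h1 : ((∑ i, c i • b i : C) : N') ∈ J'.submoduleOf N' := by
      change ((((∑ i, c i • b i : C) : N')) : M) ∈ J'
      have : ((((∑ i, c i • b i : C) : N')) : M) = ∑ i, c i • ((b i : N') : M) := by
        rw [Submodule.coe_sum, Submodule.coe_sum]
        rfl
      rw [this]
      exact hc
    have h2 : ((∑ i, c i • b i : C) : N') = 0 := by
      have := hC.disjoint.le_bot ⟨h1, (∑ i, c i • b i : C).2⟩
      simpa using this
    have h3 : ∑ i, c i • b i = 0 := Subtype.ext h2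
    funext i
    exact Fintype.linearIndependent_iff.1 b.linearIndependent c h3 i
  · apply le_antisymm
    · intro x hx
      obtain ⟨j, hj, c, hc, hjc⟩ := Submodule.mem_sup.1
        (hC.codisjoint.eq_top.ge (Submodule.mem_top (x := (⟨x, hx⟩ : N'))))
      have hx' : x = ((j : N') : M) + ((c : N') : M) := by
        rw [← Submodule.coe_add, hjc]
      rw [hx']
      refine Submodule.add_mem _ (Submodule.mem_sup_right hj) (Submodule.mem_sup_left ?_)
      have h4 := b.sum_repr ⟨c, hc⟩
      have h5 : (c : M) = ∑ i, b.repr ⟨c, hc⟩ i • ((b i : N') : M) := by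
        conv_lhs => rw [show c = ((⟨c, hc⟩ : C) : N') from rfl, ← h4]
        rw [Submodule.coe_sum, Submodule.coe_sum]
        rfl
      rw [h5]
      refine Submodule.sum_mem _ fun i _ => ?_
      rw [← algebraMap_smul (MonoidAlgebra 𝔽 Γ)]
      exact Submodule.smul_mem _ _ (Submodule.subset_span ⟨i, rfl⟩)
    · refine sup_le (Submodule.span_le.2 ?_) (augSMul_le N)
      rintro _ ⟨i, rfl⟩
      exact (b i : N').2

end basics

section free

theorem augSMul_iterate_pi (Γ : Type*) [Group Γ] (d n : ℕ) :
    augSMul^[n] (⊤ : Submodule (MonoidAlgebra 𝔽 Γ) (Fin d → MonoidAlgebra 𝔽 Γ)) =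
      Submodule.pi Set.univ fun _ => augSMul^[n] (⊤ : Submodule (MonoidAlgebra 𝔽 Γ) (MonoidAlgebra 𝔽 Γ)) := by
  apply le_antisymm
  · intro y hy i _
    have h := map_augSMul_iterate (LinearMap.proj i : (Fin d → MonoidAlgebra 𝔽 Γ) →ₗ[MonoidAlgebra 𝔽 Γ] MonoidAlgebra 𝔽 Γ) n ⊤
    have h1 : y i ∈ (augSMul^[n] ⊤).map
        (LinearMap.proj i : (Fin d → MonoidAlgebra 𝔽 Γ) →ₗ[MonoidAlgebra 𝔽 Γ] MonoidAlgebra 𝔽 Γ) :=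
      ⟨y, hy, rfl⟩
    rw [h] at h1
    exact augSMul_iterate_mono n le_top h1
  · intro y hy
    have : y = ∑ i, LinearMap.single (MonoidAlgebra 𝔽 Γ) (fun _ => MonoidAlgebra 𝔽 Γ) i (y i) := by
      ext1 j
      simp [Finset.sum_apply, Pi.single_apply]
    rw [this]
    refine Submodule.sum_mem _ fun i _ => ?_
    have h := map_augSMul_iterate
      (LinearMap.single (MonoidAlgebra 𝔽 Γ) (fun _ : Fin d => MonoidAlgebra 𝔽 Γ) i) n ⊤
    have h1 : LinearMap.single (MonoidAlgebra 𝔽 Γ) (fun _ => MonoidAlgebra 𝔽 Γ) i (y i) ∈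
        (augSMul^[n] ⊤).map (LinearMap.single (MonoidAlgebra 𝔽 Γ)
          (fun _ : Fin d => MonoidAlgebra 𝔽 Γ) i) := ⟨y i, hy i trivial, rfl⟩
    rw [h] at h1
    exact augSMul_iterate_mono n le_top h1

theorem finrank_augSMul_iterate_pi [Finite Γ] (d n : ℕ) :
    Module.finrank 𝔽 (augSMul^[n]
      (⊤ : Submodule (MonoidAlgebra 𝔽 Γ) (Fin d → MonoidAlgebra 𝔽 Γ))) =
      d * Module.finrank 𝔽 (augSMul^[n] (⊤ : Submodule (MonoidAlgebra 𝔽 Γ) (MonoidAlgebra 𝔽 Γ))) := by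
  rw [augSMul_iterate_pi Γ]
  set N := augSMul^[n] (⊤ : Submodule (MonoidAlgebra 𝔽 Γ) (MonoidAlgebra 𝔽 Γ))
  let e : (Submodule.pi Set.univ fun _ : Fin d => N) ≃ₗ[𝔽] (Fin d → N) :=
    { toFun := fun y i => ⟨y.1 i, y.2 i trivial⟩
      invFun := fun y => ⟨fun i => y i, fun i _ => (y i).2⟩
      left_inv := fun _ => rfl
      right_inv := fun _ => rfl
      map_add' := fun _ _ => rfl
      map_smul' := fun _ _ => rfl }
  have : Module.Finite 𝔽 (MonoidAlgebra 𝔽 Γ) := Module.Finite.of_basis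
    (MonoidAlgebra.basis Γ 𝔽)
  have : Finite (MonoidAlgebra 𝔽 Γ) := Module.finite_of_finite 𝔽
  have : Module.Finite 𝔽 N := Module.Finite.of_finite
  rw [e.finrank_eq, Module.finrank_pi_fintype]
  simp

theorem sub_mem_augSMul_top (a : MonoidAlgebra 𝔽 Γ) :
    ∃ c : 𝔽, a - c • 1 ∈ augSMul (⊤ : Submodule (MonoidAlgebra 𝔽 Γ) (MonoidAlgebra 𝔽 Γ)) := by
  induction a using MonoidAlgebra.induction_on with
  | of g =>
    refine ⟨1, ?_⟩
    have := of_smul_sub_mem_augSMul g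
      (Submodule.mem_top (R := MonoidAlgebra 𝔽 Γ) (x := (1 : MonoidAlgebra 𝔽 Γ)))
    rwa [smul_eq_mul, mul_one, ← one_smul 𝔽 (1 : MonoidAlgebra 𝔽 Γ)] at this
  | add a b ha hb =>
    obtain ⟨c, hc⟩ := ha
    obtain ⟨c', hc'⟩ := hb
    refine ⟨c + c', ?_⟩
    have := Submodule.add_mem _ hc hc'
    rwa [show a - c • 1 + (b - c' • 1) = a + b - (c + c') • (1 : MonoidAlgebra 𝔽 Γ) by
      rw [add_smul]; abel] at this
  | smul r a ha =>
    obtain ⟨c, hc⟩ := ha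
    refine ⟨r * c, ?_⟩
    have := Submodule.smul_mem _ (algebraMap 𝔽 (MonoidAlgebra 𝔽 Γ) r) hc
    rwa [algebraMap_smul, smul_sub, smul_smul] at this

/-- A presentation of the augmentation ideal of the group algebra of a finite `2`-group by a
free module needs many relations. -/
theorem golod_shafarevich [Finite Γ] (hΓ : IsPGroup 2 Γ) (d s : ℕ) (hd : 2 ≤ d)
    (π : (Fin d → MonoidAlgebra 𝔽 Γ) →ₗ[MonoidAlgebra 𝔽 Γ] MonoidAlgebra 𝔽 Γ)
    (hπ : LinearMap.range π = augSMul ⊤)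
    (hker : LinearMap.ker π ≤ augSMul ⊤)
    (ρ : (Fin s → MonoidAlgebra 𝔽 Γ) →ₗ[MonoidAlgebra 𝔽 Γ] (Fin d → MonoidAlgebra 𝔽 Γ))
    (hρ : LinearMap.range ρ = LinearMap.ker π) : d ^ 2 < 4 * s := by
  have : Module.Finite 𝔽 (MonoidAlgebra 𝔽 Γ) := Module.Finite.of_basis
    (MonoidAlgebra.basis Γ 𝔽)
  have : Finite (MonoidAlgebra 𝔽 Γ) := Module.finite_of_finite 𝔽
  by_contra! hs
  let a : ℕ → ℕ := fun n =>
    Module.finrank 𝔽 (augSMul^[n] (⊤ : Submodule (MonoidAlgebra 𝔽 Γ) (MonoidAlgebra 𝔽 Γ)))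
  have hmono : ∀ {M : Type _} [AddCommGroup M] [Module (MonoidAlgebra 𝔽 Γ) M] [Module 𝔽 M]
      [IsScalarTower 𝔽 (MonoidAlgebra 𝔽 Γ) M] [Finite M]
      (N N' : Submodule (MonoidAlgebra 𝔽 Γ) M), N ≤ N' →
      Module.finrank 𝔽 N ≤ Module.finrank 𝔽 N' := by
    intro M _ _ _ _ _ N N' h
    have : Module.Finite 𝔽 M := Module.Finite.of_finite
    exact Submodule.finrank_mono (s := N.restrictScalars 𝔽) (t := N'.restrictScalars 𝔽) h
  have ha1 : a 1 < a 0 := by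
    have hlt : augSMul (⊤ : Submodule (MonoidAlgebra 𝔽 Γ) (MonoidAlgebra 𝔽 Γ)) < ⊤ := by
      refine lt_of_le_of_ne le_top fun h => ?_
      have := eq_bot_of_augSMul_eq hΓ h
      exact one_ne_zero ((Submodule.mem_bot _).1
        (this ▸ Submodule.mem_top : (1 : MonoidAlgebra 𝔽 Γ) ∈ (⊥ : Submodule (MonoidAlgebra 𝔽 Γ) _)))
    exact Submodule.finrank_lt_finrank_of_lt (K := 𝔽) (s := (augSMul (⊤ : Submodule
      (MonoidAlgebra 𝔽 Γ) (MonoidAlgebra 𝔽 Γ))).restrictScalars 𝔽)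
      (t := (⊤ : Submodule (MonoidAlgebra 𝔽 Γ) (MonoidAlgebra 𝔽 Γ)).restrictScalars 𝔽) hlt
  have hale : ∀ n, a n ≤ a 0 := fun n => hmono _ _ le_top
  have hrec : ∀ n, (a (n + 2) : ℤ) - a 0 ≤ -1 + d * (a (n + 1) - a 0) - s * (a n - a 0) := by
    intro n
    have e1 := finrank_map_add_finrank_inf_ker π ⊤
    rw [Submodule.map_top, hπ, top_inf_eq] at e1
    have e1' := finrank_augSMul_iterate_pi (Γ := Γ) d 0
    have e2 := finrank_map_add_finrank_inf_ker π (augSMul^[n + 1] ⊤)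
    rw [map_augSMul_iterate, Submodule.map_top, hπ, ← Function.iterate_succ_apply,
      finrank_augSMul_iterate_pi] at e2
    have e3 := finrank_map_add_finrank_inf_ker ρ ⊤
    rw [Submodule.map_top, hρ, top_inf_eq] at e3
    have e3' := finrank_augSMul_iterate_pi (Γ := Γ) s 0
    have e4 := finrank_map_add_finrank_inf_ker ρ (augSMul^[n] ⊤)
    rw [map_augSMul_iterate, Submodule.map_top, hρ, finrank_augSMul_iterate_pi] at e4
    have e5 : augSMul^[n] (LinearMap.ker π) ≤ augSMul^[n + 1] ⊤ ⊓ LinearMap.ker π := by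
      refine le_inf (augSMul_iterate_mono n hker) ?_
      have : ∀ n (N : Submodule (MonoidAlgebra 𝔽 Γ) (Fin d → MonoidAlgebra 𝔽 Γ)),
          augSMul^[n] N ≤ N := by
        intro n
        induction n with
        | zero => exact fun N => le_rfl
        | succ n ih => exact fun N => (ih _).trans (augSMul_le N)
      exact this _ _
    have e5' := hmono _ _ e5
    have e6 := hmono (augSMul^[n] ⊤ ⊓ LinearMap.ker ρ) _ inf_le_right
    change _ = d * a 0 at e1'
    change _ = s * a 0 at e3'
    change a (n + 2) + _ = d * a (n + 1) at e2
    change _ + _ = s * a n at e4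
    replace e1 := (show a 1 + _ = _ from e1).trans e1'
    replace e3 := e3.trans e3'
    zify at e1 e2 e3 e4 e5' e6 ha1
    linarith
  have hgrow : ∀ n, 2 * ((a 0 : ℤ) - a (n + 1)) ≥ d * (a 0 - a n) + 2 := by
    intro n
    induction n with
    | zero => zify at ha1; simp only [sub_self, mul_zero, zero_add]; linarith
    | succ n ih =>
      have h := hrec n
      have h0 : (0 : ℤ) ≤ a 0 - a n := by have := hale n; zify at this; linarith
      have hs' : (4 * s : ℤ) ≤ d ^ 2 := by exact_mod_cast hs
      have h1 := mul_le_mul_of_nonneg_right hs' h0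
      have h2 := mul_le_mul_of_nonneg_left ih (by positivity : (0 : ℤ) ≤ d)
      have hd' : (2 : ℤ) ≤ d := by exact_mod_cast hd
      rw [show n + 1 + 1 = n + 2 from rfl]
      nlinarith
  have hlin : ∀ n : ℕ, (n : ℤ) ≤ a 0 - a n := by
    intro n
    induction n with
    | zero => simp
    | succ n ih =>
      have h := hgrow n
      have hd' : (2 : ℤ) ≤ d := by exact_mod_cast hd
      have h0 : (0 : ℤ) ≤ a 0 - a n := by have := hale n; zify at this; linarith
      push_cast
      nlinarith
  have := hlin (a 0 + 1)
  push_cast at this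
  have h2 : (0 : ℤ) ≤ a (a 0 + 1) := by positivity
  linarith

/-- A character vanishing on generators of the augmentation ideal is trivial. -/
theorem apply_eq_zero_of_apply_generators {ι : Type*} (ψ : Γ → 𝔽)
    (hψ : ∀ g h, ψ (g * h) = ψ g + ψ h) (x : ι → MonoidAlgebra 𝔽 Γ)
    (hx : augSMul (⊤ : Submodule (MonoidAlgebra 𝔽 Γ) (MonoidAlgebra 𝔽 Γ)) =
      Submodule.span _ (Set.range x) ⊔ augSMul (augSMul ⊤))
    (h0 : ∀ i, (MonoidAlgebra.basis Γ 𝔽).constr 𝔽 ψ (x i) = 0) (g : Γ) : ψ g = 0 := by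
  set X : MonoidAlgebra 𝔽 Γ →ₗ[𝔽] 𝔽 := (MonoidAlgebra.basis Γ 𝔽).constr 𝔽 ψ with hXdef
  set ε : MonoidAlgebra 𝔽 Γ →ₗ[𝔽] 𝔽 := (MonoidAlgebra.basis Γ 𝔽).constr 𝔽 (fun _ => (1 : 𝔽))
    with hεdef
  have hX : ∀ g, X (MonoidAlgebra.of 𝔽 Γ g) = ψ g := by
    intro g
    have := (MonoidAlgebra.basis Γ 𝔽).constr_basis 𝔽 ψ g
    rwa [MonoidAlgebra.basis_apply] at this
  have hε : ∀ g, ε (MonoidAlgebra.of 𝔽 Γ g) = 1 := by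
    intro g
    have := (MonoidAlgebra.basis Γ 𝔽).constr_basis 𝔽 (fun _ => (1 : 𝔽)) g
    rwa [MonoidAlgebra.basis_apply] at this
  have hmul : ∀ a b, X (a * b) = X a * ε b + ε a * X b ∧ ε (a * b) = ε a * ε b := by
    intro a b
    induction a using MonoidAlgebra.induction_on with
    | of g =>
      induction b using MonoidAlgebra.induction_on with
      | of h => rw [← map_mul, hX, hX, hX, hε, hε, hε, hψ]; simp
      | add b b' hb hb' =>
        rw [mul_add, map_add, map_add, map_add, map_add, hb.1, hb'.1, hb.2, hb'.2]
        constructor <;> ring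
      | smul r b hb =>
        rw [mul_smul_comm, map_smul, map_smul, map_smul, map_smul, hb.1, hb.2]
        simp only [smul_eq_mul]
        constructor <;> ring
    | add a a' ha ha' =>
      rw [add_mul, map_add, map_add, map_add, map_add, ha.1, ha'.1, ha.2, ha'.2]
      constructor <;> ring
    | smul r a ha =>
      rw [smul_mul_assoc, map_smul, map_smul, map_smul, map_smul, ha.1, ha.2]
      simp only [smul_eq_mul]
      constructor <;> ring
  -- elements of the augmentation ideal
  have hεJ : ∀ a ∈ augSMul (⊤ : Submodule (MonoidAlgebra 𝔽 Γ) (MonoidAlgebra 𝔽 Γ)), ε a = 0 := by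
    intro a ha
    induction ha using Submodule.span_induction with
    | mem a ha =>
      obtain ⟨g, m, -, rfl⟩ := ha
      rw [smul_eq_mul, map_sub, (hmul _ _).2, hε, one_mul, sub_self]
    | zero => exact map_zero _
    | add a b _ _ ha hb => rw [map_add, ha, hb, add_zero]
    | smul r a _ ha => rw [smul_eq_mul, (hmul _ _).2, ha, mul_zero]
  have hxJ : ∀ i, x i ∈ augSMul (⊤ : Submodule (MonoidAlgebra 𝔽 Γ) (MonoidAlgebra 𝔽 Γ)) := by
    intro i
    rw [hx]
    exact Submodule.mem_sup_left (Submodule.subset_span ⟨i, rfl⟩)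
  let S : Submodule (MonoidAlgebra 𝔽 Γ) (MonoidAlgebra 𝔽 Γ) :=
    { carrier := {a | X a = 0 ∧ ε a = 0}
      zero_mem' := ⟨map_zero _, map_zero _⟩
      add_mem' := fun {a b} ha hb => ⟨by rw [map_add, ha.1, hb.1, add_zero],
        by rw [map_add, ha.2, hb.2, add_zero]⟩
      smul_mem' := fun r a ha => ⟨by rw [smul_eq_mul, (hmul _ _).1, ha.1, ha.2]; ring,
        by rw [smul_eq_mul, (hmul _ _).2, ha.2, mul_zero]⟩ }
  have hXJ : augSMul (⊤ : Submodule (MonoidAlgebra 𝔽 Γ) (MonoidAlgebra 𝔽 Γ)) ≤ S := by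
    rw [hx]
    refine sup_le ?_ ?_
    · rw [Submodule.span_le]
      rintro _ ⟨i, rfl⟩
      exact ⟨h0 i, hεJ _ (hxJ i)⟩
    · rw [augSMul, Submodule.span_le]
      rintro _ ⟨g, m, hm, rfl⟩
      refine ⟨?_, ?_⟩
      · rw [smul_eq_mul, map_sub, (hmul _ _).1, hε, hεJ m hm]
        ring
      · rw [smul_eq_mul, map_sub, (hmul _ _).2, hεJ m hm]
        ring
  have hg : MonoidAlgebra.of 𝔽 Γ g - 1 ∈
      augSMul (⊤ : Submodule (MonoidAlgebra 𝔽 Γ) (MonoidAlgebra 𝔽 Γ)) := by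
    have := of_smul_sub_mem_augSMul g
      (Submodule.mem_top (R := MonoidAlgebra 𝔽 Γ) (x := (1 : MonoidAlgebra 𝔽 Γ)))
    rwa [smul_eq_mul, mul_one] at this
  have := (hXJ hg).1
  have h1 : ψ 1 = 0 := by simpa using hψ 1 1
  rwa [map_sub, hX, ← map_one (MonoidAlgebra.of 𝔽 Γ), hX, h1, sub_zero] at this

theorem exists_presentation [Finite Γ] (hΓ : IsPGroup 2 Γ) (k : ℕ) (hk : 2 ≤ k)
    (χ : Fin k → Γ → 𝔽) (hχ : ∀ j g h, χ j (g * h) = χ j g + χ j h)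
    (hind : ∀ c : Fin k → 𝔽, (∀ g, ∑ j, c j * χ j g = 0) → c = 0) :
    ∃ (d s : ℕ) (π : (Fin d → MonoidAlgebra 𝔽 Γ) →ₗ[MonoidAlgebra 𝔽 Γ] MonoidAlgebra 𝔽 Γ)
      (Φ : (Fin s → 𝔽) →ₗ[𝔽] Module.Dual 𝔽 (Fin d → MonoidAlgebra 𝔽 Γ)),
      k ^ 2 < 4 * s ∧ LinearMap.range π = augSMul ⊤ ∧ LinearMap.ker π ≤ augSMul ⊤ ∧
      (∀ c, ∀ y ∈ augSMul (LinearMap.ker π), Φ c y = 0) ∧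
      ∀ c, (∀ y ∈ LinearMap.ker π, Φ c y = 0) → c = 0 := by
  have : Module.Finite 𝔽 (MonoidAlgebra 𝔽 Γ) := Module.Finite.of_basis
    (MonoidAlgebra.basis Γ 𝔽)
  have : Finite (MonoidAlgebra 𝔽 Γ) := Module.finite_of_finite 𝔽
  obtain ⟨d, x, -, hx, hxind, hxspan⟩ := exists_generators
    (augSMul (⊤ : Submodule (MonoidAlgebra 𝔽 Γ) (MonoidAlgebra 𝔽 Γ)))
  let π := Fintype.linearCombination (MonoidAlgebra 𝔽 Γ) x
  have hπ : LinearMap.range π = augSMul ⊤ := by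
    rw [Fintype.range_linearCombination]
    refine eq_of_sup_augSMul_eq hΓ ?_ hxspan.symm
    rw [Submodule.span_le]
    rintro _ ⟨i, rfl⟩
    exact hx i
  have hker : LinearMap.ker π ≤ augSMul ⊤ := by
    intro y hy
    choose c hc using fun i => sub_mem_augSMul_top (y i)
    have hc0 : c = 0 := by
      apply hxind
      have h1 : ∑ i, y i • x i = 0 := by
        simpa [π, Fintype.linearCombination_apply] using hy
      have h2 : ∑ i, c i • x i = ∑ i, (c i • 1 - y i) • x i := by
        simp only [sub_smul, Finset.sum_sub_distrib, h1, sub_zero, smul_assoc, one_smul]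
      rw [h2]
      refine Submodule.sum_mem _ fun i _ => ?_
      rw [← neg_sub, neg_smul]
      refine Submodule.neg_mem _ ?_
      have h3 := map_augSMul (LinearMap.toSpanSingleton (MonoidAlgebra 𝔽 Γ) _ (x i)) ⊤
      have h4 : (y i - c i • 1) • x i ∈ (augSMul ⊤).map
        (LinearMap.toSpanSingleton (MonoidAlgebra 𝔽 Γ) _ (x i)) := ⟨_, hc i, rfl⟩
      rw [h3] at h4
      refine augSMul_mono ?_ h4
      rintro _ ⟨b, -, rfl⟩
      exact Submodule.smul_mem _ _ (hx i)
    have := augSMul_iterate_pi Γ d 1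
    simp only [Function.iterate_one] at this
    rw [this]
    intro i _
    have := hc i
    rwa [hc0, Pi.zero_apply, zero_smul, sub_zero] at this
  have hkd : k ≤ d := by
    let v : (Fin k → 𝔽) →ₗ[𝔽] (Fin d → 𝔽) :=
      LinearMap.pi fun i => Fintype.linearCombination 𝔽 fun j =>
        (MonoidAlgebra.basis Γ 𝔽).constr 𝔽 (χ j) (x i)
    have hv : Function.Injective v := by
      rw [← LinearMap.ker_eq_bot, LinearMap.ker_eq_bot']
      intro c hc
      apply hind
      refine apply_eq_zero_of_apply_generators (fun g => ∑ j, c j * χ j g) ?_ x hxspan ?_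
      · intro g h
        simp only [hχ, mul_add, Finset.sum_add_distrib]
      · intro i
        have := congr_fun hc i
        simp only [v, LinearMap.pi_apply, Fintype.linearCombination_apply] at this
        rw [Pi.zero_apply] at this
        rw [← this, ← Fintype.linearCombination_apply]
        have h2 : (MonoidAlgebra.basis Γ 𝔽).constr 𝔽 (fun g => ∑ j, c j * χ j g) =
            ∑ j, c j • (MonoidAlgebra.basis Γ 𝔽).constr 𝔽 (χ j) := by
          refine (MonoidAlgebra.basis Γ 𝔽).ext fun g => ?_
          rw [Module.Basis.constr_basis, LinearMap.sum_apply]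
          refine Finset.sum_congr rfl fun j _ => ?_
          rw [LinearMap.smul_apply, Module.Basis.constr_basis, smul_eq_mul]
        rw [h2, LinearMap.sum_apply, Fintype.linearCombination_apply]
        rfl
    simpa using LinearMap.finrank_le_finrank_of_injective hv
  obtain ⟨s, r, -, hr, hrind, hrspan⟩ := exists_generators (LinearMap.ker π)
  let ρ := Fintype.linearCombination (MonoidAlgebra 𝔽 Γ) r
  have hρ : LinearMap.range ρ = LinearMap.ker π := by
    rw [Fintype.range_linearCombination]
    refine eq_of_sup_augSMul_eq hΓ ?_ hrspan.symm
    rw [Submodule.span_le]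
    rintro _ ⟨i, rfl⟩
    exact hr i
  have hs := golod_shafarevich hΓ d s (hk.trans hkd) π hπ hker ρ hρ
  let J := (augSMul (LinearMap.ker π)).restrictScalars 𝔽
  let f : (Fin s → 𝔽) →ₗ[𝔽] (Fin d → MonoidAlgebra 𝔽 Γ) ⧸ J :=
    J.mkQ.comp (Fintype.linearCombination 𝔽 r)
  have hf : LinearMap.ker f = ⊥ := by
    rw [LinearMap.ker_eq_bot']
    intro c hc
    apply hrind
    have : J.mkQ (∑ i, c i • r i) = 0 := hc
    exact (Submodule.Quotient.mk_eq_zero _).1 this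
  obtain ⟨p, hp⟩ := f.exists_leftInverse_of_injective hf
  let q := p.comp J.mkQ
  refine ⟨d, s, π, (LinearMap.lcomp 𝔽 𝔽 q).comp
    (Fintype.linearCombination 𝔽 fun i => (LinearMap.proj i : (Fin s → 𝔽) →ₗ[𝔽] 𝔽)),
    (Nat.pow_le_pow_left hkd 2).trans_lt hs, hπ, hker, ?_, ?_⟩
  · intro c y hy
    have : q y = 0 := by
      have : J.mkQ y = 0 := by simpa [J] using hy
      rw [LinearMap.comp_apply, this, map_zero]
    rw [LinearMap.comp_apply, LinearMap.lcomp_apply, this, map_zero]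
  · intro c hc
    funext i
    have := hc (r i) (hr i)
    have hq : q (r i) = Pi.single i 1 := by
      have := LinearMap.congr_fun hp (Pi.single i 1)
      simpa [f, q, Fintype.linearCombination_apply_single] using this
    simpa [hq, Fintype.linearCombination_apply, LinearMap.lcomp_apply, LinearMap.sum_apply,
      Pi.single_apply] using this

end free

end GolodShafarevich

section UnitHerbrand

theorem index_range_two_nsmul_of_equiv {M M' : Type*} [AddCommGroup M] [AddCommGroup M'] (e : M ≃+ M') :
    (nsmulAddMonoidHom (α := M) 2).range.index = (nsmulAddMonoidHom (α := M') 2).range.index ∧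
    Nat.card (nsmulAddMonoidHom (α := M) 2).ker = Nat.card (nsmulAddMonoidHom (α := M') 2).ker := by
  constructor
  · have : (nsmulAddMonoidHom (α := M') 2).range = (nsmulAddMonoidHom (α := M) 2).range.map (e : M →+ M') := by
      ext x
      simp only [AddMonoidHom.mem_range, AddSubgroup.mem_map, nsmulAddMonoidHom_apply]
      constructor
      · rintro ⟨y, rfl⟩
        exact ⟨2 • e.symm y, ⟨_, rfl⟩, by simp⟩
      · rintro ⟨_, ⟨y, rfl⟩, rfl⟩
        exact ⟨e y, by simp⟩
    rw [this, AddSubgroup.index_map_equiv]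
  · refine Nat.card_congr (Equiv.subtypeEquiv e.toEquiv fun x => ?_)
    simp only [AddMonoidHom.mem_ker, nsmulAddMonoidHom_apply]
    rw [← e.map_eq_zero_iff]
    simp

/-- In a finitely generated abelian group `M` one has `[M : 2 • M] = 2 ^ rank M * #M[2]`. -/
theorem index_range_two_nsmul (M : Type*) [AddCommGroup M] [Module.Finite ℤ M] :
    (nsmulAddMonoidHom (α := M) 2).range.index =
      2 ^ Module.finrank ℤ M * Nat.card (nsmulAddMonoidHom (α := M) 2).ker ∧
    Nat.card (nsmulAddMonoidHom (α := M) 2).ker ≠ 0 := by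
  have : AddGroup.FG M := Module.Finite.iff_addGroup_fg.mp inferInstance
  obtain ⟨n, ι, _, p, hp, e, ⟨f⟩⟩ := AddCommGroup.equiv_free_prod_directSum_zmod M
  have : ∀ i, NeZero (p i ^ e i) := fun i => ⟨pow_ne_zero _ (hp i).ne_zero⟩
  set T := DirectSum ι fun i => ZMod (p i ^ e i) with hT
  have : Finite T := by
    classical
    exact Finite.of_equiv _ (DirectSum.addEquivProd fun i => ZMod (p i ^ e i)).symm.toEquiv
  obtain ⟨h1, h2⟩ := index_range_two_nsmul_of_equiv f
  have hr : (nsmulAddMonoidHom (α := (Fin n →₀ ℤ) × T) 2).range =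
      (nsmulAddMonoidHom (α := Fin n →₀ ℤ) 2).range.prod (nsmulAddMonoidHom (α := T) 2).range := by
    ext ⟨x, y⟩
    simp only [AddMonoidHom.mem_range, AddSubgroup.mem_prod, nsmulAddMonoidHom_apply, Prod.exists,
      Prod.smul_mk, Prod.mk.injEq]
    constructor
    · rintro ⟨a, b, h, h'⟩
      exact ⟨⟨a, h⟩, ⟨b, h'⟩⟩
    · rintro ⟨⟨a, h⟩, ⟨b, h'⟩⟩
      exact ⟨a, b, h, h'⟩
  have hf : (nsmulAddMonoidHom (α := Fin n →₀ ℤ) 2).range.index = 2 ^ n := by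
    have := ModN.natCard_eq (Fin n →₀ ℤ) 2
    rw [Module.finrank_finsupp_self, Fintype.card_fin] at this
    rw [← this]
    have e1 : (nsmulAddMonoidHom (α := Fin n →₀ ℤ) 2).range =
        (LinearMap.range (LinearMap.lsmul ℤ (Fin n →₀ ℤ) (2 : ℕ))).toAddSubgroup := by
      ext x
      simp only [AddMonoidHom.mem_range, nsmulAddMonoidHom_apply, Submodule.mem_toAddSubgroup,
        LinearMap.mem_range, LinearMap.lsmul_apply]
      refine exists_congr fun y => ?_
      rw [Nat.cast_smul_eq_nsmul]
    rw [e1]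
    rfl
  have hk : Nat.card (nsmulAddMonoidHom (α := (Fin n →₀ ℤ) × T) 2).ker =
      Nat.card (nsmulAddMonoidHom (α := T) 2).ker := by
    refine (Nat.card_congr ⟨fun y => ⟨(0, y.1), ?m1⟩, fun x => ⟨x.1.2, ?m2⟩, ?_, ?_⟩).symm
    case m1 =>
      have := y.2
      rw [AddMonoidHom.mem_ker] at this ⊢
      simpa using this
    case m2 =>
      have := x.2
      rw [AddMonoidHom.mem_ker] at this ⊢
      simpa using congrArg Prod.snd this
    · intro y; rfl
    · rintro ⟨⟨x, y⟩, h⟩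
      rw [AddMonoidHom.mem_ker] at h
      have h3 : (2 : ℕ) • x = 0 := congrArg Prod.fst h
      have : x = 0 := by
        ext i
        have := DFunLike.congr_fun h3 i
        simpa using this
      simp [this]
  have hT' : Module.finrank ℤ (LinearMap.ker (LinearMap.fst ℤ (Fin n →₀ ℤ) T)) = 0 := by
    refine (Module.finrank_eq_zero_iff (R := ℤ) (M := LinearMap.ker (LinearMap.fst ℤ (Fin n →₀ ℤ) T))).2 ?_
    rintro ⟨⟨x, y⟩, h⟩
    refine ⟨Nat.card T, by exact_mod_cast Nat.card_pos.ne', ?_⟩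
    have : x = 0 := h
    ext1
    simp [this]
  have hrk : Module.finrank ℤ M = n := by
    have q := Submodule.finrank_quotient_add_finrank (LinearMap.ker (LinearMap.fst ℤ (Fin n →₀ ℤ) T))
    rw [hT', ((LinearMap.fst ℤ (Fin n →₀ ℤ) T).quotKerEquivOfSurjective
      LinearMap.fst_surjective).finrank_eq, Module.finrank_finsupp_self, Fintype.card_fin] at q
    have q2 := f.toIntLinearEquiv.finrank_eq
    exact q2.trans q.symm
  rw [h1, h2, hr, AddSubgroup.index_prod, hf, hk, hrk, AddSubgroup.index_range]
  exact ⟨rfl, Nat.card_pos.ne'⟩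

/-- The Herbrand quotient of a finitely generated module with an involution. -/
theorem herbrand_involution {A : Type*} [AddCommGroup A] (N δ : A →+ A) (U : AddSubgroup A)
    [Module.Finite ℤ U] (hN : U.map N ≤ U) (hδ : U.map δ ≤ U)
    (hsum : ∀ x, N x + δ x = 2 • x) (hδN : ∀ x, δ (N x) = 0) (hNδ : ∀ x, N (δ x) = 0)
    (hrank : Module.finrank ℤ (U ⊓ N.ker : AddSubgroup A) =
      Module.finrank ℤ (U ⊓ δ.ker : AddSubgroup A) + 1)
    (htor : ∀ x ∈ U, 2 • x = 0 → N x = 0 ∧ δ x = 0) :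
    (U.map δ).relIndex (U ⊓ N.ker) = 2 * (U.map N).relIndex (U ⊓ δ.ker) ∧
      (U.map N).relIndex (U ⊓ δ.ker) ≠ 0 := by
  have fin : ∀ f : A →+ A, Module.Finite ℤ (U ⊓ f.ker : AddSubgroup A) := by
    intro f
    have : IsNoetherian ℤ U := isNoetherian_of_isNoetherianRing_of_finite ℤ U
    exact Module.Finite.of_injective
      (AddSubgroup.inclusion (show U ⊓ f.ker ≤ U from inf_le_left)).toIntLinearMap
      (AddSubgroup.inclusion_injective (show U ⊓ f.ker ≤ U from inf_le_left))
  have := fin N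
  have := fin δ
  have ridx : ∀ M : AddSubgroup A, (M.map (nsmulAddMonoidHom 2)).relIndex M =
      (nsmulAddMonoidHom (α := M) 2).range.index := by
    intro M
    rw [AddSubgroup.relIndex]
    congr 1
    ext x
    simp only [AddSubgroup.mem_addSubgroupOf, AddSubgroup.mem_map, AddMonoidHom.mem_range,
      nsmulAddMonoidHom_apply, Subtype.exists, Subtype.ext_iff]
    constructor
    · rintro ⟨y, hy, h⟩; exact ⟨y, hy, by simpa using h⟩
    · rintro ⟨y, hy, h⟩; exact ⟨y, hy, by simpa using h⟩
  have hcard : Nat.card (nsmulAddMonoidHom (α := (U ⊓ N.ker : AddSubgroup A)) 2).ker =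
      Nat.card (nsmulAddMonoidHom (α := (U ⊓ δ.ker : AddSubgroup A)) 2).ker := by
    refine Nat.card_congr ⟨fun y => ⟨⟨y.1.1, ?a1⟩, ?a2⟩, fun y => ⟨⟨y.1.1, ?a3⟩, ?a4⟩,
      fun _ => rfl, fun _ => rfl⟩
    case a1 =>
      obtain ⟨⟨y, hy⟩, h⟩ := y
      exact ⟨hy.1, (htor y hy.1 (congrArg Subtype.val h)).2⟩
    case a3 =>
      obtain ⟨⟨y, hy⟩, h⟩ := y
      exact ⟨hy.1, (htor y hy.1 (congrArg Subtype.val h)).1⟩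
    case a2 =>
      obtain ⟨⟨y, hy⟩, h⟩ := y
      exact Subtype.ext (congrArg Subtype.val h :)
    case a4 =>
      obtain ⟨⟨y, hy⟩, h⟩ := y
      exact Subtype.ext (congrArg Subtype.val h :)
  obtain ⟨e1, -⟩ := index_range_two_nsmul (U ⊓ N.ker : AddSubgroup A)
  obtain ⟨e2, c2⟩ := index_range_two_nsmul (U ⊓ δ.ker : AddSubgroup A)
  rw [← ridx, hrank, hcard] at e1
  rw [← ridx] at e2
  have n2 : (AddSubgroup.map (nsmulAddMonoidHom 2) (U ⊓ δ.ker)).relIndex (U ⊓ δ.ker) ≠ 0 := by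
    rw [e2]
    exact mul_ne_zero (by positivity) c2
  have main : ∀ N δ : A →+ A, U.map N ≤ U → (∀ x, N x + δ x = 2 • x) → (∀ x, δ (N x) = 0) →
      (AddSubgroup.map (nsmulAddMonoidHom 2) (U ⊓ δ.ker)).relIndex (U ⊓ δ.ker) =
       ((U ⊓ N.ker) ⊔ (U ⊓ δ.ker)).relIndex U * (U.map N).relIndex (U ⊓ δ.ker) := by
    intro N δ hN hsum hδN
    have h1 : AddSubgroup.map (nsmulAddMonoidHom 2) (U ⊓ δ.ker) = (U ⊓ δ.ker).map N := by
      ext x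
      simp only [AddSubgroup.mem_map]
      refine exists_congr fun y => and_congr_right fun hy => ?_
      have : δ y = 0 := hy.2
      have h2 := hsum y
      rw [this, add_zero] at h2
      rw [h2]; rfl
    have h2 : U.map N ≤ U ⊓ δ.ker := by
      refine le_inf hN ?_
      rintro _ ⟨x, -, rfl⟩
      exact hδN x
    rw [h1, ← AddSubgroup.relIndex_mul_relIndex _ _ _ (AddSubgroup.map_mono inf_le_left) h2]
    congr 1
    rw [AddSubgroup.relIndex_map_map]
    rw [AddSubgroup.relIndex_sup_eq_of_le le_sup_right, ← AddSubgroup.inf_relIndex_right,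
      sup_inf_assoc_of_le _ (inf_le_left : U ⊓ δ.ker ≤ U), sup_comm, inf_comm N.ker]
  have m1 := main N δ hN hsum hδN
  have m2 := main δ N hδ (fun x => by rw [add_comm, hsum]) hNδ
  rw [sup_comm] at m2
  have n3 : (U ⊓ N.ker ⊔ U ⊓ δ.ker).relIndex U ≠ 0 := by
    intro h; rw [h, zero_mul] at m1; exact n2 m1
  refine ⟨?_, by intro h; rw [h, mul_zero] at m1; exact n2 m1⟩
  apply mul_left_cancel₀ n3
  rw [← m2, e1, pow_succ, mul_left_comm, ← m1, e2]
  ring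

end UnitHerbrand

section Divisors

open IsDedekindDomain HeightOneSpectrum WithZero

namespace NumberField

variable {F : Type*} [Field F] [NumberField F]

/-- The order of `x` at a finite prime (zero if `x = 0`). -/
noncomputable def ord (P : HeightOneSpectrum (𝓞 F)) (x : F) : ℤ := -log (P.valuation F x)

theorem valuation_ne_zero (P : HeightOneSpectrum (𝓞 F)) {x : F} (hx : x ≠ 0) : P.valuation F x ≠ 0 :=
  (Valuation.ne_zero_iff _).2 hx

theorem valuation_eq_exp (P : HeightOneSpectrum (𝓞 F)) {x : F} (hx : x ≠ 0) :
    P.valuation F x = exp (-ord P x) := by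
  rw [ord, neg_neg, exp_log (valuation_ne_zero P hx)]

theorem ord_mul (P : HeightOneSpectrum (𝓞 F)) {x y : F} (hx : x ≠ 0) (hy : y ≠ 0) :
    ord P (x * y) = ord P x + ord P y := by
  rw [ord, map_mul, log_mul (valuation_ne_zero P hx) (valuation_ne_zero P hy), neg_add]; rfl

@[simp] theorem ord_one (P : HeightOneSpectrum (𝓞 F)) : ord P (1 : F) = 0 := by simp [ord]

@[simp] theorem ord_inv (P : HeightOneSpectrum (𝓞 F)) (x : F) : ord P x⁻¹ = -ord P x := by
  simp [ord, log_inv]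

theorem ord_pow (P : HeightOneSpectrum (𝓞 F)) (x : F) (n : ℕ) : ord P (x ^ n) = n * ord P x := by
  simp [ord, log_pow]

theorem ord_nonneg_iff (P : HeightOneSpectrum (𝓞 F)) {x : F} (hx : x ≠ 0) :
    0 ≤ ord P x ↔ P.valuation F x ≤ 1 := by
  rw [valuation_eq_exp P hx, ← exp_zero, exp_le_exp]; omega

theorem ord_pos_iff (P : HeightOneSpectrum (𝓞 F)) {x : F} (hx : x ≠ 0) :
    0 < ord P x ↔ P.valuation F x < 1 := by
  rw [valuation_eq_exp P hx, ← exp_zero, exp_lt_exp]; omega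

theorem ord_eq_zero_iff (P : HeightOneSpectrum (𝓞 F)) {x : F} (hx : x ≠ 0) :
    ord P x = 0 ↔ P.valuation F x = 1 := by
  rw [valuation_eq_exp P hx, ← exp_zero, exp_inj]; omega

theorem ord_lt_iff (P : HeightOneSpectrum (𝓞 F)) {x y : F} (hx : x ≠ 0) (hy : y ≠ 0) :
    ord P x < ord P y ↔ P.valuation F y < P.valuation F x := by
  rw [valuation_eq_exp P hx, valuation_eq_exp P hy, exp_lt_exp]; omega

theorem ord_coe_nonneg (P : HeightOneSpectrum (𝓞 F)) (r : 𝓞 F) : 0 ≤ ord P (r : F) := by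
  rcases eq_or_ne r 0 with rfl | hr
  · simp [ord]
  · exact (ord_nonneg_iff P (by simpa using hr)).2 (P.valuation_le_one r)

theorem ord_coe_pos_iff (P : HeightOneSpectrum (𝓞 F)) {r : 𝓞 F} (hr : r ≠ 0) :
    0 < ord P (r : F) ↔ r ∈ P.asIdeal :=
  (ord_pos_iff P (by simpa using hr)).trans (P.valuation_lt_one_iff_mem r)

theorem ord_coe_eq_zero (P : HeightOneSpectrum (𝓞 F)) {r : 𝓞 F} (hr : r ∉ P.asIdeal) :
    ord P (r : F) = 0 := by
  have h0 : r ≠ 0 := by rintro rfl; exact hr (zero_mem _)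
  have := mt (ord_coe_pos_iff P h0).1 hr
  have := ord_coe_nonneg P r
  omega

theorem le_ord_coe_iff (P : HeightOneSpectrum (𝓞 F)) {r : 𝓞 F} (hr : r ≠ 0) (n : ℕ) :
    (n : ℤ) ≤ ord P (r : F) ↔ r ∈ P.asIdeal ^ n := by
  rw [← intValuation_le_pow_iff_mem, ← valuation_of_algebraMap (K := F)]
  change _ ↔ P.valuation F (r : F) ≤ _
  rw [valuation_eq_exp P (by simpa using hr), exp_le_exp]; omega

/-- Elements which are integral at all primes are integral. -/
theorem exists_coe_eq_of_ord_nonneg {x : F} (h : ∀ P : HeightOneSpectrum (𝓞 F), 0 ≤ ord P x) :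
    ∃ r : 𝓞 F, (r : F) = x := by
  rcases eq_or_ne x 0 with rfl | hx
  · exact ⟨0, rfl⟩
  obtain ⟨r, hr⟩ := mem_integers_of_valuation_le_one (R := 𝓞 F) F x
    fun P => (ord_nonneg_iff P hx).1 (h P)
  exact ⟨r, hr⟩

theorem finite_ord_ne_zero {x : F} (hx : x ≠ 0) :
    {P : HeightOneSpectrum (𝓞 F) | ord P x ≠ 0}.Finite := by
  refine ((HeightOneSpectrum.Support.finite (𝓞 F) x).union
    (HeightOneSpectrum.Support.finite (𝓞 F) x⁻¹)).subset fun P hP => ?_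
  rcases lt_or_gt_of_ne (show ord P x ≠ 0 from hP) with h | h
  · left
    change 1 < P.valuation F x
    rw [valuation_eq_exp P hx, ← exp_zero, exp_lt_exp]; omega
  · right
    change 1 < P.valuation F x⁻¹
    rw [valuation_eq_exp P (inv_ne_zero hx), ← exp_zero, exp_lt_exp, ord_inv]; omega

variable (F) in
/-- The group of divisors of a number field. -/
abbrev Div : Type _ := HeightOneSpectrum (𝓞 F) →₀ ℤ

variable (F) in
/-- The principal divisor of a nonzero element. -/
noncomputable def principal : Additive Fˣ →+ Div F where
  toFun x := Finsupp.ofSupportFinite (fun P => ord P (x.toMul : F)) (finite_ord_ne_zero x.toMul.ne_zero)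
  map_zero' := by ext P; simp [Finsupp.ofSupportFinite_coe]
  map_add' x y := by
    ext P
    exact ord_mul P x.toMul.ne_zero y.toMul.ne_zero

@[simp] theorem principal_apply (x : Additive Fˣ) (P : HeightOneSpectrum (𝓞 F)) :
    principal F x P = ord P (x.toMul : F) := rfl

theorem principal_eq_zero_iff (x : Additive Fˣ) :
    principal F x = 0 ↔ ∃ u : (𝓞 F)ˣ, ((u : 𝓞 F) : F) = (x.toMul : F) := by
  constructor
  · intro h
    have h0 : ∀ P : HeightOneSpectrum (𝓞 F), ord P (x.toMul : F) = 0 := fun P => by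
      rw [← principal_apply, h]; rfl
    obtain ⟨r, hr⟩ := exists_coe_eq_of_ord_nonneg (x := (x.toMul : F)) fun P => (h0 P).ge
    obtain ⟨s, hs⟩ := exists_coe_eq_of_ord_nonneg (x := (x.toMul : F)⁻¹) fun P => by
      rw [ord_inv, h0]; simp
    have : r * s = 1 := by
      apply NumberField.RingOfIntegers.ext
      change (r : F) * (s : F) = 1
      rw [hr, hs, mul_inv_cancel₀ x.toMul.ne_zero]
    exact ⟨⟨r, s, this, by rw [mul_comm, this]⟩, hr⟩
  · rintro ⟨u, hu⟩
    ext P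
    rw [principal_apply, ← hu]
    apply ord_coe_eq_zero
    intro h
    exact P.isPrime.ne_top (Ideal.eq_top_of_isUnit_mem _ h u.isUnit)

theorem ord_eq_count (P : HeightOneSpectrum (𝓞 F)) {x : F} (hx : x ≠ 0) :
    ord P x = FractionalIdeal.count F P (FractionalIdeal.spanSingleton _ x) := by
  obtain ⟨r, s, hs, rfl⟩ := IsFractionRing.div_surjective (A := 𝓞 F) x
  have hs0 : s ≠ 0 := nonZeroDivisors.ne_zero hs
  have hr0 : r ≠ 0 := by rintro rfl; simp at hx
  have key : ∀ r : 𝓞 F, r ≠ 0 → ord P (algebraMap (𝓞 F) F r) =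
      FractionalIdeal.count F P (FractionalIdeal.spanSingleton _ (algebraMap (𝓞 F) F r)) := by
    intro r hr
    rw [← FractionalIdeal.coeIdeal_span_singleton, FractionalIdeal.count_coe _ _ (by simpa using hr),
      ord, valuation_of_algebraMap, intValuation_if_neg _ hr, log_exp, neg_neg]
  rw [div_eq_mul_inv, ord_mul P (by simpa using hr0) (by simpa using hs0), ord_inv, key r hr0, key s hs0,
    ← FractionalIdeal.spanSingleton_mul_spanSingleton, FractionalIdeal.count_mul,
    ← FractionalIdeal.spanSingleton_inv, FractionalIdeal.count_inv]
  · simpa [FractionalIdeal.spanSingleton_ne_zero_iff] using hr0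
  · simpa [FractionalIdeal.spanSingleton_ne_zero_iff] using hs0

/-- Finiteness of the class group, in terms of divisors. -/
theorem index_range_principal_ne_zero : (principal F).range.index ≠ 0 := by
  let c : Div F →+ Additive (ClassGroup (𝓞 F)) :=
    { toFun := fun f => Additive.ofMul (ClassGroup.mk F (f.prod fun P n =>
        (Units.mk0 (P.asIdeal : FractionalIdeal (nonZeroDivisors (𝓞 F)) F)
          (FractionalIdeal.coeIdeal_ne_zero.2 P.ne_bot)) ^ n))
      map_zero' := by simp
      map_add' := fun f g => by
        rw [Finsupp.prod_add_index' (by simp) (fun _ _ _ => zpow_add _ _ _), map_mul]; rfl }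
  have hc : c.ker ≤ (principal F).range := by
    intro f hf
    have h1 : ClassGroup.mk F (f.prod fun P n =>
        (Units.mk0 (P.asIdeal : FractionalIdeal (nonZeroDivisors (𝓞 F)) F)
          (FractionalIdeal.coeIdeal_ne_zero.2 P.ne_bot)) ^ n) = 1 := hf
    have h2 := (ClassGroup.mk_eq_one_iff).1 h1
    rw [FractionalIdeal.isPrincipal_iff] at h2
    obtain ⟨x, hx⟩ := h2
    have hval : ((f.prod fun P n => (Units.mk0 (P.asIdeal : FractionalIdeal (nonZeroDivisors (𝓞 F)) F)
          (FractionalIdeal.coeIdeal_ne_zero.2 P.ne_bot)) ^ n : (FractionalIdeal (nonZeroDivisors (𝓞 F)) F)ˣ) :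
          FractionalIdeal (nonZeroDivisors (𝓞 F)) F) =
        f.prod fun P n => (P.asIdeal : FractionalIdeal (nonZeroDivisors (𝓞 F)) F) ^ n := by
      simp [Finsupp.prod]
    have hx0 : x ≠ 0 := by
      rintro rfl
      rw [FractionalIdeal.spanSingleton_zero] at hx
      exact Units.ne_zero _ hx
    refine ⟨Additive.ofMul (Units.mk0 x hx0), ?_⟩
    ext P
    rw [principal_apply]
    change ord P x = _
    rw [ord_eq_count P hx0, ← hx, hval]
    exact FractionalIdeal.count_finsuppProd (K := F) P f
  intro h
  have := AddSubgroup.index_dvd_of_le hc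
  rw [h, zero_dvd_iff, AddSubgroup.index_ker] at this
  exact Nat.card_pos.ne' this

end NumberField
end Divisors

section LocalSquares

open IsDedekindDomain HeightOneSpectrum

namespace NumberField

variable {F : Type*} [Field F] [NumberField F]

theorem ord_coe_eq_iff (P : HeightOneSpectrum (𝓞 F)) {r : 𝓞 F} (hr : r ≠ 0) (n : ℕ) :
    ord P (r : F) = n ↔ r ∈ P.asIdeal ^ n ∧ r ∉ P.asIdeal ^ (n + 1) := by
  rw [← le_ord_coe_iff P hr, ← le_ord_coe_iff P hr]; push_cast; omega

/-- Approximation: integral elements with prescribed orders at finitely many primes. -/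
theorem exists_ord_eq (S : Finset (HeightOneSpectrum (𝓞 F))) (n : HeightOneSpectrum (𝓞 F) → ℕ) :
    ∃ b : 𝓞 F, b ≠ 0 ∧ ∀ P ∈ S, ord P (b : F) = n P := by
  classical
  obtain rfl | ⟨P0, hP0⟩ := S.eq_empty_or_nonempty
  · exact ⟨1, one_ne_zero, by simp⟩
  have h : ∀ P : HeightOneSpectrum (𝓞 F), ∃ x : 𝓞 F, x ∈ P.asIdeal ^ n P ∧ x ∉ P.asIdeal ^ (n P + 1) :=
    fun P => by
      have := Ideal.pow_right_strictAnti P.asIdeal P.ne_bot P.isPrime.ne_top (Nat.lt_succ_self (n P))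
      exact SetLike.exists_of_lt this
  choose π hπ hπ' using h
  obtain ⟨b, hb⟩ := exists_forall_sub_mem_ideal (s := S) (fun P => P.asIdeal) (fun P => n P + 1)
    (fun P _ => P.prime) (fun P _ Q _ h h' => h (HeightOneSpectrum.ext h')) (fun P => π P)
  have h1 : ∀ P ∈ S, b ∈ P.asIdeal ^ n P ∧ b ∉ P.asIdeal ^ (n P + 1) := fun P hP => by
    have h2 := hb P hP
    constructor
    · have := add_mem (Ideal.pow_le_pow_right (Nat.le_succ (n P)) h2) (hπ P)
      simpa using this
    · intro h3
      have := sub_mem h3 h2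
      exact hπ' P (by simpa using this)
  have hb0 : b ≠ 0 := by
    rintro rfl
    exact (h1 P0 hP0).2 (zero_mem _)
  exact ⟨b, hb0, fun P hP => (ord_coe_eq_iff P hb0 _).2 (h1 P hP)⟩

/-- An element of even order at the primes of `S` is, up to squares, integral and a unit on `S`. -/
theorem exists_integral_unit_on {x : F} (hx : x ≠ 0) (S : Finset (HeightOneSpectrum (𝓞 F)))
    (h : ∀ P ∈ S, Even (ord P x)) :
    ∃ z : F, z ≠ 0 ∧ ∃ r : 𝓞 F, x * z ^ 2 = r ∧ ∀ P ∈ S, r ∉ P.asIdeal := by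
  classical
  obtain ⟨c, hc0, hc⟩ := exists_ord_eq S (fun P => (ord P x).natAbs)
  have hcF : (c : F) ≠ 0 := by simpa using hc0
  set U := (finite_ord_ne_zero hx).toFinset ∪ (finite_ord_ne_zero hcF).toFinset with hU
  obtain ⟨b, hb0, hb⟩ := exists_ord_eq (S ∪ U)
    (fun P => if P ∈ S then ((ord P x).natAbs - ord P x / 2).toNat else ((ord P x).natAbs + ord P (c : F)).toNat)
  have hbF : (b : F) ≠ 0 := by simpa using hb0
  have hz : (b : F) / c ≠ 0 := div_ne_zero hbF hcF
  have hord : ∀ P, ord P (x * ((b : F) / c) ^ 2) = ord P x + 2 * (ord P (b : F) - ord P (c : F)) := by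
    intro P
    rw [ord_mul P hx (pow_ne_zero 2 hz), ord_pow, div_eq_mul_inv, ord_mul P hbF (inv_ne_zero hcF), ord_inv]
    push_cast; ring
  have hS : ∀ P ∈ S, ord P (x * ((b : F) / c) ^ 2) = 0 := by
    intro P hP
    have h1 := hb P (Finset.mem_union_left _ hP)
    rw [if_pos hP] at h1
    have h2 := hc P hP
    obtain ⟨k, hk⟩ := h P hP
    rw [hord, h1, h2]
    omega
  have hnn : ∀ P, 0 ≤ ord P (x * ((b : F) / c) ^ 2) := by
    intro P
    by_cases hP : P ∈ S
    · exact (hS P hP).ge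
    by_cases hPU : P ∈ U
    · have h1 := hb P (Finset.mem_union_right _ hPU)
      rw [if_neg hP] at h1
      have := ord_coe_nonneg P c
      rw [hord, h1]; omega
    · have h1 : ord P x = 0 := by
        by_contra h0
        exact hPU (Finset.mem_union_left _ (by simpa using h0))
      have h2 : ord P (c : F) = 0 := by
        by_contra h0
        exact hPU (Finset.mem_union_right _ (by simpa using h0))
      have := ord_coe_nonneg P b
      rw [hord, h1, h2]; omega
  obtain ⟨r, hr⟩ := exists_coe_eq_of_ord_nonneg hnn
  refine ⟨_, hz, r, hr.symm, fun P hP hmem => ?_⟩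
  have hr0 : r ≠ 0 := by
    rintro rfl
    exact mul_ne_zero hx (pow_ne_zero 2 hz) (by rw [← hr]; simp)
  have := (ord_coe_pos_iff P hr0).2 hmem
  rw [hr, hS P hP] at this
  exact lt_irrefl _ this

variable (F) in
/-- The nonzero elements of even order at `P`. -/
noncomputable def evenAt (P : HeightOneSpectrum (𝓞 F)) : AddSubgroup (Additive Fˣ) where
  carrier := {x | Even (ord P (x.toMul : F))}
  zero_mem' := by simp
  add_mem' {x y} hx hy := by
    change Even (ord P ((x.toMul : F) * (y.toMul : F)))
    rw [ord_mul P x.toMul.ne_zero y.toMul.ne_zero]; exact Even.add hx hy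
  neg_mem' {x} hx := by
    change Even (ord P (((x.toMul)⁻¹ : Fˣ) : F))
    rw [Units.val_inv_eq_inv_val, ord_inv]; exact Even.neg hx

theorem mem_evenAt {P : HeightOneSpectrum (𝓞 F)} {x : Additive Fˣ} :
    x ∈ evenAt F P ↔ Even (ord P (x.toMul : F)) := Iff.rfl

/-- `x` is a square up to a unit which is a square modulo `I`. -/
def IsSquareMod (I J : Ideal (𝓞 F)) (x : F) : Prop :=
  ∃ z : F, z ≠ 0 ∧ ∃ r w : 𝓞 F, x * z ^ 2 = r ∧ IsCoprime (Ideal.span {r}) I ∧ r - w ^ 2 ∈ J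

omit [NumberField F] in
theorem IsSquareMod.mul {I J : Ideal (𝓞 F)} {x y : F} (hx : IsSquareMod I J x) (hy : IsSquareMod I J y) :
    IsSquareMod I J (x * y) := by
  obtain ⟨z, hz, r, w, h, hr, hw⟩ := hx
  obtain ⟨z', hz', r', w', h', hr', hw'⟩ := hy
  refine ⟨z * z', mul_ne_zero hz hz', r * r', w * w', ?_, ?_, ?_⟩
  · have : ((r * r' : 𝓞 F) : F) = (r : F) * (r' : F) := map_mul _ _ _
    rw [this, ← h, ← h']; ring
  · rw [← Ideal.span_singleton_mul_span_singleton]; exact IsCoprime.mul_left hr hr'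
  · have : r * r' - (w * w') ^ 2 = r' * (r - w ^ 2) + w ^ 2 * (r' - w' ^ 2) := by ring
    rw [this]
    exact add_mem (Ideal.mul_mem_left _ _ hw) (Ideal.mul_mem_left _ _ hw')

omit [NumberField F] in
theorem IsSquareMod.mul_sq {I J : Ideal (𝓞 F)} {x y : F} (hx : IsSquareMod I J x) (hy : y ≠ 0) :
    IsSquareMod I J (x * y ^ 2) := by
  obtain ⟨z, hz, r, w, h, hr, hw⟩ := hx
  refine ⟨z * y⁻¹, mul_ne_zero hz (inv_ne_zero hy), r, w, ?_, hr, hw⟩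
  rw [← h]; field_simp

theorem isSquareMod_one (I J : Ideal (𝓞 F)) : IsSquareMod I J (1 : F) :=
  ⟨1, one_ne_zero, 1, 1, by simp, by simp [isCoprime_one_left, ← Ideal.one_eq_top], by simp⟩

variable (F) in
/-- The subgroup of elements which are squares up to a unit which is a square modulo `J`. -/
noncomputable def squareMod (I J : Ideal (𝓞 F)) : AddSubgroup (Additive Fˣ) where
  carrier := {x | IsSquareMod I J (x.toMul : F)}
  zero_mem' := isSquareMod_one I J
  add_mem' {_ _} hx hy := hx.mul hy
  neg_mem' {x} hx := by
    have h := IsSquareMod.mul_sq hx (inv_ne_zero x.toMul.ne_zero)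
    change IsSquareMod I J (((x.toMul)⁻¹ : Fˣ) : F)
    convert h using 1
    have := x.toMul.ne_zero
    simp only [Units.val_inv_eq_inv_val]
    field_simp

theorem mem_squareMod {I J : Ideal (𝓞 F)} {x : Additive Fˣ} :
    x ∈ squareMod F I J ↔ IsSquareMod I J (x.toMul : F) := Iff.rfl

variable (F) in
/-- The elements that are locally squares modulo `P`. -/
noncomputable abbrev squareAt (P : HeightOneSpectrum (𝓞 F)) : AddSubgroup (Additive Fˣ) :=
  squareMod F P.asIdeal P.asIdeal

variable (F) in
/-- The elements which are squares modulo `4`, up to squares. -/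
noncomputable abbrev squareAtTwo : AddSubgroup (Additive Fˣ) :=
  squareMod F (Ideal.span {2}) (Ideal.span {4})

theorem two_nsmul_mem_squareMod (I J : Ideal (𝓞 F)) (x : Additive Fˣ) : 2 • x ∈ squareMod F I J := by
  rw [mem_squareMod]
  have := (isSquareMod_one I J).mul_sq x.toMul.ne_zero
  simpa using this

theorem isCoprime_span_iff_not_mem (P : HeightOneSpectrum (𝓞 F)) (r : 𝓞 F) :
    IsCoprime (Ideal.span {r}) P.asIdeal ↔ r ∉ P.asIdeal := by
  rw [isCoprime_comm, Ideal.isCoprime_iff_sup_eq, ← not_iff_not, not_not]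
  constructor
  · intro h
    by_contra hr
    exact h (P.isMaximal.1.2 _ (lt_of_le_of_ne le_sup_left fun h' => hr (by
      rw [h']; exact Ideal.mem_sup_right (Ideal.mem_span_singleton_self r))))
  · intro h
    rw [sup_eq_left.2 ((Ideal.span_singleton_le_iff_mem _).2 h)]
    exact P.isPrime.ne_top

/-- Elements congruent to one modulo `P` are local squares. -/
theorem isSquareMod_of_ord_sub_one_pos (P : HeightOneSpectrum (𝓞 F)) {x : F} (hx : x ≠ 0) (hx1 : x ≠ 1)
    (h : 0 < ord P (x - 1)) : IsSquareMod P.asIdeal P.asIdeal x := by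
  classical
  have hv := (ord_pos_iff P (sub_ne_zero.2 hx1)).1 h
  have hv1 : P.valuation F x = 1 := by
    have := Valuation.map_one_add_of_lt _ hv
    simpa using this
  have h0 : ord P x = 0 := (ord_eq_zero_iff P hx).2 hv1
  -- a denominator prime to `P`
  obtain ⟨b, hb0, hb⟩ := exists_ord_eq (insert P (finite_ord_ne_zero hx).toFinset)
    (fun Q => (ord Q x).natAbs)
  have hbF : (b : F) ≠ 0 := by simpa using hb0
  have hbP : ord P (b : F) = 0 := by rw [hb P (Finset.mem_insert_self _ _), h0]; rfl
  have hnn : ∀ Q, 0 ≤ ord Q (x * b) := by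
    intro Q
    rw [ord_mul Q hx hbF]
    by_cases hQ : ord Q x = 0
    · have := ord_coe_nonneg Q b; omega
    · rw [hb Q (Finset.mem_insert_of_mem (by simpa using hQ))]; omega
  obtain ⟨a, ha⟩ := exists_coe_eq_of_ord_nonneg hnn
  have hr : (((a * b : 𝓞 F)) : F) = x * (b : F) ^ 2 := by
    have : ((a * b : 𝓞 F) : F) = (a : F) * (b : F) := map_mul _ _ _
    rw [this, ha]; ring
  have hr0 : a * b ≠ 0 := by
    intro h0
    rw [h0] at hr
    exact mul_ne_zero hx (pow_ne_zero 2 hbF) (by rw [← hr]; simp)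
  refine ⟨b, hbF, a * b, b, hr.symm, ?_, ?_⟩
  · rw [isCoprime_span_iff_not_mem, ← ord_coe_pos_iff P hr0, hr, ord_mul P hx (pow_ne_zero 2 hbF), ord_pow, h0, hbP]
    simp
  · by_cases h1 : a * b - b ^ 2 = 0
    · rw [h1]; exact zero_mem _
    · rw [← ord_coe_pos_iff P h1]
      have : ((a * b - b ^ 2 : 𝓞 F) : F) = (x - 1) * (b : F) ^ 2 := by
        have : ((a * b - b ^ 2 : 𝓞 F) : F) = ((a * b : 𝓞 F) : F) - (b : F) ^ 2 := by
          rw [← map_pow]; exact map_sub _ _ _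
        rw [this, hr]; ring
      rw [this, ord_mul P (sub_ne_zero.2 hx1) (pow_ne_zero 2 hbF), ord_pow, hbP]
      simpa using h

/-- The key local property of norms at a ramified prime. -/
theorem isSquareMod_of_eq_sq_sub (P : HeightOneSpectrum (𝓞 F)) {x y z α : F} (hx : x ≠ 0) (hα : α ≠ 0)
    (h : α = y ^ 2 - x * z ^ 2) (hodd : ¬ Even (ord P x)) (heven : Even (ord P α)) :
    IsSquareMod P.asIdeal P.asIdeal α := by
  by_cases hz : z = 0
  · subst hz
    have hy : y ≠ 0 := by rintro rfl; simp at h; exact hα h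
    have : α = 1 * y ^ 2 := by rw [h]; ring
    rw [this]
    exact (isSquareMod_one _ _).mul_sq hy
  by_cases hy : y = 0
  · subst hy
    exfalso
    have h1 : ord P α = ord P x + 2 * ord P z := by
      have : α = (-1) * (x * z ^ 2) := by rw [h]; ring
      have h2 : ord P (-1 : F) = 0 := by
        rw [ord_eq_zero_iff P (by simp), Valuation.map_neg, map_one]
      rw [this, ord_mul P (by simp) (mul_ne_zero hx (pow_ne_zero 2 hz)), h2, ord_mul P hx (pow_ne_zero 2 hz), ord_pow]
      push_cast; ring
    rw [h1] at heven
    exact hodd (by simpa [Int.even_add] using heven)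
  set u := x * (z / y) ^ 2 with hu
  have hu0 : u ≠ 0 := mul_ne_zero hx (pow_ne_zero 2 (div_ne_zero hz hy))
  have hαu : α = (1 - u) * y ^ 2 := by rw [h, hu]; field_simp
  have h1u : 1 - u ≠ 0 := by
    intro h0; rw [h0, zero_mul] at hαu; exact hα hαu
  have hou : ¬ Even (ord P u) := by
    rw [hu, ord_mul P hx (pow_ne_zero 2 (div_ne_zero hz hy)), ord_pow]
    simpa [Int.even_add] using hodd
  have heu : Even (ord P (1 - u)) := by
    rw [hαu, ord_mul P h1u (pow_ne_zero 2 hy), ord_pow] at heven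
    simpa [Int.even_add] using heven
  have hpos : 0 < ord P u := by
    by_contra hle
    have hne : ord P u ≠ 0 := by intro h0; rw [h0] at hou; exact hou (by simp)
    have hlt : ord P u < 0 := by omega
    have h1 : P.valuation F (1 : F) < P.valuation F u := by
      rw [← ord_lt_iff P hu0 one_ne_zero, ord_one]; exact hlt
    have h2 : P.valuation F (1 - u) = P.valuation F u := by
      rw [Valuation.map_sub_eq_of_lt_right _ h1]
    have h3 : ord P (1 - u) = ord P u := by rw [ord, h2]; rfl
    rw [h3] at heu
    exact hou heu
  rw [hαu]
  refine IsSquareMod.mul_sq ?_ hy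
  refine isSquareMod_of_ord_sub_one_pos P h1u (by simpa using hu0) ?_
  have : 1 - u - 1 = -u := by ring
  rw [this, ord, Valuation.map_neg]
  exact hpos

/-- The index of the local squares at `P`. -/
theorem exists_label_squareAt (P : HeightOneSpectrum (𝓞 F)) {x y : Additive Fˣ} (hx : x ∈ evenAt F P)
    (hy : y ∈ evenAt F P) (h : x ∈ squareAt F P ↔ y ∈ squareAt F P) : x - y ∈ squareAt F P := by
  classical
  by_cases hxs : x ∈ squareAt F P
  · exact sub_mem hxs (h.1 hxs)
  have hys : y ∉ squareAt F P := fun h' => hxs (h.2 h')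
  suffices x + y ∈ squareAt F P by
    have h2 := sub_mem this (two_nsmul_mem_squareMod P.asIdeal P.asIdeal y)
    have : x + y - 2 • y = x - y := by rw [two_nsmul]; abel
    rwa [this] at h2
  obtain ⟨z, hz, r, hr, hrP⟩ := exists_integral_unit_on x.toMul.ne_zero {P} (by simpa [mem_evenAt] using hx)
  obtain ⟨z', hz', r', hr', hrP'⟩ := exists_integral_unit_on y.toMul.ne_zero {P} (by simpa [mem_evenAt] using hy)
  have hrP := hrP P (by simp)
  have hrP' := hrP' P (by simp)
  let : Field (𝓞 F ⧸ P.asIdeal) := Ideal.Quotient.field P.asIdeal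
  have : Finite (𝓞 F ⧸ P.asIdeal) := Ideal.finiteQuotientOfFreeOfNeBot P.asIdeal P.ne_bot
  let := Fintype.ofFinite (𝓞 F ⧸ P.asIdeal)
  have key : ∀ s : 𝓞 F, IsSquare (Ideal.Quotient.mk P.asIdeal s) → ∃ w : 𝓞 F, s - w ^ 2 ∈ P.asIdeal := by
    rintro s ⟨q, hq⟩
    obtain ⟨w, rfl⟩ := Ideal.Quotient.mk_surjective q
    exact ⟨w, by rw [← Ideal.Quotient.eq, hq, pow_two, map_mul]⟩
  have h1 : ¬ IsSquare (Ideal.Quotient.mk P.asIdeal r) := fun hs => by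
    obtain ⟨w, hw⟩ := key r hs
    exact hxs ⟨z, hz, r, w, hr, (isCoprime_span_iff_not_mem P r).2 hrP, hw⟩
  have h2 : ¬ IsSquare (Ideal.Quotient.mk P.asIdeal r') := fun hs => by
    obtain ⟨w, hw⟩ := key r' hs
    exact hys ⟨z', hz', r', w, hr', (isCoprime_span_iff_not_mem P r').2 hrP', hw⟩
  have hchar : ringChar (𝓞 F ⧸ P.asIdeal) ≠ 2 := fun hc => h1 (FiniteField.isSquare_of_char_two hc _)
  have h3 : IsSquare (Ideal.Quotient.mk P.asIdeal (r * r')) := by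
    rw [map_mul, ← quadraticChar_one_iff_isSquare, map_mul,
      (quadraticChar_neg_one_iff_not_isSquare).2 h1, (quadraticChar_neg_one_iff_not_isSquare).2 h2]
    · rfl
    · rw [← map_mul, Ne, Ideal.Quotient.eq_zero_iff_mem]
      exact fun h => (P.isPrime.mem_or_mem h).elim hrP hrP'
  obtain ⟨w, hw⟩ := key _ h3
  refine ⟨z * z', mul_ne_zero hz hz', r * r', w, ?_, ?_, hw⟩
  · have : ((r * r' : 𝓞 F) : F) = (r : F) * (r' : F) := map_mul _ _ _
    rw [this, ← hr, ← hr']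
    change (x.toMul : F) * (y.toMul : F) * _ = _
    ring
  · rw [isCoprime_span_iff_not_mem]
    exact fun h => (P.isPrime.mem_or_mem h).elim hrP hrP'

end NumberField
end LocalSquares

theorem AddSubgroup.relIndex_le_card_of_label {A T : Type*} [AddCommGroup A] [Finite T] (H K : AddSubgroup A)
    (f : A → T) (h : ∀ x ∈ K, ∀ y ∈ K, f x = f y → x - y ∈ H) :
    H.relIndex K ≠ 0 ∧ H.relIndex K ≤ Nat.card T := by
  have hinj : Function.Injective (fun q : K ⧸ H.addSubgroupOf K => f (q.out : K)) := by
    intro q q' hq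
    have h1 := h _ q.out.2 _ q'.out.2 hq
    rw [← QuotientAddGroup.out_eq' q, ← QuotientAddGroup.out_eq' q', QuotientAddGroup.eq]
    rw [AddSubgroup.mem_addSubgroupOf]
    have := H.neg_mem h1
    simpa [sub_eq_add_neg, add_comm] using this
  have : Finite (K ⧸ H.addSubgroupOf K) := Finite.of_injective _ hinj
  exact ⟨Nat.card_pos.ne', Nat.card_le_card_of_injective _ hinj⟩

section LocalAtTwo

open IsDedekindDomain HeightOneSpectrum

namespace NumberField

variable {F : Type*} [Field F] [NumberField F]

omit [NumberField F] in
theorem coe_two : ((2 : 𝓞 F) : F) = 2 := map_ofNat (algebraMap (𝓞 F) F) 2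

variable (F) in
/-- The prime `2` is unramified in `F`. -/
def TwoUnramified : Prop := ∀ P : HeightOneSpectrum (𝓞 F), ord P (2 : F) ≤ 1

theorem TwoUnramified.mem_of_sq_mem (h : TwoUnramified F) {w : 𝓞 F}
    (hw : w ^ 2 ∈ Ideal.span {(2 : 𝓞 F)}) : w ∈ Ideal.span {(2 : 𝓞 F)} := by
  rw [Ideal.mem_span_singleton] at *
  obtain ⟨c, hc⟩ := hw
  rcases eq_or_ne w 0 with rfl | hw0
  · exact dvd_zero _
  have hwF : (w : F) ≠ 0 := by simpa using hw0
  have hcF : (w : F) ^ 2 = 2 * (c : F) := by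
    have := congrArg (algebraMap (𝓞 F) F) hc
    rw [map_mul, map_pow] at this
    rw [← coe_two]; exact this
  have hc0 : (c : F) ≠ 0 := by rintro h0; rw [h0, mul_zero] at hcF; exact hwF (by simpa using hcF)
  obtain ⟨d, hd⟩ := exists_coe_eq_of_ord_nonneg (x := (w : F) * 2⁻¹) fun P => by
    rw [ord_mul P hwF (by simp), ord_inv]
    have h1 := ord_pow P (w : F) 2
    rw [hcF, ord_mul P two_ne_zero hc0] at h1
    have := ord_coe_nonneg P c
    have := h P
    have := ord_coe_nonneg P w
    push_cast at h1
    omega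
  refine ⟨d, NumberField.RingOfIntegers.ext ?_⟩
  change (w : F) = ((2 * d : 𝓞 F) : F)
  have : ((2 * d : 𝓞 F) : F) = 2 * (d : F) := by rw [← coe_two]; exact map_mul _ _ _
  rw [this, hd]; field_simp

theorem finite_quotient_two : Finite (𝓞 F ⧸ Ideal.span {(2 : 𝓞 F)}) :=
  Ideal.finiteQuotientOfFreeOfNeBot _ (by simp)

theorem card_quotient_two : Nat.card (𝓞 F ⧸ Ideal.span {(2 : 𝓞 F)}) = 2 ^ Module.finrank ℚ F := by
  change Submodule.cardQuot _ = _
  rw [← Ideal.absNorm_apply, Ideal.absNorm_span_singleton]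
  have : Algebra.norm ℤ (2 : 𝓞 F) = 2 ^ Module.finrank ℚ F := by
    have := Algebra.norm_algebraMap (S := 𝓞 F) (2 : ℤ)
    rw [RingOfIntegers.rank] at this
    simpa using this
  rw [this, Int.natAbs_pow]; rfl

theorem TwoUnramified.exists_sq (h : TwoUnramified F) (r : 𝓞 F) :
    ∃ w : 𝓞 F, r - w ^ 2 ∈ Ideal.span {(2 : 𝓞 F)} := by
  have := finite_quotient_two (F := F)
  have h2 : (2 : 𝓞 F ⧸ Ideal.span {(2 : 𝓞 F)}) = 0 := by
    have : (Ideal.Quotient.mk (Ideal.span {(2 : 𝓞 F)})) 2 = 0 :=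
      Ideal.Quotient.eq_zero_iff_mem.2 (Ideal.mem_span_singleton_self _)
    rwa [map_ofNat] at this
  have hinj : Function.Injective (fun q : 𝓞 F ⧸ Ideal.span {(2 : 𝓞 F)} => q ^ 2) := by
    intro q q' hq
    have h3 : (q - q') ^ 2 = 0 := by
      have h4 : (q - q') ^ 2 = (q ^ 2 - q' ^ 2) + 2 * (q' ^ 2 - q * q') := by ring
      rw [h4, h2, zero_mul, add_zero]; exact sub_eq_zero.2 hq
    obtain ⟨w, hw⟩ := Ideal.Quotient.mk_surjective (q - q')
    rw [← hw, ← map_pow, Ideal.Quotient.eq_zero_iff_mem] at h3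
    rw [← sub_eq_zero, ← hw, Ideal.Quotient.eq_zero_iff_mem]
    exact h.mem_of_sq_mem h3
  obtain ⟨q, hq⟩ := (Finite.surjective_of_injective hinj) (Ideal.Quotient.mk _ r)
  obtain ⟨w, rfl⟩ := Ideal.Quotient.mk_surjective q
  refine ⟨w, ?_⟩
  rw [← Ideal.Quotient.eq, ← hq, map_pow]

theorem isCoprime_two_of_forall {r : 𝓞 F}
    (h : ∀ P : HeightOneSpectrum (𝓞 F), (2 : 𝓞 F) ∈ P.asIdeal → r ∉ P.asIdeal) : IsCoprime r 2 := by
  rw [← Ideal.isCoprime_span_singleton_iff, Ideal.isCoprime_iff_sup_eq]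
  by_contra hne
  obtain ⟨M, hM, hle⟩ := Ideal.exists_le_maximal _ hne
  have h2 : (2 : 𝓞 F) ∈ M := hle (Ideal.mem_sup_right (Ideal.mem_span_singleton_self _))
  have hr : r ∈ M := hle (Ideal.mem_sup_left (Ideal.mem_span_singleton_self _))
  exact h ⟨M, hM.isPrime, fun h0 => by rw [h0] at h2; simp at h2⟩ h2 hr

theorem finite_primes_two : {P : HeightOneSpectrum (𝓞 F) | (2 : 𝓞 F) ∈ P.asIdeal}.Finite := by
  refine (finite_ord_ne_zero (F := F) (two_ne_zero)).subset fun P hP => ?_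
  have := (ord_coe_pos_iff P (r := (2 : 𝓞 F)) two_ne_zero).2 hP
  rw [coe_two] at this
  exact this.ne'

variable (F) in
/-- The elements of even order at the primes above two. -/
noncomputable def evenAtTwo : AddSubgroup (Additive Fˣ) :=
  ⨅ P : {P : HeightOneSpectrum (𝓞 F) // (2 : 𝓞 F) ∈ P.asIdeal}, evenAt F P.1

theorem mem_evenAtTwo {x : Additive Fˣ} : x ∈ evenAtTwo F ↔
    ∀ P : HeightOneSpectrum (𝓞 F), (2 : 𝓞 F) ∈ P.asIdeal → Even (ord P (x.toMul : F)) := by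
  simp [evenAtTwo, AddSubgroup.mem_iInf, mem_evenAt]

theorem TwoUnramified.exists_normal_form (h : TwoUnramified F) {x : Additive Fˣ} (hx : x ∈ evenAtTwo F) :
    ∃ z : F, z ≠ 0 ∧ ∃ y : 𝓞 F, (x.toMul : F) * z ^ 2 = ((1 + 2 * y : 𝓞 F) : F) := by
  rw [mem_evenAtTwo] at hx
  obtain ⟨z, hz, r, hr, hrP⟩ := exists_integral_unit_on x.toMul.ne_zero (finite_primes_two (F := F)).toFinset
    fun P hP => hx P (by simpa using hP)
  have hcop : IsCoprime r 2 := isCoprime_two_of_forall fun P hP => hrP P (by simpa using hP)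
  obtain ⟨w, hw⟩ := h.exists_sq r
  obtain ⟨k, hk⟩ := Ideal.mem_span_singleton.1 hw
  have hr' : r = w ^ 2 + 2 * k := by rw [← hk]; ring
  have hwc : IsCoprime w 2 := by
    rw [hr'] at hcop
    have := (IsCoprime.add_mul_left_left_iff).1 hcop
    exact (IsCoprime.pow_left_iff two_pos).1 this
  obtain ⟨v, l, hvl⟩ := hwc
  have hv0 : v * w = 1 - l * 2 := by rw [← hvl]; ring
  refine ⟨z * (v : F), mul_ne_zero hz ?_, (2 * l ^ 2 - 2 * l + k * v ^ 2), ?_⟩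
  · intro hv
    have hv' : v = 0 := by simpa using hv
    rw [hv', zero_mul] at hv0
    have : (1 : 𝓞 F) ∈ Ideal.span {(2 : 𝓞 F)} :=
      Ideal.mem_span_singleton.2 ⟨l, by rw [sub_eq_zero.1 hv0.symm]; ring⟩
    have h2 : IsUnit (2 : 𝓞 F) := isUnit_of_dvd_one (Ideal.mem_span_singleton.1 this)
    have h3 : Nat.card (𝓞 F ⧸ Ideal.span {(2 : 𝓞 F)}) = 1 := by
      rw [Ideal.span_singleton_eq_top.2 h2]
      exact Nat.card_unique
    rw [card_quotient_two] at h3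
    have := Module.finrank_pos (R := ℚ) (M := F)
    exact absurd h3 (Nat.one_lt_two_pow this.ne').ne'
  · have : (x.toMul : F) * (z * (v : F)) ^ 2 = ((r * v ^ 2 : 𝓞 F) : F) := by
      have : ((r * v ^ 2 : 𝓞 F) : F) = (r : F) * (v : F) ^ 2 := by simp
      rw [this, ← hr]; ring
    rw [this]
    congr 1
    rw [hr']
    linear_combination (v * w + 1 - l * 2) * hv0

theorem sub_mem_squareAtTwo {a b : Additive Fˣ} {z z' : F} (hz : z ≠ 0) (hz' : z' ≠ 0) {y y' : 𝓞 F}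
    (hy : (a.toMul : F) * z ^ 2 = ((1 + 2 * y : 𝓞 F) : F))
    (hy' : (b.toMul : F) * z' ^ 2 = ((1 + 2 * y' : 𝓞 F) : F))
    (hab : y - y' ∈ Ideal.span {(2 : 𝓞 F)}) : a - b ∈ squareAtTwo F := by
  obtain ⟨k, hk⟩ := Ideal.mem_span_singleton.1 hab
  have hya : y = y' + 2 * k := by rw [← hk]; ring
  suffices a + b ∈ squareAtTwo F by
    have h2 := sub_mem this (two_nsmul_mem_squareMod (Ideal.span {2}) (Ideal.span {4}) b)
    have : a + b - 2 • b = a - b := by rw [two_nsmul]; abel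
    rwa [this] at h2
  refine ⟨z * z', mul_ne_zero hz hz', (1 + 2 * y) * (1 + 2 * y'), 1, ?_, ?_, ?_⟩
  · have : (((1 + 2 * y) * (1 + 2 * y') : 𝓞 F) : F) =
        ((1 + 2 * y : 𝓞 F) : F) * ((1 + 2 * y' : 𝓞 F) : F) := map_mul _ _ _
    rw [this, ← hy, ← hy']
    change (a.toMul : F) * (b.toMul : F) * _ = _
    ring
  · rw [Ideal.isCoprime_span_singleton_iff]
    have : ∀ t : 𝓞 F, IsCoprime (1 + 2 * t) 2 := fun t => ⟨1, -t, by ring⟩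
    exact IsCoprime.mul_left (this _) (this _)
  · rw [Ideal.mem_span_singleton, hya]
    exact ⟨y' + y' ^ 2 + k * (1 + 2 * y'), by ring⟩

theorem TwoUnramified.exists_label (h : TwoUnramified F) :
    ∃ f : Additive Fˣ → 𝓞 F ⧸ Ideal.span {(2 : 𝓞 F)}, ∀ x ∈ evenAtTwo F, ∀ y ∈ evenAtTwo F,
      f x = f y → x - y ∈ squareAtTwo F := by
  classical
  choose! z hz y hy using fun x (hx : x ∈ evenAtTwo F) => h.exists_normal_form hx
  exact ⟨fun x => Ideal.Quotient.mk _ (y x), fun a ha b hb hab =>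
    sub_mem_squareAtTwo (hz a ha) (hz b hb) (hy a ha) (hy b hb) ((Ideal.Quotient.eq).1 hab)⟩

variable (F) in
/-- The totally positive elements. -/
noncomputable def totallyPositive : AddSubgroup (Additive Fˣ) where
  carrier := {x | ∀ φ : F →+* ℝ, 0 < φ (x.toMul : F)}
  zero_mem' := fun φ => by simp
  add_mem' {x y} hx hy := fun φ => by
    change 0 < φ ((x.toMul : F) * (y.toMul : F))
    rw [map_mul]; exact mul_pos (hx φ) (hy φ)
  neg_mem' {x} hx := fun φ => by
    change 0 < φ (((x.toMul)⁻¹ : Fˣ) : F)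
    rw [Units.val_inv_eq_inv_val, map_inv₀]; exact inv_pos.2 (hx φ)

theorem finite_realEmb : Finite (F →+* ℝ) ∧ Nat.card (F →+* ℝ) ≤ Module.finrank ℚ F := by
  have hinj : Function.Injective (fun φ : F →+* ℝ => (algebraMap ℝ ℂ).comp φ) := by
    intro φ ψ h
    ext x
    exact (algebraMap ℝ ℂ).injective (RingHom.congr_fun h x)
  refine ⟨Finite.of_injective _ hinj, ?_⟩
  rw [← NumberField.Embeddings.card F ℂ, ← Nat.card_eq_fintype_card]
  exact Nat.card_le_card_of_injective _ hinj

omit [NumberField F] in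
theorem sub_mem_totallyPositive (x y : Additive Fˣ)
    (h : (fun φ : F →+* ℝ => 0 < φ (x.toMul : F)) = (fun φ : F →+* ℝ => 0 < φ (y.toMul : F))) :
    x - y ∈ totallyPositive F := by
  intro φ
  have h1 := congrFun h φ
  change 0 < φ (((x.toMul) / (y.toMul) : Fˣ) : F)
  rw [Units.val_div_eq_div_val, map_div₀]
  have hx : φ (x.toMul : F) ≠ 0 := by simp
  have hy : φ (y.toMul : F) ≠ 0 := by simp
  rcases lt_or_gt_of_ne hx with hx' | hx'
  · have : ¬ 0 < φ (y.toMul : F) := by rw [← h1]; exact hx'.not_gt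
    exact div_pos_of_neg_of_neg hx' (lt_of_le_of_ne (not_lt.1 this) hy)
  · exact div_pos hx' (h1 ▸ hx')

end NumberField
end LocalAtTwo

section GaloisAction

open IsDedekindDomain HeightOneSpectrum WithZero

namespace NumberField

variable {F : Type*} [Field F] [NumberField F] {E : Type*} [Field E] [NumberField E]

/-- The action of an automorphism on finite primes. -/
noncomputable def mapPrime (σ : E ≃+* E) :
    HeightOneSpectrum (𝓞 E) ≃ HeightOneSpectrum (𝓞 E) :=
  HeightOneSpectrum.equivOfRingEquiv (RingOfIntegers.mapRingEquiv σ)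

theorem mem_mapPrime (σ : E ≃+* E) (P : HeightOneSpectrum (𝓞 E)) (r : 𝓞 E) :
    r ∈ (mapPrime σ P).asIdeal ↔ RingOfIntegers.mapRingEquiv σ.symm r ∈ P.asIdeal := Iff.rfl

theorem mapPrime_mul (σ τ : E ≃+* E) (P : HeightOneSpectrum (𝓞 E)) :
    mapPrime (σ * τ) P = mapPrime σ (mapPrime τ P) := rfl

theorem mapPrime_one (P : HeightOneSpectrum (𝓞 E)) : mapPrime (1 : E ≃+* E) P = P := rfl

theorem mapPrime_symm (σ : E ≃+* E) : (mapPrime σ).symm = mapPrime σ.symm := rfl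

theorem map_mapRingEquiv_eq (σ : E ≃+* E) (P : HeightOneSpectrum (𝓞 E)) :
    P.asIdeal.map (RingOfIntegers.mapRingEquiv σ : 𝓞 E →+* 𝓞 E) = (mapPrime σ P).asIdeal := by
  rw [Ideal.map_comap_of_equiv]; rfl

theorem ord_mapPrime (σ : E ≃+* E) (P : HeightOneSpectrum (𝓞 E)) (x : E) :
    ord (mapPrime σ P) (σ x) = ord P x := by
  have key : ∀ (σ : E ≃+* E) (P : HeightOneSpectrum (𝓞 E)) (r : 𝓞 E), r ≠ 0 →
      ord P (r : E) ≤ ord (mapPrime σ P) (σ r) := by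
    intro σ P r hr
    obtain ⟨n, hn⟩ := Int.eq_ofNat_of_zero_le (ord_coe_nonneg P r)
    have hr' : RingOfIntegers.mapRingEquiv σ r ≠ 0 := by simpa using hr
    have h1 := (le_ord_coe_iff P hr n).1 hn.ge
    have h2 := Ideal.mem_map_of_mem (RingOfIntegers.mapRingEquiv σ : 𝓞 E →+* 𝓞 E) h1
    rw [Ideal.map_pow, map_mapRingEquiv_eq] at h2
    have := (le_ord_coe_iff _ hr' n).2 h2
    rw [hn]; exact this
  have key2 : ∀ r : 𝓞 E, r ≠ 0 → ord (mapPrime σ P) (σ r) = ord P (r : E) := by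
    intro r hr
    refine le_antisymm ?_ (key σ P r hr)
    have hr' : RingOfIntegers.mapRingEquiv σ r ≠ 0 := by simpa using hr
    have := key σ.symm (mapPrime σ P) _ hr'
    rw [← mapPrime_symm, Equiv.symm_apply_apply, RingOfIntegers.mapRingEquiv_apply,
      RingEquiv.symm_apply_apply] at this
    exact this
  rcases eq_or_ne x 0 with rfl | hx
  · simp [ord]
  obtain ⟨a, b, hb, rfl⟩ := IsFractionRing.div_surjective (A := 𝓞 E) x
  have hb0 : b ≠ 0 := nonZeroDivisors.ne_zero hb
  have ha0 : a ≠ 0 := by rintro rfl; simp at hx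
  have h1 : (algebraMap (𝓞 E) E a) ≠ 0 := by simpa using ha0
  have h2 : (algebraMap (𝓞 E) E b) ≠ 0 := by simpa using hb0
  rw [map_div₀, div_eq_mul_inv, div_eq_mul_inv, ord_mul _ h1 (inv_ne_zero h2),
    ord_mul _ (by simpa using ha0) (by simpa using hb0), ord_inv, ord_inv, key2 a ha0, key2 b hb0]

/-- The action of an automorphism on divisors. -/
noncomputable def mapDiv (σ : E ≃+* E) : Div E →+ Div E :=
  (Finsupp.domCongr (mapPrime σ)).toAddMonoidHom

theorem mapDiv_apply (σ : E ≃+* E) (f : Div E) (P : HeightOneSpectrum (𝓞 E)) :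
    mapDiv σ f P = f (mapPrime σ.symm P) := rfl

theorem mapDiv_apply_mapPrime (σ : E ≃+* E) (f : Div E) (P : HeightOneSpectrum (𝓞 E)) :
    mapDiv σ f (mapPrime σ P) = f P := by
  rw [mapDiv_apply, ← mapPrime_symm, Equiv.symm_apply_apply]

theorem mapDiv_mul (σ τ : E ≃+* E) (f : Div E) : mapDiv (σ * τ) f = mapDiv σ (mapDiv τ f) := by
  ext P; rfl

theorem mapDiv_one (f : Div E) : mapDiv (1 : E ≃+* E) f = f := by
  ext P; rfl

/-- The action of an automorphism on the multiplicative group, written additively. -/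
noncomputable def mapUnits (σ : E ≃+* E) : Additive Eˣ →+ Additive Eˣ :=
  (Units.map (σ : E →* E)).toAdditive

@[simp] theorem coe_mapUnits (σ : E ≃+* E) (x : Additive Eˣ) :
    (((mapUnits σ x).toMul : Eˣ) : E) = σ (x.toMul : Eˣ) := rfl

theorem mapDiv_principal (σ : E ≃+* E) (x : Additive Eˣ) :
    mapDiv σ (principal E x) = principal E (mapUnits σ x) := by
  ext P
  obtain ⟨Q, rfl⟩ := (mapPrime σ).surjective P
  rw [mapDiv_apply_mapPrime, principal_apply, principal_apply, coe_mapUnits, ord_mapPrime]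

section Extension

variable [Algebra F E]

/-- The ramification index over `F` of a prime of `E`. -/
noncomputable def ram (F : Type*) [Field F] [NumberField F] [Algebra F E]
    (P : HeightOneSpectrum (𝓞 E)) : ℕ :=
  (P.under (𝓞 F)).asIdeal.ramificationIdx' P.asIdeal

instance (P : HeightOneSpectrum (𝓞 E)) : P.asIdeal.LiesOver (P.under (𝓞 F)).asIdeal :=
  ⟨rfl⟩

theorem ord_algebraMap (P : HeightOneSpectrum (𝓞 E)) (x : F) :
    ord P (algebraMap F E x) = ram F P * ord (P.under (𝓞 F)) x := by
  rw [ord, ← valuation_liesOver E (P.under (𝓞 F)) P x, log_pow, ord, ram]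
  simp

theorem exists_ord_eq_one (P : HeightOneSpectrum (𝓞 F)) : ∃ b : 𝓞 F, b ≠ 0 ∧ ord P (b : F) = 1 := by
  classical
  obtain ⟨b, hb, h⟩ := exists_ord_eq {P} (fun _ => 1)
  exact ⟨b, hb, by simpa using h P (by simp)⟩

theorem ram_pos (P : HeightOneSpectrum (𝓞 E)) : 0 < ram F P := by
  obtain ⟨b, hb, h⟩ := exists_ord_eq_one (P.under (𝓞 F))
  have h1 : 0 < ord P (algebraMap F E b) := by
    have : algebraMap F E b = (algebraMap (𝓞 F) (𝓞 E) b : 𝓞 E) := rfl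
    rw [this, ord_coe_pos_iff _ (by simpa using hb)]
    exact (ord_coe_pos_iff (P.under (𝓞 F)) hb).1 (by omega)
  rw [ord_algebraMap, h] at h1
  by_contra h0
  have : ram F P = 0 := by omega
  simp [this] at h1

theorem ram_eq_of_ord_eq (P : HeightOneSpectrum (𝓞 E)) {x : F} (h : ord (P.under (𝓞 F)) x = 1) :
    (ram F P : ℤ) = ord P (algebraMap F E x) := by rw [ord_algebraMap, h, mul_one]

theorem finite_under_preimage (p : HeightOneSpectrum (𝓞 F)) :
    {P : HeightOneSpectrum (𝓞 E) | P.under (𝓞 F) = p}.Finite := by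
  have : (p.asIdeal.primesOver (𝓞 E)).Finite := IsDedekindDomain.primesOver_finite _ _
  refine (this.preimage (f := HeightOneSpectrum.asIdeal)
    (fun _ _ _ _ h => HeightOneSpectrum.ext h)).subset ?_
  rintro P rfl
  exact ⟨P.isPrime, inferInstance⟩

theorem under_surjective (p : HeightOneSpectrum (𝓞 F)) :
    ∃ P : HeightOneSpectrum (𝓞 E), P.under (𝓞 F) = p := by
  obtain ⟨P, hP, h⟩ := Ideal.exists_maximal_ideal_liesOver_of_isIntegral (S := 𝓞 E) p.asIdeal
  exact ⟨⟨P, hP.isPrime, Ideal.ne_bot_of_liesOver_of_ne_bot p.ne_bot P⟩,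
    HeightOneSpectrum.ext h.over.symm⟩

variable (F E) in
/-- Extension of divisors from `F` to `E`. -/
noncomputable def pullDiv : Div F →+ Div E where
  toFun f := Finsupp.onFinset
    (Set.Finite.toFinset (s := {P : HeightOneSpectrum (𝓞 E) | f (P.under (𝓞 F)) ≠ 0}) (by
      refine (Set.Finite.biUnion f.support.finite_toSet
        (fun p _ => finite_under_preimage (E := E) p)).subset ?_
      intro P hP
      simpa using hP))
    (fun P => ram F P * f (P.under (𝓞 F)))
    (by intro P h; simp only [Set.Finite.mem_toFinset, Set.mem_ofPred_eq]; exact right_ne_zero_of_mul h)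
  map_zero' := by ext; simp
  map_add' f g := by ext P; simp [mul_add]

theorem pullDiv_apply (f : Div F) (P : HeightOneSpectrum (𝓞 E)) :
    pullDiv F E f P = ram F P * f (P.under (𝓞 F)) := rfl

theorem pullDiv_injective : Function.Injective (pullDiv F E) := by
  refine (injective_iff_map_eq_zero _).2 fun f hf => ?_
  ext p
  obtain ⟨P, rfl⟩ := under_surjective (E := E) p
  have := DFunLike.congr_fun hf P
  rw [pullDiv_apply] at this
  have h0 := ram_pos (F := F) P
  simpa [h0.ne'] using this

variable (F E) in
/-- The inclusion of multiplicative groups, written additively. -/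
noncomputable def inclUnits : Additive Fˣ →+ Additive Eˣ :=
  (Units.map (algebraMap F E : F →* E)).toAdditive

@[simp] theorem coe_inclUnits (x : Additive Fˣ) :
    (((inclUnits F E x).toMul : Eˣ) : E) = algebraMap F E (x.toMul : Fˣ) := rfl

theorem pullDiv_principal (x : Additive Fˣ) :
    pullDiv F E (principal F x) = principal E (inclUnits F E x) := by
  ext P
  rw [pullDiv_apply, principal_apply, principal_apply, coe_inclUnits, ord_algebraMap]

theorem under_mapPrime (σ : E ≃+* E) (hσ : ∀ x : F, σ (algebraMap F E x) = algebraMap F E x)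
    (P : HeightOneSpectrum (𝓞 E)) : (mapPrime σ P).under (𝓞 F) = P.under (𝓞 F) := by
  refine HeightOneSpectrum.ext (Ideal.ext fun r => ?_)
  change RingOfIntegers.mapRingEquiv σ.symm (algebraMap (𝓞 F) (𝓞 E) r) ∈ P.asIdeal ↔
    algebraMap (𝓞 F) (𝓞 E) r ∈ P.asIdeal
  have : RingOfIntegers.mapRingEquiv σ.symm (algebraMap (𝓞 F) (𝓞 E) r) =
      algebraMap (𝓞 F) (𝓞 E) r := by
    apply RingOfIntegers.ext
    change σ.symm (algebraMap F E r) = algebraMap F E r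
    rw [RingEquiv.symm_apply_eq, hσ]
  rw [this]

theorem ram_mapPrime (σ : E ≃+* E) (hσ : ∀ x : F, σ (algebraMap F E x) = algebraMap F E x)
    (P : HeightOneSpectrum (𝓞 E)) : ram F (mapPrime σ P) = ram F P := by
  obtain ⟨b, hb, h⟩ := exists_ord_eq_one (P.under (𝓞 F))
  have h1 := ram_eq_of_ord_eq P h
  have h2 := ram_eq_of_ord_eq (mapPrime σ P) (x := (b : F)) (by rw [under_mapPrime σ hσ, h])
  rw [← hσ, ord_mapPrime, ← h1] at h2
  exact_mod_cast h2

theorem mapDiv_pullDiv (σ : E ≃+* E) (hσ : ∀ x : F, σ (algebraMap F E x) = algebraMap F E x)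
    (f : Div F) : mapDiv σ (pullDiv F E f) = pullDiv F E f := by
  ext P
  obtain ⟨P, rfl⟩ := (mapPrime σ).surjective P
  rw [mapDiv_apply_mapPrime, pullDiv_apply, pullDiv_apply, under_mapPrime σ hσ, ram_mapPrime σ hσ]

/-- A divisor proportional to the ramification indices on the fibres of primes and divisible by the ramification indices is
extended from `F`. -/
theorem exists_pullDiv_eq (f : Div E)
    (h : ∀ P Q : HeightOneSpectrum (𝓞 E), P.under (𝓞 F) = Q.under (𝓞 F) →
      ram F Q * f P = ram F P * f Q)
    (hr : ∀ P, (ram F P : ℤ) ∣ f P) : ∃ g : Div F, pullDiv F E g = f := by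
  classical
  choose q hq using under_surjective (F := F) (E := E)
  choose m hm using hr
  refine ⟨Finsupp.onFinset (f.support.image (fun P => P.under (𝓞 F))) (fun p => m (q p)) ?_, ?_⟩
  · intro p hp
    rw [Finset.mem_image]
    refine ⟨q p, ?_, hq p⟩
    rw [Finsupp.mem_support_iff, hm]
    exact mul_ne_zero (by exact_mod_cast (ram_pos _).ne') hp
  · ext P
    have e1 : (q (P.under (𝓞 F))).under (𝓞 F) = P.under (𝓞 F) := hq _
    rw [pullDiv_apply, Finsupp.onFinset_apply]
    have e2 := h _ _ e1
    rw [hm (q _)] at e2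
    have h0 : (ram F (q (P.under (𝓞 F))) : ℤ) ≠ 0 := by exact_mod_cast (ram_pos _).ne'
    refine mul_left_cancel₀ h0 ?_
    linear_combination e2

end Extension

end NumberField

end GaloisAction

section Quadratic

open IsDedekindDomain HeightOneSpectrum WithZero Module

namespace NumberField

variable {F : Type*} [Field F] [NumberField F] {E : Type*} [Field E] [NumberField E] [Algebra F E]

theorem ord_prod {ι : Type*} (S : Finset ι) (f : ι → E) (hf : ∀ i ∈ S, f i ≠ 0)
    (P : HeightOneSpectrum (𝓞 E)) : ord P (∏ i ∈ S, f i) = ∑ i ∈ S, ord P (f i) := by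
  classical
  induction S using Finset.induction_on with
  | empty => simp
  | insert i S hi ih =>
    rw [Finset.prod_insert hi, Finset.sum_insert hi,
      ord_mul P (hf i (by simp)) (Finset.prod_ne_zero_iff.2 fun j hj => hf j (by simp [hj])),
      ih fun j hj => hf j (by simp [hj])]

/-- A set of automorphisms containing `1` whose products of conjugates lie in the base field acts
transitively on the primes over a given prime. -/
theorem exists_mapPrime_eq (S : Finset (E ≃+* E)) (h1 : 1 ∈ S)
    (hS : ∀ b : E, ∃ c : F, ∏ σ ∈ S, σ b = algebraMap F E c) (P Q : HeightOneSpectrum (𝓞 E))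
    (h : P.under (𝓞 F) = Q.under (𝓞 F)) : ∃ σ ∈ S, mapPrime σ P = Q := by
  classical
  by_contra! hne
  obtain ⟨b, hb, hbS⟩ := exists_ord_eq (insert P (S.image fun σ => mapPrime σ.symm Q))
    (fun R => if R = P then 1 else 0)
  have hb0 : (b : E) ≠ 0 := by simpa using hb
  obtain ⟨c, hc⟩ := hS (b : E)
  have hcoe : ∀ σ : E ≃+* E, ((RingOfIntegers.mapRingEquiv σ b : 𝓞 E) : E) = σ b := fun _ => rfl
  have hs0 : ∀ σ ∈ S, σ (b : E) ≠ 0 := fun σ _ => by simpa using hb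
  have hQ : ord Q (algebraMap F E c) = 0 := by
    rw [← hc, ord_prod _ _ hs0]
    refine Finset.sum_eq_zero fun σ hσ => ?_
    have e : mapPrime σ (mapPrime σ.symm Q) = Q := (mapPrime σ).apply_symm_apply Q
    rw [← e, ord_mapPrime, hbS _ (Finset.mem_insert_of_mem (Finset.mem_image_of_mem _ hσ)),
      if_neg]
    · rfl
    · rintro h'
      exact hne σ hσ (by rw [← h', e])
  have hP : 0 < ord P (algebraMap F E c) := by
    rw [← hc, ord_prod _ _ hs0]
    refine Finset.sum_pos' (fun σ _ => by rw [← hcoe]; exact ord_coe_nonneg _ _) ⟨1, h1, ?_⟩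
    change 0 < ord P (b : E)
    rw [hbS P (Finset.mem_insert_self _ _)]; simp
  rw [ord_algebraMap] at hP hQ
  rw [h] at hP
  have := (ram_pos (F := F) Q).ne'
  have h0 : ord (Q.under (𝓞 F)) c = 0 := by simpa [this] using hQ
  simp [h0] at hP

/-- `E = F(√a)` with `θ = √a` and `σ` the nontrivial automorphism. -/
structure IsSqrtExt (F : Type*) [Field F] {E : Type*} [Field E] [Algebra F E] (σ : E ≃+* E) (θ : E)
    (a : F) : Prop where
  sq : θ ^ 2 = algebraMap F E a
  not_sq : ¬ IsSquare a
  span : ∀ y : E, ∃ u v : F, y = algebraMap F E u + algebraMap F E v * θ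
  fix : ∀ u : F, σ (algebraMap F E u) = algebraMap F E u
  neg : σ θ = -θ

/-- The norm `y ↦ y * σ y`. -/
noncomputable def normUnits (σ : E ≃+* E) : Additive Eˣ →+ Additive Eˣ :=
  AddMonoidHom.id _ + mapUnits σ

/-- The map `y ↦ y / σ y`. -/
noncomputable def deltaUnits (σ : E ≃+* E) : Additive Eˣ →+ Additive Eˣ :=
  AddMonoidHom.id _ - mapUnits σ

/-- The norm `f ↦ f + σ f` on divisors. -/
noncomputable def normDiv (σ : E ≃+* E) : Div E →+ Div E := AddMonoidHom.id _ + mapDiv σ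

/-- The map `f ↦ f - σ f` on divisors. -/
noncomputable def deltaDiv (σ : E ≃+* E) : Div E →+ Div E := AddMonoidHom.id _ - mapDiv σ

theorem normUnits_apply (σ : E ≃+* E) (y) : normUnits σ y = y + mapUnits σ y := rfl
theorem deltaUnits_apply (σ : E ≃+* E) (y) : deltaUnits σ y = y - mapUnits σ y := rfl
theorem normDiv_apply (σ : E ≃+* E) (y) : normDiv σ y = y + mapDiv σ y := rfl
theorem deltaDiv_apply (σ : E ≃+* E) (y) : deltaDiv σ y = y - mapDiv σ y := rfl

theorem addUnits_ext {x y : Additive Eˣ} (h : (x.toMul : E) = y.toMul) : x = y :=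
  Additive.toMul.injective (Units.ext h)

@[simp] theorem coe_normUnits (σ : E ≃+* E) (y : Additive Eˣ) :
    (((normUnits σ y).toMul : Eˣ) : E) = (y.toMul : E) * σ (y.toMul : E) := rfl

theorem coe_deltaUnits (σ : E ≃+* E) (y : Additive Eˣ) :
    (((deltaUnits σ y).toMul : Eˣ) : E) = (y.toMul : E) / σ (y.toMul : E) := by
  rw [deltaUnits_apply, toMul_sub, Units.val_div_eq_div_val, coe_mapUnits]

namespace IsSqrtExt

variable {σ : E ≃+* E} {θ : E} {a : F} (h : IsSqrtExt F σ θ a)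
include h

theorem ne_zero : a ≠ 0 := by rintro rfl; exact h.not_sq ⟨0, by simp⟩

theorem theta_ne_zero : θ ≠ 0 := by
  rintro h0
  have := h.sq
  rw [h0] at this
  exact h.ne_zero (by simpa using this.symm)

theorem theta_not_mem (u : F) : θ ≠ algebraMap F E u := by
  rintro h0
  have := h.sq
  rw [h0, ← map_pow] at this
  exact h.not_sq ⟨u, by rw [← _root_.sq]; exact ((algebraMap F E).injective this).symm⟩

theorem apply_apply (y : E) : σ (σ y) = y := by
  obtain ⟨u, v, rfl⟩ := h.span y
  simp [h.fix, h.neg]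

theorem apply_ne (y : E) : σ y = y ↔ ∃ u : F, y = algebraMap F E u := by
  constructor
  · intro hy
    obtain ⟨u, v, rfl⟩ := h.span y
    refine ⟨u, ?_⟩
    simp only [map_add, map_mul, h.fix, h.neg] at hy
    have : (2 : E) * (algebraMap F E v * θ) = 0 := by linear_combination -hy
    have := (mul_eq_zero.1 this).resolve_left two_ne_zero
    simp [this]
  · rintro ⟨u, rfl⟩; exact h.fix u

theorem mapUnits_mapUnits (y : Additive Eˣ) : mapUnits σ (mapUnits σ y) = y :=
  addUnits_ext (by simp [h.apply_apply])

theorem mul_self : σ * σ = 1 := RingEquiv.ext h.apply_apply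

theorem mapPrime_mapPrime (P : HeightOneSpectrum (𝓞 E)) : mapPrime σ (mapPrime σ P) = P := by
  rw [← mapPrime_mul, h.mul_self, mapPrime_one]

theorem symm_eq : σ.symm = σ := by
  ext y; rw [RingEquiv.symm_apply_eq, h.apply_apply]

theorem mapDiv_mapDiv (f : Div E) : mapDiv σ (mapDiv σ f) = f := by
  rw [← mapDiv_mul, h.mul_self, mapDiv_one]

theorem mapDiv_apply (f : Div E) (P) : mapDiv σ f P = f (mapPrime σ P) := by
  rw [NumberField.mapDiv_apply, h.symm_eq]

theorem ne_one : σ ≠ 1 := by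
  rintro rfl
  have h1 : θ = -θ := h.neg
  have h2 : (2 : E) * θ = 0 := by linear_combination h1
  exact h.theta_ne_zero ((mul_eq_zero.1 h2).resolve_left two_ne_zero)

theorem norm_mem (y : E) : ∃ c : F, y * σ y = algebraMap F E c := by
  refine (h.apply_ne _).1 ?_
  rw [map_mul, h.apply_apply, mul_comm]

theorem ker_deltaUnits : (deltaUnits σ).ker = (inclUnits F E).range := by
  ext y
  rw [AddMonoidHom.mem_ker, deltaUnits_apply, sub_eq_zero]
  constructor
  · intro hy
    obtain ⟨u, hu⟩ := (h.apply_ne (y.toMul : E)).1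
      (by rw [← coe_mapUnits, ← hy])
    have hu0 : u ≠ 0 := by rintro rfl; simp at hu
    exact ⟨Additive.ofMul (Units.mk0 u hu0), addUnits_ext hu.symm⟩
  · rintro ⟨u, rfl⟩
    exact addUnits_ext (h.fix _).symm

theorem ker_normUnits : (normUnits σ).ker = (deltaUnits σ).range := by
  ext y
  rw [AddMonoidHom.mem_ker]
  constructor
  · intro hy
    have hy : (y.toMul : E) * σ (y.toMul : E) = 1 := by
      rw [← coe_normUnits, hy]; rfl
    by_cases h1 : (1 : E) + y.toMul = 0
    · refine ⟨Additive.ofMul (Units.mk0 θ h.theta_ne_zero), addUnits_ext ?_⟩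
      rw [coe_deltaUnits, toMul_ofMul, Units.val_mk0, h.neg, div_neg, div_self h.theta_ne_zero]
      linear_combination -h1
    · refine ⟨Additive.ofMul (Units.mk0 _ h1), addUnits_ext ?_⟩
      rw [coe_deltaUnits, toMul_ofMul, Units.val_mk0, div_eq_iff, map_add, map_one]
      · linear_combination -hy
      · simpa using (map_ne_zero σ).2 h1
  · rintro ⟨z, rfl⟩
    rw [normUnits_apply, deltaUnits_apply, map_sub, h.mapUnits_mapUnits]
    abel

theorem ker_normDiv : (normDiv σ).ker = (deltaDiv σ).range := by
  classical
  ext f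
  rw [AddMonoidHom.mem_ker]
  constructor
  · intro hf
    have hf : ∀ P, f P + f (mapPrime σ P) = 0 := fun P => by
      rw [← h.mapDiv_apply]; exact DFunLike.congr_fun hf P
    let : LinearOrder (HeightOneSpectrum (𝓞 E)) := linearOrderOfSTO WellOrderingRel
    refine ⟨f.filter (fun P => P < mapPrime σ P), ?_⟩
    ext P
    rw [deltaDiv_apply, Finsupp.sub_apply, h.mapDiv_apply, Finsupp.filter_apply,
      Finsupp.filter_apply, h.mapPrime_mapPrime]
    rcases lt_trichotomy P (mapPrime σ P) with hlt | heq | hgt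
    · rw [if_pos hlt, if_neg hlt.not_gt, sub_zero]
    · have := hf P
      rw [← heq] at this ⊢
      simp; omega
    · rw [if_neg hgt.not_gt, if_pos hgt]
      have := hf P
      omega
  · rintro ⟨z, rfl⟩
    rw [normDiv_apply, deltaDiv_apply, map_sub, h.mapDiv_mapDiv]
    abel

theorem under_eq_iff (P Q : HeightOneSpectrum (𝓞 E)) :
    P.under (𝓞 F) = Q.under (𝓞 F) ↔ Q = P ∨ Q = mapPrime σ P := by
  classical
  constructor
  · intro hPQ
    obtain ⟨τ, hτ, rfl⟩ := exists_mapPrime_eq ({1, σ} : Finset (E ≃+* E)) (by simp) (fun b => by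
      rw [Finset.prod_pair h.ne_one.symm]
      exact h.norm_mem b) P Q hPQ
    simp only [Finset.mem_insert, Finset.mem_singleton] at hτ
    rcases hτ with rfl | rfl
    · exact Or.inl rfl
    · exact Or.inr rfl
  · rintro (rfl | rfl)
    · rfl
    · exact (under_mapPrime σ h.fix P).symm

theorem finrank_eq_two : finrank F E = 2 := by
  have hli : LinearIndependent F ![(1 : E), θ] := by
    refine LinearIndependent.pair_iff.2 fun u v huv => ?_
    rw [Algebra.smul_def, Algebra.smul_def, mul_one] at huv
    have hv : v = 0 := by
      by_contra hv
      refine h.theta_not_mem (-u / v) ?_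
      rw [map_div₀, map_neg, eq_div_iff (by simpa using hv)]
      linear_combination huv
    subst hv
    simpa using huv
  have hsp : ⊤ ≤ Submodule.span F (Set.range ![(1 : E), θ]) := by
    rintro y -
    obtain ⟨u, v, rfl⟩ := h.span y
    rw [Matrix.range_cons, Matrix.range_cons, Matrix.range_empty, Set.union_empty,
      Set.singleton_union, Submodule.mem_span_pair]
    exact ⟨u, v, by rw [Algebra.smul_def, Algebra.smul_def, mul_one]⟩
  rw [finrank_eq_card_basis (Basis.mk hli hsp), Fintype.card_fin]

end IsSqrtExt

section Chevalley

variable (E) in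
/-- The inclusion of the unit group, written additively. -/
noncomputable def unitIncl : Additive (𝓞 E)ˣ →+ Additive Eˣ :=
  (Units.map (algebraMap (𝓞 E) E : 𝓞 E →* E)).toAdditive

theorem unitIncl_injective : Function.Injective (unitIncl E) := by
  intro x y hxy
  refine Additive.toMul.injective (Units.ext (RingOfIntegers.ext ?_))
  exact congrArg (fun z : Additive Eˣ => ((z.toMul : Eˣ) : E)) hxy

theorem ker_principal : (principal E).ker = (unitIncl E).range := by
  ext x
  rw [AddMonoidHom.mem_ker, principal_eq_zero_iff]
  exact ⟨fun ⟨u, hu⟩ => ⟨Additive.ofMul u, addUnits_ext hu⟩, fun ⟨u, hu⟩ => ⟨u.toMul, by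
    rw [← hu]; rfl⟩⟩

theorem finrank_units [IsTotallyReal E] :
    finrank ℤ (Additive (𝓞 E)ˣ) + 1 = finrank ℚ E := by
  rw [Units.finrank_eq, Units.rank, ← Nat.card_eq_fintype_card]
  have := IsTotallyReal.finrank (K := E)
  have h2 := InfinitePlace.card_eq_nrRealPlaces_add_nrComplexPlaces (K := E)
  rw [IsTotallyReal.nrComplexPlaces_eq_zero] at h2
  have h3 : 0 < finrank ℚ E := finrank_pos
  rw [Nat.card_eq_fintype_card]
  omega

theorem finrank_range_int {A B : Type*} [AddCommGroup A] [AddCommGroup B] (f : A →+ B)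
    (hf : Function.Injective f) : finrank ℤ f.range = finrank ℤ A :=
  (LinearEquiv.ofInjective f.toIntLinearMap hf).finrank_eq.symm

theorem finrank_range_add_finrank_ker_int {A B : Type*} [AddCommGroup A] [AddCommGroup B]
    [Module.Finite ℤ A] (f : A →+ B) : finrank ℤ f.range + finrank ℤ f.ker = finrank ℤ A := by
  have h := Submodule.finrank_quotient_add_finrank (LinearMap.ker f.toIntLinearMap)
  rw [f.toIntLinearMap.quotKerEquivRange.finrank_eq] at h
  exact h

theorem finrank_le_int {A : Type*} [AddCommGroup A] {H K : AddSubgroup A} [Module.Finite ℤ K]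
    (h : H ≤ K) : finrank ℤ H ≤ finrank ℤ K :=
  LinearMap.finrank_le_finrank_of_injective (f := (AddSubgroup.inclusion h).toIntLinearMap)
    (AddSubgroup.inclusion_injective h)

theorem finrank_eq_add_of_norm {A : Type*} [AddCommGroup A] (N δ : A →+ A) (U : AddSubgroup A)
    [Module.Finite ℤ U] (hN : U.map N ≤ U) (hδN : ∀ x, δ (N x) = 0)
    (hsum : ∀ x, N x + δ x = 2 • x) :
    finrank ℤ U = finrank ℤ (U ⊓ N.ker : AddSubgroup A) +
      finrank ℤ (U ⊓ δ.ker : AddSubgroup A) := by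
  have : IsNoetherian ℤ U := isNoetherian_of_isNoetherianRing_of_finite ℤ U
  have fin : ∀ V ≤ U, Module.Finite ℤ V := fun V hV =>
    Module.Finite.of_injective (AddSubgroup.inclusion hV).toIntLinearMap
      (AddSubgroup.inclusion_injective hV)
  have hVU : U ⊓ δ.ker ≤ U := inf_le_left
  have := fin _ hVU
  have e0 := finrank_range_add_finrank_ker_int (N.comp U.subtype)
  have e1 := finrank_range_add_finrank_ker_int (N.comp (U ⊓ δ.ker).subtype)
  have k0 : finrank ℤ (N.comp U.subtype).ker = finrank ℤ (U ⊓ N.ker : AddSubgroup A) := by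
    rw [← finrank_range_int ((U.subtype).comp (N.comp U.subtype).ker.subtype)
      (U.subtype_injective.comp (AddSubgroup.subtype_injective _))]
    have : (U.subtype.comp (N.comp U.subtype).ker.subtype).range = U ⊓ N.ker := by
      ext x
      constructor
      · rintro ⟨⟨⟨x, hx⟩, h⟩, rfl⟩
        exact ⟨hx, h⟩
      · rintro ⟨hx, h⟩
        exact ⟨⟨⟨x, hx⟩, h⟩, rfl⟩
    rw [this]
  have k1 : finrank ℤ (N.comp (U ⊓ δ.ker).subtype).ker = 0 := by
    have : Module.Finite ℤ (N.comp (U ⊓ δ.ker).subtype).ker :=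
      Module.Finite.of_injective ((N.comp (U ⊓ δ.ker).subtype).ker.subtype).toIntLinearMap
        (AddSubgroup.subtype_injective _)
    rw [Module.finrank_eq_zero_iff]
    rintro ⟨⟨x, hx, h⟩, h'⟩
    refine ⟨2, two_ne_zero, Subtype.ext (Subtype.ext ?_)⟩
    have h1 : δ x = 0 := h
    have h2 : N x = 0 := h'
    have := hsum x
    rw [h1, h2, add_zero] at this
    rw [ofNat_smul_eq_nsmul]
    exact this.symm
  have l1 : (N.comp (U ⊓ δ.ker).subtype).range ≤ (N.comp U.subtype).range := by
    rintro _ ⟨⟨x, hx⟩, rfl⟩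
    exact ⟨⟨x, hx.1⟩, rfl⟩
  have l2 : (N.comp U.subtype).range ≤ U ⊓ δ.ker := by
    rintro _ ⟨⟨x, hx⟩, rfl⟩
    exact ⟨hN ⟨x, hx, rfl⟩, hδN x⟩
  have := fin _ (l2.trans hVU)
  have m1 := finrank_le_int l1
  have m2 := finrank_le_int l2
  omega

theorem chevalley {σ : E ≃+* E} {θ : E} {a : F} (h : IsSqrtExt F σ θ a) [IsTotallyReal F]
    [IsTotallyReal E] :
    ((inclUnits F E).range.map (principal E) ⊔ (normDiv σ).range).relIndex (deltaDiv σ).ker =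
      2 * (normUnits σ).range.relIndex
        ((inclUnits F E).range ⊓ (normDiv σ).range.comap (principal E)) := by
  have hNN : ∀ x, deltaUnits σ (normUnits σ x) = 0 := fun x => by
    rw [deltaUnits_apply, normUnits_apply, map_add, h.mapUnits_mapUnits]; abel
  have hNN2 : ∀ x, normUnits σ (deltaUnits σ x) = 0 := fun x => by
    rw [deltaUnits_apply, normUnits_apply, map_sub, h.mapUnits_mapUnits]; abel
  have hNN' : ∀ x, deltaDiv σ (normDiv σ x) = 0 := fun x => by
    rw [deltaDiv_apply, normDiv_apply, map_add, h.mapDiv_mapDiv]; abel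
  have hsum : ∀ x, normUnits σ x + deltaUnits σ x = 2 • x := fun x => by
    rw [deltaUnits_apply, normUnits_apply, two_nsmul]; abel
  have hN : (principal E).comp (normUnits σ) = (normDiv σ).comp (principal E) := by
    refine AddMonoidHom.ext fun x => ?_
    rw [AddMonoidHom.comp_apply, AddMonoidHom.comp_apply, normUnits_apply, normDiv_apply, map_add,
      mapDiv_principal]
  have hδ : (principal E).comp (deltaUnits σ) = (deltaDiv σ).comp (principal E) := by
    refine AddMonoidHom.ext fun x => ?_
    rw [AddMonoidHom.comp_apply, AddMonoidHom.comp_apply, deltaUnits_apply, deltaDiv_apply, map_sub,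
      mapDiv_principal]
  have stable : ∀ (f : Additive Eˣ →+ Additive Eˣ) (f' : Div E →+ Div E),
      (principal E).comp f = f'.comp (principal E) →
      (principal E).ker.map f ≤ (principal E).ker := by
    rintro f f' hf _ ⟨x, hx, rfl⟩
    rw [AddMonoidHom.mem_ker]
    have := DFunLike.congr_fun hf x
    rw [AddMonoidHom.comp_apply, AddMonoidHom.comp_apply, (AddMonoidHom.mem_ker).1 hx,
      map_zero] at this
    exact this
  have e : (principal E).ker = (unitIncl E).range := ker_principal
  have : Module.Finite ℤ (principal E).ker := by
    rw [e]
    exact Module.Finite.of_surjective (unitIncl E).rangeRestrict.toIntLinearMap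
      (unitIncl E).rangeRestrict_surjective
  have eV : (principal E).ker ⊓ (deltaUnits σ).ker =
      ((inclUnits F E).comp (unitIncl F)).range := by
    rw [h.ker_deltaUnits]
    ext x
    constructor
    · rintro ⟨hx, y, rfl⟩
      have h0 : principal F y = 0 := pullDiv_injective (E := E) (by
        rw [pullDiv_principal, map_zero]; exact hx)
      have : y ∈ (unitIncl F).range := by rw [← ker_principal]; exact h0
      obtain ⟨u, rfl⟩ := this
      exact ⟨u, rfl⟩
    · rintro ⟨u, rfl⟩
      refine ⟨?_, unitIncl F u, rfl⟩
      have h0 : principal F (unitIncl F u) = 0 := by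
        have : unitIncl F u ∈ (principal F).ker := by rw [ker_principal]; exact ⟨u, rfl⟩
        exact this
      change principal E (inclUnits F E (unitIncl F u)) = 0
      rw [← pullDiv_principal, h0, map_zero]
  have hrank : finrank ℤ ((principal E).ker ⊓ (normUnits σ).ker : AddSubgroup _) =
      finrank ℤ ((principal E).ker ⊓ (deltaUnits σ).ker : AddSubgroup _) + 1 := by
    have r1 := finrank_eq_add_of_norm (normUnits σ) (deltaUnits σ) (principal E).ker
      (stable _ _ hN) hNN hsum
    have inj : Function.Injective ((inclUnits F E).comp (unitIncl F)) := by
      refine Function.Injective.comp (g := inclUnits F E) ?_ unitIncl_injective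
      intro x y hxy
      refine addUnits_ext ((algebraMap F E).injective ?_)
      exact congrArg (fun z : Additive Eˣ => ((z.toMul : Eˣ) : E)) hxy
    rw [eV, finrank_range_int _ inj] at r1 ⊢
    rw [e, finrank_range_int _ unitIncl_injective] at r1
    have u1 := finrank_units (E := E)
    have u2 := finrank_units (E := F)
    have u3 := Module.finrank_mul_finrank ℚ F E
    rw [h.finrank_eq_two] at u3
    rw [e]
    omega
  obtain ⟨h2, h0⟩ := herbrand_involution (normUnits σ) (deltaUnits σ) (principal E).ker
    (stable _ _ hN) (stable _ _ hδ) hsum hNN hNN2 hrank (by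
      intro x _ hx
      have : ((x.toMul : Eˣ) : E) ^ 2 = 1 :=
        congrArg (fun z : Additive Eˣ => ((z.toMul : Eˣ) : E)) hx
      rcases sq_eq_one_iff.1 this with h1 | h1
      · have : x = 0 := addUnits_ext h1
        simp [this]
      · constructor
        · refine addUnits_ext ?_
          rw [coe_normUnits, h1]; simp
        · refine addUnits_ext ?_
          rw [coe_deltaUnits, h1]; simp)
  have := ambiguous_index_formula (principal E) (normUnits σ) (deltaUnits σ) (normDiv σ)
    (deltaDiv σ) hN hδ h.ker_normUnits h.ker_normDiv (AddMonoidHom.ext hNN)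
    (AddMonoidHom.ext hNN') index_range_principal_ne_zero h2 h0
  rwa [h.ker_deltaUnits] at this

end Chevalley

end NumberField

end Quadratic

section NoField

open IsDedekindDomain HeightOneSpectrum WithZero Module

namespace NumberField

variable {F : Type*} [Field F] [NumberField F] {E : Type*} [Field E] [NumberField E] [Algebra F E]

theorem IsSqrtExt.exists_of_sq (h2 : finrank F E = 2) {θ : E} {a : F}
    (hθ : θ ^ 2 = algebraMap F E a) (ha : ¬ IsSquare a) :
    ∃ σ : E ≃ₐ[F] E, IsSqrtExt F (σ : E ≃+* E) θ a := by
  have : Algebra.IsQuadraticExtension F E := ⟨h2⟩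
  have hc : Nat.card (E ≃ₐ[F] E) = 2 := by rw [IsGalois.card_aut_eq_finrank, h2]
  have : Nontrivial (E ≃ₐ[F] E) := by
    rw [← Finite.one_lt_card_iff_nontrivial, hc]; norm_num
  obtain ⟨σ, hσ⟩ := exists_ne (1 : E ≃ₐ[F] E)
  have hall : ∀ τ : E ≃ₐ[F] E, τ = 1 ∨ τ = σ := by
    intro τ
    obtain ⟨x, y, -, hxy⟩ := Nat.card_eq_two_iff.1 hc
    have hm : ∀ ρ : E ≃ₐ[F] E, ρ = x ∨ ρ = y := fun ρ => by
      have : ρ ∈ ({x, y} : Set (E ≃ₐ[F] E)) := hxy ▸ Set.mem_univ ρ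
      simpa using this
    rcases hm 1 with h1 | h1 <;> rcases hm σ with h2 | h2 <;> rcases hm τ with h3 | h3 <;>
      simp_all
  have hmem : ∀ y : E, σ y = y → ∃ u : F, y = algebraMap F E u := by
    intro y hy
    obtain ⟨u, hu⟩ := (IsGalois.mem_range_algebraMap_iff_fixed y).2 fun τ => by
      rcases hall τ with rfl | rfl
      · rfl
      · exact hy
    exact ⟨u, hu.symm⟩
  have hθF : ∀ u : F, θ ≠ algebraMap F E u := by
    rintro u rfl
    rw [← map_pow] at hθ
    exact ha ⟨u, by rw [← pow_two]; exact ((algebraMap F E).injective hθ).symm⟩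
  have hneg : σ θ = -θ := by
    have : (σ θ) ^ 2 = θ ^ 2 := by rw [← map_pow, hθ, σ.commutes]
    rcases sq_eq_sq_iff_eq_or_eq_neg.1 this with h | h
    · obtain ⟨u, hu⟩ := hmem θ h
      exact absurd hu (hθF u)
    · exact h
  have hθ0 : θ ≠ 0 := fun h => hθF 0 (by simpa using h)
  have hinv : ∀ y, σ (σ y) = y := fun y => by
    rcases hall (σ * σ) with h | h
    · exact DFunLike.congr_fun h y
    · exact absurd (mul_eq_left.1 h) hσ
  refine ⟨σ, hθ, ha, fun y => ?_, fun u => σ.commutes u, hneg⟩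
  obtain ⟨u, hu⟩ := hmem ((y + σ y) / 2) (by
    rw [map_div₀, map_add, hinv, map_ofNat, add_comm])
  obtain ⟨v, hv⟩ := hmem ((y - σ y) / (2 * θ)) (by
    rw [map_div₀, map_sub, hinv, map_mul, map_ofNat, hneg, mul_neg, div_neg, ← neg_div, neg_sub])
  refine ⟨u, v, ?_⟩
  rw [← hu, ← hv]
  field_simp
  ring

theorem IsSqrtExt.exists_of_finrank (h2 : finrank F E = 2) :
    ∃ (σ : E ≃ₐ[F] E) (θ : E) (a : F), IsSqrtExt F (σ : E ≃+* E) θ a := by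
  have : Algebra.IsQuadraticExtension F E := ⟨h2⟩
  have hc : Nat.card (E ≃ₐ[F] E) = 2 := by rw [IsGalois.card_aut_eq_finrank, h2]
  have : Nontrivial (E ≃ₐ[F] E) := by
    rw [← Finite.one_lt_card_iff_nontrivial, hc]; norm_num
  obtain ⟨σ, hσ⟩ := exists_ne (1 : E ≃ₐ[F] E)
  have hord : σ * σ = 1 := by
    have := pow_card_eq_one' (x := σ)
    rwa [hc, pow_two] at this
  obtain ⟨y, hy⟩ : ∃ y, σ y ≠ y := by
    by_contra! h
    exact hσ (AlgEquiv.ext h)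
  have hall : ∀ τ : E ≃ₐ[F] E, τ = 1 ∨ τ = σ := by
    intro τ
    obtain ⟨x, y, -, hxy⟩ := Nat.card_eq_two_iff.1 hc
    have hm : ∀ ρ : E ≃ₐ[F] E, ρ = x ∨ ρ = y := fun ρ => by
      have : ρ ∈ ({x, y} : Set (E ≃ₐ[F] E)) := hxy ▸ Set.mem_univ ρ
      simpa using this
    rcases hm 1 with h1 | h1 <;> rcases hm σ with h2 | h2 <;> rcases hm τ with h3 | h3 <;>
      simp_all
  have hinv : ∀ y, σ (σ y) = y := fun y => DFunLike.congr_fun hord y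
  have hneg : σ (y - σ y) = -(y - σ y) := by rw [map_sub, hinv]; ring
  have hne : y - σ y ≠ 0 := sub_ne_zero.2 (Ne.symm hy)
  obtain ⟨a, ha⟩ := (IsGalois.mem_range_algebraMap_iff_fixed ((y - σ y) ^ 2)).2 fun τ => by
    rcases hall τ with rfl | rfl
    · rfl
    · rw [map_pow, hneg, neg_sq]
  have hsq : ¬ IsSquare a := by
    rintro ⟨u, rfl⟩
    rw [map_mul, ← pow_two, eq_comm] at ha
    have hfix : σ (y - σ y) = y - σ y := by
      rcases sq_eq_sq_iff_eq_or_eq_neg.1 ha with h | h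
      · rw [h, σ.commutes]
      · rw [h, map_neg, σ.commutes]
    rw [hneg] at hfix
    have : (2 : E) * (y - σ y) = 0 := by linear_combination -hfix
    exact hne ((mul_eq_zero.1 this).resolve_left two_ne_zero)
  obtain ⟨τ, hτ⟩ := IsSqrtExt.exists_of_sq h2 ha.symm hsq
  exact ⟨τ, _, a, hτ⟩

variable (F) in
/-- The group of units all of whose orders are even. -/
noncomputable def evenUnits : AddSubgroup (Additive Fˣ) := ⨅ P, evenAt F P

theorem mem_evenUnits {x : Additive Fˣ} :
    x ∈ evenUnits F ↔ ∀ P : HeightOneSpectrum (𝓞 F), Even (ord P (x.toMul : F)) := by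
  rw [evenUnits, AddSubgroup.mem_iInf]; rfl

theorem exists_two_nsmul_eq {ι : Type*} (f : ι →₀ ℤ) (h : ∀ i, Even (f i)) :
    ∃ g : ι →₀ ℤ, 2 • g = f := by
  refine ⟨f.mapRange (· / 2) (by simp), ?_⟩
  ext i
  have := (h i).two_dvd
  simp only [Finsupp.smul_apply, Finsupp.mapRange_apply, nsmul_eq_mul]
  push_cast
  omega

namespace IsSqrtExt

variable {σ : E ≃+* E} {θ : E} {a : F} (h : IsSqrtExt F σ θ a)
include h

theorem isTotallyReal [IsTotallyReal F] (ha : ∀ φ : F →+* ℝ, 0 < φ a) : IsTotallyReal E := by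
  rw [isTotallyReal_iff]
  intro v
  rw [InfinitePlace.isReal_iff, ComplexEmbedding.isReal_iff]
  set φ := v.embedding
  have hF : ComplexEmbedding.IsReal (φ.comp (algebraMap F E)) :=
    IsTotallyReal.complexEmbedding_isReal _
  have key : ∀ u : F, ((hF.embedding u : ℝ) : ℂ) = φ (algebraMap F E u) := fun u =>
    ComplexEmbedding.IsReal.coe_embedding_apply hF u
  have hθ : ∃ r : ℝ, φ θ = r := by
    have h1 : φ θ ^ 2 = ((Real.sqrt (hF.embedding a) : ℝ) : ℂ) ^ 2 := by
      rw [← map_pow, h.sq, ← key, ← Complex.ofReal_pow, Real.sq_sqrt (ha _).le]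
    rcases sq_eq_sq_iff_eq_or_eq_neg.1 h1 with h2 | h2
    · exact ⟨_, h2⟩
    · exact ⟨-Real.sqrt (hF.embedding a), by rw [h2]; push_cast; rfl⟩
  obtain ⟨r, hr⟩ := hθ
  refine RingHom.ext fun y => ?_
  obtain ⟨u, v, rfl⟩ := h.span y
  rw [ComplexEmbedding.conjugate_coe_eq, map_add, map_mul, hr, ← key, ← key, map_add, map_mul,
    Complex.conj_ofReal, Complex.conj_ofReal, Complex.conj_ofReal]

theorem ram_dvd_two (P : HeightOneSpectrum (𝓞 E)) : ram F P ∣ 2 := by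
  classical
  obtain ⟨b, hb, hbP⟩ := exists_ord_eq {P, mapPrime σ P} (fun Q => if Q = P then 1 else 0)
  have hb0 : (b : E) ≠ 0 := by simpa using hb
  obtain ⟨c, hc⟩ := h.norm_mem b
  have h1 : ord P (b : E) = 1 := by simpa using hbP P (by simp)
  have h2 : ord P ((b : E) * σ b) = ord P (b : E) + ord (mapPrime σ P) (b : E) := by
    rw [ord_mul P hb0 (by simpa using hb), ← ord_mapPrime σ P (σ b), h.apply_apply]
  have h3 := hbP (mapPrime σ P) (by simp)
  rw [hc, ord_algebraMap, h1, h3] at h2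
  have : (ram F P : ℤ) ∣ 2 := by
    refine Dvd.dvd.trans (Dvd.intro _ h2) ?_
    split_ifs
    · norm_num
    · norm_num
  exact_mod_cast this

theorem ram_eq_one (P : HeightOneSpectrum (𝓞 E)) (hP : mapPrime σ P ≠ P) : ram F P = 1 := by
  classical
  obtain ⟨b, hb, hbP⟩ := exists_ord_eq {P, mapPrime σ P} (fun Q => if Q = P then 1 else 0)
  have hb0 : (b : E) ≠ 0 := by simpa using hb
  obtain ⟨c, hc⟩ := h.norm_mem b
  have h1 : ord P (b : E) = 1 := by simpa using hbP P (by simp)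
  have h2 : ord P ((b : E) * σ b) = ord P (b : E) + ord (mapPrime σ P) (b : E) := by
    rw [ord_mul P hb0 (by simpa using hb), ← ord_mapPrime σ P (σ b), h.apply_apply]
  have h3 := hbP (mapPrime σ P) (by simp)
  rw [hc, ord_algebraMap, h1, h3, if_neg hP] at h2
  have : (ram F P : ℤ) ∣ 1 := Dvd.intro _ h2
  exact Nat.dvd_one.1 (by exact_mod_cast this)

theorem exists_pullDiv_eq (f : Div E) (hf : mapDiv σ f = f) (hr : ∀ P, (ram F P : ℤ) ∣ f P) :
    ∃ g : Div F, pullDiv F E g = f := by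
  refine NumberField.exists_pullDiv_eq f (fun P Q hPQ => ?_) hr
  rcases (h.under_eq_iff P Q).1 hPQ with rfl | rfl
  · rfl
  · rw [ram_mapPrime σ h.fix, ← h.mapDiv_apply, hf]

theorem normDiv_pullDiv (g : Div F) : normDiv σ (pullDiv F E g) = 2 • pullDiv F E g := by
  rw [normDiv_apply, mapDiv_pullDiv σ h.fix, two_nsmul]

/-- If every extended divisor is a norm up to principal divisors from `F`, then the everywhere even
elements cannot have independent square classes at the ramified primes. -/
theorem relIndex_evenUnits_lt [IsTotallyReal F] [IsTotallyReal E]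
    (T : Finset (HeightOneSpectrum (𝓞 F)))
    (hram : ∀ P : HeightOneSpectrum (𝓞 E), P.under (𝓞 F) ∉ T → ram F P = 1)
    (hT : ∀ t ∈ T, ¬ Even (ord t a))
    (hsplit : ∀ g : Div F, pullDiv F E g ∈
      (inclUnits F E).range.map (principal E) ⊔ (normDiv σ).range) :
    (⨅ t ∈ T, squareAt F t).relIndex (evenUnits F) < 2 ^ T.card := by
  classical
  choose q hq using under_surjective (F := F) (E := E)
  have hA := chevalley h
  set H := (inclUnits F E).range.map (principal E) ⊔ (normDiv σ).range with hH
  obtain ⟨n0, hle⟩ := AddSubgroup.relIndex_le_card_of_label H (deltaDiv σ).ker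
    (fun f => fun t : T => ((f (q t) : ℤ) : ZMod 2)) (by
      intro f hf g hg hfg
      rw [AddMonoidHom.mem_ker, deltaDiv_apply, sub_eq_zero] at hf hg
      obtain ⟨k, hk⟩ := h.exists_pullDiv_eq (f - g) (by rw [map_sub, ← hf, ← hg]) (by
        intro P
        by_cases hP : P.under (𝓞 F) ∈ T
        · have h1 := congrFun hfg ⟨_, hP⟩
          simp only at h1
          have h2 : (2 : ℤ) ∣ (f - g) (q (P.under (𝓞 F))) := by
            refine (ZMod.intCast_zmod_eq_zero_iff_dvd _ 2).1 ?_
            rw [Finsupp.sub_apply, Int.cast_sub, h1, sub_self]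
          have h3 : (f - g) (q (P.under (𝓞 F))) = (f - g) P := by
            rcases (h.under_eq_iff P _).1 (hq (P.under (𝓞 F))).symm with e | e
            · rw [e]
            · rw [e, ← h.mapDiv_apply, map_sub, ← hf, ← hg]
          rw [← h3]
          exact Dvd.dvd.trans (by exact_mod_cast h.ram_dvd_two P) h2
        · rw [hram P hP]; simp)
      rw [← hk]
      exact hsplit k)
  rw [hA] at hle n0
  have hcard : Nat.card (T → ZMod 2) = 2 ^ T.card := by
    rw [Nat.card_fun]; simp
  rw [hcard] at hle
  set Θ := (normUnits σ).range.relIndex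
        ((inclUnits F E).range ⊓ (normDiv σ).range.comap (principal E)) with hΘ
  have hsub : (evenUnits F).map (inclUnits F E) ≤
      (inclUnits F E).range ⊓ (normDiv σ).range.comap (principal E) := by
    rintro _ ⟨y, hy, rfl⟩
    refine ⟨⟨y, rfl⟩, ?_⟩
    obtain ⟨g, hg⟩ := exists_two_nsmul_eq (principal F y) (mem_evenUnits.1 hy)
    refine ⟨pullDiv F E g, ?_⟩
    rw [h.normDiv_pullDiv, ← map_nsmul, hg, pullDiv_principal]
  have hΘ0 : Θ ≠ 0 := by omega
  have h1 : (normUnits σ).range.relIndex ((evenUnits F).map (inclUnits F E)) ≤ Θ :=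
    AddSubgroup.relIndex_le_of_le_right hsub hΘ0
  have h10 : (normUnits σ).range.relIndex ((evenUnits F).map (inclUnits F E)) ≠ 0 := fun h0 =>
    hΘ0 (AddSubgroup.relIndex_eq_zero_of_le_right hsub h0)
  rw [← AddSubgroup.relIndex_comap] at h1 h10
  have h2 : (normUnits σ).range.comap (inclUnits F E) ⊓ evenUnits F ≤ ⨅ t ∈ T, squareAt F t := by
    rintro y ⟨⟨z, hz⟩, hy⟩
    simp only [AddSubgroup.mem_iInf]
    intro t ht
    have hz := congrArg (fun z : Additive Eˣ => ((z.toMul : Eˣ) : E)) hz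
    simp only [coe_normUnits, coe_inclUnits] at hz
    obtain ⟨u, v, huv⟩ := h.span (z.toMul : E)
    refine isSquareMod_of_eq_sq_sub t (x := a) (y := u) (z := v) h.ne_zero (Units.ne_zero _) ?_
      (hT t ht) (mem_evenUnits.1 hy t)
    apply (algebraMap F E).injective
    rw [← hz, huv, map_add, map_mul, h.fix, h.fix, h.neg, map_sub, map_mul, map_pow, map_pow,
      ← h.sq]
    ring
  rw [← AddSubgroup.inf_relIndex_right] at h1 h10
  have h3 := AddSubgroup.relIndex_le_of_le_left h2 h10
  omega

end IsSqrtExt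

end NumberField

end NoField

section Unramified

open IsDedekindDomain HeightOneSpectrum WithZero Module

namespace NumberField

variable {F : Type*} [Field F] [NumberField F] {E : Type*} [Field E] [NumberField E] [Algebra F E]

theorem mem_dual_one_iff (y : E) :
    y ∈ FractionalIdeal.dual (𝓞 F) F (1 : FractionalIdeal (nonZeroDivisors (𝓞 E)) E) ↔
      ∀ c : 𝓞 E, IsIntegral ℤ (Algebra.trace F E (y * c)) := by
  rw [FractionalIdeal.mem_dual (one_ne_zero' (FractionalIdeal (nonZeroDivisors (𝓞 E)) E))]
  constructor
  · intro h c
    obtain ⟨x, hx⟩ := h c ((FractionalIdeal.mem_one_iff _).2 ⟨c, rfl⟩)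
    rw [Algebra.traceForm_apply] at hx
    rw [← hx]
    exact x.2
  · intro h c hc
    obtain ⟨c, rfl⟩ := (FractionalIdeal.mem_one_iff _).1 hc
    exact ⟨⟨_, h c⟩, rfl⟩

theorem mem_differentIdeal_of_forall {b : 𝓞 E}
    (hb : ∀ y : E, (∀ c : 𝓞 E, IsIntegral ℤ (Algebra.trace F E (y * c))) → IsIntegral ℤ (b * y)) :
    b ∈ differentIdeal (𝓞 F) (𝓞 E) := by
  have h : (algebraMap (𝓞 E) E b) ∈ (differentIdeal (𝓞 F) (𝓞 E) : FractionalIdeal (nonZeroDivisors (𝓞 E)) E) := by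
    rw [coeIdeal_differentIdeal (𝓞 F) F, FractionalIdeal.mem_inv_iff (FractionalIdeal.dual_ne_zero _ _ (one_ne_zero' (FractionalIdeal (nonZeroDivisors (𝓞 E)) E)))]
    intro y hy
    rw [mem_dual_one_iff] at hy
    exact (FractionalIdeal.mem_one_iff _).2 ⟨⟨_, hb y hy⟩, rfl⟩
  obtain ⟨c, hc, hcb⟩ := (FractionalIdeal.mem_coeIdeal _).1 h
  rwa [← RingOfIntegers.ext hcb]

theorem IsSqrtExt.trace_eq {σ : E ≃+* E} {θ : E} {a : F} (h : IsSqrtExt F σ θ a) (y : E) :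
    algebraMap F E (Algebra.trace F E y) = y + σ y := by
  classical
  have : Algebra.IsQuadraticExtension F E := ⟨h.finrank_eq_two⟩
  have hc : Nat.card (E ≃ₐ[F] E) = 2 := by rw [IsGalois.card_aut_eq_finrank, h.finrank_eq_two]
  let τ : E ≃ₐ[F] E := AlgEquiv.ofRingEquiv (f := σ) h.fix
  have hτ : τ ≠ 1 := fun h1 => h.ne_one (RingEquiv.ext fun x => by
    simpa [τ] using congrArg (fun f : E ≃ₐ[F] E => f x) h1)
  have hu : (Finset.univ : Finset (E ≃ₐ[F] E)) = {1, τ} := by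
    symm
    apply Finset.eq_univ_of_card
    rw [Finset.card_pair hτ.symm, ← Nat.card_eq_fintype_card, hc]
  rw [trace_eq_sum_automorphisms, hu, Finset.sum_pair hτ.symm]
  rfl

theorem IsSqrtExt.sub_mem_differentIdeal {σ : E ≃+* E} {θ : E} {a : F} (h : IsSqrtExt F σ θ a)
    (α β : 𝓞 E) (hβ : (β : E) = α - σ α) : β ∈ differentIdeal (𝓞 F) (𝓞 E) := by
  refine mem_differentIdeal_of_forall (F := F) fun y hy => ?_
  have h1 := (hy α).algebraMap (B := E)
  have h2 := (hy 1).algebraMap (B := E)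
  have h3 : IsIntegral ℤ (σ α) := α.2.map σ.toRingHom.toIntAlgHom
  rw [h.trace_eq] at h1 h2
  have : (β : E) * y = (y * α + σ (y * α)) - σ α * (y * (1 : 𝓞 E) + σ (y * (1 : 𝓞 E))) := by
    rw [hβ]
    simp only [map_mul, map_one, mul_one]
    ring
  rw [this]
  exact h1.sub (h3.mul h2)

theorem ram_eq_one_of_not_le {P : HeightOneSpectrum (𝓞 E)}
    (h : ¬ differentIdeal (𝓞 F) (𝓞 E) ≤ P.asIdeal) : ram F P = 1 := by
  rw [← Ideal.dvd_iff_le, not_dvd_differentIdeal_iff] at h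
  rw [ram, Ideal.ramificationIdx'_eq_ramificationIdx _ _ (P.under (𝓞 F)).ne_bot]
  exact Ideal.ramificationIdx_eq_one_iff.2 h

variable (F E) in
/-- `E / F` is unramified at all finite primes. -/
def Unramified : Prop := differentIdeal (𝓞 F) (𝓞 E) = ⊤

theorem Unramified.ram_eq_one (h : Unramified F E) (P : HeightOneSpectrum (𝓞 E)) : ram F P = 1 := by
  refine ram_eq_one_of_not_le ?_
  rw [h, top_le_iff]
  exact P.isPrime.ne_top

theorem unramified_of_forall (h : ∀ P : HeightOneSpectrum (𝓞 E), ¬ differentIdeal (𝓞 F) (𝓞 E) ≤ P.asIdeal) :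
    Unramified F E := by
  by_contra hne
  obtain ⟨M, hM, hle⟩ := Ideal.exists_le_maximal _ hne
  exact h ⟨M, hM.isPrime, fun h0 => differentIdeal_ne_bot (A := 𝓞 F) (B := 𝓞 E) (le_bot_iff.1 (h0 ▸ hle))⟩ hle

/-- A quadratic extension `F(√a)` is unramified at odd primes where `a` has even order. -/
theorem IsSqrtExt.not_le_of_even {σ : E ≃+* E} {θ : E} {a : F} (h : IsSqrtExt F σ θ a)
    {P : HeightOneSpectrum (𝓞 E)} (h2 : (2 : 𝓞 E) ∉ P.asIdeal) (ha : Even (ord (P.under (𝓞 F)) a)) :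
    ¬ differentIdeal (𝓞 F) (𝓞 E) ≤ P.asIdeal := by
  obtain ⟨z, hz, r, hr, hrP⟩ := exists_integral_unit_on h.ne_zero {P.under (𝓞 F)} (by simpa using ha)
  replace hrP := hrP _ (Finset.mem_singleton_self _)
  have hsq : (θ * algebraMap F E z) ^ 2 = algebraMap F E r := by
    rw [mul_pow, h.sq, ← map_pow, ← map_mul, hr]
  have hInt : IsIntegral ℤ (θ * algebraMap F E z) :=
    IsIntegral.of_pow two_pos (by rw [hsq]; exact r.2.algebraMap)
  let α : 𝓞 E := ⟨_, hInt⟩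
  have hα2 : α ^ 2 = algebraMap (𝓞 F) (𝓞 E) r := RingOfIntegers.ext hsq
  intro hle
  have hmem := hle (h.sub_mem_differentIdeal α (2 * α) (by
    change _ = θ * algebraMap F E z - σ (θ * algebraMap F E z)
    have h22 : ((2 * α : 𝓞 E) : E) = 2 * (θ * algebraMap F E z) := by
      rw [← coe_two (F := E)]
      exact map_mul (algebraMap (𝓞 E) E) 2 α
    rw [h22, map_mul, h.neg, h.fix]
    ring))
  have hα := (P.isPrime.mem_or_mem hmem).resolve_left h2
  have := P.asIdeal.pow_mem_of_mem hα 2 two_pos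
  rw [hα2] at this
  exact hrP this

/-- A quadratic extension `F(√a)` is unramified above two if `a` is a square modulo four. -/
theorem IsSqrtExt.not_le_of_squareAtTwo {σ : E ≃+* E} {θ : E} {a : F} (h : IsSqrtExt F σ θ a)
    {P : HeightOneSpectrum (𝓞 E)} (h2 : (2 : 𝓞 E) ∈ P.asIdeal)
    (ha : IsSquareMod (Ideal.span {(2 : 𝓞 F)}) (Ideal.span {4}) a) :
    ¬ differentIdeal (𝓞 F) (𝓞 E) ≤ P.asIdeal := by
  obtain ⟨z, hz, r, w, hr, hc, hw⟩ := ha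
  obtain ⟨k, hk⟩ := Ideal.mem_span_singleton.1 hw
  have hrP : r ∉ (P.under (𝓞 F)).asIdeal := by
    rw [← isCoprime_span_iff_not_mem]
    refine hc.of_isCoprime_of_dvd_right (Ideal.dvd_iff_le.2 ?_)
    rw [Ideal.span_singleton_le_iff_mem]
    change algebraMap (𝓞 F) (𝓞 E) 2 ∈ P.asIdeal
    rwa [map_ofNat]
  have hsq : (θ * algebraMap F E z) ^ 2 = algebraMap F E r := by
    rw [mul_pow, h.sq, ← map_pow, ← map_mul, hr]
  have hkF : (r : F) - (w : F) ^ 2 = 4 * (k : F) := by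
    have := congrArg (algebraMap (𝓞 F) F) hk
    rw [map_sub, map_mul, map_pow, map_ofNat] at this
    exact this
  have hkE : algebraMap F E r - (algebraMap F E w) ^ 2 = 4 * algebraMap F E k := by
    have := congrArg (algebraMap F E) hkF
    rw [map_sub, map_mul, map_pow, map_ofNat] at this
    exact this
  have hwE : IsIntegral ℤ (algebraMap F E w) := w.2.algebraMap
  have hkE' : IsIntegral ℤ (algebraMap F E k) := k.2.algebraMap
  set t := θ * algebraMap F E z with ht
  have hInt : IsIntegral ℤ ((algebraMap F E w + t) / 2) := by
    have hrel : ((algebraMap F E w + t) / 2) ^ 2 - algebraMap F E w * ((algebraMap F E w + t) / 2)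
        = algebraMap F E k := by
      linear_combination (1/4 : E) * hsq + (1/4 : E) * hkE
    refine isIntegral_trans (A := 𝓞 F) (R := ℤ) _ ⟨Polynomial.X ^ 2 - (Polynomial.C w * Polynomial.X + Polynomial.C k), ?_, ?_⟩
    · refine Polynomial.monic_X_pow_sub ?_
      exact lt_of_le_of_lt Polynomial.degree_linear_le (by norm_num)
    · simp only [Polynomial.eval₂_sub, Polynomial.eval₂_pow, Polynomial.eval₂_X, Polynomial.eval₂_add,
        Polynomial.eval₂_mul, Polynomial.eval₂_C]
      change _ ^ 2 - (algebraMap F E w * _ + algebraMap F E k) = 0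
      linear_combination hrel
  let α : 𝓞 E := ⟨_, hInt⟩
  have hInt' : IsIntegral ℤ t :=
    IsIntegral.of_pow two_pos (by rw [hsq]; exact r.2.algebraMap)
  let β : 𝓞 E := ⟨_, hInt'⟩
  have hβ2 : β ^ 2 = algebraMap (𝓞 F) (𝓞 E) r := RingOfIntegers.ext hsq
  intro hle
  have hmem := hle (h.sub_mem_differentIdeal α β (by
    change t = (algebraMap F E w + t) / 2 - σ ((algebraMap F E w + t) / 2)
    have : σ t = - t := by rw [ht, map_mul, h.neg, h.fix]; ring
    rw [map_div₀, map_add, this, h.fix, map_ofNat]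
    ring))
  have := P.asIdeal.pow_mem_of_mem hmem 2 two_pos
  rw [hβ2] at this
  exact hrP this

theorem IsSqrtExt.ram_eq_one_of_even {σ : E ≃+* E} {θ : E} {a : F} (h : IsSqrtExt F σ θ a)
    (P : HeightOneSpectrum (𝓞 E)) (ha : Even (ord (P.under (𝓞 F)) a))
    (h2 : IsSquareMod (Ideal.span {(2 : 𝓞 F)}) (Ideal.span {4}) a) : ram F P = 1 := by
  by_cases hP : (2 : 𝓞 E) ∈ P.asIdeal
  · exact ram_eq_one_of_not_le (h.not_le_of_squareAtTwo hP h2)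
  · exact ram_eq_one_of_not_le (h.not_le_of_even hP ha)

theorem IsSqrtExt.unramified {σ : E ≃+* E} {θ : E} {a : F} (h : IsSqrtExt F σ θ a)
    (ha : ∀ p, Even (ord p a))
    (h2 : IsSquareMod (Ideal.span {(2 : 𝓞 F)}) (Ideal.span {4}) a) : Unramified F E := by
  refine unramified_of_forall fun P => ?_
  by_cases hP : (2 : 𝓞 E) ∈ P.asIdeal
  · exact h.not_le_of_squareAtTwo hP h2
  · exact h.not_le_of_even hP (ha _)

theorem Unramified.twoUnramified (h : Unramified F E) (hF : TwoUnramified F) : TwoUnramified E := by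
  intro P
  have := ord_algebraMap (F := F) P 2
  rw [h.ram_eq_one, map_ofNat] at this
  rw [this]
  simpa using hF _

theorem Unramified.natAbs_discr (h : Unramified F E) :
    (discr E).natAbs = (discr F).natAbs ^ finrank F E := by
  rw [natAbs_discr_eq_absNorm_differentIdeal_mul_natAbs_discr_pow F (𝓞 F) E (𝓞 E), h]
  simp

theorem Unramified.isIntegral (h : Unramified F E) (y : E)
    (hy : ∀ c : 𝓞 E, IsIntegral ℤ (Algebra.trace F E (y * c))) : IsIntegral ℤ y := by
  rw [← mem_dual_one_iff] at hy
  have h1 := coeIdeal_differentIdeal (𝓞 F) F E (𝓞 E)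
  rw [h, FractionalIdeal.coeIdeal_top, eq_comm, inv_eq_one] at h1
  rw [h1] at hy
  obtain ⟨c, rfl⟩ := (FractionalIdeal.mem_one_iff _).1 hy
  exact c.2

theorem Unramified.exists_trace_eq_one (h : Unramified F E) :
    ∃ c : 𝓞 E, Algebra.trace F E (c : E) = 1 := by
  have hInt (c : 𝓞 E) : Algebra.trace F E (c : E) = (Algebra.intTrace (𝓞 F) (𝓞 E) c : 𝓞 F) :=
    (Algebra.algebraMap_intTrace (A := 𝓞 F) (K := F) (L := E) (B := 𝓞 E) c).symm
  by_contra! hne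
  set I : Ideal (𝓞 F) := LinearMap.range (Algebra.intTrace (𝓞 F) (𝓞 E)) with hI
  have hI1 : I ≠ ⊤ := by
    intro h1
    have : (1 : 𝓞 F) ∈ I := h1 ▸ Submodule.mem_top
    obtain ⟨c, hc⟩ := this
    exact hne c (by rw [hInt, hc]; exact map_one (algebraMap (𝓞 F) F))
  obtain ⟨M, hM, hle⟩ := Ideal.exists_le_maximal _ hI1
  have hMbot : M ≠ ⊥ := by
    intro h0
    have : Algebra.intTrace (𝓞 F) (𝓞 E) 1 ∈ M := hle ⟨1, rfl⟩
    rw [h0, Ideal.mem_bot] at this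
    have h2 := hInt 1
    rw [this, show ((1 : 𝓞 E) : E) = 1 from map_one (algebraMap (𝓞 E) E), ← map_one (algebraMap F E),
      Algebra.trace_algebraMap,
      show ((0 : 𝓞 F) : F) = 0 from map_zero (algebraMap (𝓞 F) F)] at h2
    rw [nsmul_one] at h2
    exact (finrank_pos (R := F) (M := E)).ne' (by exact_mod_cast h2)
  obtain ⟨x, hx, hx1⟩ := FractionalIdeal.exists_notMem_one_of_ne_bot (K := F) hMbot hM.ne_top
  refine hx1 ?_
  have hxint : IsIntegral ℤ (algebraMap F E x) := by
    refine h.isIntegral _ fun c => ?_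
    rw [← Algebra.smul_def, map_smul, smul_eq_mul, hInt]
    obtain ⟨y, hy⟩ := (FractionalIdeal.mem_one_iff _).1
      ((FractionalIdeal.mem_inv_iff (by simpa using hMbot)).1 hx _
        ((FractionalIdeal.mem_coeIdeal _).2 ⟨_, hle ⟨c, rfl⟩, rfl⟩))
    rw [← hy]
    exact y.2
  rw [isIntegral_algebraMap_iff (algebraMap F E).injective] at hxint
  exact (FractionalIdeal.mem_one_iff _).2 ⟨⟨x, hxint⟩, rfl⟩

variable {M : Type*} [Field M] [NumberField M] [Algebra F M] [Algebra M E] [IsScalarTower F M E]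

theorem unramified_trans_iff : Unramified F E ↔ Unramified F M ∧ Unramified M E := by
  unfold Unramified
  rw [differentIdeal_eq_differentIdeal_mul_differentIdeal (𝓞 F) (𝓞 M) (𝓞 E)]
  constructor
  · intro h
    refine ⟨?_, top_le_iff.1 (h.symm.le.trans Ideal.mul_le_left)⟩
    by_contra hne
    obtain ⟨Q, hQ, hle⟩ := Ideal.exists_le_maximal _ hne
    obtain ⟨P, hP⟩ := under_surjective (F := M) (E := E)
      ⟨Q, hQ.isPrime, fun h0 => differentIdeal_ne_bot (A := 𝓞 F) (B := 𝓞 M) (le_bot_iff.1 (h0 ▸ hle))⟩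
    refine P.isPrime.ne_top (top_le_iff.1 ?_)
    rw [← h]
    refine Ideal.mul_le_right.trans (Ideal.map_le_iff_le_comap.2 (hle.trans ?_))
    have := congrArg HeightOneSpectrum.asIdeal hP
    exact this.symm.le
  · rintro ⟨h1, h2⟩
    rw [h1, h2, Ideal.map_top, Ideal.mul_top]

end NumberField
end Unramified

section ExistsSqrt

open IsDedekindDomain HeightOneSpectrum WithZero Module

namespace NumberField

theorem exists_isSqrtExt.{u} {F : Type u} [Field F] [NumberField F] {a : F} (ha : ¬ IsSquare a) :
    ∃ (E : Type u) (_ : Field E) (_ : NumberField E) (_ : Algebra F E) (σ : E ≃+* E) (θ : E),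
      IsSqrtExt F σ θ a := by
  have hirr : Irreducible (Polynomial.X ^ 2 - Polynomial.C a) :=
    X_pow_sub_C_irreducible_of_prime Nat.prime_two fun b hb => ha ⟨b, by rw [← hb, pow_two]⟩
  have hne : (Polynomial.X ^ 2 - Polynomial.C a) ≠ 0 := hirr.ne_zero
  have := Fact.mk hirr
  have : Module.Finite F (AdjoinRoot (Polynomial.X ^ 2 - Polynomial.C a)) :=
    (AdjoinRoot.powerBasis hne).finite
  have := NumberField.of_module_finite F (AdjoinRoot (Polynomial.X ^ 2 - Polynomial.C a))
  have h2 : finrank F (AdjoinRoot (Polynomial.X ^ 2 - Polynomial.C a)) = 2 := by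
    rw [(AdjoinRoot.powerBasis hne).finrank, AdjoinRoot.powerBasis_dim]
    compute_degree!
  have hθ : (AdjoinRoot.root (Polynomial.X ^ 2 - Polynomial.C a)) ^ 2 = algebraMap F _ a := by
    have := AdjoinRoot.eval₂_root (Polynomial.X ^ 2 - Polynomial.C a)
    simp only [Polynomial.eval₂_sub, Polynomial.eval₂_pow, Polynomial.eval₂_X, Polynomial.eval₂_C] at this
    exact sub_eq_zero.1 this
  obtain ⟨σ, hσ⟩ := IsSqrtExt.exists_of_sq h2 hθ ha
  exact ⟨_, _, inferInstance, _, _, _, hσ⟩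

end NumberField
end ExistsSqrt

section IdealSums

open IsDedekindDomain HeightOneSpectrum Module Filter Topology

namespace NumberField

variable {F : Type*} [Field F] [NumberField F] {E : Type*} [Field E] [NumberField E]

/-- The weight `N(I) ^ (-s)` of an ideal. -/
noncomputable def idealWeight (s : ℝ) (I : Ideal (𝓞 E)) : ENNReal :=
  ENNReal.ofReal ((Ideal.absNorm I : ℝ) ^ (-s))

open Classical in
variable (E) in
/-- The partial Dedekind zeta function, over the ideals prime to `W`. -/
noncomputable def idealSum (W : Finset (HeightOneSpectrum (𝓞 E))) (s : ℝ) : ENNReal :=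
  ∑' I : Ideal (𝓞 E), if ∀ P ∈ W, ¬ I ≤ P.asIdeal then idealWeight s I else 0

theorem idealSum_empty_eq_tsum (s : ℝ) :
    idealSum E ∅ s = ∑' n : ℕ, ENNReal.ofReal
      ((Nat.card {I : Ideal (𝓞 E) // Ideal.absNorm I = n} : ℝ) * (n : ℝ) ^ (-s)) := by
  unfold idealSum
  rw [← (Equiv.sigmaFiberEquiv (Ideal.absNorm (S := 𝓞 E))).tsum_eq, ENNReal.tsum_sigma']
  refine tsum_congr fun n => ?_
  have : Finite {I : Ideal (𝓞 E) // Ideal.absNorm I = n} := Ideal.finite_setOfPred_absNorm_eq n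
  have : ∀ I : {I : Ideal (𝓞 E) // Ideal.absNorm I = n},
      idealWeight s I.1 = ENNReal.ofReal ((n : ℝ) ^ (-s)) := fun I => by
    rw [idealWeight, I.2]
  simp only [Finset.notMem_empty, false_imp_iff, implies_true, if_true, Equiv.sigmaFiberEquiv_apply, this]
  rw [ENNReal.tsum_const, ENNReal.ofReal_mul (Nat.cast_nonneg _), ENNReal.ofReal_natCast,
    ENat.card_eq_coe_natCard]
  rfl

theorem idealSum_empty_eq {s : ℝ} (hs : 1 < s) (h0 : dedekindZeta E s ≠ 0) :
    ∃ L : ℝ, 0 ≤ L ∧ dedekindZeta E s = L ∧ idealSum E ∅ s = ENNReal.ofReal L := by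
  have hsum : LSeriesSummable (fun n => ((Nat.card {I : Ideal (𝓞 E) // Ideal.absNorm I = n} : ℕ) : ℂ)) s := by
    by_contra h
    exact h0 (LSeries.eq_zero_of_not_LSeriesSummable _ _ h)
  have hterm : ∀ n : ℕ, LSeries.term (fun n => ((Nat.card {I : Ideal (𝓞 E) // Ideal.absNorm I = n} : ℕ) : ℂ)) s n =
      (((Nat.card {I : Ideal (𝓞 E) // Ideal.absNorm I = n} : ℝ) * (n : ℝ) ^ (-s) : ℝ) : ℂ) := by
    intro n
    rcases Nat.eq_zero_or_pos n with rfl | hn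
    · simp [Real.zero_rpow (by linarith : -s ≠ 0)]
    · rw [LSeries.term_of_ne_zero hn.ne', Real.rpow_neg (Nat.cast_nonneg _), Complex.ofReal_mul,
        Complex.ofReal_inv, Complex.ofReal_cpow (Nat.cast_nonneg _)]
      simp [div_eq_mul_inv]
  have h2 : Summable fun n : ℕ => (Nat.card {I : Ideal (𝓞 E) // Ideal.absNorm I = n} : ℝ) * (n : ℝ) ^ (-s) :=
    Complex.summable_ofReal.1 (hsum.congr fun n => (hterm n))
  have hnn : ∀ n : ℕ, 0 ≤ (Nat.card {I : Ideal (𝓞 E) // Ideal.absNorm I = n} : ℝ) * (n : ℝ) ^ (-s) :=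
    fun n => by positivity
  refine ⟨∑' n : ℕ, (Nat.card {I : Ideal (𝓞 E) // Ideal.absNorm I = n} : ℝ) * (n : ℝ) ^ (-s), tsum_nonneg hnn, ?_, ?_⟩
  · rw [dedekindZeta, LSeries, Complex.ofReal_tsum]
    exact tsum_congr hterm
  · rw [idealSum_empty_eq_tsum, ENNReal.ofReal_tsum_of_nonneg hnn h2]

theorem tendsto_idealSum_empty :
    ∃ κ : ℝ, 0 < κ ∧ (∀ᶠ s in 𝓝[>] (1 : ℝ), idealSum E ∅ s ≠ ⊤) ∧
      Tendsto (fun s : ℝ => (s - 1) * (idealSum E ∅ s).toReal) (𝓝[>] 1) (𝓝 κ) := by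
  have ht := tendsto_sub_one_mul_dedekindZeta_nhdsGT E
  have hne : ∀ᶠ s : ℝ in 𝓝[>] (1 : ℝ), ((s : ℂ) - 1) * dedekindZeta E s ≠ 0 :=
    ht.eventually_ne (Complex.ofReal_ne_zero.2 (dedekindZeta_residue_ne_zero E))
  refine ⟨_, dedekindZeta_residue_pos E, ?_, ?_⟩
  · filter_upwards [hne, self_mem_nhdsWithin] with s hs h1
    obtain ⟨L, -, -, h⟩ := idealSum_empty_eq h1 (right_ne_zero_of_mul hs)
    rw [h]
    exact ENNReal.ofReal_ne_top
  · have h3 := (Complex.continuous_re.tendsto _).comp ht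
    rw [Complex.ofReal_re] at h3
    refine h3.congr' ?_
    filter_upwards [hne, self_mem_nhdsWithin] with s hs h1
    obtain ⟨L, hL, hz, h⟩ := idealSum_empty_eq h1 (right_ne_zero_of_mul hs)
    rw [h, ENNReal.toReal_ofReal hL, Function.comp_apply, hz, ← Complex.ofReal_one,
      ← Complex.ofReal_sub, ← Complex.ofReal_mul, Complex.ofReal_re]

theorem idealWeight_mul (s : ℝ) (I J : Ideal (𝓞 E)) :
    idealWeight s (I * J) = idealWeight s I * idealWeight s J := by
  unfold idealWeight
  rw [map_mul, Nat.cast_mul, Real.mul_rpow (Nat.cast_nonneg _) (Nat.cast_nonneg _),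
    ENNReal.ofReal_mul (by positivity)]

theorem idealWeight_bot {s : ℝ} (hs : s ≠ 0) : idealWeight s (⊥ : Ideal (𝓞 E)) = 0 := by
  simp [idealWeight, Real.zero_rpow (neg_ne_zero.2 hs)]

theorem idealWeight_le_of_absNorm_le {s : ℝ} (hs : 0 ≤ s) {I : Ideal (𝓞 E)} {J : Ideal (𝓞 F)} (hI : I ≠ ⊥)
    (h : Ideal.absNorm I ≤ Ideal.absNorm J) : idealWeight s J ≤ idealWeight s I := by
  unfold idealWeight
  refine ENNReal.ofReal_le_ofReal ?_
  refine Real.rpow_le_rpow_of_nonpos ?_ (by exact_mod_cast h) (by linarith)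
  exact_mod_cast Nat.pos_of_ne_zero (fun h0 => hI (Ideal.absNorm_eq_zero_iff.1 h0))

theorem idealWeight_prime_le {s : ℝ} (hs : 1 ≤ s) (P : HeightOneSpectrum (𝓞 E)) :
    idealWeight s P.asIdeal ≤ 2⁻¹ := by
  have h2 : 2 ≤ Ideal.absNorm P.asIdeal := by
    have h0 : Ideal.absNorm P.asIdeal ≠ 0 := fun h => P.ne_bot (Ideal.absNorm_eq_zero_iff.1 h)
    have h1 : Ideal.absNorm P.asIdeal ≠ 1 := fun h => P.isPrime.ne_top (Ideal.absNorm_eq_one_iff.1 h)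
    omega
  unfold idealWeight
  rw [show (2⁻¹ : ENNReal) = ENNReal.ofReal ((2 : ℝ)⁻¹) by
    rw [ENNReal.ofReal_inv_of_pos two_pos]; simp]
  refine ENNReal.ofReal_le_ofReal ?_
  rw [Real.rpow_neg (Nat.cast_nonneg _)]
  refine inv_anti₀ two_pos ?_
  have : (2 : ℝ) ≤ Ideal.absNorm P.asIdeal := by exact_mod_cast h2
  calc (2 : ℝ) ≤ (Ideal.absNorm P.asIdeal : ℝ) ^ (1 : ℝ) := by rwa [Real.rpow_one]
    _ ≤ _ := Real.rpow_le_rpow_of_exponent_le (by linarith) hs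

theorem idealSum_le_add [DecidableEq (HeightOneSpectrum (𝓞 E))] (W : Finset (HeightOneSpectrum (𝓞 E)))
    (P : HeightOneSpectrum (𝓞 E)) (s : ℝ) :
    idealSum E W s ≤ idealSum E (insert P W) s + idealWeight s P.asIdeal * idealSum E W s := by
  classical
  have key : ∀ I : Ideal (𝓞 E), (if ∀ Q ∈ W, ¬ I ≤ Q.asIdeal then idealWeight s I else 0) ≤
      (if ∀ Q ∈ insert P W, ¬ I ≤ Q.asIdeal then idealWeight s I else 0) +
      (if (∀ Q ∈ W, ¬ I ≤ Q.asIdeal) ∧ I ≤ P.asIdeal then idealWeight s I else 0) := by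
    intro I
    by_cases h1 : ∀ Q ∈ W, ¬ I ≤ Q.asIdeal
    · by_cases h2 : I ≤ P.asIdeal
      · rw [if_pos h1, if_pos (⟨h1, h2⟩ : _ ∧ _)]; exact le_add_self
      · rw [if_pos h1, if_pos (show ∀ Q ∈ insert P W, ¬ I ≤ Q.asIdeal from (Finset.forall_mem_insert _ _ _).2 ⟨h2, h1⟩)]; exact le_self_add
    · rw [if_neg h1]; exact zero_le
  have h2 : (∑' I : Ideal (𝓞 E), if (∀ Q ∈ W, ¬ I ≤ Q.asIdeal) ∧ I ≤ P.asIdeal then idealWeight s I else 0) ≤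
      idealWeight s P.asIdeal * idealSum E W s := by
    unfold idealSum
    rw [← ENNReal.tsum_mul_left]
    have hinj : Function.Injective fun J : Ideal (𝓞 E) => P.asIdeal * J := fun J J' h =>
      mul_left_cancel₀ P.ne_bot h
    rw [← hinj.tsum_eq]
    · refine ENNReal.tsum_le_tsum fun J => ?_
      by_cases h : (∀ Q ∈ W, ¬ P.asIdeal * J ≤ Q.asIdeal) ∧ P.asIdeal * J ≤ P.asIdeal
      · rw [if_pos h, if_pos (show ∀ Q ∈ W, ¬ J ≤ Q.asIdeal from fun Q hQ hJ =>
          h.1 Q hQ (Ideal.mul_le_right.trans hJ)), idealWeight_mul]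
      · rw [if_neg h]; exact zero_le
    · intro I hI
      have : I ≤ P.asIdeal := by
        by_contra h
        exact hI (if_neg fun h' => h h'.2)
      obtain ⟨J, rfl⟩ := Ideal.dvd_iff_le.2 this
      exact ⟨J, rfl⟩
  calc idealSum E W s ≤ ∑' I : Ideal (𝓞 E), _ := ENNReal.tsum_le_tsum key
    _ = _ := ENNReal.tsum_add
    _ ≤ _ := add_le_add (by unfold idealSum; exact (tsum_congr fun I => by congr).le) h2

theorem idealSum_empty_le (W : Finset (HeightOneSpectrum (𝓞 E))) {s : ℝ} (hs : 1 ≤ s)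
    (hfin : idealSum E ∅ s ≠ ⊤) : idealSum E ∅ s ≤ 2 ^ W.card * idealSum E W s := by
  classical
  have hle : ∀ W, idealSum E W s ≤ idealSum E ∅ s := fun W => by
    unfold idealSum
    refine ENNReal.tsum_le_tsum fun I => ?_
    split_ifs <;> simp_all
  induction W using Finset.induction_on with
  | empty => simp
  | insert P W hP ih =>
    have hW : idealSum E W s ≠ ⊤ := ne_top_of_le_ne_top hfin (hle W)
    have h2 : idealSum E W s ≤ 2 * idealSum E (insert P W) s := by
      have h1 : idealSum E W s ≤ idealSum E (insert P W) s + 2⁻¹ * idealSum E W s :=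
        (idealSum_le_add W P s).trans (by gcongr; exact idealWeight_prime_le hs P)
      have hI : idealSum E (insert P W) s ≠ ⊤ := ne_top_of_le_ne_top hfin (hle _)
      rw [← ENNReal.toReal_le_toReal hW (ENNReal.mul_ne_top (by simp) hI), ENNReal.toReal_mul]
      have h3 := ENNReal.toReal_mono (by finiteness) h1
      rw [ENNReal.toReal_add hI (by finiteness), ENNReal.toReal_mul, ENNReal.toReal_inv] at h3
      simp only [ENNReal.toReal_ofNat] at h3 ⊢
      linarith
    rw [Finset.card_insert_of_notMem hP, pow_succ, mul_assoc]
    exact ih.trans (by gcongr)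

end NumberField
end IdealSums

section NonResidues

open IsDedekindDomain HeightOneSpectrum Module Filter Topology UniqueFactorizationMonoid

namespace NumberField

variable {F : Type*} [Field F] [NumberField F] {E : Type*} [Field E] [NumberField E] [Algebra F E]

theorem idealSum_sq_le (W : Finset (HeightOneSpectrum (𝓞 F)))
    (H : ∀ p : HeightOneSpectrum (𝓞 F), p ∉ W → ∃ Q Q' : HeightOneSpectrum (𝓞 E), Q ≠ Q' ∧
      Q.under (𝓞 F) = p ∧ Q'.under (𝓞 F) = p ∧
      Ideal.absNorm Q.asIdeal ≤ Ideal.absNorm p.asIdeal ∧ Ideal.absNorm Q'.asIdeal ≤ Ideal.absNorm p.asIdeal)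
    {s : ℝ} (hs : 0 < s) : idealSum F W s * idealSum F W s ≤ idealSum E ∅ s := by
  classical
  have H' : ∀ I : Ideal (𝓞 F), ∃ J J' : Ideal (𝓞 E), I ≠ ⊥ → I.IsPrime → (∀ P ∈ W, ¬ I ≤ P.asIdeal) →
      J ≠ J' ∧ Prime J ∧ Prime J' ∧ J.comap (algebraMap (𝓞 F) (𝓞 E)) = I ∧
        J'.comap (algebraMap (𝓞 F) (𝓞 E)) = I ∧
      Ideal.absNorm J ≤ Ideal.absNorm I ∧ Ideal.absNorm J' ≤ Ideal.absNorm I := by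
    intro I
    by_cases hI : I ≠ ⊥ ∧ I.IsPrime ∧ (∀ P ∈ W, ¬ I ≤ P.asIdeal)
    · obtain ⟨Q, Q', hne, h1, h2, h3, h4⟩ := H ⟨I, hI.2.1, hI.1⟩ fun h => hI.2.2 _ h le_rfl
      exact ⟨Q.asIdeal, Q'.asIdeal, fun _ _ _ => ⟨fun h => hne (HeightOneSpectrum.ext h), Q.prime, Q'.prime,
        congrArg HeightOneSpectrum.asIdeal h1, congrArg HeightOneSpectrum.asIdeal h2, h3, h4⟩⟩
    · exact ⟨⊥, ⊥, fun h1 h2 h3 => absurd ⟨h1, h2, h3⟩ hI⟩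
  choose q q' hq using H'
  let S := {I : Ideal (𝓞 F) // I ≠ ⊥ ∧ ∀ P ∈ W, ¬ I ≤ P.asIdeal}
  have hfac : ∀ a : S, ∀ I ∈ normalizedFactors a.1, q I ≠ q' I ∧ Prime (q I) ∧ Prime (q' I) ∧
      (q I).comap (algebraMap (𝓞 F) (𝓞 E)) = I ∧ (q' I).comap (algebraMap (𝓞 F) (𝓞 E)) = I ∧
      Ideal.absNorm (q I) ≤ Ideal.absNorm I ∧ Ideal.absNorm (q' I) ≤ Ideal.absNorm I := by
    intro a I hI
    have hp := prime_of_normalized_factor I hI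
    exact hq I hp.ne_zero (Ideal.isPrime_of_prime hp)
      fun P hP hle => a.2.2 P hP ((Ideal.dvd_iff_le.1 (dvd_of_mem_normalizedFactors hI)).trans hle)
  let T : S × S → Ideal (𝓞 E) := fun x =>
    ((normalizedFactors x.1.1).map q + (normalizedFactors x.2.1).map q').prod
  have hT : ∀ x, normalizedFactors (T x) = (normalizedFactors x.1.1).map q + (normalizedFactors x.2.1).map q' := by
    intro x
    refine normalizedFactors_prod_of_prime fun J hJ => ?_
    rw [Multiset.mem_add, Multiset.mem_map, Multiset.mem_map] at hJ
    rcases hJ with ⟨I, hI, rfl⟩ | ⟨I, hI, rfl⟩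
    · exact (hfac _ I hI).2.1
    · exact (hfac _ I hI).2.2.1
  have hprod : ∀ a : S, (normalizedFactors a.1).prod = a.1 := fun a =>
    Ideal.prod_normalizedFactors_eq_self a.2.1
  let R : Ideal (𝓞 E) → Prop := fun J => J = q (J.comap (algebraMap (𝓞 F) (𝓞 E)))
  have hfilter : ∀ x, (normalizedFactors (T x)).filter R = (normalizedFactors x.1.1).map q ∧
      (normalizedFactors (T x)).filter (fun J => ¬ R J) = (normalizedFactors x.2.1).map q' := by
    intro x
    have h1 : ∀ J ∈ (normalizedFactors x.1.1).map q, R J := by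
      intro J hJ
      obtain ⟨I, hI, rfl⟩ := Multiset.mem_map.1 hJ
      change q I = q _
      rw [(hfac _ I hI).2.2.2.1]
    have h2 : ∀ J ∈ (normalizedFactors x.2.1).map q', ¬ R J := by
      intro J hJ
      obtain ⟨I, hI, rfl⟩ := Multiset.mem_map.1 hJ
      change ¬ q' I = q _
      rw [(hfac _ I hI).2.2.2.2.1]
      exact (hfac _ I hI).1.symm
    rw [hT, Multiset.filter_add, Multiset.filter_add, Multiset.filter_eq_self.2 h1,
      Multiset.filter_eq_nil.2 h2, Multiset.filter_eq_self.2 h2,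
      Multiset.filter_eq_nil.2 (fun J hJ => not_not.2 (h1 J hJ)), add_zero, zero_add]
    exact ⟨rfl, rfl⟩
  have hrec : ∀ a : S, ((normalizedFactors a.1).map q).map (Ideal.comap (algebraMap (𝓞 F) (𝓞 E))) =
      normalizedFactors a.1 ∧
      ((normalizedFactors a.1).map q').map (Ideal.comap (algebraMap (𝓞 F) (𝓞 E))) =
      normalizedFactors a.1 := by
    intro a
    rw [Multiset.map_map, Multiset.map_map]
    constructor
    · exact (Multiset.map_congr rfl fun I hI => (hfac a I hI).2.2.2.1).trans (Multiset.map_id _)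
    · exact (Multiset.map_congr rfl fun I hI => (hfac a I hI).2.2.2.2.1).trans (Multiset.map_id _)
  have hinj : Function.Injective T := by
    intro x y hxy
    have h1 : (normalizedFactors x.1.1).map q = (normalizedFactors y.1.1).map q := by
      rw [← (hfilter x).1, ← (hfilter y).1, hxy]
    have h2 : (normalizedFactors x.2.1).map q' = (normalizedFactors y.2.1).map q' := by
      rw [← (hfilter x).2, ← (hfilter y).2, hxy]
    refine Prod.ext (Subtype.ext ?_) (Subtype.ext ?_)
    · have h3 : normalizedFactors x.1.1 = normalizedFactors y.1.1 :=
        (hrec x.1).1.symm.trans ((congrArg _ h1).trans (hrec y.1).1)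
      exact (hprod x.1).symm.trans ((congrArg _ h3).trans (hprod y.1))
    · have h3 : normalizedFactors x.2.1 = normalizedFactors y.2.1 :=
        (hrec x.2).2.symm.trans ((congrArg _ h2).trans (hrec y.2).2)
      exact (hprod x.2).symm.trans ((congrArg _ h3).trans (hprod y.2))
  have hnorm : ∀ x : S × S, Ideal.absNorm (T x) ≤ Ideal.absNorm (x.1.1 * x.2.1) := by
    intro x
    change Ideal.absNorm ((normalizedFactors x.1.1).map q + (normalizedFactors x.2.1).map q').prod ≤ _
    rw [map_mul (Ideal.absNorm (S := 𝓞 F)), ← hprod x.1, ← hprod x.2, Multiset.prod_add, map_mul, map_multiset_prod, map_multiset_prod,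
      map_multiset_prod, map_multiset_prod, Multiset.map_map, Multiset.map_map, hprod, hprod]
    refine Nat.mul_le_mul ?_ ?_
    · exact Multiset.prod_map_le_prod_map₀ _ _ (fun _ _ => Nat.zero_le _) fun I hI => (hfac _ I hI).2.2.2.2.2.1
    · exact Multiset.prod_map_le_prod_map₀ _ _ (fun _ _ => Nat.zero_le _) fun I hI => (hfac _ I hI).2.2.2.2.2.2
  have hsum : idealSum F W s = ∑' a : S, idealWeight s a.1 := by
    unfold idealSum
    rw [← Subtype.val_injective.tsum_eq (f := fun I : Ideal (𝓞 F) =>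
      if ∀ P ∈ W, ¬ I ≤ P.asIdeal then idealWeight s I else 0)
      (g := (Subtype.val : S → Ideal (𝓞 F)))]
    · exact tsum_congr fun a => if_pos a.2.2
    · intro I hI
      refine ⟨⟨I, ?_, ?_⟩, rfl⟩
      · rintro rfl
        refine hI ?_
        simp [idealWeight_bot hs.ne']
      · by_contra h
        exact hI (if_neg h)
  rw [hsum, ← ENNReal.tsum_mul_left]
  simp_rw [← ENNReal.tsum_mul_right]
  rw [ENNReal.tsum_comm, ← ENNReal.tsum_prod (f := fun a b : S => idealWeight s a.1 * idealWeight s b.1)]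
  calc ∑' x : S × S, idealWeight s x.1.1 * idealWeight s x.2.1 ≤ ∑' x : S × S, idealWeight s (T x) := by
        refine ENNReal.tsum_le_tsum fun x => ?_
        rw [← idealWeight_mul]
        refine idealWeight_le_of_absNorm_le hs.le ?_ (hnorm x)
        refine Multiset.prod_ne_zero fun h0 => ?_
        rw [← hT] at h0
        exact (prime_of_normalized_factor _ h0).ne_zero rfl
    _ ≤ ∑' J : Ideal (𝓞 E), idealWeight s J := ENNReal.tsum_comp_le_tsum_of_injective hinj _
    _ = idealSum E ∅ s := by unfold idealSum; simp

theorem exists_not_split (W : Finset (HeightOneSpectrum (𝓞 F))) :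
    ∃ p : HeightOneSpectrum (𝓞 F), p ∉ W ∧ ∀ Q Q' : HeightOneSpectrum (𝓞 E), Q ≠ Q' →
      Q.under (𝓞 F) = p → Q'.under (𝓞 F) = p →
      Ideal.absNorm Q.asIdeal ≤ Ideal.absNorm p.asIdeal → ¬ Ideal.absNorm Q'.asIdeal ≤ Ideal.absNorm p.asIdeal := by
  by_contra! H
  obtain ⟨κ, hκ, hf, ht⟩ := tendsto_idealSum_empty (E := F)
  obtain ⟨κ', hκ', hf', ht'⟩ := tendsto_idealSum_empty (E := E)
  have hs0 : Tendsto (fun s : ℝ => s - 1) (𝓝[>] 1) (𝓝 0) := by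
    have : Tendsto (fun s : ℝ => s - 1) (𝓝 1) (𝓝 (1 - 1)) := (continuous_id.sub continuous_const).tendsto _
    rw [sub_self] at this
    exact this.mono_left nhdsWithin_le_nhds
  have h1 := (ht.mul ht).sub ((hs0.mul ht').const_mul ((2 : ℝ) ^ W.card * 2 ^ W.card))
  rw [zero_mul, mul_zero, sub_zero] at h1
  have h2 := h1.eventually (lt_mem_nhds (mul_pos hκ hκ))
  obtain ⟨s, hs, hs1, hfs, hfs'⟩ := (h2.and ((eventually_mem_nhdsWithin (a := (1 : ℝ)) (s := Set.Ioi 1)).and (hf.and hf'))).exists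
  replace hs1 : 1 < s := hs1
  have h3 := idealSum_empty_le W hs1.le hfs
  have h4 := idealSum_sq_le (E := E) W H (by linarith : 0 < s)
  have h5 : idealSum F ∅ s * idealSum F ∅ s ≤ 2 ^ W.card * 2 ^ W.card * idealSum E ∅ s := by
    calc _ ≤ (2 ^ W.card * idealSum F W s) * (2 ^ W.card * idealSum F W s) := by gcongr
      _ = 2 ^ W.card * 2 ^ W.card * (idealSum F W s * idealSum F W s) := by ring
      _ ≤ _ := by gcongr
  have h6 := ENNReal.toReal_mono (by finiteness) h5
  simp only [ENNReal.toReal_mul, ENNReal.toReal_pow, ENNReal.toReal_ofNat] at h6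
  have h7 : 0 < s - 1 := by linarith
  nlinarith [mul_le_mul_of_nonneg_left h6 (mul_pos h7 h7).le]

/-- An odd prime at which `a` is a local square splits in `F(√a)`. -/
theorem IsSqrtExt.mapPrime_ne {σ : E ≃+* E} {θ : E} {a : F} (h : IsSqrtExt F σ θ a)
    {Q : HeightOneSpectrum (𝓞 E)} (h2 : (2 : 𝓞 E) ∉ Q.asIdeal)
    (ha : IsSquareMod (Q.under (𝓞 F)).asIdeal (Q.under (𝓞 F)).asIdeal a) : mapPrime σ Q ≠ Q := by
  obtain ⟨z, hz, r, w, hr, hc, hw⟩ := ha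
  rw [isCoprime_span_iff_not_mem] at hc
  have hsq : (θ * algebraMap F E z) ^ 2 = algebraMap F E r := by
    rw [mul_pow, h.sq, ← map_pow, ← map_mul, hr]
  have hInt : IsIntegral ℤ (θ * algebraMap F E z) :=
    IsIntegral.of_pow two_pos (by rw [hsq]; exact r.2.algebraMap)
  let α : 𝓞 E := ⟨_, hInt⟩
  have hα2 : α ^ 2 = algebraMap (𝓞 F) (𝓞 E) r := RingOfIntegers.ext hsq
  have hσα : RingOfIntegers.mapRingEquiv σ α = -α := RingOfIntegers.ext <| by
    change σ (θ * algebraMap F E z) = -(θ * algebraMap F E z)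
    rw [map_mul, h.neg, h.fix, neg_mul]
  have hσw : RingOfIntegers.mapRingEquiv σ (algebraMap (𝓞 F) (𝓞 E) w) = algebraMap (𝓞 F) (𝓞 E) w :=
    RingOfIntegers.ext (h.fix w)
  have hr2 : α ^ 2 ∉ Q.asIdeal := by
    rw [hα2]
    exact hc
  intro hσ
  have hinv : ∀ y ∈ Q.asIdeal, RingOfIntegers.mapRingEquiv σ y ∈ Q.asIdeal := by
    intro y hy
    rw [← hσ, mem_mapPrime, h.symm_eq] at hy
    exact hy
  have hmul : (α - algebraMap (𝓞 F) (𝓞 E) w) * (α + algebraMap (𝓞 F) (𝓞 E) w) ∈ Q.asIdeal := by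
    have h1 : algebraMap (𝓞 F) (𝓞 E) (r - w ^ 2) ∈ Q.asIdeal := hw
    rw [map_sub, ← hα2, map_pow] at h1
    convert h1 using 1
    ring
  have h2α : (2 : 𝓞 E) * α ∈ Q.asIdeal := by
    rcases Q.isPrime.mem_or_mem hmul with h1 | h1
    · have h3 := Q.asIdeal.sub_mem h1 (hinv _ h1)
      rw [map_sub, hσα, hσw] at h3
      convert h3 using 1
      ring
    · have h3 := Q.asIdeal.sub_mem h1 (hinv _ h1)
      rw [map_add, hσα, hσw] at h3
      convert h3 using 1
      ring
  rcases Q.isPrime.mem_or_mem h2α with h1 | h1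
  · exact h2 h1
  · exact hr2 (Q.asIdeal.pow_mem_of_mem h1 2 two_pos)

theorem absNorm_mapPrime (σ : E ≃+* E) (Q : HeightOneSpectrum (𝓞 E)) :
    Ideal.absNorm (mapPrime σ Q).asIdeal = Ideal.absNorm Q.asIdeal := by
  rw [Ideal.absNorm_apply, Ideal.absNorm_apply, Submodule.cardQuot_apply, Submodule.cardQuot_apply]
  refine Nat.card_congr (Ideal.quotientEquiv _ _ (RingOfIntegers.mapRingEquiv σ.symm) ?_).toEquiv
  ext x
  rw [Ideal.map_comap_of_equiv]
  change _ ↔ _ ∈ (mapPrime σ Q).asIdeal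
  rw [mem_mapPrime]
  exact Eq.to_iff (congrArg (· ∈ Q.asIdeal) (RingOfIntegers.ext (σ.symm_apply_apply (x : E)).symm))

theorem IsSqrtExt.absNorm_le {σ : E ≃+* E} {θ : E} {a : F} (h : IsSqrtExt F σ θ a)
    {Q : HeightOneSpectrum (𝓞 E)} (hQ : mapPrime σ Q ≠ Q) :
    Ideal.absNorm Q.asIdeal ≤ Ideal.absNorm (Q.under (𝓞 F)).asIdeal := by
  have h1 : Ideal.absNorm (Ideal.map (algebraMap (𝓞 F) (𝓞 E)) (Q.under (𝓞 F)).asIdeal) =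
      Ideal.absNorm (Q.under (𝓞 F)).asIdeal ^ 2 := by
    rw [Ideal.absNorm_algebraMap, ← h.finrank_eq_two, IsFractionRing.finrank_eq (𝓞 F) F (𝓞 E) E]
  have hle : ∀ P : HeightOneSpectrum (𝓞 E), P.under (𝓞 F) = Q.under (𝓞 F) →
      Ideal.map (algebraMap (𝓞 F) (𝓞 E)) (Q.under (𝓞 F)).asIdeal ≤ P.asIdeal := by
    intro P hP
    rw [Ideal.map_le_iff_le_comap, ← hP]
    exact le_rfl
  have h2 : Q.asIdeal * (mapPrime σ Q).asIdeal ∣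
      Ideal.map (algebraMap (𝓞 F) (𝓞 E)) (Q.under (𝓞 F)).asIdeal := by
    refine IsCoprime.mul_dvd ?_ (Ideal.dvd_iff_le.2 (hle _ rfl))
      (Ideal.dvd_iff_le.2 (hle _ ((h.under_eq_iff _ _).2 (Or.inr rfl)).symm))
    rw [Ideal.isCoprime_iff_sup_eq]
    exact (Q.isMaximal.coprime_of_ne (mapPrime σ Q).isMaximal
      fun h0 => hQ (HeightOneSpectrum.ext h0.symm))
  have h3 := map_dvd (Ideal.absNorm (S := 𝓞 E)) h2
  rw [h1, map_mul, absNorm_mapPrime] at h3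
  have h4 : 0 < Ideal.absNorm (Q.under (𝓞 F)).asIdeal :=
    Nat.pos_of_ne_zero fun h0 => (Q.under (𝓞 F)).ne_bot (Ideal.absNorm_eq_zero_iff.1 h0)
  have h5 := Nat.le_of_dvd (pow_pos h4 2) h3
  rw [← pow_two] at h5
  exact le_of_pow_le_pow_left₀ two_ne_zero (Nat.zero_le _) h5

theorem exists_not_isSquareMod {E : Type*} [Field E] [NumberField E] {b : E} (hb : ¬ IsSquare b)
    (Z : Finset (HeightOneSpectrum (𝓞 E))) :
    ∃ P : HeightOneSpectrum (𝓞 E), P ∉ Z ∧ (2 : 𝓞 E) ∉ P.asIdeal ∧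
      ¬ IsSquareMod P.asIdeal P.asIdeal b := by
  classical
  obtain ⟨E', _, _, _, σ, θ, h⟩ := exists_isSqrtExt hb
  have hfin := finite_primes_two (F := E)
  obtain ⟨P, hP, hP'⟩ := exists_not_split (F := E) (E := E') (Z ∪ hfin.toFinset)
  rw [Finset.mem_union, not_or] at hP
  have h2 : (2 : 𝓞 E) ∉ P.asIdeal := fun h0 => hP.2 (hfin.mem_toFinset.2 h0)
  refine ⟨P, hP.1, h2, fun hsq => ?_⟩
  obtain ⟨Q, rfl⟩ := under_surjective (F := E) (E := E') P
  have hne : mapPrime σ Q ≠ Q := h.mapPrime_ne (fun h0 => h2 <| by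
    change algebraMap (𝓞 E) (𝓞 E') 2 ∈ Q.asIdeal
    rwa [map_ofNat]) hsq
  have hn := h.absNorm_le hne
  refine hP' Q (mapPrime σ Q) hne.symm rfl ((h.under_eq_iff _ _).2 (Or.inr rfl)).symm hn ?_
  rwa [absNorm_mapPrime]

theorem IsSqrtExt.pullDiv_single_mem {σ : E ≃+* E} {θ : E} {a : F} (h : IsSqrtExt F σ θ a)
    {P : HeightOneSpectrum (𝓞 F)} (h2 : (2 : 𝓞 F) ∉ P.asIdeal)
    (ha : IsSquareMod P.asIdeal P.asIdeal a) (n : ℤ) :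
    pullDiv F E (Finsupp.single P n) ∈ (normDiv σ).range := by
  classical
  obtain ⟨Q, rfl⟩ := under_surjective (F := F) (E := E) P
  have hne : mapPrime σ Q ≠ Q := h.mapPrime_ne (fun h0 => h2 <| by
    change algebraMap (𝓞 F) (𝓞 E) 2 ∈ Q.asIdeal
    rwa [map_ofNat]) ha
  refine ⟨Finsupp.single Q n, Finsupp.ext fun P => ?_⟩
  rw [pullDiv_apply, normDiv_apply, Finsupp.add_apply, h.mapDiv_apply]
  have hram : ∀ P : HeightOneSpectrum (𝓞 E), P.under (𝓞 F) = Q.under (𝓞 F) → ram F P = 1 := by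
    intro P hP
    refine IsSqrtExt.ram_eq_one h P fun h0 => ?_
    rcases (h.under_eq_iff Q P).1 hP.symm with h1 | h1
    · rw [h1] at h0
      exact hne h0
    · rw [h1, h.mapPrime_mapPrime] at h0
      exact hne h0.symm
  by_cases hP : P.under (𝓞 F) = Q.under (𝓞 F)
  · rw [hram P hP, hP, Finsupp.single_eq_same]
    rcases (h.under_eq_iff Q P).1 hP.symm with h1 | h1
    · rw [h1, Finsupp.single_eq_same, Finsupp.single_eq_of_ne hne]
      simp
    · have h3 : mapPrime σ P = Q := by rw [h1, h.mapPrime_mapPrime]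
      rw [h3, Finsupp.single_eq_same, h1, Finsupp.single_eq_of_ne hne]
      simp
  · have h3 : P ≠ Q := fun h0 => hP (by rw [h0])
    have h4 : mapPrime σ P ≠ Q := fun h0 => hP (((h.under_eq_iff P (mapPrime σ P)).2 (Or.inr rfl)).trans (by rw [h0]))
    rw [Finsupp.single_eq_of_ne h3, Finsupp.single_eq_of_ne h4, Finsupp.single_eq_of_ne hP]
    simp

end NumberField
end NonResidues

section SecondInequality

theorem AddSubgroup.exists_finset_generators {A ι : Type*} [AddCommGroup A] (f : ι → A) (G : Set ι)
    (B : AddSubgroup A) (hB : B.index ≠ 0) (h2 : ∀ x, 2 • x ∈ B)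
    (hG : ∀ C : AddSubgroup A, B ≤ C → (∀ i ∈ G, f i ∈ C) → C = ⊤) :
    ∃ S : Finset ι, ↑S ⊆ G ∧ 2 ^ S.card ≤ B.index ∧
      ∀ C : AddSubgroup A, B ≤ C → (∀ i ∈ S, f i ∈ C) → C = ⊤ := by
  classical
  induction hn : B.index using Nat.strong_induction_on generalizing B with
  | _ n ih =>
  by_cases hall : ∀ i ∈ G, f i ∈ B
  · refine ⟨∅, by simp, ?_, fun C hC _ => hG C hC fun i hi => hC (hall i hi)⟩
    rw [Finset.card_empty, pow_zero, ← hn]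
    exact Nat.pos_of_ne_zero hB
  push Not at hall
  obtain ⟨i, hi, hiB⟩ := hall
  set B' := B ⊔ AddSubgroup.zmultiples (f i) with hB'
  have hle : B ≤ B' := le_sup_left
  have hmul := AddSubgroup.relIndex_mul_index hle
  have hne : B.relIndex B' ≠ 1 := by
    rw [Ne, AddSubgroup.relIndex_eq_one]
    exact fun h => hiB (h (le_sup_right (a := B) (AddSubgroup.mem_zmultiples _)))
  have hB'0 : B'.index ≠ 0 := fun h => hB (by rw [← hmul, h, mul_zero])
  have hr0 : B.relIndex B' ≠ 0 := fun h => hB (by rw [← hmul, h, zero_mul])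
  have hge : 2 * B'.index ≤ B.index := by
    rw [← hmul]
    exact Nat.mul_le_mul_right _ (by omega)
  obtain ⟨S, hSG, hcard, hS⟩ := ih B'.index (by omega) B' hB'0 (fun x => hle (h2 x))
    (fun C hC h => hG C (hle.trans hC) h) rfl
  refine ⟨insert i S, ?_, ?_, fun C hC h => hS C (sup_le hC ?_) fun j hj => h j (Finset.mem_insert_of_mem hj)⟩
  · rw [Finset.coe_insert]
    exact Set.insert_subset hi hSG
  · calc 2 ^ (insert i S).card ≤ 2 ^ (S.card + 1) := Nat.pow_le_pow_right two_pos (Finset.card_insert_le _ _)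
      _ = 2 * 2 ^ S.card := by ring
      _ ≤ n := by omega
  · rw [AddSubgroup.zmultiples_le]
    exact h i (Finset.mem_insert_self _ _)

/-- The image of multiplication by two. -/
def AddSubgroup.doubles (A : Type*) [AddCommGroup A] : AddSubgroup A := (nsmulAddMonoidHom (α := A) 2).range

theorem AddSubgroup.mem_doubles {A : Type*} [AddCommGroup A] {x : A} :
    x ∈ AddSubgroup.doubles A ↔ ∃ y, 2 • y = x := Iff.rfl

theorem AddSubgroup.relIndex_comap_two_eq {A : Type*} [AddCommGroup A] (P : AddSubgroup A) (hP : P.index ≠ 0) :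
    P.relIndex (P.comap (nsmulAddMonoidHom (α := A) 2)) = (P ⊔ AddSubgroup.doubles A).index := by
  have h1 := AddSubgroup.relIndex_mul_index (H := P) (K := P.comap (nsmulAddMonoidHom (α := A) 2))
    fun x hx => P.nsmul_mem hx 2
  have h2 := AddSubgroup.relIndex_mul_index (H := P) (K := P ⊔ AddSubgroup.doubles A) le_sup_left
  rw [AddSubgroup.index_comap] at h1
  rw [sup_comm, AddSubgroup.relIndex_sup_eq_of_le le_rfl] at h2
  have h3 : P.relIndex (AddSubgroup.doubles A) ≠ 0 := fun h => hP (by rw [← h2, h, zero_mul])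
  rw [sup_comm]
  refine Nat.eq_of_mul_eq_mul_left (Nat.pos_of_ne_zero h3) ?_
  rw [h2, mul_comm]
  exact h1

theorem AddSubgroup.relIndex_doubles_comap {A I : Type*} [AddCommGroup A] [AddCommGroup I]
    (hI : ∀ x : I, 2 • x = 0 → x = 0) (D : A →+ I) (hD : D.range.index ≠ 0) :
    (doubles A).relIndex ((doubles I).comap D) = (doubles A).relIndex D.ker * (D.range ⊔ doubles I).index := by
  have hle : doubles A ⊔ D.ker ≤ (doubles I).comap D := by
    refine sup_le ?_ fun x hx => ?_
    · rintro _ ⟨y, rfl⟩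
      exact ⟨D y, (map_nsmul D 2 y).symm⟩
    · rw [mem_comap, AddMonoidHom.mem_ker.1 hx]
      exact zero_mem _
  rw [← relIndex_mul_relIndex _ _ _ (le_sup_left (b := D.ker)) hle, sup_comm,
    relIndex_sup_eq_of_le (le_refl (doubles A)), sup_comm, ← relIndex_comap_two_eq _ hD]
  congr 1
  have h1 : doubles A ⊔ D.ker = (D.range.map (nsmulAddMonoidHom (α := I) 2)).comap D := by
    refine le_antisymm (sup_le ?_ fun x hx => ?_) ?_
    · rintro _ ⟨y, rfl⟩
      exact ⟨D y, ⟨y, rfl⟩, (map_nsmul D 2 y).symm⟩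
    · rw [mem_comap, AddMonoidHom.mem_ker.1 hx]
      exact zero_mem _
    · rintro x ⟨_, ⟨y, rfl⟩, hy⟩
      replace hy : 2 • D y = D x := hy
      rw [show x = 2 • y + (x - 2 • y) by abel]
      refine add_mem (mem_sup_left ⟨y, rfl⟩) (mem_sup_right ?_)
      rw [AddMonoidHom.mem_ker, map_sub, map_nsmul, hy, sub_self]
  have h2 : (doubles I) ⊓ D.range = (D.range.comap (nsmulAddMonoidHom (α := I) 2)).map (nsmulAddMonoidHom 2) := by
    ext x
    constructor
    · rintro ⟨⟨y, rfl⟩, hx⟩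
      exact ⟨y, hx, rfl⟩
    · rintro ⟨y, hy, rfl⟩
      exact ⟨⟨y, rfl⟩, hy⟩
  have hinj : Function.Injective (nsmulAddMonoidHom (α := I) 2) := by
    rw [injective_iff_map_eq_zero]
    exact fun x hx => hI x hx
  rw [h1, relIndex_comap, map_comap_eq, inf_comm, h2, relIndex_map_map_of_injective _ _ hinj]

open IsDedekindDomain HeightOneSpectrum Module

namespace NumberField

variable {F : Type*} [Field F] [NumberField F]

theorem evenUnits_eq_comap : evenUnits F = (AddSubgroup.doubles (Div F)).comap (principal F) := by
  ext x
  rw [mem_evenUnits, AddSubgroup.mem_comap, AddSubgroup.mem_doubles]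
  constructor
  · exact fun h => exists_two_nsmul_eq _ h
  · rintro ⟨g, hg⟩ P
    rw [← principal_apply, ← hg]
    exact ⟨g P, by rw [Finsupp.smul_apply, two_nsmul]⟩

theorem div_two_nsmul_eq_zero {ι : Type*} (x : ι →₀ ℤ) (h : 2 • x = 0) : x = 0 := by
  ext P
  have := DFunLike.congr_fun h P
  simpa using this

theorem doubles_relIndex_ker [IsTotallyReal F] :
    2 ^ finrank ℚ F ≤ (AddSubgroup.doubles (Additive Fˣ)).relIndex (principal F).ker := by
  rw [ker_principal, ← AddSubgroup.index_comap]
  have h1 : (AddSubgroup.doubles (Additive Fˣ)).comap (unitIncl F) =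
      (nsmulAddMonoidHom (α := Additive (𝓞 F)ˣ) 2).range := by
    ext x
    constructor
    · rintro ⟨y, hy⟩
      replace hy : 2 • y = unitIncl F x := hy
      have h2 : y ∈ (principal F).ker := by
        refine div_two_nsmul_eq_zero _ ?_
        rw [← map_nsmul, hy]
        have : unitIncl F x ∈ (principal F).ker := by rw [ker_principal]; exact ⟨x, rfl⟩
        exact this
      rw [ker_principal] at h2
      obtain ⟨z, rfl⟩ := h2
      exact ⟨z, unitIncl_injective (by rw [← hy]; exact map_nsmul (unitIncl F) 2 z)⟩
    · rintro ⟨y, rfl⟩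
      exact ⟨unitIncl F y, (map_nsmul (unitIncl F) 2 y).symm⟩
  obtain ⟨h2, h3⟩ := index_range_two_nsmul (Additive (𝓞 F)ˣ)
  rw [h1, h2, ← finrank_units, pow_succ]
  refine Nat.mul_le_mul_left _ ?_
  have : Finite (nsmulAddMonoidHom (α := Additive (𝓞 F)ˣ) 2).ker := (Nat.card_ne_zero.1 h3).2
  rw [Nat.succ_le_iff, Finite.one_lt_card_iff_nontrivial]
  refine ⟨⟨0, zero_mem _⟩, ⟨Additive.ofMul (-1), ?_⟩, fun h => ?_⟩
  · rw [AddMonoidHom.mem_ker]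
    exact Additive.toMul.injective (neg_one_sq (R := (𝓞 F)ˣ))
  · have h4 : (1 : (𝓞 F)ˣ) = -1 := congrArg (fun z => Additive.toMul z.1) h
    have h5 : (1 : 𝓞 F) = -1 := congrArg Units.val h4
    have h6 : (2 : 𝓞 F) = 0 := by linear_combination h5
    exact two_ne_zero h6

variable (F) in
/-- The divisors that are principal up to doubles. -/
noncomputable def classDoubles : AddSubgroup (Div F) := (principal F).range ⊔ AddSubgroup.doubles (Div F)

theorem index_classDoubles_ne_zero : (classDoubles F).index ≠ 0 := fun h =>
  index_range_principal_ne_zero (F := F) <| by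
    have := AddSubgroup.relIndex_mul_index (H := (principal F).range) (K := classDoubles F) le_sup_left
    rw [← this, h, mul_zero]

theorem doubles_relIndex_evenUnits [IsTotallyReal F] :
    2 ^ finrank ℚ F * (classDoubles F).index ≤
      (AddSubgroup.doubles (Additive Fˣ)).relIndex (evenUnits F) := by
  have h := AddSubgroup.relIndex_doubles_comap (fun x => div_two_nsmul_eq_zero x) (principal F)
    index_range_principal_ne_zero
  rw [evenUnits_eq_comap, h]
  exact Nat.mul_le_mul_right _ doubles_relIndex_ker

theorem exists_odd_generators : ∃ S : Finset (HeightOneSpectrum (𝓞 F)),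
    (∀ P ∈ S, (2 : 𝓞 F) ∉ P.asIdeal) ∧ 2 ^ S.card ≤ (classDoubles F).index ∧
    ∀ C : AddSubgroup (Div F), classDoubles F ≤ C → (∀ P ∈ S, Finsupp.single P 1 ∈ C) → C = ⊤ := by
  classical
  refine AddSubgroup.exists_finset_generators (fun P : HeightOneSpectrum (𝓞 F) => (Finsupp.single P 1 : Div F))
    {P | (2 : 𝓞 F) ∉ P.asIdeal} (classDoubles F) index_classDoubles_ne_zero
    (fun x => AddSubgroup.mem_sup_right ⟨x, rfl⟩) fun C hC h => ?_
  have hsingle : ∀ P : HeightOneSpectrum (𝓞 F), (2 : 𝓞 F) ∉ P.asIdeal → ∀ n : ℤ, (Finsupp.single P n : Div F) ∈ C := by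
    intro P hP n
    have := C.zsmul_mem (h P hP) n
    rwa [Finsupp.smul_single, smul_eq_mul, mul_one] at this
  rw [eq_top_iff]
  intro g _
  let T := (finite_primes_two (F := F)).toFinset
  have hT : ∀ P, P ∈ T ↔ (2 : 𝓞 F) ∈ P.asIdeal := fun P => Set.Finite.mem_toFinset _
  suffices H : ∀ g : Div F, (∀ P ∈ T, g P = 0) → g ∈ C by
    obtain ⟨b, hb0, hb⟩ := exists_ord_eq T (fun P => (g P).natAbs)
    have hu : (b : F) ≠ 0 := RingOfIntegers.coe_ne_zero_iff.2 hb0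
    let k : Div F := ∑ P ∈ T, Finsupp.single P ((g P - (g P).natAbs) / 2)
    have hk : ∀ P ∈ T, k P = (g P - (g P).natAbs) / 2 := by
      intro P hP
      simp only [k, Finsupp.finsetSum_apply, Finsupp.single_apply]
      rw [Finset.sum_ite_eq' T P, if_pos hP]
    have h1 := H (g - principal F (Additive.ofMul (Units.mk0 _ hu)) - 2 • k) (by
      intro P hP
      rw [Finsupp.sub_apply, Finsupp.sub_apply, principal_apply, Finsupp.smul_apply, hk P hP, two_nsmul]
      change g P - ord P (b : F) - _ = 0
      rw [hb P hP]
      omega)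
    have h2 : principal F (Additive.ofMul (Units.mk0 _ hu)) ∈ C := hC (AddSubgroup.mem_sup_left ⟨_, rfl⟩)
    have h3 : 2 • k ∈ C := hC (AddSubgroup.mem_sup_right ⟨k, rfl⟩)
    have h4 := add_mem (add_mem h1 h3) h2
    rwa [sub_add_cancel, sub_add_cancel] at h4
  intro g hg
  rw [← g.sum_single]
  refine sum_mem fun P hP => hsingle P (fun h2 => ?_) _
  exact Finsupp.mem_support_iff.1 hP (hg P ((hT P).2 h2))

end NumberField
end SecondInequality

section SecondInequality

open IsDedekindDomain HeightOneSpectrum Module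

namespace NumberField

variable {F : Type*} [Field F] [NumberField F] {E : Type*} [Field E] [NumberField E] [Algebra F E]

theorem mem_biInf_squareAt {T : Finset (HeightOneSpectrum (𝓞 F))} {x : Additive Fˣ} :
    x ∈ (⨅ t ∈ T, squareAt F t) ↔ ∀ t ∈ T, x ∈ squareAt F t := by
  simp only [AddSubgroup.mem_iInf]

theorem relIndex_squareAt_le (T : Finset (HeightOneSpectrum (𝓞 F))) (K : AddSubgroup (Additive Fˣ))
    (hK : ∀ t ∈ T, K ≤ evenAt F t) :
    (⨅ t ∈ T, squareAt F t).relIndex K ≠ 0 ∧ (⨅ t ∈ T, squareAt F t).relIndex K ≤ 2 ^ T.card := by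
  have h := AddSubgroup.relIndex_le_card_of_label (⨅ t ∈ T, squareAt F t) K
    (fun x => fun t : T => x ∈ squareAt F t.1) fun x hx y hy hxy => by
      rw [mem_biInf_squareAt]
      exact fun t ht => exists_label_squareAt t (hK t ht hx) (hK t ht hy) (congrFun hxy ⟨t, ht⟩).to_iff
  rw [Nat.card_fun, Nat.card_eq_fintype_card, Fintype.card_prop, Nat.card_eq_fintype_card,
    Fintype.card_coe] at h
  exact h

theorem doubles_le_squareMod (I J : Ideal (𝓞 F)) : AddSubgroup.doubles (Additive Fˣ) ≤ squareMod F I J := by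
  rintro _ ⟨y, rfl⟩
  exact two_nsmul_mem_squareMod I J y

theorem mem_doubles_units {x : Additive Fˣ} :
    x ∈ AddSubgroup.doubles (Additive Fˣ) ↔ IsSquare (x.toMul : F) := by
  constructor
  · rintro ⟨y, rfl⟩
    exact ⟨(y.toMul : F), by
      change (((y.toMul) ^ 2 : Fˣ) : F) = _
      rw [Units.val_pow_eq_pow_val, pow_two]⟩
  · rintro ⟨r, hr⟩
    have hr0 : r ≠ 0 := by
      rintro rfl
      exact x.toMul.ne_zero (by rw [hr, mul_zero])
    refine ⟨Additive.ofMul (Units.mk0 r hr0), addUnits_ext ?_⟩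
    change (((Units.mk0 r hr0) ^ 2 : Fˣ) : F) = _
    rw [Units.val_pow_eq_pow_val, Units.val_mk0, hr, pow_two]

theorem IsSquareMod.map_algebraMap {Q : HeightOneSpectrum (𝓞 E)} {x : F}
    (h : IsSquareMod (Q.under (𝓞 F)).asIdeal (Q.under (𝓞 F)).asIdeal x) :
    IsSquareMod Q.asIdeal Q.asIdeal (algebraMap F E x) := by
  obtain ⟨z, hz, r, w, hr, hc, hw⟩ := h
  rw [isCoprime_span_iff_not_mem] at hc
  refine ⟨algebraMap F E z, by simpa using hz, algebraMap (𝓞 F) (𝓞 E) r,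
    algebraMap (𝓞 F) (𝓞 E) w, ?_, ?_, ?_⟩
  · rw [← map_pow, ← map_mul, hr]
    rfl
  · rw [isCoprime_span_iff_not_mem]
    exact hc
  · rw [← map_pow, ← map_sub]
    exact hw

variable {σ : E ≃+* E} {θ : E} {a : F}

theorem IsSqrtExt.even_of_unramified (h : IsSqrtExt F σ θ a) (hU : Unramified F E)
    (p : HeightOneSpectrum (𝓞 F)) : Even (ord p a) := by
  obtain ⟨P, rfl⟩ := under_surjective (F := F) (E := E) p
  have h1 := ord_algebraMap P a
  rw [← h.sq, ord_pow, hU.ram_eq_one] at h1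
  push_cast at h1
  rw [one_mul] at h1
  exact ⟨_, by rw [← h1, two_mul]⟩

/-- The element `a` as a member of the additive group of units. -/
noncomputable def IsSqrtExt.unit (h : IsSqrtExt F σ θ a) : Additive Fˣ := Additive.ofMul (Units.mk0 a h.ne_zero)

theorem IsSqrtExt.mem_of_isSquare (h : IsSqrtExt F σ θ a) {b : Additive Fˣ}
    (hb : IsSquare (algebraMap F E (b.toMul : F))) :
    b ∈ AddSubgroup.doubles (Additive Fˣ) ⊔ AddSubgroup.zmultiples h.unit := by
  obtain ⟨y, hy⟩ := hb
  have h1 : σ y * σ y = y * y := by rw [← map_mul, ← hy, h.fix]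
  rcases mul_self_eq_mul_self_iff.1 h1 with h2 | h2
  · obtain ⟨u, rfl⟩ := (h.apply_ne y).1 h2
    refine AddSubgroup.mem_sup_left (mem_doubles_units.2 ⟨u, ?_⟩)
    exact (algebraMap F E).injective (by rw [hy, map_mul])
  · have h3 : σ (y * θ) = y * θ := by rw [map_mul, h2, h.neg]; ring
    obtain ⟨u, hu⟩ := (h.apply_ne _).1 h3
    rw [show b = (b + h.unit) - h.unit by abel]
    refine sub_mem (AddSubgroup.mem_sup_left (mem_doubles_units.2 ⟨u, ?_⟩))
      (AddSubgroup.mem_sup_right (AddSubgroup.mem_zmultiples _))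
    refine (algebraMap F E).injective ?_
    change algebraMap F E ((b.toMul : F) * a) = _
    rw [map_mul, hy, map_mul, ← hu, ← h.sq]
    ring

theorem IsSqrtExt.exists_prime (h : IsSqrtExt F σ θ a) (hU : Unramified F E)
    (Z : Finset (HeightOneSpectrum (𝓞 F))) {b : Additive Fˣ} (hb : b ∈ evenUnits F)
    (hb' : b ∉ AddSubgroup.doubles (Additive Fˣ) ⊔ AddSubgroup.zmultiples h.unit) :
    ∃ p : HeightOneSpectrum (𝓞 F), p ∉ Z ∧ (2 : 𝓞 F) ∉ p.asIdeal ∧ h.unit ∈ squareAt F p ∧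
      b ∉ squareAt F p := by
  classical
  have hZ : {P : HeightOneSpectrum (𝓞 E) | P.under (𝓞 F) ∈ Z}.Finite :=
    Set.Finite.subset (Z.finite_toSet.biUnion fun p _ => finite_under_preimage (F := F) (E := E) p)
      fun P hP => Set.mem_biUnion (show P.under (𝓞 F) ∈ (Z : Set _) from hP) rfl
  obtain ⟨P, hP, h2, hbP⟩ := exists_not_isSquareMod (fun h0 => hb' (h.mem_of_isSquare h0)) hZ.toFinset
  have hbp : b ∉ squareAt F (P.under (𝓞 F)) := fun h0 => hbP (IsSquareMod.map_algebraMap h0)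
  refine ⟨P.under (𝓞 F), fun h0 => hP (hZ.mem_toFinset.2 h0), fun h0 => h2 ?_, ?_, hbp⟩
  · have : algebraMap (𝓞 F) (𝓞 E) 2 ∈ P.asIdeal := h0
    rwa [map_ofNat] at this
  · by_contra ha
    have hab := exists_label_squareAt (P.under (𝓞 F)) (x := b) (y := h.unit) (mem_evenUnits.1 hb _)
      (h.even_of_unramified hU _) (iff_of_false hbp ha)
    have h3 := IsSquareMod.map_algebraMap (E := E) hab
    refine hbP ?_
    convert h3.mul_sq h.theta_ne_zero using 1
    change _ = algebraMap F E (((b.toMul) / (Units.mk0 a h.ne_zero) : Fˣ) : F) * _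
    rw [Units.val_div_eq_div_val, Units.val_mk0, map_div₀, h.sq,
      div_mul_cancel₀ _ (by simpa using h.ne_zero)]

/-- A set of split primes at which the everywhere even elements are independently non-squares. -/
structure IsSplitSet (a' : Additive Fˣ) (Z T : Finset (HeightOneSpectrum (𝓞 F))) : Prop where
  not_mem : ∀ t ∈ T, t ∉ Z
  odd : ∀ t ∈ T, (2 : 𝓞 F) ∉ t.asIdeal
  split : ∀ t ∈ T, a' ∈ squareAt F t
  index : (⨅ t ∈ T, squareAt F t).relIndex (evenUnits F) = 2 ^ T.card

theorem IsSqrtExt.exists_isSplitSet [IsTotallyReal F] (h : IsSqrtExt F σ θ a) (hU : Unramified F E)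
    (hfin : (AddSubgroup.doubles (Additive Fˣ)).relIndex (evenUnits F) ≠ 0)
    (Z : Finset (HeightOneSpectrum (𝓞 F))) :
    ∃ T, IsSplitSet h.unit Z T ∧
      (AddSubgroup.doubles (Additive Fˣ)).relIndex (evenUnits F) ≤ 2 ^ T.card * 2 := by
  classical
  by_contra! H
  have hstep : ∀ T, IsSplitSet h.unit Z T → ∃ T', IsSplitSet h.unit Z T' ∧ T'.card = T.card + 1 := by
    intro T hT
    set V := (⨅ t ∈ T, squareAt F t) ⊓ evenUnits F with hV
    have hVle : ¬ V ≤ AddSubgroup.doubles (Additive Fˣ) ⊔ AddSubgroup.zmultiples h.unit := by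
      intro hle
      have h1 : AddSubgroup.doubles (Additive Fˣ) ≤ V := by
        refine le_inf (le_iInf₂ fun t _ => doubles_le_squareMod _ _) ?_
        rintro _ ⟨y, rfl⟩
        rw [evenUnits_eq_comap]
        exact ⟨principal F y, (map_nsmul (principal F) 2 y).symm⟩
      have h2 := AddSubgroup.relIndex_mul_relIndex _ _ _ h1 (inf_le_right (b := evenUnits F))
      rw [hV, AddSubgroup.inf_relIndex_right, hT.index, ← hV] at h2
      have h3 : (AddSubgroup.doubles (Additive Fˣ)).relIndex
          (AddSubgroup.doubles (Additive Fˣ) ⊔ AddSubgroup.zmultiples h.unit) ≠ 0 ∧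
          (AddSubgroup.doubles (Additive Fˣ)).relIndex
          (AddSubgroup.doubles (Additive Fˣ) ⊔ AddSubgroup.zmultiples h.unit) ≤ 2 := by
        have h4 := AddSubgroup.relIndex_le_card_of_label (AddSubgroup.doubles (Additive Fˣ))
          (AddSubgroup.doubles (Additive Fˣ) ⊔ AddSubgroup.zmultiples h.unit)
          (fun x => x ∈ AddSubgroup.doubles (Additive Fˣ)) (by
            have key : ∀ x ∈ AddSubgroup.doubles (Additive Fˣ) ⊔ AddSubgroup.zmultiples h.unit,
                x ∉ AddSubgroup.doubles (Additive Fˣ) → x - h.unit ∈ AddSubgroup.doubles (Additive Fˣ) := by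
              intro x hx hx'
              obtain ⟨y, hy, z, hz, rfl⟩ := AddSubgroup.mem_sup.1 hx
              obtain ⟨n, rfl⟩ := AddSubgroup.mem_zmultiples_iff.1 hz
              rw [add_sub_assoc]
              refine add_mem hy ?_
              rcases Int.even_or_odd n with ⟨m, hm⟩ | ⟨m, hm⟩
              · refine absurd (add_mem hy ⟨m • h.unit, ?_⟩) hx'
                change 2 • (m • h.unit) = _
                rw [hm, add_zsmul, two_nsmul]
              · refine ⟨m • h.unit, ?_⟩
                change 2 • (m • h.unit) = _
                rw [hm, add_zsmul, one_zsmul, add_sub_cancel_right, mul_zsmul, two_zsmul, two_nsmul]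
            intro x hx y hy hxy
            by_cases hx1 : x ∈ AddSubgroup.doubles (Additive Fˣ)
            · exact sub_mem hx1 (hxy.to_iff.1 hx1)
            · have := sub_mem (key x hx hx1) (key y hy fun h0 => hx1 (hxy.to_iff.2 h0))
              rwa [sub_sub_sub_cancel_right] at this)
        rwa [Nat.card_eq_fintype_card, Fintype.card_prop] at h4
      have h5 := (AddSubgroup.relIndex_le_of_le_right hle h3.1).trans h3.2
      have h6 := H T hT
      rw [← h2, Nat.mul_comm (AddSubgroup.relIndex _ _)] at h6
      exact absurd (Nat.mul_le_mul_left (2 ^ T.card) h5) (not_le.2 h6)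
    obtain ⟨b, hbV, hb⟩ := SetLike.not_le_iff_exists.1 hVle
    obtain ⟨p, hpZ, hp2, hpa, hpb⟩ := h.exists_prime hU (Z ∪ T) hbV.2 hb
    rw [Finset.mem_union, not_or] at hpZ
    refine ⟨insert p T, ⟨?_, ?_, ?_, ?_⟩, Finset.card_insert_of_notMem hpZ.2⟩
    · rintro t ht
      rcases Finset.mem_insert.1 ht with rfl | ht
      exacts [hpZ.1, hT.not_mem t ht]
    · rintro t ht
      rcases Finset.mem_insert.1 ht with rfl | ht
      exacts [hp2, hT.odd t ht]
    · rintro t ht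
      rcases Finset.mem_insert.1 ht with rfl | ht
      exacts [hpa, hT.split t ht]
    · rw [Finset.card_insert_of_notMem hpZ.2, Finset.iInf_insert, ← AddSubgroup.inf_relIndex_right,
        ← AddSubgroup.relIndex_mul_relIndex _ V _ (by rw [hV, inf_assoc]; exact inf_le_right)
        (by rw [hV]; exact inf_le_right), inf_assoc, ← hV, AddSubgroup.inf_relIndex_right, hV,
        AddSubgroup.inf_relIndex_right, hT.index, ← hV, pow_succ, mul_comm]
      congr 1
      have h1 := relIndex_squareAt_le {p} V (fun t _ => inf_le_right.trans (iInf_le _ t))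
      rw [Finset.iInf_singleton, Finset.card_singleton, pow_one] at h1
      have h2 : (squareAt F p).relIndex V ≠ 1 := fun h0 => hpb (AddSubgroup.relIndex_eq_one.1 h0 hbV)
      omega
  have hall : ∀ n : ℕ, ∃ T, IsSplitSet h.unit Z T ∧ T.card = n := by
    intro n
    induction n with
    | zero => exact ⟨∅, ⟨by simp, by simp, by simp, by simp⟩, rfl⟩
    | succ n ih =>
      obtain ⟨T, hT, rfl⟩ := ih
      exact hstep T hT
  obtain ⟨T, hT, hc⟩ := hall ((AddSubgroup.doubles (Additive Fˣ)).relIndex (evenUnits F))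
  have h4 := AddSubgroup.relIndex_le_of_le_left (K := (⨅ t ∈ T, squareAt F t))
    (le_iInf₂ fun t _ => doubles_le_squareMod _ _) hfin
  rw [hT.index, hc] at h4
  exact absurd h4 (not_le.2 Nat.lt_two_pow_self)

end NumberField
end SecondInequality

section SecondInequality

open IsDedekindDomain HeightOneSpectrum Module

namespace NumberField

variable {F : Type*} [Field F] [NumberField F] {E : Type*} [Field E] [NumberField E] [Algebra F E]

/-- The divisors with even coefficients outside `T`. -/
def evenDivOutside (T : Finset (HeightOneSpectrum (𝓞 F))) : AddSubgroup (Div F) where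
  carrier := {g | ∀ P ∉ T, Even (g P)}
  zero_mem' := fun _ _ => Even.zero
  add_mem' hx hy := fun P hP => (hx P hP).add (hy P hP)
  neg_mem' hx := fun P hP => (hx P hP).neg

theorem mem_doubles_div {g : Div F} : g ∈ AddSubgroup.doubles (Div F) ↔ ∀ P, Even (g P) := by
  constructor
  · rintro ⟨k, rfl⟩ P
    exact ⟨k P, by rw [← two_nsmul]; rfl⟩
  · exact fun h => exists_two_nsmul_eq g h

theorem doubles_relIndex_evenDivOutside (T : Finset (HeightOneSpectrum (𝓞 F))) :
    (AddSubgroup.doubles (Div F)).relIndex (evenDivOutside T) = 2 ^ T.card := by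
  classical
  let φ : Div F →+ (T → ZMod 2) :=
    { toFun := fun g t => (g t.1 : ZMod 2)
      map_zero' := funext fun t => by simp
      map_add' := fun f g => funext fun t => by simp }
  have h1 : AddSubgroup.doubles (Div F) ⊓ evenDivOutside T = φ.ker ⊓ evenDivOutside T := by
    ext g
    rw [AddSubgroup.mem_inf, AddSubgroup.mem_inf, mem_doubles_div, AddMonoidHom.mem_ker]
    refine and_congr_left fun hg => ⟨fun h => funext fun t => ?_, fun h P => ?_⟩
    · exact (ZMod.intCast_eq_zero_iff_even).2 (h t.1)
    · by_cases hP : P ∈ T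
      · exact (ZMod.intCast_eq_zero_iff_even).1 (congrFun h ⟨P, hP⟩)
      · exact hg P hP
  rw [← AddSubgroup.inf_relIndex_right, h1, AddSubgroup.inf_relIndex_right, AddSubgroup.relIndex_ker]
  have h2 : (evenDivOutside T).map φ = ⊤ := by
    rw [eq_top_iff]
    intro v _
    refine ⟨∑ t : T, Finsupp.single t.1 ((v t).val : ℤ), fun P hP => ?_, funext fun t => ?_⟩
    · rw [Finsupp.finsetSum_apply, Finset.sum_eq_zero]
      · exact Even.zero
      · exact fun t _ => Finsupp.single_eq_of_ne fun h0 => hP (h0 ▸ t.2)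
    · change (((∑ t : T, Finsupp.single t.1 ((v t).val : ℤ) : Div F) t.1 : ℤ) : ZMod 2) = v t
      rw [Finsupp.finsetSum_apply, Finset.sum_eq_single t]
      · rw [Finsupp.single_eq_same]
        simp
      · exact fun s _ hs => Finsupp.single_eq_of_ne fun h0 => hs (Subtype.ext h0.symm)
      · exact fun h0 => absurd (Finset.mem_univ t) h0
  rw [h2, Nat.card_congr AddSubgroup.topEquiv.toEquiv, Nat.card_eq_fintype_card, Fintype.card_fun, ZMod.card,
    Fintype.card_coe]

theorem two_pow_mul_index_le (T : Finset (HeightOneSpectrum (𝓞 F))) (W : AddSubgroup (Div F))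
    (hW : classDoubles F ≤ W) (hT : evenDivOutside T ≤ W) :
    (evenUnits F).relIndex ((evenDivOutside T).comap (principal F)) ≠ 0 ∧
    2 ^ T.card * W.index ≤
      (evenUnits F).relIndex ((evenDivOutside T).comap (principal F)) * (classDoubles F).index := by
  have h2J : AddSubgroup.doubles (Div F) ≤ evenDivOutside T := fun g hg P _ => mem_doubles_div.1 hg P
  set M := evenDivOutside T ⊓ (principal F).range with hM
  have h1 : (evenUnits F).relIndex ((evenDivOutside T).comap (principal F)) =
      (AddSubgroup.doubles (Div F)).relIndex (AddSubgroup.doubles (Div F) ⊔ M) := by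
    rw [evenUnits_eq_comap, AddSubgroup.relIndex_comap, AddSubgroup.map_comap_eq, sup_comm,
      AddSubgroup.relIndex_sup_eq_of_le le_rfl, hM, inf_comm]
  have h3 := AddSubgroup.relIndex_mul_relIndex (AddSubgroup.doubles (Div F)) _ (evenDivOutside T)
    (le_sup_left (b := M)) (sup_le h2J inf_le_left)
  rw [doubles_relIndex_evenDivOutside, ← h1] at h3
  have h4 : classDoubles F ⊓ evenDivOutside T ≤ AddSubgroup.doubles (Div F) ⊔ M := by
    rintro g ⟨hg1, hg2⟩
    obtain ⟨y, hy, z, hz, rfl⟩ := AddSubgroup.mem_sup.1 hg1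
    refine add_mem (AddSubgroup.mem_sup_right ⟨?_, hy⟩) (AddSubgroup.mem_sup_left hz)
    have := (evenDivOutside T).sub_mem hg2 (h2J hz)
    rwa [add_sub_cancel_right] at this
  have h5 : classDoubles F ≤ W := hW
  have h6 := AddSubgroup.relIndex_mul_index h5
  have hc := index_classDoubles_ne_zero (F := F)
  have h7 : (classDoubles F).relIndex W ≠ 0 := fun h => hc (by rw [← h6, h, zero_mul])
  have h8 : (AddSubgroup.doubles (Div F) ⊔ M).relIndex (evenDivOutside T) ≤ (classDoubles F).relIndex W := by
    refine (AddSubgroup.relIndex_le_of_le_left h4 ?_).trans ?_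
    · rw [AddSubgroup.inf_relIndex_right]
      exact fun h => h7 (AddSubgroup.relIndex_eq_zero_of_le_right hT h)
    · rw [AddSubgroup.inf_relIndex_right]
      exact AddSubgroup.relIndex_le_of_le_right hT h7
  refine ⟨fun h => ?_, ?_⟩
  · rw [h, zero_mul] at h3
    exact (Nat.two_pow_pos T.card).ne h3
  · rw [← h3, ← h6, mul_assoc]
    gcongr

/-- The divisors of `E` that are norms up to principal divisors coming from `F`. -/
noncomputable def normClass (F : Type*) [Field F] [NumberField F] {E : Type*} [Field E] [NumberField E]
    [Algebra F E] (σ : E ≃+* E) : AddSubgroup (Div E) :=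
  (inclUnits F E).range.map (principal E) ⊔ (normDiv σ).range

variable {σ : E ≃+* E} {θ : E} {a : F}

theorem IsSqrtExt.classDoubles_le (h : IsSqrtExt F σ θ a) :
    classDoubles F ≤ (normClass F σ).comap (pullDiv F E) := by
  refine sup_le ?_ ?_
  · rintro _ ⟨x, rfl⟩
    rw [AddSubgroup.mem_comap, pullDiv_principal]
    exact AddSubgroup.mem_sup_left ⟨_, ⟨x, rfl⟩, rfl⟩
  · rintro _ ⟨g, rfl⟩
    refine AddSubgroup.mem_sup_right ⟨pullDiv F E g, ?_⟩
    rw [h.normDiv_pullDiv]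
    exact (map_nsmul (pullDiv F E) 2 g).symm

theorem IsSqrtExt.evenDivOutside_le (h : IsSqrtExt F σ θ a) (T : Finset (HeightOneSpectrum (𝓞 F)))
    (h2 : ∀ t ∈ T, (2 : 𝓞 F) ∉ t.asIdeal) (ha : ∀ t ∈ T, IsSquareMod t.asIdeal t.asIdeal a) :
    evenDivOutside T ≤ (normClass F σ).comap (pullDiv F E) := by
  classical
  intro g hg
  have h1 : g - ∑ t ∈ T, Finsupp.single t (g t) ∈ AddSubgroup.doubles (Div F) := by
    rw [mem_doubles_div]
    intro P
    rw [Finsupp.sub_apply, Finsupp.finsetSum_apply]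
    simp only [Finsupp.single_apply]
    rw [Finset.sum_ite_eq' T P]
    split_ifs with hP
    · simp
    · simpa using hg P hP
  have h3 : ∑ t ∈ T, Finsupp.single t (g t) ∈ (normClass F σ).comap (pullDiv F E) :=
    sum_mem fun t ht => AddSubgroup.mem_sup_right (h.pullDiv_single_mem (h2 t ht) (ha t ht) _)
  have h4 := add_mem (h.classDoubles_le (AddSubgroup.mem_sup_right h1)) h3
  rwa [sub_add_cancel] at h4

theorem relIndex_totallyPositive_le (K : AddSubgroup (Additive Fˣ)) :
    (totallyPositive F).relIndex K ≠ 0 ∧ (totallyPositive F).relIndex K ≤ 2 ^ finrank ℚ F := by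
  have := (finite_realEmb (F := F)).1
  have h := AddSubgroup.relIndex_le_card_of_label (totallyPositive F) K
    (fun x => fun φ : F →+* ℝ => 0 < φ (x.toMul : F)) fun x _ y _ hxy => sub_mem_totallyPositive x y hxy
  rw [Nat.card_fun, Nat.card_eq_fintype_card, Fintype.card_prop] at h
  exact ⟨h.1, h.2.trans (Nat.pow_le_pow_right two_pos finite_realEmb.2)⟩

theorem TwoUnramified.relIndex_squareAtTwo_le (h : TwoUnramified F) (K : AddSubgroup (Additive Fˣ))
    (hK : K ≤ evenAtTwo F) :
    (squareAtTwo F).relIndex K ≠ 0 ∧ (squareAtTwo F).relIndex K ≤ 2 ^ finrank ℚ F := by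
  have := finite_quotient_two (F := F)
  obtain ⟨f, hf⟩ := h.exists_label
  have h := AddSubgroup.relIndex_le_card_of_label (squareAtTwo F) K f
    fun x hx y hy hxy => hf x (hK hx) y (hK hy) hxy
  rwa [card_quotient_two] at h

/-- The second inequality: norms have index at most two. -/
theorem IsSqrtExt.index_normClass_le.{u} {F : Type u} [Field F] [NumberField F] {E : Type*} [Field E]
    [NumberField E] [Algebra F E] {σ : E ≃+* E} {θ : E} {a : F} [IsTotallyReal F] [IsTotallyReal E]
    (h : IsSqrtExt F σ θ a)
    (hU : Unramified F E) (h2 : TwoUnramified F) :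
    ((normClass F σ).comap (pullDiv F E)).index ≠ 0 ∧ ((normClass F σ).comap (pullDiv F E)).index ≤ 2 := by
  classical
  set W := (normClass F σ).comap (pullDiv F E) with hW
  set Sq := AddSubgroup.doubles (Additive Fˣ) with hSq
  have hc := index_classDoubles_ne_zero (F := F)
  have hW0 : W.index ≠ 0 := fun h0 => hc (by
    rw [← AddSubgroup.relIndex_mul_index h.classDoubles_le, ← hW, h0, mul_zero])
  refine ⟨hW0, ?_⟩
  set X := evenUnits F with hX
  set n := finrank ℚ F
  set c := (classDoubles F).index with hcdef
  have hSqX : 2 ^ n * c ≤ Sq.relIndex X := doubles_relIndex_evenUnits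
  have hSqX0 : Sq.relIndex X ≠ 0 := by
    have : 0 < 2 ^ n * c := Nat.mul_pos (Nat.two_pow_pos n) (Nat.pos_of_ne_zero hc)
    omega
  obtain ⟨S, hS2, hScard, hS⟩ := exists_odd_generators (F := F)
  obtain ⟨T, hT, hTcard⟩ := h.exists_isSplitSet hU hSqX0 S
  obtain ⟨hXT0, hXT⟩ := two_pow_mul_index_le T W h.classDoubles_le (h.evenDivOutside_le T hT.odd hT.split)
  set XT := (evenDivOutside T).comap (principal F) with hXTdef
  have hXTeven : ∀ P ∉ T, XT ≤ evenAt F P := fun P hP x hx => hx P hP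
  set Y := XT ⊓ (totallyPositive F ⊓ squareAtTwo F ⊓ ⨅ s ∈ S, squareAt F s) with hY
  have hpos := relIndex_totallyPositive_le XT
  have htwo := h2.relIndex_squareAtTwo_le XT (fun x hx => mem_evenAtTwo.2 fun P hP =>
    hXTeven P (fun hPT => hT.odd P hPT hP) hx)
  have hSS := relIndex_squareAt_le S XT (fun t ht => hXTeven t fun htT => hT.not_mem t htT ht)
  have hYi : Y.relIndex XT ≠ 0 ∧ Y.relIndex XT ≤ 2 ^ n * 2 ^ n * c := by
    rw [hY, inf_comm, AddSubgroup.inf_relIndex_right]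
    refine ⟨AddSubgroup.relIndex_inf_ne_zero (AddSubgroup.relIndex_inf_ne_zero hpos.1 htwo.1) hSS.1, ?_⟩
    refine AddSubgroup.relIndex_inf_le.trans (Nat.mul_le_mul (AddSubgroup.relIndex_inf_le.trans
      (Nat.mul_le_mul hpos.2 htwo.2)) (hSS.2.trans hScard))
  have hSqXle : Sq ≤ X := by
    rintro _ ⟨y, rfl⟩
    rw [hX, evenUnits_eq_comap]
    exact ⟨principal F y, (map_nsmul (principal F) 2 y).symm⟩
  have hXXT : X ≤ XT := fun x hx P _ => mem_evenUnits.1 hx P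
  have htower := AddSubgroup.relIndex_mul_relIndex _ _ _ hSqXle hXXT
  by_cases hYSq : Y ≤ Sq
  · have h3 : Sq.relIndex XT ≤ 2 ^ n * 2 ^ n * c := (AddSubgroup.relIndex_le_of_le_left hYSq hYi.1).trans hYi.2
    rw [← htower] at h3
    set p := X.relIndex XT
    set q := Sq.relIndex X
    set N := 2 ^ n
    set t := 2 ^ T.card
    have hNpos : 0 < N := Nat.two_pow_pos n
    have hcpos : 0 < c := Nat.pos_of_ne_zero hc
    have hNc : 0 < N * c := Nat.mul_pos hNpos hcpos
    by_contra! hlt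
    have e1 : q * (t * W.index) ≤ q * (p * c) := Nat.mul_le_mul_left _ hXT
    have e2 : q * (p * c) ≤ N * N * c * c := by
      rw [← mul_assoc]
      exact Nat.mul_le_mul_right _ h3
    have e3 : (N * c) * (N * c) ≤ q * q := Nat.mul_le_mul hSqX hSqX
    have e4 : q * q * W.index ≤ q * (t * 2) * W.index := by gcongr
    have e5 : q * q * 3 ≤ q * q * W.index := Nat.mul_le_mul_left _ hlt
    have e6 : 0 < (N * c) * (N * c) := Nat.mul_pos hNc hNc
    nlinarith
  · exfalso
    obtain ⟨x, ⟨hxT, ⟨⟨hxpos, hx2⟩, hxS⟩⟩, hxsq⟩ := SetLike.not_le_iff_exists.1 hYSq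
    rw [hSq, mem_doubles_units] at hxsq
    obtain ⟨E', _, _, _, τ, η, h'⟩ := exists_isSqrtExt hxsq
    have := h'.isTotallyReal hxpos
    let Tx := T.filter fun t => ¬ Even (ord t (x.toMul : F))
    have hlt := h'.relIndex_evenUnits_lt Tx (fun P hP => ?_) (fun t ht => (Finset.mem_filter.1 ht).2) ?_
    · have hle : (⨅ t ∈ Tx, squareAt F t) ⊓ (⨅ t ∈ T \ Tx, squareAt F t) ≤ ⨅ t ∈ T, squareAt F t := by
        rintro y ⟨hy1, hy2⟩
        have hy1' := mem_biInf_squareAt.1 hy1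
        have hy2' := mem_biInf_squareAt.1 hy2
        refine mem_biInf_squareAt.2 fun t ht => ?_
        by_cases htx : t ∈ Tx
        · exact hy1' t htx
        · exact hy2' t (Finset.mem_sdiff.2 ⟨ht, htx⟩)
      have k1 := relIndex_squareAt_le Tx X (fun t _ => iInf_le _ t)
      have k2 := relIndex_squareAt_le (T \ Tx) X (fun t _ => iInf_le _ t)
      have k3 := (AddSubgroup.relIndex_le_of_le_left hle (AddSubgroup.relIndex_inf_ne_zero k1.1 k2.1)).trans
        AddSubgroup.relIndex_inf_le
      rw [hT.index, ← Finset.card_sdiff_add_card_eq_card (Finset.filter_subset _ _ : Tx ⊆ T), pow_add] at k3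
      have k4 := Nat.two_pow_pos (T \ Tx).card
      have k5 := Nat.mul_le_mul_left ((⨅ t ∈ Tx, squareAt F t).relIndex X) k2.2
      have k6 := (Nat.mul_lt_mul_right k4).2 hlt
      rw [mul_comm] at k3
      exact absurd (k3.trans k5) (not_le.2 k6)
    · refine h'.ram_eq_one_of_even P ?_ hx2
      by_cases hPT : P.under (𝓞 F) ∈ T
      · by_contra hev
        exact hP (Finset.mem_filter.2 ⟨hPT, hev⟩)
      · exact hXTeven _ hPT hxT
    · intro g
      have htop := hS ((normClass F τ).comap (pullDiv F E')) h'.classDoubles_le fun s hs =>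
        AddSubgroup.mem_sup_right (h'.pullDiv_single_mem (hS2 s hs) (mem_biInf_squareAt.1 hxS s hs) 1)
      have : g ∈ (normClass F τ).comap (pullDiv F E') := by
        rw [htop]
        trivial
      exact this

end NumberField
end SecondInequality

section Lifting

open IsDedekindDomain HeightOneSpectrum Module

namespace NumberField

variable {F : Type*} [Field F] [NumberField F] {E : Type*} [Field E] [NumberField E] [Algebra F E]

/-- In an unramified quadratic extension an element of the base field which is a local norm at the
level of divisors is a norm. -/
theorem IsSqrtExt.exists_norm_eq {σ : E ≃+* E} {θ : E} {a : F} (h : IsSqrtExt F σ θ a)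
    [IsTotallyReal F] [IsTotallyReal E] (hU : Unramified F E) (h2 : TwoUnramified F)
    (x : Additive Fˣ) (f : Div E) (hf : normDiv σ f = principal E (inclUnits F E x)) :
    ∃ v : Additive Eˣ, normUnits σ v = inclUnits F E x := by
  have hker : (deltaDiv σ).ker = (pullDiv F E).range := by
    ext g
    rw [AddMonoidHom.mem_ker, deltaDiv_apply, sub_eq_zero]
    constructor
    · intro hg
      obtain ⟨k, hk⟩ := h.exists_pullDiv_eq g hg.symm fun P => by rw [hU.ram_eq_one]; simp
      exact ⟨k, hk⟩
    · rintro ⟨k, rfl⟩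
      rw [mapDiv_pullDiv σ h.fix]
  have hc := chevalley h
  have hi := h.index_normClass_le hU h2
  have he : (normClass F σ).relIndex (deltaDiv σ).ker =
      ((normClass F σ).comap (pullDiv F E)).index := by
    rw [hker, AddSubgroup.index_comap]
  have hc' : (normClass F σ).relIndex (deltaDiv σ).ker = _ := hc
  rw [he] at hc'
  have h1 : (normUnits σ).range.relIndex
      ((inclUnits F E).range ⊓ (normDiv σ).range.comap (principal E)) = 1 := by
    have := hi.1
    have := hi.2
    omega
  have h3 := AddSubgroup.relIndex_eq_one.1 h1 (show inclUnits F E x ∈ _ from ⟨⟨x, rfl⟩, ⟨f, hf⟩⟩)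
  exact h3

theorem exists_algEquiv_mapPrime_eq [IsGalois F E] (P Q : HeightOneSpectrum (𝓞 E))
    (h : P.under (𝓞 F) = Q.under (𝓞 F)) :
    ∃ g : E ≃ₐ[F] E, mapPrime (g : E ≃+* E) P = Q := by
  classical
  obtain ⟨σ, hσ, hP⟩ := exists_mapPrime_eq (F := F)
    (Finset.univ.image fun g : E ≃ₐ[F] E => (g : E ≃+* E))
    (Finset.mem_image.2 ⟨1, Finset.mem_univ _, rfl⟩) (fun b => ⟨Algebra.norm F b, by
      rw [Algebra.norm_eq_prod_automorphisms, Finset.prod_image]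
      · rfl
      · intro g _ g' _ hg
        exact AlgEquiv.ext fun x => DFunLike.congr_fun (F := E ≃+* E) hg x⟩) P Q h
  obtain ⟨g, _, rfl⟩ := Finset.mem_image.1 hσ
  exact ⟨g, hP⟩

theorem exists_pullDiv_eq_of_forall [IsGalois F E] (hU : Unramified F E) (f : Div E)
    (hf : ∀ g : E ≃ₐ[F] E, mapDiv (g : E ≃+* E) f = f) : ∃ k : Div F, pullDiv F E k = f := by
  refine exists_pullDiv_eq f (fun P Q hPQ => ?_) (fun P => by rw [hU.ram_eq_one]; simp)
  obtain ⟨g, rfl⟩ := exists_algEquiv_mapPrime_eq P Q hPQ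
  rw [hU.ram_eq_one, hU.ram_eq_one, ← mapDiv_apply_mapPrime (g : E ≃+* E) f P, hf g]

theorem under_mapPrime_of_comm (τ : E ≃+* E) (σ : F ≃+* F)
    (hσ : ∀ x : F, τ (algebraMap F E x) = algebraMap F E (σ x)) (P : HeightOneSpectrum (𝓞 E)) :
    (mapPrime τ P).under (𝓞 F) = mapPrime σ (P.under (𝓞 F)) := by
  refine HeightOneSpectrum.ext (Ideal.ext fun r => ?_)
  change RingOfIntegers.mapRingEquiv τ.symm (algebraMap (𝓞 F) (𝓞 E) r) ∈ P.asIdeal ↔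
    algebraMap (𝓞 F) (𝓞 E) (RingOfIntegers.mapRingEquiv σ.symm r) ∈ P.asIdeal
  have : RingOfIntegers.mapRingEquiv τ.symm (algebraMap (𝓞 F) (𝓞 E) r) =
      algebraMap (𝓞 F) (𝓞 E) (RingOfIntegers.mapRingEquiv σ.symm r) := by
    apply RingOfIntegers.ext
    change τ.symm (algebraMap F E r) = algebraMap F E (σ.symm r)
    rw [RingEquiv.symm_apply_eq, hσ, RingEquiv.apply_symm_apply]
  rw [this]

theorem mapDiv_pullDiv_of_comm (hU : Unramified F E) (τ : E ≃+* E) (σ : F ≃+* F)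
    (hσ : ∀ x : F, τ (algebraMap F E x) = algebraMap F E (σ x)) (f : Div F) :
    mapDiv τ (pullDiv F E f) = pullDiv F E (mapDiv σ f) := by
  ext P
  obtain ⟨P, rfl⟩ := (mapPrime τ).surjective P
  rw [mapDiv_apply_mapPrime, pullDiv_apply, pullDiv_apply, under_mapPrime_of_comm τ σ hσ,
    mapDiv_apply_mapPrime, hU.ram_eq_one, hU.ram_eq_one]

/-- Hilbert's theorem 90 for crossed homomorphisms on a group acting through the Galois group. -/
theorem exists_coboundary [IsGalois F E] {G : Type*} [Group G] (p : G →* (E ≃ₐ[F] E))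
    (hp : Function.Surjective p) (t : G → Additive Eˣ)
    (ht : ∀ x y, t (x * y) = t x + mapUnits (p x : E ≃+* E) (t y)) (h1 : ∀ x, p x = 1 → t x = 0) :
    ∃ u : Additive Eˣ, ∀ x, t x = mapUnits (p x : E ≃+* E) u - u := by
  have hlift : ∀ x y, p x = p y → t x = t y := fun x y hxy => by
    have h3 := ht x (x⁻¹ * y)
    rw [mul_inv_cancel_left, h1 (x⁻¹ * y) (by rw [map_mul, map_inv, hxy, inv_mul_cancel]), map_zero,
      add_zero] at h3
    exact h3.symm
  choose l hl using hp
  obtain ⟨u, hu⟩ := groupCohomology.isMulCoboundary₁_of_isMulCocycle₁_of_aut_to_units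
    (fun g => (t (l g)).toMul) (fun g g' => by
      have h3 := ht (l g) (l g')
      rw [hlift (l g * l g') (l (g * g')) (by rw [map_mul, hl, hl, hl]), hl] at h3
      refine Units.ext ?_
      have h4 := congrArg (fun z => ((z.toMul : Eˣ) : E)) h3
      rw [mul_comm]
      exact h4)
  refine ⟨Additive.ofMul u, fun x => addUnits_ext ?_⟩
  rw [hlift x (l (p x)) (hl _).symm]
  exact (congrArg (fun z : Eˣ => (z : E)) (hu (p x))).symm

/-- Crossed homomorphisms into the group of divisors are principal. -/
theorem exists_coboundary_div {G : Type*} [Group G] [Finite G] (p : G →* (E ≃+* E))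
    (t : G → Div E) (ht : ∀ x y, t (x * y) = t x + mapDiv (p x) (t y)) :
    ∃ u : Div E, ∀ x, t x = u - mapDiv (p x) u := by
  classical
  cases nonempty_fintype G
  have hc : (0 : ℤ) < Fintype.card G := by exact_mod_cast Fintype.card_pos
  let S : Div E := ∑ g, t g
  have hS : ∀ x, S = (Fintype.card G) • t x + mapDiv (p x) S := fun x => by
    have : S = ∑ g, t (x * g) := (Fintype.sum_equiv (Equiv.mulLeft x) _ _ fun _ => rfl).symm
    conv_lhs => rw [this]
    simp only [ht, Finset.sum_add_distrib, S, map_sum]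
    simp
  refine ⟨S.mapRange (fun n => n / (Fintype.card G : ℤ)) (Int.zero_ediv _), fun x => ?_⟩
  ext P
  have h3 := DFunLike.congr_fun (hS x) P
  rw [Finsupp.add_apply, Finsupp.smul_apply, mapDiv_apply, nsmul_eq_mul] at h3
  rw [Finsupp.sub_apply, mapDiv_apply, Finsupp.mapRange_apply, Finsupp.mapRange_apply, h3,
    add_comm, Int.add_mul_ediv_left _ _ hc.ne']
  ring

end NumberField
end Lifting

section Lifting

open IsDedekindDomain HeightOneSpectrum Module

/-- Extension of a crossed homomorphism from a normal subgroup of index two. -/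
theorem exists_crossedHom_extension {G M : Type*} [Group G] [AddCommGroup M] (A : G → M →+ M)
    (hA : ∀ g h m, A (g * h) m = A g (A h m)) (H : Subgroup G) (hH : H.index = 2) (τ : G)
    (hτ : τ ∉ H) (s : G → M) (hs : ∀ x ∈ H, ∀ y ∈ H, s (x * y) = s x + A x (s y)) (z : M)
    (h1 : ∀ x ∈ H, z + A τ (s x) = s (τ * x * τ⁻¹) + A (τ * x * τ⁻¹) z)
    (h2 : z + A τ z = s (τ * τ)) :
    ∃ S : G → M, (∀ x ∈ H, S x = s x) ∧ ∀ x y, S (x * y) = S x + A x (S y) := by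
  classical
  have := Subgroup.normal_of_index_eq_two hH
  let S : G → M := fun g => if g ∈ H then s g else s (g * τ⁻¹) + A (g * τ⁻¹) z
  have S1 : ∀ x ∈ H, S x = s x := fun x hx => if_pos hx
  have S2 : ∀ x ∈ H, S (x * τ) = s x + A x z := fun x hx => by
    have : x * τ ∉ H := fun hx' => hτ ((H.mul_mem_cancel_left hx).1 hx')
    simp only [S, if_neg this, mul_inv_cancel_right]
  have dec : ∀ g, g ∈ H ∨ ∃ x ∈ H, g = x * τ := fun g => by
    by_cases hg : g ∈ H
    · exact Or.inl hg
    · refine Or.inr ⟨g * τ⁻¹, ?_, by group⟩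
      rw [Subgroup.mul_mem_iff_of_index_two hH, inv_mem_iff]
      exact iff_of_false hg hτ
  have hττ : τ * τ ∈ H := Subgroup.mul_self_mem_of_index_two hH τ
  refine ⟨S, S1, fun g h => ?_⟩
  rcases dec g with hg | ⟨x, hx, rfl⟩ <;> rcases dec h with hh | ⟨y, hy, rfl⟩
  · rw [S1 _ (mul_mem hg hh), S1 _ hg, S1 _ hh, hs _ hg _ hh]
  · rw [← mul_assoc, S2 _ (mul_mem hg hy), S1 _ hg, S2 _ hy, hs _ hg _ hy, hA, map_add, add_assoc]
  · have hc : τ * h * τ⁻¹ ∈ H := Subgroup.Normal.conj_mem inferInstance _ hh τ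
    rw [show x * τ * h = x * (τ * h * τ⁻¹) * τ by group, S2 _ (mul_mem hx hc), S2 _ hx, S1 _ hh,
      hs _ hx _ hc, hA x, hA x τ, add_assoc, ← map_add, ← h1 h hh, map_add, add_assoc]
  · have hc : τ * y * τ⁻¹ ∈ H := Subgroup.Normal.conj_mem inferInstance _ hy τ
    rw [show x * τ * (y * τ) = x * ((τ * y * τ⁻¹) * (τ * τ)) by group,
      S1 _ (mul_mem hx (mul_mem hc hττ)), S2 _ hx, S2 _ hy, hs _ hx _ (mul_mem hc hττ),
      hs _ hc _ hττ, ← h2]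
    have e1 : A (τ * y * τ⁻¹) z = z + A τ (s y) - s (τ * y * τ⁻¹) := by rw [h1 y hy]; abel
    have e2 : A (τ * y * τ⁻¹) (A τ z) = A τ (A y z) := by
      rw [← hA, ← hA, inv_mul_cancel_right]
    rw [map_add (A (τ * y * τ⁻¹)), e1, e2, hA x]
    simp only [map_add, map_sub]
    abel

namespace NumberField

variable {L : Type*} [Field L] [NumberField L]

variable {F : Type*} [Field F] [NumberField F] {E : Type*} [Field E] [NumberField E] [Algebra F E]
  [Algebra E L] [Algebra F L] [IsScalarTower F E L]

theorem IsSqrtExt.exists_lift_step {σ : E ≃+* E} {θ : E} {a : F} (h : IsSqrtExt F σ θ a)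
    [IsTotallyReal F] [IsTotallyReal E] (hU : Unramified F E) (h2 : TwoUnramified F)
    [IsGalois F L] [IsGalois E L] (hUL : Unramified E L) {G : Type*} [Group G] [Finite G]
    (p : G →* (L ≃ₐ[F] L)) (H : Subgroup G) (hH : H.index = 2) (q : H →* (L ≃ₐ[E] L))
    (hq : Function.Surjective q) (hpq : ∀ x y, p (x : H) y = q x y) (τ : G) (hτ : τ ∉ H)
    (hpτ : ∀ y : E, p τ (algebraMap E L y) = algebraMap E L (σ y)) (s : G → Additive Lˣ)
    (hs : ∀ x ∈ H, ∀ y ∈ H, s (x * y) = s x + mapUnits (p x : L ≃+* L) (s y))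
    (hk : ∀ x ∈ H, p x = 1 → mapUnits (p τ : L ≃+* L) (s (τ⁻¹ * x * τ)) = s x) :
    ∃ S : G → Additive Lˣ, (∀ x ∈ H, S x = s x) ∧
      ∀ x y, S (x * y) = S x + mapUnits (p x : L ≃+* L) (S y) := by
  have := Subgroup.normal_of_index_eq_two hH
  set A : G → Additive Lˣ →+ Additive Lˣ := fun g => mapUnits (p g : L ≃+* L) with hAdef
  have hA : ∀ g h m, A (g * h) m = A g (A h m) := fun g h m => by
    simp only [A, map_mul]; rfl
  set B : G → Div L →+ Div L := fun g => mapDiv (p g : L ≃+* L) with hBdef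
  have hB : ∀ g h m, B (g * h) m = B g (B h m) := fun g h m => by
    simp only [B, map_mul]
    exact mapDiv_mul (p g : L ≃+* L) (p h : L ≃+* L) m
  have hBA : ∀ g m, B g (principal L m) = principal L (A g m) := fun g m => mapDiv_principal _ _
  have hqA : ∀ x : H, mapUnits (q x : L ≃+* L) = A x := fun x => by
    have : (q x : L ≃+* L) = (p x : L ≃+* L) := RingEquiv.ext fun y => (hpq x y).symm
    rw [this]
  have hττ : τ * τ ∈ H := Subgroup.mul_self_mem_of_index_two hH τ
  have hconj : ∀ x ∈ H, τ⁻¹ * x * τ ∈ H := fun x hx => by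
    simpa using Subgroup.Normal.conj_mem inferInstance x hx τ⁻¹
  have hA1 : ∀ m, A 1 m = m := fun m => by simp only [A, map_one]; rfl
  -- comparison of `s` with its conjugate
  obtain ⟨u, hu⟩ := exists_coboundary q hq (fun x => A τ (s (τ⁻¹ * x * τ)) - s x) (by
    intro x y
    have e1 := hs _ (hconj x x.2) _ (hconj y y.2)
    have e2 := hs _ x.2 _ y.2
    rw [show τ⁻¹ * x * τ * (τ⁻¹ * y * τ) = τ⁻¹ * (x * y) * τ by group] at e1
    simp only [Subgroup.coe_mul]
    rw [e1, e2, hqA]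
    change A τ (s _ + A _ _) - (s x + A x _) = _
    rw [map_add, map_sub, ← hA, ← hA, show τ * (τ⁻¹ * x * τ) = x * τ by group]
    abel) (by
    intro x hx
    rw [sub_eq_zero]
    refine hk x x.2 ?_
    ext y
    rw [hpq, hx]; rfl)
  have hu' : ∀ x ∈ H, A τ (s (τ⁻¹ * x * τ)) - s x = A x u - u := fun x hx => by
    have := hu ⟨x, hx⟩
    rwa [hqA] at this
  -- the obstruction `w`
  set w := s (τ * τ) - u - A τ u with hw
  have hwH : ∀ x ∈ H, A x w = w := fun x hx => by
    have e1 := hu' x hx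
    have e2 := congrArg (A τ) (hu' _ (hconj x hx))
    have e3 := hs _ hx _ hττ
    have e4 := hs _ hττ _ (hconj _ (hconj x hx))
    rw [show τ * τ * (τ⁻¹ * (τ⁻¹ * x * τ) * τ) = x * (τ * τ) by group] at e4
    change _ = _ + A x _ at e3
    change _ = _ + A (τ * τ) _ at e4
    rw [map_sub, map_sub, ← hA, ← hA, show τ * (τ⁻¹ * x * τ) = x * τ by group] at e2
    rw [hw, map_sub, map_sub, ← hA]
    rw [e3] at e4
    have e5 : A x (s (τ * τ)) = s (τ * τ) + A (τ * τ) (s (τ⁻¹ * (τ⁻¹ * x * τ) * τ)) - s x := by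
      rw [← e4]; abel
    rw [e5]
    have e6 : A x u = A τ (s (τ⁻¹ * x * τ)) - s x + u := by rw [e1]; abel
    have e7 : A (x * τ) u = A (τ * τ) (s (τ⁻¹ * (τ⁻¹ * x * τ) * τ)) - A τ (s (τ⁻¹ * x * τ)) + A τ u := by
      rw [e2]; abel
    rw [e6, e7]
    abel
  have hwτ : A τ w = w := by
    have e1 := hu' _ hττ
    rw [show τ⁻¹ * (τ * τ) * τ = τ * τ by group] at e1
    rw [hw, map_sub, map_sub, ← hA]
    have e2 : A τ (s (τ * τ)) = s (τ * τ) + (A (τ * τ) u - u) := by rw [← e1]; abel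
    rw [e2]
    abel
  obtain ⟨w1, hw1⟩ : ∃ w1 : E, algebraMap E L w1 = (w.toMul : L) := by
    refine (IsGalois.mem_range_algebraMap_iff_fixed (F := E) (E := L) _).2 fun f => ?_
    obtain ⟨x, rfl⟩ := hq f
    have e1 := congrArg (fun z => ((z.toMul : Lˣ) : L)) (hwH x x.2)
    rw [← hpq]
    exact e1
  have hw1σ : σ w1 = w1 := by
    apply (algebraMap E L).injective
    rw [← hpτ, hw1]
    exact congrArg (fun z => ((z.toMul : Lˣ) : L)) hwτ
  obtain ⟨w0, rfl⟩ := (h.apply_ne w1).1 hw1σ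
  have hw0 : w0 ≠ 0 := by
    rintro rfl
    rw [map_zero, map_zero] at hw1
    exact w.toMul.ne_zero hw1.symm
  set W : Additive Fˣ := Additive.ofMul (Units.mk0 w0 hw0)
  have hW : inclUnits E L (inclUnits F E W) = w := addUnits_ext hw1
  -- the divisor whose norm is the divisor of `w`
  obtain ⟨D, hD⟩ := exists_coboundary_div (E := L)
    ((MulSemiringAction.toRingAut (L ≃ₐ[F] L) L).comp (p.comp H.subtype))
    (fun x => principal L (s x)) (fun x y => by
      simp only [Subgroup.coe_mul]
      rw [hs _ x.2 _ y.2, map_add]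
      congr 1
      exact (hBA _ _).symm)
  have hD' : ∀ x ∈ H, principal L (s x) = D - B x D := fun x hx => hD ⟨x, hx⟩
  set c := B τ D - D + principal L u with hc
  obtain ⟨d, hd⟩ := exists_pullDiv_eq_of_forall hUL c (fun f => by
    obtain ⟨x, rfl⟩ := hq f
    have hqB : mapDiv (q x : L ≃+* L) = B x := by
      have : (q x : L ≃+* L) = (p x : L ≃+* L) := RingEquiv.ext fun y => (hpq x y).symm
      rw [this]
    rw [hqB]
    have e1 := congrArg (principal L) (hu' x x.2)
    rw [map_sub, map_sub, ← hBA, ← hBA, hD' _ x.2, hD' _ (hconj x x.2), map_sub, ← hB,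
      show τ * (τ⁻¹ * x * τ) = x * τ by group, hB] at e1
    rw [hc, map_add, map_sub]
    have e2 : B x (principal L u) = B τ D - B x (B τ D) - (D - B x D) + principal L u := by
      rw [e1]; abel
    rw [e2]
    abel)
  have hcn : c + B τ c = - principal L w := by
    rw [hw, map_sub, map_sub, hD' _ hττ, hc, map_add, map_sub, ← hB, ← hBA]
    abel
  have hdn : normDiv σ (-d) = principal E (inclUnits F E W) := by
    apply pullDiv_injective (F := E) (E := L)
    rw [pullDiv_principal, hW, map_neg, map_neg, normDiv_apply, map_add,
      ← mapDiv_pullDiv_of_comm hUL (p τ : L ≃+* L) σ hpτ, hd, neg_eq_iff_eq_neg]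
    exact hcn
  obtain ⟨v, hv⟩ := h.exists_norm_eq hU h2 W _ hdn
  have hAσ : A τ (inclUnits E L v) = inclUnits E L (mapUnits σ v) := addUnits_ext (hpτ _)
  have hHv : ∀ x ∈ H, A x (inclUnits E L v) = inclUnits E L v := fun x hx => addUnits_ext (by
    change p ((⟨x, hx⟩ : H) : G) (algebraMap E L _) = algebraMap E L _
    rw [hpq]
    exact AlgEquiv.commutes _ _)
  refine exists_crossedHom_extension A hA H hH τ hτ s hs (u + inclUnits E L v) (fun x hx => ?_) ?_
  · have hc : τ * x * τ⁻¹ ∈ H := Subgroup.Normal.conj_mem inferInstance _ hx τ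
    have e1 := hu' _ hc
    rw [show τ⁻¹ * (τ * x * τ⁻¹) * τ = x by group] at e1
    rw [map_add, hHv _ hc]
    have e2 : A τ (s x) = A (τ * x * τ⁻¹) u - u + s (τ * x * τ⁻¹) := by rw [← e1]; abel
    rw [e2]
    abel
  · have e1 : inclUnits E L v + inclUnits E L (mapUnits σ v) = w := by
      rw [← hW, ← hv, normUnits_apply, map_add]
    rw [map_add, hAσ]
    have e2 : inclUnits E L (mapUnits σ v) = w - inclUnits E L v := by rw [← e1]; abel
    rw [e2, hw]
    abel

end NumberField
end Lifting

section Lifting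

open IsDedekindDomain HeightOneSpectrum Module IntermediateField

namespace NumberField

/-- In an unramified totally real Galois 2-extension every sign character of the kernel extends to
a crossed homomorphism. -/
theorem exists_lift.{u, v} {L : Type u} [Field L] [NumberField L] [IsTotallyReal L] (n : ℕ) :
    ∀ (F : Type u) [Field F] [NumberField F] [Algebra F L] [IsGalois F L] (_ : Unramified F L)
      (_ : TwoUnramified F) (_ : finrank F L = 2 ^ n) {G : Type v} [Group G] [Finite G]
      (p : G →* (L ≃ₐ[F] L)) (_ : Function.Surjective p) (k : G → Additive Lˣ)
      (_ : ∀ x y, p x = 1 → p y = 1 → k (x * y) = k x + k y)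
      (_ : ∀ x, p x = 1 → ∀ g : L ≃+* L, mapUnits g (k x) = k x)
      (_ : ∀ x, p x = 1 → ∀ g, k (g * x * g⁻¹) = k x),
      ∃ s : G → Additive Lˣ, (∀ x, p x = 1 → s x = k x) ∧
        ∀ x y, s (x * y) = s x + mapUnits (p x : L ≃+* L) (s y) := by
  induction n with
  | zero =>
    intro F _ _ _ _ _ _ hF G _ _ p _ k hk _ _
    have hc : Nat.card (L ≃ₐ[F] L) = 1 := by rw [IsGalois.card_aut_eq_finrank, hF, pow_zero]
    have := (Nat.card_eq_one_iff_unique.1 hc).1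
    have h1 : ∀ x, p x = 1 := fun x => Subsingleton.elim _ _
    refine ⟨k, fun _ _ => rfl, fun x y => ?_⟩
    rw [hk x y (h1 x) (h1 y), h1 x]
    rfl
  | succ n ih =>
    intro F _ _ _ _ hU h2 hF G _ _ p hp k hk hk2 hk3
    have hc : Nat.card (L ≃ₐ[F] L) = 2 ^ (n + 1) := by rw [IsGalois.card_aut_eq_finrank, hF]
    obtain ⟨N, hN⟩ := Sylow.exists_subgroup_card_pow_prime (G := L ≃ₐ[F] L) 2 (n := n)
      (hc ▸ pow_dvd_pow 2 n.le_succ)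
    have hNi : N.index = 2 := by
      have h3 := N.card_mul_index
      rw [hN, hc, pow_succ] at h3
      exact Nat.eq_of_mul_eq_mul_left (Nat.two_pow_pos n) h3
    let E : IntermediateField F L := fixedField N
    have hEL : finrank E L = 2 ^ n := by rw [finrank_fixedField_eq_card, hN]
    have hFE : finrank F E = 2 := by
      have h3 := finrank_mul_finrank F E L
      rw [hF, hEL, pow_succ, mul_comm] at h3
      exact Nat.eq_of_mul_eq_mul_left (Nat.two_pow_pos n) h3
    have hfix : E.fixingSubgroup = N := fixingSubgroup_fixedField N
    have : NumberField E := NumberField.of_module_finite F E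
    have : IsTotallyReal E := IsTotallyReal.of_algebra E L
    have : IsTotallyReal F := IsTotallyReal.of_algebra F L
    obtain ⟨hU1, hU2⟩ := (unramified_trans_iff (F := F) (M := E) (E := L)).1 hU
    obtain ⟨σ, θ, a, h⟩ := IsSqrtExt.exists_of_finrank hFE
    obtain ⟨τ, hτ⟩ := hp (σ.liftNormal L)
    have hpτ : ∀ y : E, p τ (algebraMap E L y) = algebraMap E L (σ y) := fun y => by
      rw [hτ]; exact σ.liftNormal_commutes L y
    let H : Subgroup G := N.comap p
    have hH : H.index = 2 := by
      rw [Subgroup.index_comap_of_surjective _ hp, hNi]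
    have := Subgroup.normal_of_index_eq_two hH
    have hHE : ∀ x ∈ H, ∀ y : E, p x y = y := fun x hx y => by
      have h3 : p x ∈ E.fixingSubgroup := by rw [hfix]; exact hx
      exact h3 y
    have hτH : τ ∉ H := fun h3 => h.ne_one (RingEquiv.ext fun y => by
      have h4 := hHE τ h3 y
      apply (algebraMap E L).injective
      exact (hpτ y).symm.trans h4)
    let q : H →* (L ≃ₐ[E] L) := MonoidHom.mk'
      (fun x => { (p x : L ≃+* L) with commutes' := fun y => hHE x x.2 y })
      (fun x y => by
        ext z
        change p ((x * y : H) : G) z = p x (p y z)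
        rw [Subgroup.coe_mul, map_mul]; rfl)
    have hpq : ∀ x y, p (x : H) y = q x y := fun x y => rfl
    have hq : Function.Surjective q := fun f => by
      obtain ⟨x, hx⟩ := hp (f.restrictScalars F)
      have hxH : x ∈ H := by
        change p x ∈ N
        rw [← hfix, hx]
        exact fun y => f.commutes y
      refine ⟨⟨x, hxH⟩, AlgEquiv.ext fun y => ?_⟩
      rw [← hpq]
      exact DFunLike.congr_fun hx y
    have hq1 : ∀ x : H, q x = 1 → p x = 1 := fun x hx => AlgEquiv.ext fun y => by
      rw [hpq, hx]; rfl
    obtain ⟨s, hs1, hs2⟩ := ih E hU2 (hU1.twoUnramified h2) hEL q hq (fun x => k x)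
      (fun x y hx hy => hk x y (hq1 x hx) (hq1 y hy)) (fun x hx => hk2 x (hq1 x hx))
      (fun x hx g => hk3 x (hq1 x hx) g)
    classical
    let s' : G → Additive Lˣ := fun x => if hx : x ∈ H then s ⟨x, hx⟩ else 0
    have hs' : ∀ x (hx : x ∈ H), s' x = s ⟨x, hx⟩ := fun x hx => dif_pos hx
    have h1H : ∀ x, p x = 1 → x ∈ H := fun x hx => by
      change p x ∈ N
      rw [hx]; exact one_mem N
    have hs'1 : ∀ x, p x = 1 → s' x = k x := fun x hx => by
      rw [hs' x (h1H x hx)]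
      refine hs1 _ ?_
      ext y
      rw [← hpq, hx]; rfl
    obtain ⟨S, hS1, hS2⟩ := h.exists_lift_step hU1 h2 hU2 p H hH q hq hpq τ hτH hpτ s'
      (fun x hx y hy => by
        rw [hs' _ (mul_mem hx hy), hs' _ hx, hs' _ hy]
        exact hs2 ⟨x, hx⟩ ⟨y, hy⟩)
      (fun x hx hx1 => by
        have h3 : p (τ⁻¹ * x * τ) = 1 := by rw [map_mul, map_mul, hx1, mul_one, ← map_mul]; simp
        rw [hs'1 _ h3, hs'1 _ hx1, hk2 _ h3]
        simpa using hk3 x hx1 τ⁻¹)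
    exact ⟨S, fun x hx => by rw [hS1 x (h1H x hx), hs'1 x hx], hS2⟩

end NumberField
end Lifting

section GolodShafarevich

variable {Γ : Type*} [Group Γ]

local notation "𝔽" => ZMod 2

/-- The group of pairs `(y, g)` with `π y = g - 1`, a subgroup of a semidirect product. -/
def RelGroup {d : ℕ} (π : (Fin d → MonoidAlgebra 𝔽 Γ) →ₗ[MonoidAlgebra 𝔽 Γ] MonoidAlgebra 𝔽 Γ) :
    Type _ :=
  {q : (Fin d → MonoidAlgebra 𝔽 Γ) × Γ // π q.1 = MonoidAlgebra.of 𝔽 Γ q.2 - 1}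

namespace RelGroup

variable {d : ℕ} {π : (Fin d → MonoidAlgebra 𝔽 Γ) →ₗ[MonoidAlgebra 𝔽 Γ] MonoidAlgebra 𝔽 Γ}

@[ext] theorem ext {x y : RelGroup π} (h1 : x.1.1 = y.1.1) (h2 : x.1.2 = y.1.2) : x = y :=
  Subtype.ext (Prod.ext h1 h2)

noncomputable instance : Group (RelGroup π) where
  mul x y := ⟨(x.1.1 + MonoidAlgebra.of 𝔽 Γ x.1.2 • y.1.1, x.1.2 * y.1.2), by
    rw [map_add, map_smul, x.2, y.2, map_mul, smul_eq_mul]; noncomm_ring⟩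
  one := ⟨(0, 1), by rw [map_zero, map_one, sub_self]⟩
  inv x := ⟨(-(MonoidAlgebra.of 𝔽 Γ x.1.2⁻¹ • x.1.1), x.1.2⁻¹), by
    rw [map_neg, map_smul, x.2, smul_eq_mul, mul_sub, ← map_mul, inv_mul_cancel, map_one]
    noncomm_ring⟩
  mul_assoc x y z := ext
    (by
      change x.1.1 + _ • y.1.1 + MonoidAlgebra.of 𝔽 Γ (x.1.2 * y.1.2) • z.1.1 =
        x.1.1 + _ • (y.1.1 + _ • z.1.1)
      rw [map_mul, mul_smul, smul_add, add_assoc])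
    (mul_assoc _ _ _)
  one_mul x := ext
    (by
      change 0 + MonoidAlgebra.of 𝔽 Γ 1 • x.1.1 = _
      rw [map_one, one_smul, zero_add])
    (one_mul _)
  mul_one x := ext
    (by
      change x.1.1 + _ • (0 : Fin d → MonoidAlgebra 𝔽 Γ) = _
      rw [smul_zero, add_zero])
    (mul_one _)
  inv_mul_cancel x := ext
    (by
      change -(_ • x.1.1) + _ • x.1.1 = 0
      rw [neg_add_cancel])
    (inv_mul_cancel _)

variable (π) in
/-- The projection to `Γ`. -/
def proj : RelGroup π →* Γ where
  toFun x := x.1.2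
  map_one' := rfl
  map_mul' _ _ := rfl

theorem fst_mul (x y : RelGroup π) :
    (x * y).1.1 = x.1.1 + MonoidAlgebra.of 𝔽 Γ (proj π x) • y.1.1 := rfl

theorem proj_apply (x : RelGroup π) : proj π x = x.1.2 := rfl

theorem mem_ker {x : RelGroup π} (hx : proj π x = 1) : x.1.1 ∈ LinearMap.ker π := by
  rw [LinearMap.mem_ker, x.2, ← proj_apply, hx, map_one, sub_self]

theorem fst_conj {x : RelGroup π} (hx : proj π x = 1) (g : RelGroup π) :
    (g * x * g⁻¹).1.1 = MonoidAlgebra.of 𝔽 Γ (proj π g) • x.1.1 := by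
  have h1 : proj π (g * x * g⁻¹) = 1 := by simp [hx]
  have h2 : ((g * x * g⁻¹) * g).1.1 = (g * x).1.1 := by rw [inv_mul_cancel_right]
  rw [fst_mul, fst_mul, h1, map_one, one_smul, add_comm] at h2
  exact add_left_cancel h2

instance [Finite Γ] : Finite (RelGroup π) := by
  have : Module.Finite 𝔽 (MonoidAlgebra 𝔽 Γ) := Module.Finite.of_basis
    (MonoidAlgebra.basis Γ 𝔽)
  have : Finite (MonoidAlgebra 𝔽 Γ) := Module.finite_of_finite 𝔽
  exact Subtype.finite

theorem proj_surjective (hπ : LinearMap.range π = augSMul ⊤) : Function.Surjective (proj π) := by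
  intro g
  have := of_smul_sub_mem_augSMul g
    (Submodule.mem_top (R := MonoidAlgebra 𝔽 Γ) (x := (1 : MonoidAlgebra 𝔽 Γ)))
  rw [smul_eq_mul, mul_one, ← hπ] at this
  obtain ⟨y, hy⟩ := this
  exact ⟨⟨(y, g), hy⟩, rfl⟩

/-- A functional on the relation module which extends to a homomorphism vanishes. -/
theorem eq_zero_of_extends (hπ : LinearMap.range π = augSMul ⊤) (hker : LinearMap.ker π ≤ augSMul ⊤)
    (φ : Module.Dual 𝔽 (Fin d → MonoidAlgebra 𝔽 Γ))
    (χ : RelGroup π → 𝔽)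
    (hχ : ∀ x y, χ (x * y) = χ x + χ y) (hχφ : ∀ x, proj π x = 1 → χ x = φ x.1.1) :
    ∀ y ∈ LinearMap.ker π, φ y = 0 := by
  choose l hl using proj_surjective hπ
  let b := MonoidAlgebra.basis Γ 𝔽
  have hb : ∀ g, b g = MonoidAlgebra.of 𝔽 Γ g := fun g => rfl
  let X := b.constr 𝔽 fun g => χ (l g) - φ (l g).1.1
  let Y := b.constr 𝔽 fun g => (l g).1.1
  let π' : (Fin d → MonoidAlgebra 𝔽 Γ) →ₗ[𝔽] MonoidAlgebra 𝔽 Γ := π.restrictScalars 𝔽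
  let ψ : Module.Dual 𝔽 (Fin d → MonoidAlgebra 𝔽 Γ) := X.comp π' + φ
  have hX : ∀ g, X (MonoidAlgebra.of 𝔽 Γ g) = χ (l g) - φ (l g).1.1 := fun g => by
    rw [← hb, Module.Basis.constr_basis]
  have hY : ∀ g, Y (MonoidAlgebra.of 𝔽 Γ g) = (l g).1.1 := fun g => by
    rw [← hb, Module.Basis.constr_basis]
  have hdiff : ∀ x y : RelGroup π, proj π x = proj π y → χ x - φ x.1.1 = χ y - φ y.1.1 := by
    intro x y hxy
    have h1 : proj π (x * y⁻¹) = 1 := by simp [hxy]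
    have h2 : x.1.1 = (x * y⁻¹).1.1 + y.1.1 := by
      have : ((x * y⁻¹) * y).1.1 = x.1.1 := by rw [inv_mul_cancel_right]
      rw [fst_mul, h1, map_one, one_smul] at this
      exact this.symm
    have h3 : χ x = χ (x * y⁻¹) + χ y := by rw [← hχ, inv_mul_cancel_right]
    rw [h2, h3, hχφ _ h1, map_add]
    ring
  have h10 : χ 1 = 0 := by simpa using hχ 1 1
  have hψ : ∀ x : RelGroup π, ψ x.1.1 = χ x := by
    intro x
    have h1 : π' x.1.1 = MonoidAlgebra.of 𝔽 Γ x.1.2 - MonoidAlgebra.of 𝔽 Γ 1 := by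
      rw [map_one]; exact x.2
    rw [LinearMap.add_apply, LinearMap.comp_apply, h1, map_sub, hX, hX,
      hdiff (l x.1.2) x (hl _), hdiff (l 1) 1 (hl _), h10]
    have : φ (1 : RelGroup π).1.1 = 0 := map_zero φ
    rw [this]
    ring
  have hψ2 : ∀ (g : Γ) (x : RelGroup π), ψ (MonoidAlgebra.of 𝔽 Γ g • x.1.1) = ψ x.1.1 := by
    intro g x
    have h1 := hψ (l g * x)
    rw [fst_mul, hl, map_add, hψ, hχ] at h1
    rw [hψ]
    exact add_left_cancel h1
  have haug : ∀ m, MonoidAlgebra.lift 𝔽 𝔽 Γ (1 : Γ →* 𝔽) (π m) = 0 := by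
    intro m
    have h1 : π m ∈ augSMul (⊤ : Submodule (MonoidAlgebra 𝔽 Γ) (MonoidAlgebra 𝔽 Γ)) := by
      rw [← hπ]
      exact ⟨m, rfl⟩
    refine Submodule.span_induction (p := fun a _ => MonoidAlgebra.lift 𝔽 𝔽 Γ (1 : Γ →* 𝔽) a = 0)
      ?_ (map_zero _) (fun _ _ _ _ h h' => by rw [map_add, h, h', add_zero])
      (fun a x _ h => by rw [smul_eq_mul, map_mul, h, mul_zero]) h1
    rintro _ ⟨g, m, -, rfl⟩
    rw [smul_eq_mul, map_sub, map_mul, MonoidAlgebra.lift_of, MonoidHom.one_apply, one_mul,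
      sub_self]
  have hπY : ∀ a, π' (Y a) = a - MonoidAlgebra.lift 𝔽 𝔽 Γ (1 : Γ →* 𝔽) a • 1 := by
    intro a
    have : π'.comp Y = LinearMap.id -
        ((MonoidAlgebra.lift 𝔽 𝔽 Γ (1 : Γ →* 𝔽)).toLinearMap).smulRight 1 := by
      refine b.ext fun g => ?_
      rw [LinearMap.comp_apply, hb, hY, LinearMap.sub_apply, LinearMap.id_apply,
        LinearMap.smulRight_apply, AlgHom.toLinearMap_apply, MonoidAlgebra.lift_of,
        MonoidHom.one_apply, one_smul]
      have := (l g).2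
      rw [← proj_apply, hl] at this
      exact this
    exact LinearMap.congr_fun this a
  have hinv : ∀ (g : Γ) m, ψ (MonoidAlgebra.of 𝔽 Γ g • m) = ψ m := by
    intro g m
    let T : (Fin d → MonoidAlgebra 𝔽 Γ) →ₗ[𝔽] (Fin d → MonoidAlgebra 𝔽 Γ) :=
      DistribSMul.toLinearMap 𝔽 _ (MonoidAlgebra.of 𝔽 Γ g)
    have h1 : ∀ a, ψ (T (Y a)) = ψ (Y a) := by
      intro a
      have : (ψ.comp T).comp Y = ψ.comp Y := by
        refine b.ext fun h => ?_
        rw [LinearMap.comp_apply, LinearMap.comp_apply, LinearMap.comp_apply, hb, hY]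
        exact hψ2 g _
      exact LinearMap.congr_fun this a
    have h2 : m - Y (π' m) ∈ LinearMap.ker π := by
      change π' (m - Y (π' m)) = 0
      rw [map_sub, hπY]
      have : MonoidAlgebra.lift 𝔽 𝔽 Γ (1 : Γ →* 𝔽) (π' m) = 0 := haug m
      rw [this, zero_smul, sub_zero, sub_self]
    have h3 : ψ (T (m - Y (π' m))) = ψ (m - Y (π' m)) :=
      hψ2 g ⟨(m - Y (π' m), 1), by rw [map_one, sub_self]; exact h2⟩
    rw [map_sub, map_sub, map_sub, h1] at h3
    exact sub_left_injective h3
  intro y hy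
  have hz : ∀ z ∈ augSMul (⊤ : Submodule (MonoidAlgebra 𝔽 Γ) (Fin d → MonoidAlgebra 𝔽 Γ)), ψ z = 0 := by
    have hlin : ∀ a m, ψ (a • m) = MonoidAlgebra.lift 𝔽 𝔽 Γ (1 : Γ →* 𝔽) a * ψ m := by
      intro a m
      have : ψ.comp ((LinearMap.toSpanSingleton (MonoidAlgebra 𝔽 Γ) _ m).restrictScalars 𝔽) =
          ((MonoidAlgebra.lift 𝔽 𝔽 Γ (1 : Γ →* 𝔽)).toLinearMap).smulRight (ψ m) := by
        refine b.ext fun g => ?_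
        rw [LinearMap.comp_apply, hb, LinearMap.smulRight_apply, AlgHom.toLinearMap_apply,
          MonoidAlgebra.lift_of, MonoidHom.one_apply, one_smul]
        exact hinv g m
      exact LinearMap.congr_fun this a
    intro z hz
    refine Submodule.span_induction (p := fun z _ => ψ z = 0) ?_ (map_zero _)
      (fun _ _ _ _ h h' => by rw [map_add, h, h', add_zero])
      (fun a x _ h => by rw [hlin, h, mul_zero]) hz
    rintro _ ⟨g, m, -, rfl⟩
    rw [map_sub, hinv, sub_self]
  have h1 := hz y (hker hy)
  have h2 : π' y = 0 := hy
  rwa [LinearMap.add_apply, LinearMap.comp_apply, h2, map_zero, zero_add] at h1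

end RelGroup

/-- A finite 2-group with `k` independent characters has an extension by an elementary abelian
2-group on whose kernel many invariant characters do not extend. -/
theorem exists_extension.{u} {Γ : Type u} [Group Γ] [Finite Γ] (hΓ : IsPGroup 2 Γ) (k : ℕ)
    (hk : 2 ≤ k) (χ : Fin k → Γ → 𝔽) (hχ : ∀ j g h, χ j (g * h) = χ j g + χ j h)
    (hind : ∀ c : Fin k → 𝔽, (∀ g, ∑ j, c j * χ j g = 0) → c = 0) :
    ∃ (G : Type u) (_ : Group G) (_ : Finite G) (p : G →* Γ) (s : ℕ)
      (Φ : (Fin s → 𝔽) →+ (G → 𝔽)), Function.Surjective p ∧ k ^ 2 < 4 * s ∧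
      (∀ c x y, p x = 1 → p y = 1 → Φ c (x * y) = Φ c x + Φ c y) ∧
      (∀ c x, p x = 1 → ∀ g, Φ c (g * x * g⁻¹) = Φ c x) ∧
      ∀ c (f : G → 𝔽), (∀ x y, f (x * y) = f x + f y) → (∀ x, p x = 1 → f x = Φ c x) → c = 0 := by
  obtain ⟨d, s, π, Φ, hs, hπ, hker, h1, h2⟩ := exists_presentation hΓ k hk χ hχ hind
  refine ⟨RelGroup π, inferInstance, inferInstance, RelGroup.proj π, s,
    { toFun := fun c x => Φ c x.1.1
      map_zero' := by funext; simp
      map_add' := fun c c' => by funext; simp }, RelGroup.proj_surjective hπ, hs, ?_, ?_, ?_⟩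
  · intro c x y hx hy
    change Φ c (x * y).1.1 = Φ c x.1.1 + Φ c y.1.1
    rw [RelGroup.fst_mul, hx, map_one, one_smul, map_add]
  · intro c x hx g
    change Φ c (g * x * g⁻¹).1.1 = Φ c x.1.1
    rw [RelGroup.fst_conj hx, ← sub_eq_zero, ← map_sub]
    exact h1 c _ (of_smul_sub_mem_augSMul _ (RelGroup.mem_ker hx))
  · intro c f hf hfc
    exact h2 c (RelGroup.eq_zero_of_extends hπ hker (Φ c) f hf hfc)

end GolodShafarevich

section Lifting

open IsDedekindDomain HeightOneSpectrum Module IntermediateField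

namespace NumberField

variable {L : Type*} [Field L] [NumberField L]

/-- The sign homomorphism. -/
noncomputable def signUnits (L : Type*) [Field L] : ZMod 2 →+ Additive Lˣ :=
  ZMod.lift 2 ⟨zmultiplesHom _ (Additive.ofMul (-1)), by
    change (2 : ℤ) • Additive.ofMul (-1 : Lˣ) = 0
    rw [← ofMul_zpow]
    norm_num⟩

theorem signUnits_one : signUnits L 1 = Additive.ofMul (-1) := by
  have := ZMod.lift_coe 2 (A := Additive Lˣ) ⟨zmultiplesHom _ (Additive.ofMul (-1)), by
    change (2 : ℤ) • Additive.ofMul (-1 : Lˣ) = 0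
    rw [← ofMul_zpow]
    norm_num⟩ 1
  simpa [signUnits] using this

theorem two_nsmul_signUnits (c : ZMod 2) : 2 • signUnits L c = 0 := by
  rw [← map_nsmul, show 2 • c = 0 by revert c; decide, map_zero]

theorem mapUnits_signUnits (g : L ≃+* L) (c : ZMod 2) : mapUnits g (signUnits L c) = signUnits L c := by
  obtain rfl | rfl : c = 0 ∨ c = 1 := by revert c; decide
  · simp
  · rw [signUnits_one]
    exact addUnits_ext (by
      change g ((-1 : Lˣ) : L) = ((-1 : Lˣ) : L)
      simp)

theorem signUnits_injective : Function.Injective (signUnits L) := by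
  refine (injective_iff_map_eq_zero _).2 fun c hc => ?_
  obtain rfl | rfl : c = 0 ∨ c = 1 := (by decide : ∀ c : ZMod 2, c = 0 ∨ c = 1) c
  · rfl
  · rw [signUnits_one] at hc
    have h1 : (-1 : L) = 1 := congrArg (fun z => ((z.toMul : Lˣ) : L)) hc
    norm_num at h1

theorem exists_signUnits_eq {x : Additive Lˣ} (hx : 2 • x = 0) : ∃ c, x = signUnits L c := by
  have h1 : (x.toMul : L) ^ 2 = 1 := congrArg (fun z => ((z.toMul : Lˣ) : L)) hx
  rcases mul_self_eq_one_iff.1 ((pow_two _).symm.trans h1) with h | h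
  · exact ⟨0, addUnits_ext (by rw [map_zero]; exact h)⟩
  · exact ⟨1, addUnits_ext (by rw [signUnits_one]; exact h)⟩

/-- The elements whose conjugates agree up to squares. -/
def conjSquares (F L : Type*) [Field F] [Field L] [Algebra F L] : AddSubgroup (Additive Lˣ) where
  carrier := {a | ∀ g : L ≃ₐ[F] L, mapUnits (g : L ≃+* L) a - a ∈ AddSubgroup.doubles (Additive Lˣ)}
  zero_mem' := fun g => by rw [map_zero, sub_zero]; exact zero_mem _
  add_mem' {a b} ha hb := fun g => by
    rw [map_add, add_sub_add_comm]
    exact add_mem (ha g) (hb g)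
  neg_mem' {a} ha := fun g => by
    rw [map_neg, neg_sub_neg, ← neg_sub]
    exact neg_mem (ha g)

theorem exists_mem_conjSquares.{u} {F L : Type u} [Field F] [NumberField F] [Field L] [NumberField L]
    [IsTotallyReal L] [Algebra F L] [IsGalois F L] (hU : Unramified F L) (h2 : TwoUnramified F)
    (n : ℕ) (hn : finrank F L = 2 ^ n) (k : ℕ) (hk : 2 ≤ k) (χ : Fin k → (L ≃ₐ[F] L) → ZMod 2)
    (hχ : ∀ j g h, χ j (g * h) = χ j g + χ j h)
    (hind : ∀ c : Fin k → ZMod 2, (∀ g, ∑ j, c j * χ j g = 0) → c = 0)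
    (V : AddSubgroup (Additive Lˣ)) (T : Type*) [Finite T] (f : Additive Lˣ → T)
    (hf : ∀ a ∈ conjSquares F L, ∀ b ∈ conjSquares F L, f a = f b →
      ∃ x, a - b - inclUnits F L x ∈ V) (hT : ∀ s, k ^ 2 < 4 * s → Nat.card T < 2 ^ s) :
    ∃ v ∈ V, v ∈ conjSquares F L ∧ v ∉ AddSubgroup.doubles (Additive Lˣ) := by
  have hΓ : IsPGroup 2 (L ≃ₐ[F] L) :=
    IsPGroup.of_card (n := n) (by rw [IsGalois.card_aut_eq_finrank, hn])
  obtain ⟨G, _, _, p, s, Φ, hp, hs, h3, h4, h5⟩ := exists_extension hΓ k hk χ hχ hind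
  let Comp : (Fin s → ZMod 2) → Additive Lˣ → Prop := fun c a => ∃ t : G → Additive Lˣ,
    (∀ x, p x = 1 → t x = signUnits L (Φ c x)) ∧
    (∀ x y, t (x * y) = t x + mapUnits (p x : L ≃+* L) (t y)) ∧
    ∀ x, mapUnits (p x : L ≃+* L) a - a = 2 • t x
  have hex : ∀ c, ∃ a, Comp c a := by
    intro c
    obtain ⟨t, ht1, ht2⟩ := exists_lift n F hU h2 hn p hp (fun x => signUnits L (Φ c x))
      (fun x y hx hy => by rw [h3 c x y hx hy, map_add]) (fun x _ g => mapUnits_signUnits g _)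
      (fun x hx g => by rw [h4 c x hx])
    obtain ⟨u, hu⟩ := exists_coboundary p hp (fun x => 2 • t x) (fun x y => by
      simp only [ht2, nsmul_add, map_nsmul]) (fun x hx => by
      simp only [ht1 x hx, two_nsmul_signUnits])
    exact ⟨u, t, ht1, ht2, fun x => (hu x).symm⟩
  have hsub : ∀ c a c' a', Comp c a → Comp c' a' → Comp (c - c') (a - a') := by
    rintro c a c' a' ⟨t, ht1, ht2, ht3⟩ ⟨t', ht1', ht2', ht3'⟩
    refine ⟨fun x => t x - t' x, fun x hx => ?_, fun x y => ?_, fun x => ?_⟩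
    · simp only [ht1 x hx, ht1' x hx, map_sub, Pi.sub_apply]
    · simp only [ht2, ht2', map_sub]; abel
    · rw [map_sub, nsmul_sub, ← ht3, ← ht3']; abel
  have hincl : ∀ c a x, Comp c a → Comp c (a - inclUnits F L x) := by
    rintro c a x ⟨t, ht1, ht2, ht3⟩
    refine ⟨t, ht1, ht2, fun g => ?_⟩
    have : mapUnits (p g : L ≃+* L) (inclUnits F L x) = inclUnits F L x :=
      addUnits_ext ((p g).commutes _)
    rw [map_sub, this, ← ht3]; abel
  have hmem : ∀ c a, Comp c a → a ∈ conjSquares F L := by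
    rintro c a ⟨t, ht1, ht2, ht3⟩ g
    obtain ⟨x, rfl⟩ := hp g
    rw [ht3]
    exact ⟨t x, rfl⟩
  have hzero : ∀ c a, Comp c a → a ∈ AddSubgroup.doubles (Additive Lˣ) → c = 0 := by
    rintro c a ⟨t, ht1, ht2, ht3⟩ ⟨b, hb⟩
    have hb' : a = 2 • b := hb.symm
    subst hb'
    let A : G → Additive Lˣ := fun x => t x - (mapUnits (p x : L ≃+* L) b - b)
    have hA : ∀ x, 2 • A x = 0 := fun x => by
      simp only [A]
      rw [nsmul_sub, ← ht3, map_nsmul, nsmul_sub, sub_self]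
    choose χ' hχ' using fun x => exists_signUnits_eq (hA x)
    refine h5 c χ' (fun x y => signUnits_injective (L := L) ?_) (fun x hx => signUnits_injective (L := L) ?_)
    · rw [map_add, ← hχ', ← hχ', ← mapUnits_signUnits (p x : L ≃+* L), ← hχ']
      simp only [A, ht2, map_mul, map_sub]
      change _ - (mapUnits (p x : L ≃+* L) (mapUnits (p y : L ≃+* L) b) - b) = _
      abel
    · rw [← hχ']
      simp only [A, ht1 x hx, hx]
      change _ - (b - b) = _
      rw [sub_self, sub_zero]
  choose a ha using hex
  have hcard : Nat.card T < Nat.card (Fin s → ZMod 2) := by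
    have := hT s hs
    simpa using this
  obtain ⟨c, c', hne, heq⟩ : ∃ c c', c ≠ c' ∧ f (a c) = f (a c') := by
    by_contra! hcon
    have : Function.Injective fun c => f (a c) := fun c c' h => by
      by_contra hne
      exact hcon c c' hne h
    exact absurd (Nat.card_le_card_of_injective _ this) (not_le.2 hcard)
  obtain ⟨x, hx⟩ := hf _ (hmem _ _ (ha c)) _ (hmem _ _ (ha c')) heq
  have hC := hincl _ _ x (hsub _ _ _ _ (ha c) (ha c'))
  exact ⟨_, hx, hmem _ _ hC, fun h => hne (sub_eq_zero.1 (hzero _ _ hC h))⟩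

end NumberField
end Lifting

section Labels

open IsDedekindDomain HeightOneSpectrum Module

theorem AddSubgroup.exists_label_prod {A : Type*} [AddCommGroup A] (S E V R : AddSubgroup A) (hR : R ≤ S)
    {T₁ T₂ : Type*} (f₁ : A → T₁) (h₁ : ∀ a ∈ S, ∀ b ∈ S, f₁ a = f₁ b → ∃ r ∈ R, a - b - r ∈ E)
    (f₂ : A → T₂) (h₂ : ∀ a ∈ S ⊓ E, ∀ b ∈ S ⊓ E, f₂ a = f₂ b → a - b ∈ V) :
    ∃ f : A → T₁ × T₂, ∀ a ∈ S, ∀ b ∈ S, f a = f b → ∃ r ∈ R, a - b - r ∈ V := by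
  classical
  have hrep : ∀ t : T₁, ∃ c ∈ S, (∃ a ∈ S, f₁ a = t) → f₁ c = t := fun t => by
    by_cases h : ∃ a ∈ S, f₁ a = t
    · obtain ⟨a, ha, hat⟩ := h
      exact ⟨a, ha, fun _ => hat⟩
    · exact ⟨0, zero_mem _, fun h' => (h h').elim⟩
  choose c hcS hc using hrep
  choose! r hr hrE using fun a (ha : a ∈ S) => h₁ a ha (c (f₁ a)) (hcS _) (hc _ ⟨a, ha, rfl⟩).symm
  refine ⟨fun a => (f₁ a, f₂ (a - c (f₁ a) - r a)), fun a ha b hb hab => ⟨r a - r b, sub_mem (hr a ha) (hr b hb), ?_⟩⟩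
  obtain ⟨e1, e2⟩ := Prod.mk.inj hab
  have := h₂ _ ⟨S.sub_mem (S.sub_mem ha (hcS _)) (hR (hr a ha)), hrE a ha⟩ _
    ⟨S.sub_mem (S.sub_mem hb (hcS _)) (hR (hr b hb)), hrE b hb⟩ e2
  rw [e1] at this
  convert this using 1
  abel

namespace NumberField

variable {F L : Type*} [Field F] [NumberField F] [Field L] [NumberField L] [Algebra F L]

theorem mem_conjSquares {a : Additive Lˣ} : a ∈ conjSquares F L ↔
    ∀ g : L ≃ₐ[F] L, ∃ s : L, s ≠ 0 ∧ g (a.toMul : L) = (a.toMul : L) * s ^ 2 := by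
  refine forall_congr' fun g => ?_
  rw [mem_doubles_units]
  change IsSquare (((mapUnits (g : L ≃+* L) a).toMul / a.toMul : Lˣ) : L) ↔ _
  rw [Units.val_div_eq_div_val, coe_mapUnits]
  change IsSquare (g (a.toMul : L) / _) ↔ _
  have ha : (a.toMul : L) ≠ 0 := a.toMul.ne_zero
  have hg : g (a.toMul : L) ≠ 0 := by simp
  constructor
  · rintro ⟨s, hs⟩
    have hs' : g (a.toMul : L) = (a.toMul : L) * s ^ 2 := by
      rw [div_eq_iff ha] at hs
      rw [hs]; ring
    exact ⟨s, fun h0 => hg (by rw [hs', h0]; ring), hs'⟩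
  · rintro ⟨s, hs, h⟩
    exact ⟨s, by rw [h]; field_simp⟩

theorem range_inclUnits_le_conjSquares : (inclUnits F L).range ≤ conjSquares F L := by
  rintro _ ⟨x, rfl⟩ g
  have : mapUnits (g : L ≃+* L) (inclUnits F L x) = inclUnits F L x :=
    addUnits_ext (g.commutes _)
  rw [this, sub_self]
  exact zero_mem _

/-- Parities of the orders are constant along the fibres, hence descend. -/
theorem exists_label_even [IsGalois F L] (hU : Unramified F L) :
    ∃ f : Additive Lˣ → Div F ⧸ classDoubles F, ∀ a ∈ conjSquares F L, ∀ b ∈ conjSquares F L, f a = f b →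
      ∃ r ∈ (inclUnits F L).range, a - b - r ∈ evenUnits L := by
  classical
  have key : ∀ a ∈ conjSquares F L, ∃ k : Div F,
      principal L a - pullDiv F L k ∈ AddSubgroup.doubles (Div L) := by
    intro a ha
    let D : Div L := (principal L a).mapRange (fun n => n % 2) rfl
    obtain ⟨k, hk⟩ := exists_pullDiv_eq_of_forall hU D fun g => by
      ext P
      obtain ⟨Q, rfl⟩ := (mapPrime (g : L ≃+* L)).surjective P
      rw [mapDiv_apply_mapPrime]
      obtain ⟨s, hs, h⟩ := mem_conjSquares.1 ha g
      have h1 := ord_mapPrime (g : L ≃+* L) Q (a.toMul : L)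
      change ord _ (g (a.toMul : L)) = _ at h1
      rw [h, ord_mul _ a.toMul.ne_zero (pow_ne_zero 2 hs), ord_pow] at h1
      simp only [D, Finsupp.mapRange_apply, principal_apply]
      omega
    refine ⟨k, mem_doubles_div.2 fun P => ?_⟩
    rw [hk]
    simp only [D, Finsupp.sub_apply, Finsupp.mapRange_apply, Int.even_iff]
    omega
  choose! k hk using key
  refine ⟨fun a => QuotientAddGroup.mk (k a), fun a ha b hb hab => ?_⟩
  have h1 := QuotientAddGroup.eq.1 hab.symm
  obtain ⟨_, ⟨x, rfl⟩, d, hd, hxd⟩ := AddSubgroup.mem_sup.1 h1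
  refine ⟨_, ⟨x, rfl⟩, ?_⟩
  rw [evenUnits_eq_comap, AddSubgroup.mem_comap, map_sub, map_sub, ← pullDiv_principal]
  have h2 : pullDiv F L d ∈ AddSubgroup.doubles (Div L) := by
    obtain ⟨e, rfl⟩ := hd
    exact ⟨pullDiv F L e, (map_nsmul (pullDiv F L) 2 e).symm⟩
  have h3 : k a = k b + (principal F x + d) := by rw [hxd]; abel
  have h4 := add_mem (sub_mem (hk a ha) (hk b hb)) h2
  rw [h3, map_add, map_add] at h4
  convert h4 using 1
  abel

theorem exists_label_sign [IsGalois F L] :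
    ∃ f : Additive Lˣ → (F →+* ℝ) → Prop, ∀ a ∈ conjSquares F L, ∀ b ∈ conjSquares F L, f a = f b →
      a - b ∈ totallyPositive L := by
  have key : ∀ a ∈ conjSquares F L, ∀ φ ψ : L →+* ℝ, φ.comp (algebraMap F L) = ψ.comp (algebraMap F L) →
      0 < φ (a.toMul : L) → 0 < ψ (a.toMul : L) := by
    intro a ha φ ψ h hφ
    obtain ⟨g, hg⟩ := ComplexEmbedding.exists_comp_symm_eq_of_comp_eq (k := F) (K := L)
      (Complex.ofRealHom.comp φ) (Complex.ofRealHom.comp ψ) (by rw [RingHom.comp_assoc, h, RingHom.comp_assoc])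
    have hgx : ∀ x, φ (g.symm x) = ψ x := fun x => Complex.ofReal_injective (RingHom.congr_fun hg x)
    obtain ⟨s, hs, h⟩ := mem_conjSquares.1 ha g.symm
    rw [← hgx, h, map_mul, map_pow]
    have : φ s ≠ 0 := by simpa using hs
    positivity
  refine ⟨fun a φ => ∃ ψ : L →+* ℝ, ψ.comp (algebraMap F L) = φ ∧ 0 < ψ (a.toMul : L), fun a ha b hb hab =>
    sub_mem_totallyPositive _ _ (funext fun φ => propext ?_)⟩
  have h1 := congrFun hab (φ.comp (algebraMap F L))
  constructor
  · intro h
    obtain ⟨ψ, hψ, hψb⟩ := h1.mp ⟨φ, rfl, h⟩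
    exact key b hb ψ φ hψ hψb
  · intro h
    obtain ⟨ψ, hψ, hψb⟩ := h1.mpr ⟨φ, rfl, h⟩
    exact key a ha ψ φ hψ hψb

theorem coe_mul_ringOfIntegers (a b : 𝓞 L) : ((a * b : 𝓞 L) : L) = (a : L) * b :=
  map_mul (algebraMap (𝓞 L) L) a b

/-- The residue in a normal form at two depends only on the square class. -/
theorem TwoUnramified.sub_mem_of_mul_sq (h : TwoUnramified L) {y y' : 𝓞 L} {w : L}
    (hw : ((1 + 2 * y' : 𝓞 L) : L) = ((1 + 2 * y : 𝓞 L) : L) * w ^ 2) :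
    y' - y ∈ Ideal.span {(2 : 𝓞 L)} := by
  obtain ⟨r, hr⟩ : ∃ r : 𝓞 L, (r : L) = w * ((1 + 2 * y : 𝓞 L) : L) := by
    have hInt : IsIntegral (𝓞 L) (w * ((1 + 2 * y : 𝓞 L) : L)) := by
      refine IsIntegral.of_pow two_pos ?_
      have : (w * ((1 + 2 * y : 𝓞 L) : L)) ^ 2 = (((1 + 2 * y') * (1 + 2 * y) : 𝓞 L) : L) := by
        rw [coe_mul_ringOfIntegers, hw]; ring
      rw [this]
      exact isIntegral_algebraMap
    obtain ⟨r, hr⟩ := IsIntegrallyClosed.isIntegral_iff.1 hInt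
    exact ⟨r, hr⟩
  have hr2 : r ^ 2 = (1 + 2 * y') * (1 + 2 * y) := by
    apply RingOfIntegers.ext
    rw [pow_two, coe_mul_ringOfIntegers, coe_mul_ringOfIntegers, hr, hw]; ring
  have h1 : r - 1 ∈ Ideal.span {(2 : 𝓞 L)} := h.mem_of_sq_mem (by
    rw [Ideal.mem_span_singleton]
    exact ⟨y + y' + 2 * y * y' - r + 1, by linear_combination hr2⟩)
  obtain ⟨q, hq⟩ := Ideal.mem_span_singleton.1 h1
  have hq' : r = 1 + 2 * q := by rw [← hq]; ring
  rw [hq'] at hr2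
  have h2 : (2 : 𝓞 L) * (y' - y) = 2 * (2 * (q + q ^ 2 - y - y * y')) := by linear_combination - hr2
  rw [mul_right_inj' two_ne_zero] at h2
  exact Ideal.mem_span_singleton.2 ⟨_, h2⟩

theorem exists_label_two [IsGalois F L] (hU : Unramified F L) (h2 : TwoUnramified L) :
    ∃ f : Additive Lˣ → 𝓞 F ⧸ Ideal.span {(2 : 𝓞 F)}, ∀ a ∈ conjSquares F L ⊓ evenUnits L,
      ∀ b ∈ conjSquares F L ⊓ evenUnits L, f a = f b → a - b ∈ squareAtTwo L := by
  obtain ⟨c, hc⟩ := hU.exists_trace_eq_one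
  have key : ∀ a ∈ conjSquares F L ⊓ evenUnits L, ∃ z : L, z ≠ 0 ∧ ∃ (y : 𝓞 L) (x : 𝓞 F),
      (a.toMul : L) * z ^ 2 = ((1 + 2 * y : 𝓞 L) : L) ∧
      y - algebraMap (𝓞 F) (𝓞 L) x ∈ Ideal.span {(2 : 𝓞 L)} := by
    rintro a ⟨haS, haE⟩
    obtain ⟨z, hz, y, hy⟩ := h2.exists_normal_form (mem_evenAtTwo.2 fun P _ => mem_evenUnits.1 haE P)
    have hg : ∀ g : L ≃ₐ[F] L, ∃ q : 𝓞 L, g (y : L) = y + 2 * (q : L) := by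
      intro g
      obtain ⟨s, hs, h⟩ := mem_conjSquares.1 haS g
      let y' : 𝓞 L := RingOfIntegers.mapRingEquiv (g : L ≃+* L) y
      have hy' : (y' : L) = g (y : L) := rfl
      have e : ∀ t : 𝓞 L, ((1 + 2 * t : 𝓞 L) : L) = 1 + 2 * (t : L) := fun t => by
        simp [coe_two]
      have := h2.sub_mem_of_mul_sq (y := y) (y' := y') (w := s * g z / z) (by
        have h3 : g ((a.toMul : L) * z ^ 2) = g ((1 + 2 * y : 𝓞 L) : L) := by rw [hy]
        rw [e, hy']
        rw [map_mul, map_pow, h, e, map_add, map_one, map_mul, map_ofNat] at h3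
        rw [← h3, ← hy]
        field_simp)
      obtain ⟨q, hq⟩ := Ideal.mem_span_singleton.1 this
      refine ⟨q, ?_⟩
      have := congrArg (algebraMap (𝓞 L) L) hq
      rw [map_sub, map_mul, map_ofNat] at this
      rw [← hy']
      linear_combination this
    choose q hq using hg
    have hInt : IsIntegral (𝓞 F) (Algebra.trace F L ((c * y : 𝓞 L) : L)) :=
      IsIntegral.tower_top (Algebra.isIntegral_trace (RingOfIntegers.isIntegral_coe (c * y)))
    obtain ⟨x, hx⟩ := IsIntegrallyClosed.isIntegral_iff.1 hInt
    refine ⟨z, hz, y, x, hy, Ideal.mem_span_singleton.2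
      ⟨-∑ g : L ≃ₐ[F] L, RingOfIntegers.mapRingEquiv (g : L ≃+* L) c * q g, ?_⟩⟩
    apply RingOfIntegers.ext
    have h4 : algebraMap F L (Algebra.trace F L (c : L)) = 1 := by rw [hc, map_one]
    rw [trace_eq_sum_automorphisms] at h4
    have h5 : ((algebraMap (𝓞 F) (𝓞 L) x : 𝓞 L) : L) = ∑ g : L ≃ₐ[F] L, g (c : L) * (y + 2 * (q g : L)) := by
      change algebraMap F L (x : F) = _
      have hx' : (x : F) = Algebra.trace F L ((c * y : 𝓞 L) : L) := hx
      rw [hx', trace_eq_sum_automorphisms]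
      refine Finset.sum_congr rfl fun g _ => ?_
      rw [coe_mul_ringOfIntegers, map_mul, hq]
    change algebraMap (𝓞 L) L (y - algebraMap (𝓞 F) (𝓞 L) x) = algebraMap (𝓞 L) L (2 * _)
    rw [map_sub, map_mul, map_neg, map_sum]
    change (y : L) - ((algebraMap (𝓞 F) (𝓞 L) x : 𝓞 L) : L) = _
    rw [h5]
    simp only [mul_add, Finset.sum_add_distrib, ← Finset.sum_mul, h4, map_mul (algebraMap (𝓞 L) L), map_ofNat,
      Finset.mul_sum, mul_neg]
    rw [one_mul, sub_add_cancel_left, neg_inj]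
    refine Finset.sum_congr rfl fun g _ => ?_
    change _ = 2 * (g (c : L) * (q g : L))
    ring
  choose! z hz y x hy hyx using key
  refine ⟨fun a => Ideal.Quotient.mk _ (x a), fun a ha b hb hab =>
    sub_mem_squareAtTwo (hz a ha) (hz b hb) (hy a ha) (hy b hb) ?_⟩
  have h1 := Ideal.mem_map_of_mem (algebraMap (𝓞 F) (𝓞 L)) ((Ideal.Quotient.eq).1 hab)
  rw [Ideal.map_span, Set.image_singleton, map_sub, map_ofNat] at h1
  have h3 := add_mem (sub_mem (hyx a ha) (hyx b hb)) h1
  convert h3 using 1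
  ring

/-- The square classes whose roots generate totally real unramified extensions. -/
noncomputable def unramifiedSquares (L : Type*) [Field L] [NumberField L] : AddSubgroup (Additive Lˣ) :=
  evenUnits L ⊓ totallyPositive L ⊓ squareAtTwo L

theorem exists_label_unramifiedSquares [IsGalois F L] (hU : Unramified F L) (h2 : TwoUnramified L) :
    ∃ f : Additive Lˣ → (Div F ⧸ classDoubles F) × ((F →+* ℝ) → Prop) × (𝓞 F ⧸ Ideal.span {(2 : 𝓞 F)}),
      ∀ a ∈ conjSquares F L, ∀ b ∈ conjSquares F L, f a = f b →
        ∃ x, a - b - inclUnits F L x ∈ unramifiedSquares L := by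
  obtain ⟨f₁, h₁⟩ := exists_label_even (F := F) (L := L) hU
  obtain ⟨f₂, h₂⟩ := exists_label_sign (F := F) (L := L)
  obtain ⟨f₃, h₃⟩ := exists_label_two (F := F) (L := L) hU h2
  obtain ⟨f, hf⟩ := AddSubgroup.exists_label_prod (conjSquares F L) (evenUnits L) (unramifiedSquares L)
    _ range_inclUnits_le_conjSquares f₁ h₁ (fun a => (f₂ a, f₃ a)) fun a ha b hb hab =>
      ⟨⟨(evenUnits L).sub_mem ha.2 hb.2, h₂ a ha.1 b hb.1 (Prod.mk.inj hab).1⟩, h₃ a ha b hb (Prod.mk.inj hab).2⟩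
  refine ⟨f, fun a ha b hb hab => ?_⟩
  obtain ⟨_, ⟨x, rfl⟩, hx⟩ := hf a ha b hb hab
  exact ⟨x, hx⟩

end NumberField

end Labels

section QuadraticStep

open IsDedekindDomain HeightOneSpectrum Module

namespace NumberField

theorem IsSqrtExt.isGalois {F L E : Type*} [Field F] [NumberField F] [Field L] [NumberField L] [Field E]
    [NumberField E] [Algebra F L] [Algebra L E] [Algebra F E] [IsScalarTower F L E] [IsGalois F L]
    {σ : E ≃+* E} {θ : E} {v : L} (h : IsSqrtExt L σ θ v)
    (hv : ∀ g : L ≃ₐ[F] L, ∃ s : L, g v = v * s ^ 2) : IsGalois F E := by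
  let Ω := AlgebraicClosure E
  let ι : E →ₐ[F] Ω := IsScalarTower.toAlgHom F E Ω
  have key : ∀ f : E →ₐ[F] Ω, f.fieldRange ≤ ι.fieldRange := by
    rintro f _ ⟨y, rfl⟩
    let g := (f.comp (IsScalarTower.toAlgHom F L E)).restrictNormal' L
    have hg : ∀ x : L, f (algebraMap L E x) = ι (algebraMap L E (g x)) := fun x => by
      have := (f.comp (IsScalarTower.toAlgHom F L E)).restrictNormal_commutes L x
      exact this.symm
    obtain ⟨s, hs⟩ := hv g
    have hθ : f θ = ι (θ * algebraMap L E s) ∨ f θ = - ι (θ * algebraMap L E s) := by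
      apply sq_eq_sq_iff_eq_or_eq_neg.1
      rw [← map_pow, h.sq, hg, hs, ← map_pow, mul_pow, h.sq, map_mul, map_pow]
    obtain ⟨u, w, rfl⟩ := h.span y
    change f _ ∈ _
    rw [map_add, map_mul, hg, hg]
    refine add_mem ⟨_, rfl⟩ (mul_mem ⟨_, rfl⟩ ?_)
    rcases hθ with hθ | hθ <;> rw [hθ]
    · exact ⟨_, rfl⟩
    · exact neg_mem ⟨_, rfl⟩
  have : FiniteDimensional F E := Module.Finite.trans L E
  have : Algebra.IsAlgebraic F Ω := Algebra.IsAlgebraic.trans F E Ω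
  have : Normal F Ω := normal_iff.2 fun x => ⟨Algebra.IsIntegral.isIntegral x, IsAlgClosed.splits _⟩
  have hN : Normal F ι.fieldRange := IntermediateField.normal_iff_forall_fieldRange_le.2 fun τ => by
    rintro _ ⟨⟨_, y, rfl⟩, rfl⟩
    exact key (τ.comp (AlgEquiv.ofInjectiveField ι).toAlgHom) ⟨y, rfl⟩
  let e : ι.fieldRange ≃ₐ[F] E := (AlgEquiv.ofInjectiveField ι).symm
  have : Normal F E := Normal.of_algEquiv e
  exact ⟨⟩

theorem exists_quadratic_step.{u} {F L : Type u} [Field F] [NumberField F] [Field L] [NumberField L]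
    [IsTotallyReal L] [Algebra F L] [IsGalois F L] (hU : Unramified F L)
    {v : Additive Lˣ} (hv : v ∈ unramifiedSquares L) (hc : v ∈ conjSquares F L)
    (hn : v ∉ AddSubgroup.doubles (Additive Lˣ)) :
    ∃ (E : Type u) (_ : Field E) (_ : NumberField E) (_ : Algebra F E), IsTotallyReal E ∧ IsGalois F E ∧
      Unramified F E ∧ finrank F E = 2 * finrank F L := by
  obtain ⟨⟨hv1, hv2⟩, hv3⟩ := hv
  obtain ⟨E, _, _, _, σ, θ, h⟩ := exists_isSqrtExt (fun hs => hn (mem_doubles_units.2 hs))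
  let : Algebra F E := ((algebraMap L E).comp (algebraMap F L)).toAlgebra
  have : IsScalarTower F L E := IsScalarTower.of_algebraMap_eq fun _ => rfl
  refine ⟨E, _, _, _, h.isTotallyReal hv2, h.isGalois fun g => ?_, unramified_trans_iff.2
    ⟨hU, h.unramified (mem_evenUnits.1 hv1) hv3⟩, ?_⟩
  · obtain ⟨s, -, hs⟩ := mem_conjSquares.1 hc g
    exact ⟨s, hs⟩
  · rw [← finrank_mul_finrank F L E, h.finrank_eq_two, mul_comm]

end NumberField

end QuadraticStep

section RationalBase

open IsDedekindDomain HeightOneSpectrum Module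

namespace NumberField

theorem principal_eq_single {F : Type*} [Field F] [NumberField F] {p : HeightOneSpectrum (𝓞 F)} {g : 𝓞 F}
    (hg : p.asIdeal = Ideal.span {g}) {x : Additive Fˣ} (hx : (x.toMul : F) = g) :
    principal F x = Finsupp.single p 1 := by
  classical
  have hg0 : g ≠ 0 := by
    rintro rfl
    exact p.ne_bot (by rw [hg]; simp)
  ext Q
  rw [principal_apply, hx]
  by_cases hQ : Q = p
  · subst hQ
    rw [Finsupp.single_eq_same]
    refine le_antisymm ?_ ?_
    · by_contra! hlt
      have h2 := (le_ord_coe_iff Q hg0 2).1 (by exact_mod_cast hlt)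
      rw [hg, Ideal.span_singleton_pow, Ideal.mem_span_singleton] at h2
      obtain ⟨c, hc⟩ := h2
      have h3 : g * c = 1 := mul_left_cancel₀ hg0 (by linear_combination -hc)
      exact Q.isPrime.ne_top (by rw [hg]; exact Ideal.span_singleton_eq_top.2 (IsUnit.of_mul_eq_one c h3))
    · exact_mod_cast (le_ord_coe_iff Q hg0 1).2 (by rw [pow_one, hg]; exact Ideal.mem_span_singleton_self g)
  · rw [Finsupp.single_eq_of_ne hQ]
    refine ord_coe_eq_zero Q fun hgQ => hQ ?_
    have h1 : p.asIdeal ≤ Q.asIdeal := by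
      rw [hg]; exact (Ideal.span_singleton_le_iff_mem _).2 hgQ
    exact (HeightOneSpectrum.ext (p.isMaximal.eq_of_le Q.isPrime.ne_top h1)).symm

theorem exists_principal_rat (f : Div ℚ) : ∃ x, principal ℚ x = f := by
  have : IsPrincipalIdealRing (𝓞 ℚ) :=
    IsPrincipalIdealRing.of_surjective Rat.ringOfIntegersEquiv.symm.toRingHom Rat.ringOfIntegersEquiv.symm.surjective
  suffices H : (principal ℚ).range = ⊤ from AddMonoidHom.range_eq_top.1 H f
  rw [eq_top_iff]
  rintro f -
  induction f using Finsupp.induction_linear with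
  | zero => exact zero_mem _
  | add f g hf hg => exact add_mem hf hg
  | single p n =>
    have : Finsupp.single p n = n • (Finsupp.single p 1 : Div ℚ) := by
      rw [Finsupp.smul_single, smul_eq_mul, mul_one]
    rw [this]
    refine AddSubgroup.zsmul_mem _ ?_ _
    obtain ⟨g, hg⟩ := IsPrincipalIdealRing.principal p.asIdeal
    rw [Ideal.submodule_span_eq] at hg
    have hg0 : (g : ℚ) ≠ 0 := by
      rw [RingOfIntegers.coe_ne_zero_iff]
      rintro rfl
      exact p.ne_bot (by rw [hg]; simp)
    exact ⟨Additive.ofMul (Units.mk0 _ hg0), principal_eq_single hg rfl⟩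

theorem mem_doubles_rat_of_pos {x : Additive ℚˣ} (hx : x ∈ evenUnits ℚ) (h0 : 0 < (x.toMul : ℚ)) :
    x ∈ AddSubgroup.doubles (Additive ℚˣ) := by
  rw [evenUnits_eq_comap] at hx
  obtain ⟨f, hf⟩ := hx
  obtain ⟨y, rfl⟩ := exists_principal_rat f
  have h1 : principal ℚ (x - 2 • y) = 0 := by
    rw [map_sub, map_nsmul, sub_eq_zero]; exact hf.symm
  obtain ⟨u, hu⟩ := (principal_eq_zero_iff _).1 h1
  have hpos : 0 < (((x - 2 • y).toMul : ℚˣ) : ℚ) := by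
    change 0 < ((x.toMul / y.toMul ^ 2 : ℚˣ) : ℚ)
    rw [Units.val_div_eq_div_val, Units.val_pow_eq_pow_val]
    have : (y.toMul : ℚ) ≠ 0 := y.toMul.ne_zero
    positivity
  have h2 : (((x - 2 • y).toMul : ℚˣ) : ℚ) = 1 := by
    rcases Int.isUnit_iff.1 ((u.map Rat.ringOfIntegersEquiv.toMonoidHom).isUnit) with h | h
    · have h3 : (u : 𝓞 ℚ) = 1 := Rat.ringOfIntegersEquiv.injective (by rw [map_one]; exact h)
      rw [← hu, h3]; exact map_one (algebraMap (𝓞 ℚ) ℚ)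
    · have h3 : (u : 𝓞 ℚ) = -1 := Rat.ringOfIntegersEquiv.injective (by rw [map_neg, map_one]; exact h)
      rw [← hu, h3] at hpos
      have h4 : ((-1 : 𝓞 ℚ) : ℚ) = -1 := by
        have := map_neg (algebraMap (𝓞 ℚ) ℚ) 1
        rw [map_one] at this; exact this
      rw [h4] at hpos
      norm_num at hpos
  have h3 : x - 2 • y = 0 := addUnits_ext h2
  exact ⟨y, (sub_eq_zero.1 h3).symm⟩

/-- The prime of `ℚ` generated by a prime number. -/
noncomputable def primeRat (q : ℕ) (hq : q.Prime) : HeightOneSpectrum (𝓞 ℚ) :=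
  have hp : Prime (q : 𝓞 ℚ) := by
    rw [← MulEquiv.prime_iff Rat.ringOfIntegersEquiv]
    simpa using Nat.prime_iff_prime_int.1 hq
  ⟨Ideal.span {(q : 𝓞 ℚ)}, (Ideal.span_singleton_prime hp.ne_zero).2 hp, by simpa using hp.ne_zero⟩

theorem mem_iff_eq_primeRat {q : ℕ} (hq : q.Prime) (p : HeightOneSpectrum (𝓞 ℚ)) :
    (q : 𝓞 ℚ) ∈ p.asIdeal ↔ p = primeRat q hq := by
  constructor
  · intro h
    have h1 : (primeRat q hq).asIdeal ≤ p.asIdeal := (Ideal.span_singleton_le_iff_mem _).2 h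
    exact (HeightOneSpectrum.ext ((primeRat q hq).isMaximal.eq_of_le p.isPrime.ne_top h1)).symm
  · rintro rfl
    exact Ideal.mem_span_singleton_self _

theorem primeRat_injective {q q' : ℕ} (hq : q.Prime) (hq' : q'.Prime) (h : primeRat q hq = primeRat q' hq') :
    q = q' := by
  have h1 : (q : 𝓞 ℚ) ∈ (primeRat q' hq').asIdeal := (mem_iff_eq_primeRat hq _).2 h.symm
  have h2 : (q' : 𝓞 ℚ) ∣ q := Ideal.mem_span_singleton.1 h1
  have h3 := map_dvd Rat.ringOfIntegersEquiv h2
  rw [map_natCast, map_natCast, Int.natCast_dvd_natCast] at h3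
  exact ((Nat.prime_dvd_prime_iff_eq hq' hq).1 h3).symm

theorem coe_natCast_ringOfIntegers {F : Type*} [Field F] (q : ℕ) : (((q : 𝓞 F)) : F) = q :=
  map_natCast (algebraMap (𝓞 F) F) q

open Classical in
theorem ord_natCast_rat {q : ℕ} (hq : q.Prime) (p : HeightOneSpectrum (𝓞 ℚ)) :
    ord p (q : ℚ) = if p = primeRat q hq then 1 else 0 := by
  have hq0 : (q : ℚ) ≠ 0 := by exact_mod_cast hq.ne_zero
  have := principal_eq_single (p := primeRat q hq) rfl (x := Additive.ofMul (Units.mk0 _ hq0))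
    (coe_natCast_ringOfIntegers q).symm
  have h1 := DFunLike.congr_fun this p
  rw [principal_apply, Finsupp.single_apply] at h1
  simpa [eq_comm] using h1

end NumberField

end RationalBase

section QuadraticBase

open IsDedekindDomain HeightOneSpectrum Module

namespace NumberField

variable {ι : Type*} [Fintype ι] {q : ι → ℕ} {F : Type*} [Field F] [NumberField F] {σ : F ≃+* F} {θ : F}

open Classical in
theorem ord_prod_primes (hq : ∀ i, (q i).Prime) (S : Finset ι) (p : HeightOneSpectrum (𝓞 ℚ)) :
    ord p (∏ i ∈ S, (q i : ℚ)) = ∑ i ∈ S, if p = primeRat (q i) (hq i) then 1 else 0 := by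
  rw [ord_prod S _ (fun i _ => by exact_mod_cast (hq i).ne_zero)]
  exact Finset.sum_congr rfl fun i _ => ord_natCast_rat (hq i) p

open Classical in
theorem ord_prod_primeRat (hq : ∀ i, (q i).Prime) (hinj : Function.Injective q) (S : Finset ι) (i : ι) :
    ord (primeRat (q i) (hq i)) (∏ i ∈ S, (q i : ℚ)) = if i ∈ S then 1 else 0 := by
  rw [ord_prod_primes hq]
  have key : ∀ j, primeRat (q i) (hq i) = primeRat (q j) (hq j) ↔ i = j := fun j =>
    ⟨fun h => hinj (primeRat_injective _ _ h), by rintro rfl; rfl⟩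
  simp [key]

theorem not_isSquare_prod (hq : ∀ i, (q i).Prime) (hinj : Function.Injective q) [Nonempty ι] :
    ¬ IsSquare (∏ i, (q i : ℚ)) := by
  classical
  rintro ⟨x, hx⟩
  obtain ⟨i⟩ := ‹Nonempty ι›
  have h1 := ord_prod_primeRat hq hinj Finset.univ i
  have hx0 : x ≠ 0 := by
    rintro rfl
    rw [mul_zero, Finset.prod_eq_zero_iff] at hx
    obtain ⟨j, -, hj⟩ := hx
    exact (hq j).ne_zero (by exact_mod_cast hj)
  rw [hx, ord_mul _ hx0 hx0, if_pos (Finset.mem_univ _)] at h1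
  omega

theorem isSquareMod_of_mod_four {F : Type*} [Field F] [NumberField F] {n : ℕ} (hn : n % 4 = 1) :
    IsSquareMod (Ideal.span {(2 : 𝓞 F)}) (Ideal.span {4}) (n : F) := by
  obtain ⟨m, rfl⟩ : ∃ m, n = 4 * m + 1 := ⟨n / 4, by omega⟩
  refine ⟨1, one_ne_zero, ((4 * m + 1 : ℕ) : 𝓞 F), 1, ?_, ?_, ?_⟩
  · rw [one_pow, mul_one, coe_natCast_ringOfIntegers]
  · rw [Ideal.isCoprime_span_singleton_iff]
    refine ⟨1, -(2 * m), ?_⟩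
    push_cast; ring
  · rw [Ideal.mem_span_singleton]
    refine ⟨m, ?_⟩
    push_cast; ring

theorem isSquareMod_prod (h4 : ∀ i, q i % 4 = 1) :
    IsSquareMod (Ideal.span {(2 : 𝓞 ℚ)}) (Ideal.span {4}) (∏ i, (q i : ℚ)) := by
  have : (∏ i, q i) % 4 = 1 := by
    rw [Finset.prod_nat_mod]
    simp [h4]
  have := isSquareMod_of_mod_four (F := ℚ) this
  rwa [Nat.cast_prod] at this

theorem ram_eq_one_of_ne (hq : ∀ i, (q i).Prime) (h4 : ∀ i, q i % 4 = 1)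
    (h : IsSqrtExt ℚ σ θ (∏ i, (q i : ℚ))) (P : HeightOneSpectrum (𝓞 F))
    (hP : ∀ i, P.under (𝓞 ℚ) ≠ primeRat (q i) (hq i)) : ram ℚ P = 1 := by
  classical
  refine h.ram_eq_one_of_even P ?_ (isSquareMod_prod h4)
  rw [ord_prod_primes hq, Finset.sum_congr rfl fun i _ => if_neg (hP i)]
  simp

theorem twoUnramified_of_isSqrtExt (hq : ∀ i, (q i).Prime) (h4 : ∀ i, q i % 4 = 1)
    (h : IsSqrtExt ℚ σ θ (∏ i, (q i : ℚ))) : TwoUnramified F := by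
  classical
  intro P
  have h1 := ord_algebraMap (F := ℚ) P 2
  have h2 := ord_natCast_rat Nat.prime_two (P.under (𝓞 ℚ))
  rw [Nat.cast_two] at h2
  rw [map_ofNat] at h1
  rw [h1, h2]
  split_ifs with h3
  · rw [ram_eq_one_of_ne hq h4 h P fun i hi => ?_]
    · simp
    · have := primeRat_injective _ _ (h3.symm.trans hi)
      have := h4 i
      omega
  · simp

theorem even_ord_prime (hq : ∀ i, (q i).Prime) (hinj : Function.Injective q)
    (h : IsSqrtExt ℚ σ θ (∏ i, (q i : ℚ))) (i : ι) (P : HeightOneSpectrum (𝓞 F)) : Even (ord P (q i : F)) := by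
  classical
  have h1 := ord_algebraMap (F := ℚ) P (q i : ℚ)
  rw [map_natCast, ord_natCast_rat (hq i)] at h1
  by_cases hi : P.under (𝓞 ℚ) = primeRat (q i) (hq i)
  · have h2 := ord_algebraMap (F := ℚ) P (∏ i, (q i : ℚ))
    rw [← h.sq, ord_pow, hi, ord_prod_primeRat hq hinj, if_pos (Finset.mem_univ _)] at h2
    rw [h1, if_pos hi, ← h2]
    exact ⟨_, by push_cast; ring⟩
  · rw [h1, if_neg hi, mul_zero]
    exact Even.zero

theorem IsSqrtExt.even_of_normUnits {F E : Type*} [Field F] [NumberField F] [Field E] [NumberField E]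
    [Algebra F E] {σ : E ≃+* E} {θ : E} {a : F} (h : IsSqrtExt F σ θ a) {x : Additive Eˣ}
    (hx : x ∈ evenUnits E) {c : Additive Fˣ} (hc : normUnits σ x = inclUnits F E c) : c ∈ evenUnits F := by
  rw [mem_evenUnits] at *
  intro p
  obtain ⟨P, rfl⟩ := under_surjective (F := F) (E := E) p
  have h1 : (x.toMul : E) * σ (x.toMul : E) = algebraMap F E (c.toMul : F) :=
    congrArg (fun z : Additive Eˣ => ((z.toMul : Eˣ) : E)) hc
  have h2 := ord_algebraMap P (c.toMul : F)
  have hσ : σ (x.toMul : E) ≠ 0 := by simp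
  rw [← h1, ord_mul P x.toMul.ne_zero hσ] at h2
  have h3 : ord P (σ (x.toMul : E)) = ord (mapPrime σ P) (x.toMul : E) := by
    have := ord_mapPrime σ (mapPrime σ P) (x.toMul : E)
    rwa [h.mapPrime_mapPrime] at this
  by_cases hP : mapPrime σ P = P
  · have hd := h.ram_dvd_two P
    have h4 := hx P
    rw [h3, hP] at h2
    rcases (Nat.dvd_prime Nat.prime_two).1 hd with hr | hr <;> rw [hr] at h2
    · exact ⟨ord P (x.toMul : E), by push_cast at h2; linarith⟩
    · have : ord P (x.toMul : E) = ord (P.under (𝓞 F)) (c.toMul : F) := by push_cast at h2; linarith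
      rwa [← this]
  · rw [h.ram_eq_one P hP, Nat.cast_one, one_mul] at h2
    rw [← h2, h3]
    exact (hx _).add (hx _)

theorem relIndex_doubles_evenUnits_le (hq : ∀ i, (q i).Prime) (h4 : ∀ i, q i % 4 = 1)
    (h : IsSqrtExt ℚ σ θ (∏ i, (q i : ℚ))) :
    (AddSubgroup.doubles (Additive Fˣ)).relIndex (evenUnits F) ≤ 2 * (2 * 2 ^ Fintype.card ι) := by
  classical
  choose c hc using fun a : Additive Fˣ => h.norm_mem (a.toMul : F)
  have hc0 : ∀ a, c a ≠ 0 := fun a h0 => by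
    have h1 := hc a
    rw [h0, map_zero] at h1
    have hσ : σ (a.toMul : F) ≠ 0 := by simp
    exact mul_ne_zero a.toMul.ne_zero hσ h1
  let d : Additive Fˣ → Additive ℚˣ := fun a => Additive.ofMul (Units.mk0 (c a) (hc0 a))
  have hd : ∀ a, normUnits σ a = inclUnits ℚ F (d a) := fun a => addUnits_ext (hc a)
  have hsub : ∀ x y : Additive ℚˣ, (0 < (x.toMul : ℚ)) = (0 < (y.toMul : ℚ)) →
      0 < (((x - y).toMul : ℚˣ) : ℚ) := fun x y hxy => by
    change 0 < ((x.toMul / y.toMul : ℚˣ) : ℚ)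
    rw [Units.val_div_eq_div_val]
    rcases lt_or_gt_of_ne y.toMul.ne_zero with h1 | h1
    · exact div_pos_of_neg_of_neg (lt_of_le_of_ne (not_lt.1 (hxy ▸ h1.not_gt)) x.toMul.ne_zero) h1
    · exact div_pos (hxy ▸ h1) h1
  let e : Additive Fˣ → Additive ℚˣ := fun a => if ha : ∃ x, inclUnits ℚ F x = a then ha.choose else 0
  have he : ∀ x, inclUnits ℚ F (e (inclUnits ℚ F x)) = inclUnits ℚ F x := fun x => by
    have hx : ∃ y, inclUnits ℚ F y = inclUnits ℚ F x := ⟨x, rfl⟩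
    simp only [e, dif_pos hx]
    exact hx.choose_spec
  obtain ⟨f, hf⟩ := AddSubgroup.exists_label_prod (evenUnits F) (inclUnits ℚ F).range
    (AddSubgroup.doubles (Additive Fˣ)) (AddSubgroup.doubles (Additive Fˣ))
    (by
      rw [evenUnits_eq_comap]
      rintro _ ⟨y, rfl⟩
      exact ⟨principal F y, (map_nsmul (principal F) 2 y).symm⟩)
    (fun a => (0 < ((d a).toMul : ℚ)))
    (by
      intro a ha b hb hab
      have h1 : normUnits σ (a - b) = inclUnits ℚ F (d a - d b) := by rw [map_sub, map_sub, hd, hd]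
      obtain ⟨y, hy⟩ := mem_doubles_rat_of_pos
        (h.even_of_normUnits ((evenUnits F).sub_mem ha hb) h1) (hsub _ _ hab)
      have hy' : d a - d b = 2 • y := hy.symm
      have h2 : a - b - inclUnits ℚ F y ∈ (normUnits σ).ker := by
        rw [AddMonoidHom.mem_ker, map_sub, h1, hy', map_nsmul, normUnits_apply]
        have : mapUnits σ (inclUnits ℚ F y) = inclUnits ℚ F y := addUnits_ext (h.fix _)
        rw [this]; abel
      rw [h.ker_normUnits] at h2
      obtain ⟨z, hz⟩ := h2
      refine ⟨2 • z, ⟨z, rfl⟩, y - d z, ?_⟩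
      rw [map_sub, ← hd, normUnits_apply]
      rw [deltaUnits_apply] at hz
      have : a - b = inclUnits ℚ F y + (z - mapUnits σ z) := by rw [hz]; abel
      rw [this, two_nsmul]; abel)
    (fun a => ((0 < ((e a).toMul : ℚ)), fun i => Even (ord (primeRat (q i) (hq i)) ((e a).toMul : ℚ))))
    (by
      rintro _ ⟨ha, x, rfl⟩ _ ⟨hb, y, rfl⟩ hab
      obtain ⟨h1, h2⟩ := Prod.mk.inj hab
      rw [← he x] at ha ⊢
      rw [← he y] at hb ⊢
      set x' := e (inclUnits ℚ F x)
      set y' := e (inclUnits ℚ F y)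
      rw [← map_sub]
      have hev : x' - y' ∈ evenUnits ℚ := mem_evenUnits.2 fun p => by
        obtain ⟨P, rfl⟩ := under_surjective (F := ℚ) (E := F) p
        have hord : ord (P.under (𝓞 ℚ)) (((x' - y').toMul : ℚˣ) : ℚ) =
            ord (P.under (𝓞 ℚ)) (x'.toMul : ℚ) - ord (P.under (𝓞 ℚ)) (y'.toMul : ℚ) := by
          have := DFunLike.congr_fun (map_sub (principal ℚ) x' y') (P.under (𝓞 ℚ))
          exact this
        by_cases hp : ∃ i, P.under (𝓞 ℚ) = primeRat (q i) (hq i)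
        · obtain ⟨i, hi⟩ := hp
          have h3 := congrFun h2 i
          rw [hord, Int.even_sub, hi]
          exact h3.to_iff
        · push Not at hp
          have h3 := mem_evenUnits.1 ((evenUnits F).sub_mem ha hb) P
          rw [← map_sub, coe_inclUnits, ord_algebraMap, ram_eq_one_of_ne hq h4 h P hp, Nat.cast_one, one_mul] at h3
          exact h3
      obtain ⟨z, hz⟩ := mem_doubles_rat_of_pos hev (hsub _ _ h1)
      refine ⟨inclUnits ℚ F z, ?_⟩
      rw [← hz]
      exact (map_nsmul (inclUnits ℚ F) 2 z).symm)
  have h5 := (AddSubgroup.relIndex_le_card_of_label (AddSubgroup.doubles (Additive Fˣ)) (evenUnits F) f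
    fun x hx y hy hxy => by
      obtain ⟨r, hr, h6⟩ := hf x hx y hy hxy
      have := add_mem h6 hr
      rwa [sub_add_cancel] at this).2
  simpa [Nat.card_prod, Nat.card_fun, Nat.card_eq_fintype_card] using h5

end NumberField

end QuadraticBase

section Tower

open IsDedekindDomain HeightOneSpectrum Module

namespace NumberField

variable {k : ℕ} {q : Fin (k + 1) → ℕ} {F : Type} [Field F] [NumberField F] {σ : F ≃+* F} {θ : F}

theorem finite_quotient_classDoubles : Finite (Div F ⧸ classDoubles F) :=
  Nat.finite_of_card_ne_zero index_classDoubles_ne_zero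

theorem index_classDoubles_le [IsTotallyReal F] (hq : ∀ i, (q i).Prime) (h4 : ∀ i, q i % 4 = 1)
    (h : IsSqrtExt ℚ σ θ (∏ i, (q i : ℚ))) : (classDoubles F).index ≤ 2 ^ (k + 1) := by
  have h1 := doubles_relIndex_evenUnits (F := F)
  have h2 := relIndex_doubles_evenUnits_le hq h4 h
  rw [h.finrank_eq_two] at h1
  rw [Fintype.card_fin] at h2
  omega

/-- A prime number as a unit of `ℚ`. -/
noncomputable def primeUnit (q : ℕ) (hq : q.Prime) : Additive ℚˣ :=
  Additive.ofMul (Units.mk0 (q : ℚ) (by exact_mod_cast hq.ne_zero))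

theorem coe_inclUnits_primeUnit {L : Type*} [Field L] [NumberField L] [Algebra F L] {n : ℕ} (hn : n.Prime) :
    ((inclUnits F L (inclUnits ℚ F (primeUnit n hn))).toMul : L) = n := by
  change algebraMap F L (algebraMap ℚ F (n : ℚ)) = _
  rw [map_natCast, map_natCast]

theorem primeUnit_mem_unramifiedSquares {L : Type*} [Field L] [NumberField L] [Algebra F L]
    (hq : ∀ i, (q i).Prime) (h4 : ∀ i, q i % 4 = 1) (hinj : Function.Injective q)
    (h : IsSqrtExt ℚ σ θ (∏ i, (q i : ℚ))) (i : Fin (k + 1)) :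
    inclUnits F L (inclUnits ℚ F (primeUnit (q i) (hq i))) ∈ unramifiedSquares L := by
  refine ⟨⟨mem_evenUnits.2 fun P => ?_, fun φ => ?_⟩, ?_⟩
  · rw [coe_inclUnits_primeUnit, ← map_natCast (algebraMap F L), ord_algebraMap]
    exact (even_ord_prime hq hinj h i _).mul_left _
  · rw [coe_inclUnits_primeUnit, map_natCast]
    exact_mod_cast (hq i).pos
  · change IsSquareMod _ _ _
    rw [coe_inclUnits_primeUnit]
    exact isSquareMod_of_mod_four (h4 i)

theorem inclUnits_injective {F L : Type*} [Field F] [NumberField F] [Field L] [NumberField L] [Algebra F L] :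
    Function.Injective (inclUnits F L) := fun _ _ hxy =>
  addUnits_ext ((algebraMap F L).injective (congrArg (fun z : Additive Lˣ => ((z.toMul : Lˣ) : L)) hxy))

open Classical in
theorem principal_primeUnit (hq : ∀ i, (q i).Prime) (hinj : Function.Injective q) (i j : Fin (k + 1)) :
    principal ℚ (primeUnit (q i) (hq i)) (primeRat (q j) (hq j)) = if i = j then 1 else 0 := by
  rw [principal_apply]
  change ord _ (q i : ℚ) = _
  rw [ord_natCast_rat (hq i)]
  refine if_congr ⟨fun h => (hinj (primeRat_injective _ _ h)).symm, ?_⟩ rfl rfl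
  rintro rfl
  rfl

/-- The products of a proper subfamily of the primes dividing the discriminant are not squares. -/
theorem eq_zero_of_two_nsmul (hq : ∀ i, (q i).Prime) (hinj : Function.Injective q)
    (h : IsSqrtExt ℚ σ θ (∏ i, (q i : ℚ))) (c : Fin k → ZMod 2) (y : Additive Fˣ)
    (hy : 2 • y = inclUnits ℚ F (∑ j, (c j).val • primeUnit (q j.castSucc) (hq j.castSucc))) : c = 0 := by
  classical
  set m := ∑ j, (c j).val • primeUnit (q j.castSucc) (hq j.castSucc)
  have h1 := h.mem_of_isSquare (b := m) (mem_doubles_units.1 ⟨y, hy⟩)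
  obtain ⟨_, ⟨w, rfl⟩, _, ⟨n, rfl⟩, hwn⟩ := AddSubgroup.mem_sup.1 h1
  have hunit : ∀ i, principal ℚ h.unit (primeRat (q i) (hq i)) = 1 := fun i => by
    rw [principal_apply]
    change ord _ (∏ i, (q i : ℚ)) = _
    rw [ord_prod_primeRat hq hinj, if_pos (Finset.mem_univ _)]
  have hP : ∀ i, principal ℚ m (primeRat (q i) (hq i)) =
      2 * principal ℚ w (primeRat (q i) (hq i)) + n := fun i => by
    have h2 : m = 2 • w + n • h.unit := hwn.symm
    rw [h2, map_add, map_nsmul, map_zsmul, Finsupp.add_apply, Finsupp.smul_apply, Finsupp.smul_apply, hunit]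
    simp
  have hm : ∀ i, principal ℚ m (primeRat (q i) (hq i)) =
      ∑ j, ((c j).val : ℤ) * if j.castSucc = i then 1 else 0 := fun i => by
    rw [map_sum, Finsupp.finsetSum_apply]
    refine Finset.sum_congr rfl fun j _ => ?_
    rw [map_nsmul, Finsupp.smul_apply, principal_primeUnit hq hinj]
    simp
  have hlast := hm (Fin.last k)
  rw [hP] at hlast
  simp only [(Fin.castSucc_lt_last _).ne, if_false, mul_zero, Finset.sum_const_zero] at hlast
  funext j
  have hj := hm j.castSucc
  rw [hP] at hj
  simp only [Fin.castSucc_inj, mul_ite, mul_one, mul_zero, Finset.sum_ite_eq', Finset.mem_univ, if_true] at hj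
  have hlt := (c j).val_lt
  exact (ZMod.val_eq_zero _).1 (by omega)

theorem exists_mem_unramifiedSquares [IsTotallyReal F] (hk : 4 * (k + 5) ≤ k ^ 2) (hq : ∀ i, (q i).Prime)
    (h4 : ∀ i, q i % 4 = 1) (hinj : Function.Injective q) (h : IsSqrtExt ℚ σ θ (∏ i, (q i : ℚ)))
    {L : Type} [Field L] [NumberField L] [IsTotallyReal L] [Algebra F L] [IsGalois F L] (hU : Unramified F L)
    (n : ℕ) (hn : finrank F L = 2 ^ n) :
    ∃ v ∈ unramifiedSquares L, v ∈ conjSquares F L ∧ v ∉ AddSubgroup.doubles (Additive Lˣ) := by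
  classical
  by_contra! hcon
  have hF := twoUnramified_of_isSqrtExt hq h4 h
  have hsq : ∀ j : Fin k, ∃ Θ : Additive Lˣ,
      2 • Θ = inclUnits F L (inclUnits ℚ F (primeUnit (q j.castSucc) (hq j.castSucc))) := fun j =>
    hcon _ (primeUnit_mem_unramifiedSquares hq h4 hinj h _) (range_inclUnits_le_conjSquares ⟨_, rfl⟩)
  choose Θ hΘ using hsq
  have hfix : ∀ (g : L ≃ₐ[F] L) x, mapUnits (g : L ≃+* L) (inclUnits F L x) = inclUnits F L x := fun g x =>
    addUnits_ext (g.commutes _)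
  have hχ : ∀ (j : Fin k) (g : L ≃ₐ[F] L), ∃ c, mapUnits (g : L ≃+* L) (Θ j) - Θ j = signUnits L c := fun j g =>
    exists_signUnits_eq (by rw [nsmul_sub, ← map_nsmul, hΘ, hfix, sub_self])
  choose χ hχ using hχ
  obtain ⟨f, hf⟩ := exists_label_unramifiedSquares (F := F) (L := L) hU (hU.twoUnramified hF)
  have := finite_quotient_classDoubles (F := F)
  have := finite_quotient_two (F := F)
  have := (finite_realEmb (F := F)).1
  refine absurd (exists_mem_conjSquares hU hF n hn k (by nlinarith) χ ?_ ?_ (unramifiedSquares L) _ f hf ?_)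
    (by push Not; exact hcon)
  · intro j g g'
    apply signUnits_injective (L := L)
    rw [map_add, ← hχ, ← hχ, ← mapUnits_signUnits (g : L ≃+* L), ← hχ, map_sub]
    change mapUnits (g : L ≃+* L) (mapUnits (g' : L ≃+* L) (Θ j)) - Θ j = _
    abel
  · intro c hc
    have hη : ∀ g : L ≃ₐ[F] L, mapUnits (g : L ≃+* L) (∑ j, (c j).val • Θ j) = ∑ j, (c j).val • Θ j := fun g => by
      rw [← sub_eq_zero, map_sum, ← Finset.sum_sub_distrib]
      simp only [map_nsmul, ← nsmul_sub, hχ]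
      rw [← map_zero (signUnits L), ← hc g, map_sum]
      refine Finset.sum_congr rfl fun j _ => ?_
      rw [← map_nsmul, nsmul_eq_mul, ZMod.natCast_zmod_val]
    obtain ⟨y, hy⟩ := (IsGalois.mem_range_algebraMap_iff_fixed (F := F) (E := L)
      ((∑ j, (c j).val • Θ j).toMul : L)).2 fun g =>
        congrArg (fun z : Additive Lˣ => ((z.toMul : Lˣ) : L)) (hη g)
    have hy0 : y ≠ 0 := by
      rintro rfl
      rw [map_zero] at hy
      exact (∑ j, (c j).val • Θ j).toMul.ne_zero hy.symm
    have hy' : inclUnits F L (Additive.ofMul (Units.mk0 y hy0)) = ∑ j, (c j).val • Θ j := addUnits_ext hy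
    refine eq_zero_of_two_nsmul hq hinj h c (Additive.ofMul (Units.mk0 y hy0)) (inclUnits_injective (L := L) ?_)
    rw [map_nsmul, hy', ← Finset.sum_nsmul, map_sum, map_sum]
    refine Finset.sum_congr rfl fun j _ => ?_
    rw [map_nsmul, map_nsmul, ← hΘ, nsmul_left_comm]
  · intro s hs
    have h1 : Nat.card (Div F ⧸ classDoubles F) ≤ 2 ^ (k + 1) := index_classDoubles_le hq h4 h
    have h2 : Nat.card ((F →+* ℝ) → Prop) ≤ 2 ^ 2 := by
      have := (finite_realEmb (F := F)).2
      rw [h.finrank_eq_two] at this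
      rw [Nat.card_fun, Nat.card_eq_fintype_card (α := Prop), Fintype.card_prop]
      exact Nat.pow_le_pow_right two_pos this
    have h3 : Nat.card (𝓞 F ⧸ Ideal.span {(2 : 𝓞 F)}) = 2 ^ 2 := by
      rw [card_quotient_two, h.finrank_eq_two]
    rw [Nat.card_prod, Nat.card_prod, h3]
    calc _ ≤ 2 ^ (k + 1) * (2 ^ 2 * 2 ^ 2) := Nat.mul_le_mul h1 (Nat.mul_le_mul_right _ h2)
      _ = 2 ^ (k + 5) := by ring
      _ < 2 ^ s := Nat.pow_lt_pow_right one_lt_two (by omega)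

theorem unramified_self : Unramified F F :=
  (Ideal.eq_top_iff_one _).2 (mem_differentIdeal_of_forall fun y hy => by
    simpa [Algebra.trace_self_apply] using hy 1)

/-- The tower of unramified totally real extensions does not terminate. -/
theorem exists_unramified_tower [IsTotallyReal F] (hk : 4 * (k + 5) ≤ k ^ 2) (hq : ∀ i, (q i).Prime)
    (h4 : ∀ i, q i % 4 = 1) (hinj : Function.Injective q) (h : IsSqrtExt ℚ σ θ (∏ i, (q i : ℚ))) (n : ℕ) :
    ∃ (L : Type) (_ : Field L) (_ : NumberField L) (_ : Algebra F L), IsTotallyReal L ∧ IsGalois F L ∧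
      Unramified F L ∧ finrank F L = 2 ^ n := by
  induction n with
  | zero =>
    exact ⟨F, inferInstance, inferInstance, Algebra.id F, inferInstance, inferInstance, unramified_self, by simp⟩
  | succ n ih =>
    obtain ⟨L, _, _, _, _, _, hU, hn⟩ := ih
    obtain ⟨v, hv, hc, hd⟩ := exists_mem_unramifiedSquares hk hq h4 hinj h hU n hn
    obtain ⟨E, i1, i2, i3, h1, h2, h3, h5⟩ := exists_quadratic_step hU hv hc hd
    exact ⟨E, i1, i2, i3, h1, h2, h3, by rw [h5, hn, pow_succ']⟩

theorem exists_totallyReal_of_bounded_rootDiscr : ∃ ρ : ℕ, 1 ≤ ρ ∧ ∀ n : ℕ,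
    ∃ (L : Type) (_ : Field L) (_ : NumberField L), IsTotallyReal L ∧ finrank ℚ L = 2 * 2 ^ n ∧
      (discr L).natAbs ≤ ρ ^ 2 ^ n := by
  let q : Fin (7 + 1) → ℕ := ![5, 13, 17, 29, 37, 41, 53, 61]
  have hq : ∀ i, (q i).Prime := fun i => by fin_cases i <;> norm_num [q]
  have h4 : ∀ i, q i % 4 = 1 := by decide
  have hinj : Function.Injective q := by decide
  obtain ⟨F, _, _, _, σ, θ, h⟩ := exists_isSqrtExt (not_isSquare_prod hq hinj)
  obtain rfl : ‹Algebra ℚ F› = DivisionRing.toRatAlgebra := Subsingleton.elim _ _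
  have : IsTotallyReal F := h.isTotallyReal fun φ => by
    rw [map_prod]
    refine Finset.prod_pos fun i _ => ?_
    rw [map_natCast]
    exact_mod_cast (hq i).pos
  refine ⟨(discr F).natAbs, Int.natAbs_pos.2 (discr_ne_zero F), fun n => ?_⟩
  obtain ⟨L, i1, i2, i3, h1, h2, hU, hn⟩ := exists_unramified_tower (by norm_num) hq h4 hinj h n
  refine ⟨L, i1, i2, h1, ?_, ?_⟩
  · rw [← finrank_mul_finrank ℚ F L, h.finrank_eq_two, hn]
  · rw [hU.natAbs_discr, hn]

end NumberField

end Tower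

theorem totallyReal_of_isTotallyReal (K : Type*) [Field K] [NumberField.IsTotallyReal K] : TotallyReal K := by
  intro φ x
  have h : ComplexEmbedding.IsReal φ :=
    InfinitePlace.isReal_mk_iff.1 (NumberField.IsTotallyReal.isReal _)
  exact Complex.conj_eq_iff_im.1 (RingHom.congr_fun h x)

/-- There exists an absoluteconstant `C > 0` such that: there are infinitely many `d`,
with accompanying totally real number fields `K` of degree `d` over `ℚ`, such that for
any `X ≥ 1` there is `A ⊆ 𝓞 K` with `X^d ≤ |A| ≤ (CX)^d`, `|A+A| ≤ C^d |A|` and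
`|AA| ≤ 2^(-d) |A|^2`. -/
theorem statement1 :
    ∃ C : ℝ, 0 < C ∧
      ∀ n : ℕ, ∃ d : ℕ, n ≤ d ∧ 0 < d ∧
        ∃ (K : Type) (_ : Field K) (_ : NumberField K),
          TotallyReal K ∧ Module.finrank ℚ K = d ∧
          ∀ X : ℝ, 1 ≤ X →
            ∃ A : Set (𝓞 K), A.Finite ∧
              X ^ d ≤ (A.ncard : ℝ) ∧ (A.ncard : ℝ) ≤ (C * X) ^ d ∧
              ((A + A).ncard : ℝ) ≤ C ^ d * (A.ncard : ℝ) ∧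
              ((A * A).ncard : ℝ) ≤ (2 : ℝ) ^ (-(d : ℝ)) * (A.ncard : ℝ) ^ 2 := by
  obtain ⟨ρ, hρ, hL⟩ := exists_totallyReal_of_bounded_rootDiscr
  have hC : 0 < sumProductConst ρ := by
    unfold sumProductConst
    positivity
  refine ⟨sumProductConst ρ, by exact_mod_cast hC, fun n => ⟨2 * 2 ^ n, ?_, by positivity, ?_⟩⟩
  · have := n.lt_two_pow_self
    omega
  obtain ⟨L, i1, i2, h1, h2, h3⟩ := hL n
  refine ⟨L, i1, i2, totallyReal_of_isTotallyReal L, h2, fun X hX => ?_⟩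
  have hD : |(discr L : ℝ)| ≤ (ρ : ℝ) ^ (2 * (2 * 2 ^ n)) := by
    rw [← Int.cast_abs, ← Nat.cast_natAbs]
    calc ((discr L).natAbs : ℝ) ≤ (ρ : ℝ) ^ 2 ^ n := by exact_mod_cast h3
      _ ≤ _ := pow_le_pow_right₀ (by exact_mod_cast hρ) (by omega)
  obtain ⟨A, hA, h4, h5, h6, h7⟩ :=
    exists_sumProduct_set_of_discr_le L (2 ^ n) (by positivity) h2 ρ hρ hD X hX
  refine ⟨A, hA, h4, h5, h6, ?_⟩
  rw [Real.rpow_neg two_pos.le, Real.rpow_natCast, inv_mul_eq_div, le_div_iff₀' (by positivity)]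
  exact h7
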